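/- Let K be a finite field, L/K a finite Galois field extension, G a finite group, and α : G → Gal(L/K) a surjective group homomorphism with nilpotent kernel. Then α has a geometric solution: there exist a finite Galois field extension F of the rational function field K(T) containing L(T) (where L(T) is the rational function field over L, viewed as an extension of K(T)), and a group isomorphism β : Gal(F/K(T)) → G such that for every φ ∈ Gal(F/K(T)), the automorphism α(β(φ)) of L coincides with the restriction of φ to L (where L is embedded in L(T) ⊆ F). -/

import Mathlib

universe u

/-- Lifting a homomorphism along a group extension with abelian kernel from a normal subgroup of
finite index prime to the order of the kernel. -/
theorem exists_lift_of_coprime_index {G Q H : Type*} [Group G] [Group Q] [Group H] [Finite G]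
    (π : G →* Q) (hπ : Function.Surjective π) (hab : ∀ a ∈ π.ker, ∀ b ∈ π.ker, a * b = b * a)
    (φ : H →* Q) (H₀ : Subgroup H) [H₀.Normal] [H₀.FiniteIndex]
    (hco : (Nat.card π.ker).Coprime H₀.index) (φ₀ : H₀ →* G) (h₀ : ∀ x, π (φ₀ x) = φ x) :
    ∃ ψ : H →* G, (∀ x, π (ψ x) = φ x) ∧
      ∀ U : Subgroup H, U.Normal → ∀ hU : U ≤ H₀, (∀ x (hx : x ∈ U), φ₀ ⟨x, hU hx⟩ = 1) →
        ∀ x ∈ U, ψ x = 1 := by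
  classical
  let : CommGroup π.ker := { (inferInstance : Group π.ker) with
    mul_comm := fun a b => Subtype.ext (hab a a.2 b b.2) }
  have : Fintype (H ⧸ H₀) := Fintype.ofFinite _
  let τ : H ⧸ H₀ → H := Quotient.out
  have hτ : ∀ i, (τ i : H ⧸ H₀) = i := fun i => Quotient.out_eq' i
  choose g hg using fun i => hπ (φ (τ i))
  have hmem : ∀ (γ : H) (i : H ⧸ H₀), (τ (γ • i))⁻¹ * γ * τ i ∈ H₀ := by
    intro γ i
    rw [mul_assoc, ← QuotientGroup.eq, hτ]
    conv_lhs => rw [← hτ i]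
    rfl
  let Z : H → H ⧸ H₀ → H₀ := fun γ i => ⟨_, hmem γ i⟩
  -- the local crossed homomorphism, transported back by the transversal
  let d : (p : {p : G × H // π p.1 = φ p.2}) → H ⧸ H₀ → π.ker := fun p i =>
    ⟨p.1.1 * g i * (φ₀ (Z p.1.2 i))⁻¹ * (g (p.1.2 • i))⁻¹, by
      simp only [MonoidHom.mem_ker, map_mul, map_inv, h₀, hg, p.2, Z]; group⟩
  let C : {p : G × H // π p.1 = φ p.2} → π.ker := fun p => ∏ i, d p i
  have hZ : ∀ γ δ i, Z (γ * δ) i = Z γ (δ • i) * Z δ i := by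
    intro γ δ i; ext; simp [Z, mul_smul]; group
  have hC : ∀ p q r : {p : G × H // π p.1 = φ p.2}, r.1 = p.1 * q.1 →
      (C r : G) = C p * (p.1.1 * C q * p.1.1⁻¹) := by
    intro p q r hr
    let cj : π.ker →* π.ker := (MulAut.conjNormal p.1.1).toMonoidHom
    have : C r = C p * cj (C q) := by
      have e1 : C p = ∏ i, d p (q.1.2 • i) :=
        (Equiv.prod_comp (MulAction.toPerm q.1.2) (d p)).symm
      rw [e1, map_prod, ← Finset.prod_mul_distrib]
      refine Finset.prod_congr rfl fun i _ => ?_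
      have hc : cj (d q i) * d p (q.1.2 • i) = d r i := by
        ext
        simp only [cj, d, hr, Prod.fst_mul, Prod.snd_mul, hZ, Subgroup.coe_mul,
          MulEquiv.toMonoidHom_eq_coe, MonoidHom.coe_coe, MulAut.conjNormal_apply, map_mul,
          mul_smul]
        group
      rw [← hc, mul_comm]
    rw [this]; simp [cj, MulAut.conjNormal_apply]
  have hCA : ∀ p : {p : G × H // π p.1 = φ p.2}, p.1.2 = 1 → (C p : G) = p.1.1 ^ H₀.index := by
    rintro ⟨⟨a, γ⟩, hp⟩ h1
    simp only at h1 hp ⊢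
    subst h1
    have ha : a ∈ π.ker := by simpa using hp
    have : C ⟨(a, 1), hp⟩ = (⟨a, ha⟩ : π.ker) ^ H₀.index := by
      rw [Subgroup.index_eq_card, Nat.card_eq_fintype_card, ← Finset.card_univ,
        ← Finset.prod_const]
      refine Finset.prod_congr rfl fun i _ => ?_
      ext
      have : Z 1 i = 1 := by ext; simp [Z]
      simp [d, this]
    rw [this]; rfl
  obtain ⟨k, hk⟩ : ∃ k : ℕ, ∀ a ∈ π.ker, (a ^ H₀.index) ^ k = a := by
    rcases Nat.lt_or_ge 1 (Nat.card π.ker) with h1 | h1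
    · obtain ⟨k, -, hk⟩ := Nat.exists_mul_mod_eq_one_of_coprime hco.symm h1
      refine ⟨k, fun a ha => ?_⟩
      have ha' : a ^ Nat.card π.ker = 1 :=
        congrArg Subtype.val (pow_card_eq_one' (x := (⟨a, ha⟩ : π.ker)))
      rw [← pow_mul, ← Nat.mod_add_div (H₀.index * k) (Nat.card π.ker), pow_add, pow_mul, ha', hk]
      simp
    · refine ⟨0, fun a ha => ?_⟩
      have := (Nat.card_eq_one_iff_unique.1 (le_antisymm h1 Nat.card_pos)).1
      simpa using (congrArg Subtype.val (Subsingleton.elim (⟨a, ha⟩ : π.ker) 1)).symm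
  let S : {p : G × H // π p.1 = φ p.2} → G := fun p => ((C p : G) ^ k)⁻¹ * p.1.1
  have hker : ∀ p, (C p : G) ∈ π.ker := fun p => (C p).2
  have hS : ∀ p q r : {p : G × H // π p.1 = φ p.2}, r.1 = p.1 * q.1 → S r = S p * S q := by
    intro p q r hr
    have e1 : (C r : G) ^ k = (p.1.1 * C q * p.1.1⁻¹) ^ k * C p ^ k := by
      rw [hC p q r hr, (Commute.mul_pow (hab _ (hker p) _ _) k), ((_ : Commute _ _).pow_pow k k).eq]
      · exact hab _ (hker p) _ ((MonoidHom.normal_ker π).conj_mem _ (hker q) _)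
      · exact ((MonoidHom.normal_ker π).conj_mem _ (hker q) _)
    simp only [S]
    rw [e1, conj_pow, hr]
    simp only [Prod.fst_mul]
    group
  have hSA : ∀ p : {p : G × H // π p.1 = φ p.2}, p.1.2 = 1 → S p = 1 := by
    intro p hp
    have : p.1.1 ∈ π.ker := by have := p.2; rw [hp] at this; simpa using this
    simp [S, hCA p hp, hk _ this]
  choose s hs using fun x => hπ (φ x)
  have hinv : ∀ p q : {p : G × H // π p.1 = φ p.2}, p.1.2 = q.1.2 → S p = S q := by
    intro p q hpq
    let a : {p : G × H // π p.1 = φ p.2} := ⟨(p.1.1 * q.1.1⁻¹, 1), by simp [p.2, q.2, hpq]⟩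
    rw [hS a q p (by ext <;> simp [a, hpq]), hSA a rfl, one_mul]
  refine ⟨MonoidHom.mk' (fun x => S ⟨(s x, x), hs x⟩) fun x y => ?_, fun x => ?_, ?_⟩
  · rw [← hS ⟨(s x, x), hs x⟩ ⟨(s y, y), hs y⟩ ⟨(s x * s y, x * y), by simp [hs]⟩ rfl]
    exact hinv _ _ rfl
  · have := hker ⟨(s x, x), hs x⟩
    rw [MonoidHom.mem_ker] at this
    simp [S, hs, this]
  · intro U hUn hU hφ₀ x hx
    change S _ = 1
    have hx1 : π 1 = φ x := by
      have := h₀ ⟨x, hU hx⟩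
      rwa [hφ₀ x hx] at this
    rw [hinv ⟨(s x, x), hs x⟩ ⟨(1, x), hx1⟩ rfl]
    have : ∀ i, d ⟨(1, x), hx1⟩ i = 1 := by
      intro i
      ext
      have hxi : x • i = i := by
        conv_lhs => rw [← hτ i]
        conv_rhs => rw [← hτ i]
        change ((x * τ i : H) : H ⧸ H₀) = _
        rw [eq_comm, QuotientGroup.eq]
        have := hU (hUn.conj_mem x hx (τ i)⁻¹)
        simpa [mul_assoc] using this
      have hz : φ₀ (Z x i) = 1 := by
        refine hφ₀ _ ?_
        rw [hxi]
        simpa using hUn.conj_mem x hx (τ i)⁻¹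
      simp [d, hz, hxi]
    simp [S, C, this]

/-- `φ` is multiplicative on the subgroup `D` and trivial on the intersection of `D` with an open
normal subgroup. -/
def IsRep {Γ Q : Type*} [Group Γ] [TopologicalSpace Γ] [Group Q] (D : Subgroup Γ) (φ : Γ → Q) :
    Prop :=
  (∀ x ∈ D, ∀ y ∈ D, φ (x * y) = φ x * φ y) ∧
    ∃ U : Subgroup Γ, IsOpen (U : Set Γ) ∧ U.Normal ∧ ∀ x ∈ U, x ∈ D → φ x = 1

namespace IsRep

variable {Γ Q : Type*} [Group Γ] [TopologicalSpace Γ] [Group Q] {D D' : Subgroup Γ} {φ : Γ → Q}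

theorem mono (h : IsRep D φ) (hD : D' ≤ D) : IsRep D' φ :=
  ⟨fun x hx y hy => h.1 x (hD hx) y (hD hy), h.2.imp fun _ hU =>
    ⟨hU.1, hU.2.1, fun x hx hxD => hU.2.2 x hx (hD hxD)⟩⟩

/-- The homomorphism on `D` underlying a representation. -/
def hom (h : IsRep D φ) : D →* Q :=
  MonoidHom.mk' (fun x => φ x) fun x y => h.1 x x.2 y y.2

theorem map_one (h : IsRep D φ) : φ 1 = 1 := h.hom.map_one

theorem map_inv (h : IsRep D φ) {x : Γ} (hx : x ∈ D) : φ x⁻¹ = (φ x)⁻¹ := h.hom.map_inv ⟨x, hx⟩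

theorem comp {G : Type*} [Group G] (h : IsRep D φ) (f : Q →* G) : IsRep D fun x => f (φ x) :=
  ⟨fun x hx y hy => by simp [h.1 x hx y hy], h.2.imp fun _ hU =>
    ⟨hU.1, hU.2.1, fun x hx hx' => by simp [hU.2.2 x hx hx']⟩⟩

end IsRep

/-- A family of subgroups to which `exists_lift_of_coprime_index` applies. -/
structure IsTower {Γ : Type*} [Group Γ] [TopologicalSpace Γ] (ℓ : ℕ) (D : ℕ → ℕ → Subgroup Γ) :
    Prop where
  anti : ∀ {e e' i i'}, e ∣ e' → i ≤ i' → D e' i' ≤ D e i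
  core : ∀ {e} i, 0 < e → ∃ U : Subgroup Γ, IsOpen (U : Set Γ) ∧ U.Normal ∧ U ≤ D e i
  normal : ∀ {e} i, 0 < e → ∀ x ∈ D 1 i, ∀ y ∈ D e i, x * y * x⁻¹ ∈ D e i
  index : ∀ {e} i, 0 < e → ¬ ℓ ∣ e → ¬ ℓ ∣ (D e i).relIndex (D 1 i)

/-- Central embedding problems with kernel of order `ℓ` can be solved after going up the tower. -/
def CentralStep {Γ : Type*} [Group Γ] [TopologicalSpace Γ] (ℓ : ℕ) (D : ℕ → ℕ → Subgroup Γ) :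
    Prop :=
  ∀ (G Q : Type u) [Group G] [Group Q] [Finite G], IsPGroup ℓ G → ∀ π : G →* Q,
    Function.Surjective π → π.ker ≤ Subgroup.center G → Nat.card π.ker = ℓ →
    ∀ e i, 0 < e → ¬ ℓ ∣ e → ∀ φ : Γ → Q, IsRep (D e i) φ →
    ∃ e' i', e ∣ e' ∧ 0 < e' ∧ ¬ ℓ ∣ e' ∧ i ≤ i' ∧ ∃ ψ : Γ → G, IsRep (D e' i') ψ ∧
      ∀ x ∈ D e' i', π (ψ x) = φ x

/-- A nontrivial normal subgroup of a finite `ℓ`-group contains a central subgroup of order `ℓ`. -/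
theorem IsPGroup.exists_central_le {G : Type*} [Group G] [Finite G] {ℓ : ℕ} [Fact ℓ.Prime]
    (hG : IsPGroup ℓ G) (N : Subgroup G) [N.Normal] (hN : N ≠ ⊥) :
    ∃ B : Subgroup G, B ≤ N ∧ B ≤ Subgroup.center G ∧ Nat.card B = ℓ := by
  let : MulAction G N := MulAction.compHom N (MulAut.conjNormal (H := N))
  have hsm : ∀ (g : G) (n : N), ((g • n : N) : G) = g * n * g⁻¹ := fun g n =>
    MulAut.conjNormal_apply g n
  have hdvd : ℓ ∣ Nat.card N :=
    ((hG.to_subgroup N).card_eq_or_dvd).resolve_left fun h => hN (Subgroup.eq_bot_of_card_eq N h)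
  obtain ⟨b, hb, hb1⟩ := hG.exists_fixed_point_of_prime_dvd_card_of_fixed_point N hdvd
    (a := 1) (fun g => Subtype.ext (by simp [hsm]))
  have hbc : (b : G) ∈ Subgroup.center G := by
    rw [Subgroup.mem_center_iff]
    intro g
    have := congrArg Subtype.val (hb g)
    rw [hsm] at this
    rw [← mul_inv_eq_iff_eq_mul, this]
  have hord : ℓ ∣ orderOf (b : G) := hG.dvd_orderOf fun h => hb1 (Subtype.ext h.symm)
  refine ⟨Subgroup.zpowers ((b : G) ^ (orderOf (b : G) / ℓ)), ?_, ?_, ?_⟩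
  · rw [Subgroup.zpowers_le]; exact pow_mem b.2 _
  · rw [Subgroup.zpowers_le]; exact pow_mem hbc _
  · rw [Nat.card_zpowers, orderOf_pow_orderOf_div (orderOf_pos _).ne' hord]

theorem card_ker_quotientLift_lt {G Q : Type*} [Group G] [Group Q] [Finite G] (π : G →* Q)
    {B : Subgroup G} [B.Normal] (hB : B ≤ π.ker) (hB1 : B ≠ ⊥) :
    Nat.card (QuotientGroup.lift B π hB).ker < Nat.card π.ker := by
  have h1 : (QuotientGroup.lift B π hB).ker.comap (QuotientGroup.mk' B) = π.ker := by
    rw [MonoidHom.comap_ker]; rfl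
  have h2 : (QuotientGroup.lift B π hB).ker.index = π.ker.index := by
    rw [← h1, Subgroup.index_comap_of_surjective _ (QuotientGroup.mk'_surjective B)]
  have h3 := (QuotientGroup.lift B π hB).ker.card_mul_index
  have h4 := π.ker.card_mul_index
  have h5 := B.card_eq_card_quotient_mul_card_subgroup
  have : 0 < π.ker.index := Nat.pos_of_ne_zero Subgroup.index_ne_zero_of_finite
  have hc : 0 < Nat.card (QuotientGroup.lift B π hB).ker := Nat.card_pos
  have hl := (Subgroup.one_lt_card_iff_ne_bot B).2 hB1
  rw [h2] at h3
  rw [← h3, ← h4] at h5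
  nlinarith [Nat.eq_of_mul_eq_mul_right this (h5.trans
    (by ring : _ = (Nat.card (QuotientGroup.lift B π hB).ker * Nat.card B) * _))]

section Lifting

variable {Γ : Type*} [Group Γ] [TopologicalSpace Γ] {ℓ : ℕ} [Fact ℓ.Prime]
  {D : ℕ → ℕ → Subgroup Γ}

theorem CentralStep.exists_lift_of_isPGroup (hD : IsTower ℓ D) (hS : CentralStep.{u} ℓ D) (n : ℕ) :
    ∀ (G Q : Type u) [Group G] [Group Q] [Finite G], IsPGroup ℓ G → ∀ π : G →* Q,
    Function.Surjective π → Nat.card π.ker = n →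
    ∀ e i, 0 < e → ¬ ℓ ∣ e → ∀ φ : Γ → Q, IsRep (D e i) φ →
    ∃ e' i', e ∣ e' ∧ 0 < e' ∧ ¬ ℓ ∣ e' ∧ i ≤ i' ∧ ∃ ψ : Γ → G, IsRep (D e' i') ψ ∧
      ∀ x ∈ D e' i', π (ψ x) = φ x := by
  induction n using Nat.strong_induction_on with
  | _ n ih =>
  intro G Q _ _ _ hG π hπ hn e i he hle φ hφ
  by_cases hk : π.ker = ⊥
  · let f := MulEquiv.ofBijective π ⟨(MonoidHom.ker_eq_bot_iff π).1 hk, hπ⟩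
    exact ⟨e, i, dvd_rfl, he, hle, le_rfl, _, hφ.comp f.symm.toMonoidHom,
      fun x _ => f.apply_symm_apply _⟩
  obtain ⟨B, hBk, hBc, hB⟩ := hG.exists_central_le π.ker hk
  have : B.Normal := ⟨fun b hb g => by
    rw [Subgroup.mem_center_iff.1 (hBc hb) g]; simpa using hb⟩
  let π₁ : G ⧸ B →* Q := QuotientGroup.lift B π hBk
  have hπ₁ : Function.Surjective π₁ := fun y => by
    obtain ⟨x, rfl⟩ := hπ y
    exact ⟨x, rfl⟩
  have hcard : Nat.card π₁.ker < n :=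
    hn ▸ card_ker_quotientLift_lt π hBk (fun h => by
      simp [h, (Fact.out : ℓ.Prime).ne_one.symm] at hB)
  obtain ⟨e₁, i₁, hee, he₁, hle₁, hii, ψ₁, hψ₁, hl₁⟩ :=
    ih _ hcard (G ⧸ B) Q (hG.to_quotient B) π₁ hπ₁ rfl e i he hle φ hφ
  obtain ⟨e₂, i₂, hee₂, he₂, hle₂, hii₂, ψ₂, hψ₂, hl₂⟩ :=
    hS G (G ⧸ B) hG (QuotientGroup.mk' B) (QuotientGroup.mk'_surjective B)
      (by rwa [QuotientGroup.ker_mk']) (by rwa [QuotientGroup.ker_mk']) e₁ i₁ he₁ hle₁ ψ₁ hψ₁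
  refine ⟨e₂, i₂, hee.trans hee₂, he₂, hle₂, hii.trans hii₂, ψ₂, hψ₂, fun x hx => ?_⟩
  rw [← hl₁ x (hD.anti hee₂ hii₂ hx), ← hl₂ x hx]
  rfl

theorem IsTower.exists_lift_of_coprime (hD : IsTower ℓ D) {G Q : Type*} [Group G] [Group Q]
    [Finite G] (π : G →* Q) (hπ : Function.Surjective π)
    (hab : ∀ a ∈ π.ker, ∀ b ∈ π.ker, a * b = b * a) (hker : IsPGroup ℓ π.ker) {e i : ℕ} (he : 0 < e)
    (hle : ¬ ℓ ∣ e) (φ : Γ → Q) (hφ : IsRep (D 1 i) φ) (ψ : Γ → G) (hψ : IsRep (D e i) ψ)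
    (hl : ∀ x ∈ D e i, π (ψ x) = φ x) :
    ∃ ψ' : Γ → G, IsRep (D 1 i) ψ' ∧ ∀ x ∈ D 1 i, π (ψ' x) = φ x := by
  classical
  let H₀ := (D e i).subgroupOf (D 1 i)
  have hle1 : D e i ≤ D 1 i := hD.anti (one_dvd e) le_rfl
  have hidx : ¬ ℓ ∣ H₀.index := hD.index i he hle
  have : H₀.Normal := ⟨fun y hy x => hD.normal i he x x.2 y hy⟩
  have : H₀.FiniteIndex := ⟨fun h => hidx (h ▸ dvd_zero ℓ)⟩
  have hco : (Nat.card π.ker).Coprime H₀.index := by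
    obtain ⟨n, hn⟩ := IsPGroup.iff_card.1 hker
    rw [hn]
    exact Nat.Coprime.pow_left _ ((Nat.Prime.coprime_iff_not_dvd Fact.out).2 hidx)
  let φ₀ : H₀ →* G := MonoidHom.mk' (fun x => ψ x) fun x y => hψ.1 _ x.2 _ y.2
  obtain ⟨χ, hχ, hχU⟩ := exists_lift_of_coprime_index π hπ hab hφ.hom H₀ hco φ₀ fun x => hl _ x.2
  refine ⟨fun x => if hx : x ∈ D 1 i then χ ⟨x, hx⟩ else 1, ⟨fun x hx y hy => ?_, ?_⟩, ?_⟩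
  · simp only [hx, hy, mul_mem hx hy, dif_pos, ← map_mul]
    rfl
  · obtain ⟨U, hUo, hUn, hU⟩ := hψ.2
    obtain ⟨W, hWo, hWn, hW⟩ := hD.core i he
    refine ⟨U ⊓ W, hUo.inter hWo, inferInstance, fun x hx hx1 => ?_⟩
    simp only [dif_pos hx1]
    refine hχU ((U ⊓ W).subgroupOf (D 1 i)) inferInstance (fun y hy => hW hy.2)
      (fun y hy => hU _ hy.1 (hW hy.2)) ⟨x, hx1⟩ hx
  · intro x hx
    simp only [dif_pos hx, hχ]; rfl

theorem CentralStep.exists_lift (hD : IsTower ℓ D) (hS : CentralStep.{u} ℓ D) (n : ℕ) :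
    ∀ (G Q : Type u) [Group G] [Group Q] [Finite G], ∀ π : G →* Q,
    Function.Surjective π → IsPGroup ℓ π.ker → Nat.card π.ker = n →
    ∀ (P : Subgroup Q) (e i : ℕ), IsPGroup ℓ P → 0 < e → ¬ ℓ ∣ e → ∀ φ : Γ → Q, IsRep (D 1 i) φ →
    (∀ x ∈ D e i, φ x ∈ P) →
    ∃ i', i ≤ i' ∧ ∃ ψ : Γ → G, IsRep (D 1 i') ψ ∧ ∀ x ∈ D 1 i', π (ψ x) = φ x := by
  induction n using Nat.strong_induction_on with
  | _ n ih =>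
  intro G Q _ _ _ π hπ hker hn P e i hP he hle φ hφ hφP
  by_cases hk : π.ker = ⊥
  · let f := MulEquiv.ofBijective π ⟨(MonoidHom.ker_eq_bot_iff π).1 hk, hπ⟩
    exact ⟨i, le_rfl, _, hφ.comp f.symm.toMonoidHom, fun x _ => f.apply_symm_apply _⟩
  let B : Subgroup G := (Subgroup.center π.ker).map π.ker.subtype
  have hBk : B ≤ π.ker := Subgroup.map_subtype_le _
  have hBab : ∀ a ∈ B, ∀ b ∈ π.ker, a * b = b * a := by
    rintro _ ⟨a, ha, rfl⟩ b hb
    exact (congrArg Subtype.val (Subgroup.mem_center_iff.1 ha ⟨b, hb⟩)).symm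
  have hBn : B.Normal := ConjAct.normal_of_characteristic_of_normal
  have hB1 : B ≠ ⊥ := by
    have : Nontrivial π.ker := (Subgroup.nontrivial_iff_ne_bot _).2 hk
    rw [Ne, Subgroup.map_eq_bot_iff_of_injective _ (Subgroup.subtype_injective _)]
    exact hker.bot_lt_center.ne'
  have hBp : IsPGroup ℓ B := hker.to_le hBk
  let π₁ : G ⧸ B →* Q := QuotientGroup.lift B π hBk
  have hπ₁ : Function.Surjective π₁ := fun y => by
    obtain ⟨x, rfl⟩ := hπ y
    exact ⟨x, rfl⟩
  have hkm : π₁.ker = π.ker.map (QuotientGroup.mk' B) := by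
    refine le_antisymm (fun y => ?_) ?_
    · obtain ⟨x, rfl⟩ := QuotientGroup.mk'_surjective B y
      exact fun hx => ⟨x, hx, rfl⟩
    · rintro _ ⟨x, hx, rfl⟩; exact hx
  have hker₁ : IsPGroup ℓ π₁.ker := hkm ▸ hker.map _
  have hcard : Nat.card π₁.ker < n := hn ▸ card_ker_quotientLift_lt π hBk hB1
  obtain ⟨i₁, hii₁, ψ₁, hψ₁, hl₁⟩ :=
    ih _ hcard (G ⧸ B) Q π₁ hπ₁ hker₁ rfl P e i hP he hle φ hφ hφP
  let P₁ : Subgroup (G ⧸ B) := P.comap π₁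
  have hP₁ : IsPGroup ℓ P₁ := hP.comap_of_ker_isPGroup π₁ hker₁
  let P₂ : Subgroup G := P₁.comap (QuotientGroup.mk' B)
  have hP₂ : IsPGroup ℓ P₂ := hP₁.comap_of_ker_isPGroup _ (by rwa [QuotientGroup.ker_mk'])
  let π₂ : P₂ →* P₁ := (QuotientGroup.mk' B).subgroupComap P₁
  have hπ₂ : Function.Surjective π₂ :=
    MonoidHom.subgroupComap_surjective_of_surjective _ _ (QuotientGroup.mk'_surjective B)
  have hmem : ∀ x ∈ D e i₁, ψ₁ x ∈ P₁ := fun x hx => by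
    rw [Subgroup.mem_comap, hl₁ x (hD.anti (one_dvd e) le_rfl hx)]
    exact hφP x (hD.anti dvd_rfl hii₁ hx)
  classical
  let χ : Γ → P₁ := fun x => if h : ψ₁ x ∈ P₁ then ⟨ψ₁ x, h⟩ else 1
  have hχ : ∀ x ∈ D e i₁, (χ x : G ⧸ B) = ψ₁ x := fun x hx => by simp [χ, hmem x hx]
  have hψ₁e : IsRep (D e i₁) ψ₁ := hψ₁.mono (hD.anti (one_dvd e) le_rfl)
  have hχr : IsRep (D e i₁) χ := by
    refine ⟨fun x hx y hy => Subtype.ext ?_, hψ₁e.2.imp fun U hU =>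
      ⟨hU.1, hU.2.1, fun x hx hx' => Subtype.ext ?_⟩⟩
    · rw [Subgroup.coe_mul, hχ _ hx, hχ _ hy, hχ _ (mul_mem hx hy), hψ₁e.1 x hx y hy]
    · rw [hχ x hx', hU.2.2 x hx hx']; rfl
  obtain ⟨e₂, i₂, hee₂, he₂, hle₂, hii₂, ψ₂, hψ₂, hl₂⟩ :=
    hS.exists_lift_of_isPGroup hD _ P₂ P₁ hP₂ π₂ hπ₂ rfl e i₁ he hle χ hχr
  obtain ⟨ψ, hψ, hl⟩ := hD.exists_lift_of_coprime (QuotientGroup.mk' B)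
    (QuotientGroup.mk'_surjective B)
    (fun a ha b hb => by
      rw [QuotientGroup.ker_mk'] at ha hb
      exact hBab a ha b (hBk hb))
    (by rwa [QuotientGroup.ker_mk']) he₂ hle₂ ψ₁ (hψ₁.mono (hD.anti dvd_rfl hii₂))
    (fun x => (ψ₂ x : G)) (hψ₂.comp P₂.subtype) fun x hx => by
      rw [← hχ x (hD.anti hee₂ hii₂ hx), ← hl₂ x hx]
      rfl
  refine ⟨i₂, hii₁.trans hii₂, ψ, hψ, fun x hx => ?_⟩
  rw [← hl₁ x (hD.anti dvd_rfl hii₂ hx), ← hl x hx]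
  rfl

end Lifting

section Frattini

variable {N : Type*} [Group N] [Finite N] {ℓ : ℕ} [Fact ℓ.Prime]

theorem IsPGroup.commutator_and_pow_mem_frattini (hN : IsPGroup ℓ N) (a b : N) :
    (b * a)⁻¹ * (a * b) ∈ frattini N ∧ a ^ ℓ ∈ frattini N := by
  suffices h : ∀ M : Subgroup N, IsCoatom M → (b * a)⁻¹ * (a * b) ∈ M ∧ a ^ ℓ ∈ M by
    have hf : ∀ x : N, (∀ M : Subgroup N, IsCoatom M → x ∈ M) → x ∈ frattini N := fun x hx => by
      simp only [frattini, Order.radical, Subgroup.mem_iInf]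
      exact fun M hM => hx M hM
    exact ⟨hf _ fun M hM => (h M hM).1, hf _ fun M hM => (h M hM).2⟩
  intro M hM
  have : Group.IsNilpotent N := hN.isNilpotent
  have : M.Normal := Subgroup.NormalizerCondition.normal_of_coatom M
    Group.normalizerCondition_of_isNilpotent hM
  have hq : IsPGroup ℓ (N ⧸ M) := hN.to_quotient M
  have hne : (⊤ : Subgroup (N ⧸ M)) ≠ ⊥ := fun h => hM.1 <| by
    have := congrArg (Subgroup.comap (QuotientGroup.mk' M)) h
    rwa [Subgroup.comap_top, MonoidHom.comap_bot, QuotientGroup.ker_mk', eq_comm] at this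
  obtain ⟨B, -, hBc, hB⟩ := hq.exists_central_le ⊤ hne
  have hBtop : B = ⊤ := by
    have h1 : M < B.comap (QuotientGroup.mk' M) := by
      refine lt_of_le_of_ne (QuotientGroup.le_comap_mk' M B) fun h => ?_
      have h2 : B = ⊥ := by
        rw [← Subgroup.map_comap_eq_self_of_surjective (QuotientGroup.mk'_surjective M) B, ← h,
          Subgroup.map_eq_bot_iff, QuotientGroup.ker_mk']
      rw [h2, Subgroup.card_bot] at hB
      exact (Fact.out : ℓ.Prime).ne_one hB.symm
    rw [← Subgroup.map_comap_eq_self_of_surjective (QuotientGroup.mk'_surjective M) B, hM.2 _ h1,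
      Subgroup.map_top_of_surjective _ (QuotientGroup.mk'_surjective M)]
  constructor
  · rw [← QuotientGroup.eq]
    have : (a : N ⧸ M) ∈ Subgroup.center (N ⧸ M) := hBc (hBtop ▸ Subgroup.mem_top _)
    exact Subgroup.mem_center_iff.1 this b
  · rw [← QuotientGroup.eq_one_iff, QuotientGroup.mk_pow, ← hB, hBtop, Subgroup.card_top]
    exact pow_card_eq_one'

end Frattini

/-- Embedding problems with elementary abelian kernel for the tower `D`, where
`fr : Γ → ZMod d` is the Frobenius degree. -/
def InitialStep {Γ : Type*} [Group Γ] [TopologicalSpace Γ] (ℓ d : ℕ)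
    (D : ℕ → ℕ → Subgroup Γ) (fr : Γ →* Multiplicative (ZMod d)) : Prop :=
  ∀ (V : Type u) [Group V] [Finite V], (∀ v w : V, v * w = w * v) → (∀ v : V, v ^ ℓ = 1) →
    ∀ act : Multiplicative (ZMod d) →* MulAut V,
    ∃ a : Γ → V ⋊[act] Multiplicative (ZMod d), IsRep (D 1 0) a ∧
      (∀ x ∈ D 1 0, (a x).right = fr x) ∧ ∀ i v, ∃ x ∈ D d i, (a x).left = v

/-- The action on `N ⧸ M` induced by an action on `N`, for `M` characteristic. -/
def quotientAction {N C : Type*} [Group N] [Group C] (act : C →* MulAut N) (M : Subgroup N)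
    [M.Characteristic] : C →* MulAut (N ⧸ M) where
  toFun c := QuotientGroup.congr M M (act c) (Subgroup.characteristic_iff_map_eq.1 ‹_› _)
  map_one' := by
    ext x
    obtain ⟨x, rfl⟩ := QuotientGroup.mk_surjective x
    simp
  map_mul' a b := by
    ext x
    obtain ⟨x, rfl⟩ := QuotientGroup.mk_surjective x
    simp only [map_mul]
    rfl

theorem exists_semidirect_rep {Γ : Type*} [Group Γ] [TopologicalSpace Γ] {ℓ d : ℕ} [Fact ℓ.Prime]
    {D : ℕ → ℕ → Subgroup Γ} (hD : IsTower ℓ D) (hS : CentralStep.{u} ℓ D) (hd : 0 < d)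
    (fr : Γ →* Multiplicative (ZMod d)) (hI : InitialStep.{u} ℓ d D fr)
    (hfr : ∀ e i, e ∣ d → ∀ x ∈ D e i, fr x ^ (d / e) = 1)
    (N : Type u) [Group N] [Finite N] (hN : IsPGroup ℓ N)
    (act : Multiplicative (ZMod d) →* MulAut N) :
    ∃ i, ∃ ρ : Γ → N ⋊[act] Multiplicative (ZMod d), IsRep (D 1 i) ρ ∧
      (∀ x ∈ D 1 i, (ρ x).right = fr x) ∧ ∀ n, ∃ x ∈ D d i, (ρ x).left = n := by
  have : NeZero d := ⟨hd.ne'⟩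
  obtain ⟨a, ha, har, hasurj⟩ := hI (N ⧸ frattini N)
    (fun v w => by
      obtain ⟨v, rfl⟩ := QuotientGroup.mk_surjective v
      obtain ⟨w, rfl⟩ := QuotientGroup.mk_surjective w
      rw [← QuotientGroup.mk_mul, ← QuotientGroup.mk_mul, eq_comm, QuotientGroup.eq]
      exact (hN.commutator_and_pow_mem_frattini v w).1)
    (fun v => by
      obtain ⟨v, rfl⟩ := QuotientGroup.mk_surjective v
      rw [← QuotientGroup.mk_pow, QuotientGroup.eq_one_iff]
      exact (hN.commutator_and_pow_mem_frattini v v).2) (quotientAction act (frattini N))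
  let π : N ⋊[act] Multiplicative (ZMod d) →*
      (N ⧸ frattini N) ⋊[quotientAction act (frattini N)] Multiplicative (ZMod d) :=
    SemidirectProduct.map (QuotientGroup.mk' _) (MonoidHom.id _) fun g => by ext x; rfl
  have : Finite (N ⋊[act] Multiplicative (ZMod d)) :=
    Finite.of_equiv _ SemidirectProduct.equivProd.symm
  have hπ : Function.Surjective π := by
    rintro ⟨v, c⟩
    obtain ⟨v, rfl⟩ := QuotientGroup.mk_surjective v
    exact ⟨⟨v, c⟩, rfl⟩
  have hker : IsPGroup ℓ π.ker := by
    refine (hN.of_surjective (SemidirectProduct.inl (φ := act)).rangeRestrict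
      (MonoidHom.rangeRestrict_surjective _)).to_le ?_
    rw [SemidirectProduct.range_inl_eq_ker_rightHom]
    exact fun x hx => congrArg SemidirectProduct.right hx
  let k := d.factorization ℓ
  let P₀ : Subgroup (Multiplicative (ZMod d)) := (powMonoidHom (ℓ ^ k)).ker
  have hP₀ : IsPGroup ℓ P₀ := fun x => ⟨k, Subtype.ext x.2⟩
  have hP : IsPGroup ℓ (P₀.comap (SemidirectProduct.rightHom
      (φ := quotientAction act (frattini N)))) := by
    refine hP₀.comap_of_ker_isPGroup _ ?_
    rw [← SemidirectProduct.range_inl_eq_ker_rightHom]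
    exact (hN.to_quotient _).of_surjective _ (MonoidHom.rangeRestrict_surjective _)
  have hkd : ℓ ^ k ∣ d := Nat.ordProj_dvd d ℓ
  obtain ⟨i, -, ρ, hρ, hl⟩ := hS.exists_lift hD _ _ _ π hπ hker rfl _ (d / ℓ ^ k) 0 hP
    (Nat.div_pos (Nat.le_of_dvd hd hkd) (pow_pos (Fact.out : ℓ.Prime).pos _))
    (Nat.not_dvd_ordCompl Fact.out hd.ne') a ha fun x hx => by
      rw [Subgroup.mem_comap, SemidirectProduct.rightHom_eq_right,
        har x (hD.anti (one_dvd _) le_rfl hx)]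
      have := hfr _ 0 (Nat.div_dvd_of_dvd hkd) x hx
      rwa [Nat.div_div_self hkd hd.ne'] at this
  have hr : ∀ x ∈ D 1 i, (ρ x).right = fr x := fun x hx => by
    rw [← har x (hD.anti dvd_rfl (Nat.zero_le i) hx), ← hl x hx]
    rfl
  refine ⟨i, ρ, hρ, hr, ?_⟩
  have hdi : D d i ≤ D 1 i := hD.anti (one_dvd d) le_rfl
  have hr1 : ∀ x ∈ D d i, (ρ x).right = 1 := fun x hx => by
    have := hfr d i dvd_rfl x hx
    rwa [Nat.div_self hd, pow_one, ← hr x (hdi hx)] at this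
  let κ : Subgroup N :=
    { carrier := {n | ∃ x ∈ D d i, (ρ x).left = n}
      one_mem' := ⟨1, one_mem _, by rw [hρ.map_one]; rfl⟩
      mul_mem' := by
        rintro _ _ ⟨x, hx, rfl⟩ ⟨y, hy, rfl⟩
        refine ⟨x * y, mul_mem hx hy, ?_⟩
        rw [hρ.1 x (hdi hx) y (hdi hy), SemidirectProduct.mul_left, hr1 x hx, map_one]
        rfl
      inv_mem' := by
        rintro _ ⟨x, hx, rfl⟩
        refine ⟨x⁻¹, inv_mem hx, ?_⟩
        rw [hρ.map_inv (hdi hx), SemidirectProduct.inv_left, hr1 x hx, inv_one, map_one]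
        rfl }
  have hκ : κ = ⊤ := by
    refine frattini_nongenerating (eq_top_iff.2 fun n _ => ?_)
    obtain ⟨x, hx, hxn⟩ := hasurj i (n : N ⧸ frattini N)
    have h1 : (((ρ x).left : N) : N ⧸ frattini N) = n := by
      rw [← hxn, ← hl x (hdi hx)]; rfl
    have h2 := Subgroup.mul_mem_sup (S := κ) ⟨x, hx, rfl⟩ (QuotientGroup.eq.1 h1)
    simpa using h2
  exact fun n => (hκ ▸ Subgroup.mem_top n : n ∈ κ)

section

attribute [local instance] Units.mulDistribMulActionRight

/-- `β` is a crossed homomorphism on the subgroup `N` of `P`. -/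
def IsCrossed {P X : Type*} [Group P] [CommGroup X] [MulDistribMulAction P X] (N : Subgroup P)
    (β : P → X) : Prop :=
  ∀ g ∈ N, ∀ h ∈ N, β (g * h) = β g * g • β h

namespace IsCrossed

variable {P X : Type*} [Group P] [CommGroup X] [MulDistribMulAction P X] {N : Subgroup P}
  {β : P → X}

theorem mono {N' : Subgroup P} (h : IsCrossed N β) (hN : N' ≤ N) : IsCrossed N' β :=
  fun x hx y hy => h x (hN hx) y (hN hy)

theorem map_one (h : IsCrossed N β) : β 1 = 1 := by
  have := h 1 (one_mem _) 1 (one_mem _)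
  simpa using this

theorem pow (h : IsCrossed N β) (n : ℕ) : IsCrossed N fun g => β g ^ n :=
  fun x hx y hy => by simp [h x hx y hy, mul_pow, smul_pow']

end IsCrossed

/-- **Hilbert 90** for crossed homomorphisms trivial on a subgroup of finite index. -/
theorem IsCrossed.exists_eq_div {P M : Type*} [Group P] [Field M] [MulSemiringAction P M]
    {N N₀ : Subgroup P} (hN₀ : N₀ ≤ N) (hidx : N₀.relIndex N ≠ 0) {f : P → Mˣ}
    (hf : IsCrossed N f) (hf₀ : ∀ g ∈ N₀, f g = 1)
    (hsep : ∀ g ∈ N, (∀ x : M, (∀ n ∈ N₀, n • x = x) → g • x = x) → g ∈ N₀) :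
    ∃ u : Mˣ, ∀ g ∈ N, f g = u * (g • u)⁻¹ := by
  classical
  let I := N ⧸ N₀.subgroupOf N
  have : Finite I := Nat.finite_of_card_ne_zero hidx
  have : Fintype I := Fintype.ofFinite I
  let F : Subfield M :=
    { carrier := {x | ∀ n ∈ N₀, n • x = x}
      mul_mem' := fun {a b} ha hb n hn => by rw [smul_mul', ha n hn, hb n hn]
      one_mem' := fun n _ => smul_one n
      add_mem' := fun {a b} ha hb n hn => by rw [smul_add, ha n hn, hb n hn]
      zero_mem' := fun n _ => smul_zero n
      neg_mem' := fun {a} ha n hn => by rw [smul_neg, ha n hn]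
      inv_mem' := fun a ha n hn => by rw [smul_inv'', ha n hn] }
  let τ : I → N := Quotient.out
  have hτ : ∀ i, (τ i : I) = i := fun i => Quotient.out_eq' i
  let χ : I → F →* M := fun i =>
    ((MulSemiringAction.toRingHom P M (τ i)).comp F.subtype : F →+* M)
  have hχ : ∀ i (x : F), χ i x = (τ i : P) • (x : M) := fun i x => rfl
  have hinj : Function.Injective χ := by
    intro i j hij
    rw [← hτ i, ← hτ j, QuotientGroup.eq, Subgroup.mem_subgroupOf]
    refine hsep _ (SetLike.coe_mem _) fun x hx => ?_
    have := DFunLike.congr_fun hij (⟨x, hx⟩ : F)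
    rw [hχ, hχ] at this
    simp only [Subgroup.coe_mul, InvMemClass.coe_inv, mul_smul]
    rw [← this, inv_smul_smul]
  have hli := (linearIndependent_monoidHom F M).comp χ hinj
  have key : ∃ x : F, ∑ i, (f (τ i) : M) * ((τ i : P) • (x : M)) ≠ 0 := by
    by_contra! hcon
    have h0 := Fintype.linearIndependent_iff.1 hli (fun i => (f (τ i) : M)) (by
      ext x
      simpa [hχ] using hcon x)
    exact (f (τ ((1 : N) : I))).ne_zero (h0 _)
  obtain ⟨x, hx⟩ := key
  have hwd : ∀ i (g : N), ((g : N) : I) = i →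
      (f g : M) * ((g : P) • (x : M)) = f (τ i) * ((τ i : P) • (x : M)) := by
    intro i g hi
    rw [← hτ i, eq_comm, QuotientGroup.eq, Subgroup.mem_subgroupOf] at hi
    obtain ⟨n, hn⟩ : ∃ n, n = (τ i : P)⁻¹ * g := ⟨_, rfl⟩
    have hn0 : n ∈ N₀ := hn ▸ hi
    have hg : (g : P) = τ i * n := by rw [hn]; group
    rw [hg, hf _ (τ i).2 _ (hN₀ hn0), hf₀ n hn0, smul_one, mul_one, mul_smul, x.2 n hn0]
  refine ⟨Units.mk0 _ hx, fun g hg => ?_⟩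
  rw [eq_mul_inv_iff_mul_eq]
  ext
  have hsm : ((g • Units.mk0 _ hx : Mˣ) : M) = g • ∑ i, (f (τ i) : M) * ((τ i : P) • (x : M)) := rfl
  rw [Units.val_mul, hsm, Units.val_mk0, Finset.smul_sum, Finset.mul_sum]
  refine Fintype.sum_equiv (MulAction.toPerm (β := I) (⟨g, hg⟩ : N)) _ _ fun i => ?_
  rw [MulAction.toPerm_apply, ← hwd ((⟨g, hg⟩ : N) • i) (⟨g, hg⟩ * τ i) ?_]
  · have hsm' : ((g • f (τ i) : Mˣ) : M) = g • (f (τ i) : M) := rfl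
    rw [Subgroup.coe_mul, hf g hg _ (τ i).2, Units.val_mul, smul_mul', mul_smul, mul_assoc, hsm']
  · conv_rhs => rw [← hτ i]
    rfl

/-- A homomorphism `s` on `N'`, together with an element `ξ` inducing on it the conjugation by `x`,
extends to pairs `(y, j)` with `y` in the coset of `x ^ j`. -/
theorem conj_extension_mul {P H : Type*} [Group P] [Group H] {N' : Subgroup P} {x : P}
    (hx : ∀ z, x * z * x⁻¹ ∈ N' ↔ z ∈ N') {s : P → H}
    (hs : ∀ z ∈ N', ∀ w ∈ N', s (z * w) = s z * s w) {ξ : H}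
    (hξ : ∀ z ∈ N', ξ * s z * ξ⁻¹ = s (x * z * x⁻¹)) {y y' : P} {j j' : ℕ}
    (hy : y * (x ^ j)⁻¹ ∈ N') (hy' : y' * (x ^ j')⁻¹ ∈ N') :
    y * y' * (x ^ (j + j'))⁻¹ ∈ N' ∧
    s (y * y' * (x ^ (j + j'))⁻¹) * ξ ^ (j + j') =
      (s (y * (x ^ j)⁻¹) * ξ ^ j) * (s (y' * (x ^ j')⁻¹) * ξ ^ j') := by
  have hxp : ∀ j : ℕ, ∀ z ∈ N', x ^ j * z * (x ^ j)⁻¹ ∈ N' ∧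
      ξ ^ j * s z * (ξ ^ j)⁻¹ = s (x ^ j * z * (x ^ j)⁻¹) := by
    intro j
    induction j with
    | zero => intro z hz; simpa using hz
    | succ j ih =>
      intro z hz
      have h1 : x ^ (j + 1) * z * (x ^ (j + 1))⁻¹ = x * (x ^ j * z * (x ^ j)⁻¹) * x⁻¹ := by
        rw [pow_succ']; group
      rw [h1]
      refine ⟨(hx _).2 (ih z hz).1, ?_⟩
      rw [← hξ _ (ih z hz).1, ← (ih z hz).2, pow_succ']; group
  obtain ⟨h1, h2⟩ := hxp j _ hy'
  have h3 : y * y' * (x ^ (j + j'))⁻¹ =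
      (y * (x ^ j)⁻¹) * (x ^ j * (y' * (x ^ j')⁻¹) * (x ^ j)⁻¹) := by rw [pow_add]; group
  rw [h3]
  refine ⟨mul_mem hy h1, ?_⟩
  rw [hs _ hy _ h1, ← h2, pow_add]
  group

theorem SemidirectProduct.left_pow_smul {P X : Type*} [Group P] [CommGroup X]
    [MulDistribMulAction P X] (w : X) (y : P) (n : ℕ) :
    (⟨w, y⟩ : X ⋊[MulDistribMulAction.toMulAut P X] P) ^ n =
      ⟨∏ a ∈ Finset.range n, y ^ a • w, y ^ n⟩ := by
  induction n with
  | zero => ext <;> simp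
  | succ n ih =>
    rw [pow_succ, ih]
    ext
    · simp [-SemidirectProduct.mk_eq_inl_mul_inr, Finset.prod_range_succ]
    · simp [-SemidirectProduct.mk_eq_inl_mul_inr, pow_succ]

/-- The obstruction `h` to extending a crossed homomorphism along a cyclic extension of groups. -/
theorem IsCrossed.obstruction_spec {P X : Type*} [Group P] [CommGroup X]
    [MulDistribMulAction P X] {N N' : Subgroup P} (hN' : N' ≤ N) {x : P}
    (hx : ∀ z, x * z * x⁻¹ ∈ N' ↔ z ∈ N') {m : ℕ} (hm0 : 0 < m) (hxm : x ^ m ∈ N')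
    (hmin : ∀ j, x ^ j ∈ N' → m ∣ j) (hgen : ∀ y ∈ N, ∃ j : ℕ, y * (x ^ j)⁻¹ ∈ N')
    {β' : P → X} (hβ' : IsCrossed N' β') {u : X}
    (hu : ∀ z ∈ N', β' (x * z * x⁻¹) = u * x • β' z * ((x * z * x⁻¹) • u)⁻¹)
    {h : X} (hdef : h = (∏ a ∈ Finset.range m, x ^ a • u) * (β' (x ^ m))⁻¹) :
    (∀ y ∈ N, y • h = h) ∧
      (∀ v : X, (∀ z ∈ N', z • v = v) → h = ∏ a ∈ Finset.range m, x ^ a • v →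
        ∃ β : P → X, IsCrossed N β ∧ ∀ z ∈ N', β z = β' z) ∧
      ∀ y ∈ N, ∀ d n : ℕ, y * (x ^ d)⁻¹ ∈ N' → m ∣ n → y ^ n ∈ N' →
        ∃ w : X, ∏ a ∈ Finset.range n, y ^ a • w = β' (y ^ n) * h ^ (d * (n / m)) := by
  let s : P → X ⋊[MulDistribMulAction.toMulAut P X] P := fun z => ⟨β' z, z⟩
  have hs : ∀ z ∈ N', ∀ w ∈ N', s (z * w) = s z * s w := fun z hz w hw => by
    ext
    · exact hβ' z hz w hw
    · rfl
  let ξ : X ⋊[MulDistribMulAction.toMulAut P X] P := ⟨u, x⟩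
  have hconj : ∀ (u : X), (∀ z ∈ N', β' (x * z * x⁻¹) = u * x • β' z * ((x * z * x⁻¹) • u)⁻¹) →
      ∀ z ∈ N', (⟨u, x⟩ : X ⋊[MulDistribMulAction.toMulAut P X] P) * s z *
          (⟨u, x⟩ : X ⋊[MulDistribMulAction.toMulAut P X] P)⁻¹ =
        s (x * z * x⁻¹) := fun u hu z hz => by
    rw [mul_inv_eq_iff_eq_mul]
    ext
    · simp [-SemidirectProduct.mk_eq_inl_mul_inr, s, hu z hz]
    · simp [-SemidirectProduct.mk_eq_inl_mul_inr, s]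
  have hξ := hconj u hu
  let ζ : X ⋊[MulDistribMulAction.toMulAut P X] P := ⟨h, 1⟩
  have hξm : ξ ^ m = ζ * s (x ^ m) := by
    rw [SemidirectProduct.left_pow_smul]
    ext
    · simp [-SemidirectProduct.mk_eq_inl_mul_inr, ζ, s, hdef]
    · simp [-SemidirectProduct.mk_eq_inl_mul_inr, ζ, s]
  have hmulw := fun {y y' : P} {j j' : ℕ} => conj_extension_mul (y := y) (y' := y') (j := j)
    (j' := j') (ξ := ξ) hx hs hξ
  have hs1 : s 1 = 1 := by simpa using hs 1 (one_mem _) 1 (one_mem _)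
  have hζ : ζ = ξ ^ m * (s (x ^ m))⁻¹ := by rw [hξm]; group
  have hsinv : (s (x ^ m))⁻¹ = s (x ^ m)⁻¹ := by
    rw [inv_eq_iff_mul_eq_one, ← hs _ hxm _ (inv_mem hxm), mul_inv_cancel, hs1]
  have hcξ : ξ * ζ = ζ * ξ := by
    have := hξ _ hxm
    rw [show x * x ^ m * x⁻¹ = x ^ m by group] at this
    have h1 : ξ * s (x ^ m) = s (x ^ m) * ξ := by rw [← mul_inv_eq_iff_eq_mul, this]
    have h2 : Commute ξ (s (x ^ m)) := h1
    rw [hζ]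
    exact ((Commute.refl ξ).pow_right m).mul_right h2.inv_right
  have hxinv : ∀ z ∈ N', (x ^ m)⁻¹ * z * x ^ m ∈ N' := fun z hz =>
    mul_mem (mul_mem (inv_mem hxm) hz) hxm
  have hcs : ∀ z ∈ N', s z * ζ = ζ * s z := fun z hz => by
    have e1 := (hmulw (y := x ^ m) (y' := (x ^ m)⁻¹ * z * x ^ m) (j := m) (j' := 0) (by simp)
      (by simpa using hxinv z hz)).2
    simp only [mul_inv_cancel, hs1, one_mul, add_zero, pow_zero, inv_one, mul_one] at e1
    rw [hζ, ← mul_assoc]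
    have e2 : x ^ m * ((x ^ m)⁻¹ * z * x ^ m) * (x ^ m)⁻¹ = z := by group
    rw [e2, hs _ (mul_mem (inv_mem hxm) hz) _ hxm, hs _ (inv_mem hxm) _ hz, ← hsinv] at e1
    rw [e1]; group
  have hfix : ∀ y ∈ N, y • h = h := by
    have hz : ∀ z ∈ N', z • h = h := fun z hz => by
      have := congrArg SemidirectProduct.left (hcs z hz)
      change β' z * z • h = h * (1 : P) • β' z at this
      rw [one_smul, mul_comm h] at this
      exact mul_left_cancel this
    have hxh : x • h = h := by
      have := congrArg SemidirectProduct.left hcξ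
      change u * x • h = h * (1 : P) • u at this
      rw [one_smul, mul_comm h] at this
      exact mul_left_cancel this
    have hxj : ∀ j : ℕ, x ^ j • h = h := fun j => by
      induction j with
      | zero => simp
      | succ j ih => rw [pow_succ, mul_smul, hxh, ih]
    intro y hy
    obtain ⟨j, hj⟩ := hgen y hy
    conv_lhs => rw [← hxj j]
    rw [← mul_smul] at *
    have := hz _ hj
    rw [mul_smul, inv_smul_eq_iff.2 (hxj j).symm] at this
    rw [mul_smul, hxj, this]
  refine ⟨hfix, fun v hv hhv => ?_, fun y hy d n hyd hmn hyn => ?_⟩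
  · have hu' : ∀ z ∈ N', β' (x * z * x⁻¹) = (u * v⁻¹) * x • β' z *
        ((x * z * x⁻¹) • (u * v⁻¹))⁻¹ := fun z hz => by
      rw [hu z hz, smul_mul', smul_inv', hv _ ((hx z).2 hz)]
      rw [mul_inv, inv_inv, mul_right_comm u v⁻¹, mul_assoc (_ * _) v⁻¹, mul_comm _ v,
        inv_mul_cancel_left]
    let ξ' : X ⋊[MulDistribMulAction.toMulAut P X] P := ⟨u * v⁻¹, x⟩
    have hξ'm : ξ' ^ m = s (x ^ m) := by
      rw [SemidirectProduct.left_pow_smul]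
      ext
      · simp only [s, smul_mul', smul_inv', Finset.prod_mul_distrib, Finset.prod_inv_distrib,
          ← hhv, hdef]
        simp
      · rfl
    have hmul' := fun {y y' : P} {j j' : ℕ} => conj_extension_mul (y := y) (y' := y') (j := j)
      (j' := j') (ξ := ξ') hx hs (hconj _ hu')
    have hwd : ∀ (y : P) (j j' : ℕ), y * (x ^ j)⁻¹ ∈ N' → y * (x ^ j')⁻¹ ∈ N' → j ≤ j' →
        s (y * (x ^ j)⁻¹) * ξ' ^ j = s (y * (x ^ j')⁻¹) * ξ' ^ j' := by
      intro y j j' hj hj' hle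
      obtain ⟨k, rfl⟩ := Nat.exists_eq_add_of_le hle
      have hk : x ^ k ∈ N' := by
        have := mul_mem (inv_mem hj') hj
        rw [pow_add] at this
        have h2 := (show (y * (x ^ j * x ^ k)⁻¹)⁻¹ * (y * (x ^ j)⁻¹) =
          x ^ j * x ^ k * (x ^ j)⁻¹ by group)
        rw [h2, ← pow_add, add_comm, pow_add, mul_inv_cancel_right] at this
        exact this
      obtain ⟨r, rfl⟩ := hmin k hk
      have hpow : ∀ r : ℕ, x ^ (m * r) ∈ N' ∧ ξ' ^ (m * r) = s (x ^ (m * r)) := by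
        intro r
        induction r with
        | zero => simp [-SemidirectProduct.mk_eq_inl_mul_inr, hs1]
        | succ r ih =>
          rw [Nat.mul_succ, pow_add, pow_add, hs _ ih.1 _ hxm, ih.2, hξ'm]
          exact ⟨mul_mem ih.1 hxm, rfl⟩
      have hc : (y * (x ^ (j + m * r))⁻¹) * x ^ (m * r) = y * (x ^ j)⁻¹ := by
        rw [add_comm, pow_add]; group
      rw [add_comm j, pow_add ξ', (hpow r).2, ← mul_assoc, ← hs _ (by rwa [add_comm]) _ hk,
        add_comm (m * r), hc]
    choose! J hJ using hgen
    have hwd' : ∀ (y : P) (j : ℕ), y ∈ N → y * (x ^ j)⁻¹ ∈ N' →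
        s (y * (x ^ J y)⁻¹) * ξ' ^ J y = s (y * (x ^ j)⁻¹) * ξ' ^ j := by
      intro y j hy hj
      rcases le_total (J y) j with hle | hle
      · exact hwd y _ _ (hJ y hy) hj hle
      · exact (hwd y _ _ hj (hJ y hy) hle).symm
    have hright : ∀ y, (s (y * (x ^ J y)⁻¹) * ξ' ^ J y).right = y := fun y => by
      rw [SemidirectProduct.left_pow_smul]; simp [-SemidirectProduct.mk_eq_inl_mul_inr, s]
    refine ⟨fun y => (s (y * (x ^ J y)⁻¹) * ξ' ^ J y).left, fun y hy y' hy' => ?_, fun z hz => ?_⟩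
    · have := hmul' (hJ y hy) (hJ y' hy')
      beta_reduce
      rw [hwd' (y * y') _ (mul_mem hy hy') this.1, this.2, SemidirectProduct.mul_left, hright]
      rfl
    · simp only
      rw [hwd' z 0 (hN' hz) (by simpa using hz)]
      simp [-SemidirectProduct.mk_eq_inl_mul_inr, s]
  · have hpow : ∀ n : ℕ, y ^ n * (x ^ (d * n))⁻¹ ∈ N' ∧
        s (y ^ n * (x ^ (d * n))⁻¹) * ξ ^ (d * n) = (s (y * (x ^ d)⁻¹) * ξ ^ d) ^ n := by
      intro n
      induction n with
      | zero => simp [-SemidirectProduct.mk_eq_inl_mul_inr, hs1]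
      | succ n ih =>
        have := hmulw ih.1 hyd
        rw [Nat.mul_succ, pow_succ, pow_succ, ← ih.2]
        exact this
    obtain ⟨r, rfl⟩ := hmn
    have hξk : ∀ k : ℕ, x ^ (m * k) ∈ N' ∧ ξ ^ (m * k) = s (x ^ (m * k)) * ζ ^ k := by
      intro k
      induction k with
      | zero => simp [-SemidirectProduct.mk_eq_inl_mul_inr, hs1]
      | succ k ih =>
        rw [Nat.mul_succ, pow_add, pow_add, hs _ ih.1 _ hxm, ih.2, hξm, pow_succ]
        refine ⟨mul_mem ih.1 hxm, ?_⟩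
        have hc : Commute (s (x ^ m)) (ζ ^ k * ζ) := by
          rw [← pow_succ]; exact Commute.pow_right (hcs _ hxm) _
        rw [← mul_assoc, mul_assoc _ (ζ ^ k), mul_assoc _ (ζ ^ k * ζ), ← hc.eq, mul_assoc]
    refine ⟨(s (y * (x ^ d)⁻¹) * ξ ^ d).left, ?_⟩
    have hright : (s (y * (x ^ d)⁻¹) * ξ ^ d).right = y := by
      rw [SemidirectProduct.left_pow_smul]; simp [-SemidirectProduct.mk_eq_inl_mul_inr, s]
    have e1 := (hpow (m * r)).2
    have e0 := (hpow (m * r)).1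
    have e3 : d * (m * r) = m * (d * r) := by ring
    rw [e3] at e1 e0
    rw [(hξk (d * r)).2, ← mul_assoc, ← hs _ e0 _ (hξk _).1, inv_mul_cancel_right] at e1
    have e2 : (s (y * (x ^ d)⁻¹) * ξ ^ d) = ⟨(s (y * (x ^ d)⁻¹) * ξ ^ d).left, y⟩ := by
      ext
      · rfl
      · exact hright
    have hζp : ∀ k : ℕ, ζ ^ k = ⟨h ^ k, 1⟩ := fun k => by
      rw [SemidirectProduct.left_pow_smul]; simp
    rw [e2, hζp, SemidirectProduct.left_pow_smul (_ : X) y] at e1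
    have e4 := congrArg SemidirectProduct.left e1
    simp only at e4
    rw [← e4]
    rw [Nat.mul_div_cancel_left _ hm0]
    change β' _ * y ^ (m * r) • h ^ (d * r) = _
    rw [smul_pow', hfix _ (hN' hyn)]

end

namespace MvPolynomial

/-- Over an algebraically closed field, points have height the number of variables. -/
theorem height_vanishingIdeal_singleton {A σ : Type*} [Field A] [IsAlgClosed A] [Finite σ]
    (x : σ → A) : (vanishingIdeal A {x}).height = Nat.card σ := by
  have key : ∀ x : σ → A, (vanishingIdeal A {x}).height =
      (vanishingIdeal A {(0 : σ → A)}).height := by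
    intro x
    let e : MvPolynomial σ A ≃ₐ[A] MvPolynomial σ A :=
      AlgEquiv.ofAlgHom (aeval fun i => X i + C (x i)) (aeval fun i => X i - C (x i))
        (by ext i; simp) (by ext i; simp)
    have : vanishingIdeal A {x} = (vanishingIdeal A {(0 : σ → A)}).comap e.toRingEquiv := by
      ext p
      rw [Ideal.mem_comap]
      have h : (aeval (0 : σ → A)).comp (e : MvPolynomial σ A →ₐ[A] MvPolynomial σ A) =
          aeval x := by
        ext i; simp [e]
      simp only [mem_vanishingIdeal_iff, Set.mem_singleton_iff, forall_eq, ← h]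
      rfl
    rw [this]
    exact RingEquiv.height_comap e.toRingEquiv _
  have h1 := Ideal.sup_isMaximal_height_eq_ringKrullDim (R := MvPolynomial σ A)
  have h2 : (⨆ (I : Ideal (MvPolynomial σ A)) (_ : I.IsMaximal), I.height) =
      (vanishingIdeal A {(0 : σ → A)}).height := by
    refine le_antisymm (iSup₂_le fun I hI => ?_) ?_
    · obtain ⟨y, rfl⟩ := isMaximal_iff_eq_vanishingIdeal_singleton.1 hI
      rw [key]
    · exact le_iSup₂_of_le _ (isMaximal_iff_eq_vanishingIdeal_singleton.2 ⟨0, rfl⟩) le_rfl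
  rw [h2, ringKrullDim_of_isNoetherianRing, ringKrullDim_eq_zero_of_field, zero_add] at h1
  rw [key]
  exact_mod_cast h1

/-- Fewer equations than unknowns cannot have an isolated solution at the origin. -/
theorem exists_common_zero_ne_zero {A σ : Type*} [Field A] [IsAlgClosed A] [Finite σ]
    (s : Finset (MvPolynomial σ A)) (hs : s.card < Nat.card σ)
    (h0 : ∀ p ∈ s, aeval (0 : σ → A) p = 0) :
    ∃ x : σ → A, x ≠ 0 ∧ ∀ p ∈ s, aeval x p = 0 := by
  by_contra! hcon
  have hz : zeroLocus A (Ideal.span (s : Set (MvPolynomial σ A))) = {(0 : σ → A)} := by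
    ext x
    rw [zeroLocus_span]
    simp only [Set.mem_ofPred_eq, Set.mem_singleton_iff, Finset.mem_coe]
    refine ⟨fun h => ?_, fun h => h ▸ h0⟩
    by_contra hx
    obtain ⟨p, hp, hpx⟩ := hcon x hx
    exact hpx (h p hp)
  have hrad := vanishingIdeal_zeroLocus_eq_radical (K := A)
    (Ideal.span (s : Set (MvPolynomial σ A)))
  rw [hz] at hrad
  have hmax : (vanishingIdeal A {(0 : σ → A)}).IsMaximal :=
    isMaximal_iff_eq_vanishingIdeal_singleton.2 ⟨0, rfl⟩
  have hmin : vanishingIdeal A {(0 : σ → A)} ∈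
      (Ideal.span (s : Set (MvPolynomial σ A))).minimalPrimes := by
    rw [← Ideal.radical_minimalPrimes, ← hrad, Ideal.minimalPrimes_eq_subsingleton_self]
    rfl
  have := Ideal.height_le_card_of_mem_minimalPrimes_span_finset hmin
  rw [height_vanishingIdeal_singleton] at this
  exact absurd hs (not_lt.2 (by exact_mod_cast this))

open Polynomial in
/-- **Tsen's theorem** for finite extensions of the rational function field, in a form where the
unknowns are restricted to the rational function field. -/
theorem IsHomogeneous.exists_zero_of_finrank_lt {A k F ι : Type*} [Field A] [IsAlgClosed A]
    [Field k] [Algebra A[X] k] [IsFractionRing A[X] k] [Field F] [Algebra k F]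
    [FiniteDimensional k F] [Fintype ι] {P : MvPolynomial ι F} {n : ℕ} (hn : 0 < n)
    (hP : P.IsHomogeneous n) (hcard : n * Module.finrank k F < Fintype.card ι) :
    ∃ x : ι → k, x ≠ 0 ∧ eval (fun i => algebraMap k F (x i)) P = 0 := by
  classical
  set r := Module.finrank k F with hr
  let b := Module.finBasis k F
  obtain ⟨D, hD⟩ := IsLocalization.exist_integer_multiples (nonZeroDivisors A[X])
    (P.support ×ˢ (Finset.univ : Finset (Fin r))) fun mj => b.repr (coeff mj.1 P) mj.2
  have hD' : ∀ (m : ι →₀ ℕ) (j : Fin r), ∃ q : A[X], m ∈ P.support →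
      algebraMap A[X] k q = algebraMap A[X] k D * b.repr (coeff m P) j := fun m j => by
    by_cases hm : m ∈ P.support
    · obtain ⟨q, hq⟩ := hD (m, j) (by simp [hm])
      exact ⟨q, fun _ => by rw [hq, Algebra.smul_def]⟩
    · exact ⟨0, fun h => absurd h hm⟩
  choose q hq using hD'
  let δ := (P.support ×ˢ (Finset.univ : Finset (Fin r))).sup fun mj => (q mj.1 mj.2).natDegree
  have hδ : ∀ m ∈ P.support, ∀ j, (q m j).natDegree ≤ δ := fun m hm j =>
    Finset.le_sup (f := fun mj : (ι →₀ ℕ) × Fin r => (q mj.1 mj.2).natDegree) (by simpa using hm :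
      (m, j) ∈ P.support ×ˢ (Finset.univ : Finset (Fin r)))
  let e := r * (δ + 1)
  let Y : ι → (MvPolynomial (ι × Fin (e + 1)) A)[X] := fun i =>
    ∑ k : Fin (e + 1), Polynomial.C (MvPolynomial.X (i, k)) * Polynomial.X ^ (k : ℕ)
  let R : Fin r → (MvPolynomial (ι × Fin (e + 1)) A)[X] := fun j =>
    ∑ m ∈ P.support, (q m j).map MvPolynomial.C * ∏ i, Y i ^ m i
  have hdegm : ∀ m ∈ P.support, ∑ i, m i = n := fun m hm => by
    have h1 : m.degree = Finsupp.weight 1 m := DFunLike.congr_fun Finsupp.degree_eq_weight_one m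
    rw [← hP (mem_support_iff.1 hm), ← h1, Finsupp.degree_eq_sum]
  have hYdeg : ∀ i, (Y i).natDegree ≤ e := fun i =>
    natDegree_sum_le_of_forall_le _ _ fun k _ =>
      (natDegree_C_mul_X_pow_le _ _).trans (Nat.lt_succ_iff.1 k.2)
  have hRdeg : ∀ j, (R j).natDegree ≤ δ + n * e := fun j =>
    natDegree_sum_le_of_forall_le _ _ fun m hm => by
      refine natDegree_mul_le.trans (add_le_add ((natDegree_map_le).trans (hδ m hm j)) ?_)
      refine (natDegree_prod_le _ _).trans ?_
      rw [← hdegm m hm, Finset.sum_mul]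
      exact Finset.sum_le_sum fun i _ =>
        natDegree_pow_le.trans (Nat.mul_le_mul_left _ (hYdeg i))
  let s : Finset (MvPolynomial (ι × Fin (e + 1)) A) :=
    (Finset.univ ×ˢ Finset.range (δ + n * e + 1)).image fun jt : Fin r × ℕ => (R jt.1).coeff jt.2
  have hmapY : ∀ (y : ι × Fin (e + 1) → A) i, (Y i).map (MvPolynomial.eval y) =
      ∑ k : Fin (e + 1), Polynomial.C (y (i, k)) * Polynomial.X ^ (k : ℕ) := fun y i => by
    simp [Y, Polynomial.map_sum]
  have hmapR : ∀ (y : ι × Fin (e + 1) → A) j, (R j).map (MvPolynomial.eval y) =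
      ∑ m ∈ P.support, q m j *
        ∏ i, (∑ k : Fin (e + 1), Polynomial.C (y (i, k)) * Polynomial.X ^ (k : ℕ)) ^ m i := by
    intro y j
    simp only [R, Polynomial.map_sum, Polynomial.map_mul, Polynomial.map_prod, Polynomial.map_pow,
      hmapY, Polynomial.map_map]
    refine Finset.sum_congr rfl fun m _ => ?_
    congr 1
    convert Polynomial.map_id
    ext; simp
  obtain ⟨y, hy0, hy⟩ := exists_common_zero_ne_zero s (by
    refine Finset.card_image_le.trans_lt ?_
    rw [Finset.card_product, Finset.card_univ, Fintype.card_fin, Finset.card_range,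
      Nat.card_eq_fintype_card, Fintype.card_prod, Fintype.card_fin]
    have h1 : (n * r + 1) * (e + 1) ≤ Fintype.card ι * (e + 1) := Nat.mul_le_mul_right _ hcard
    have h2 : r * (δ + n * e + 1) = n * r * e + e := by simp only [e]; ring
    nlinarith) (by
    intro p hp
    obtain ⟨⟨j, t⟩, -, rfl⟩ := Finset.mem_image.1 hp
    have := Polynomial.coeff_map (MvPolynomial.eval (0 : ι × Fin (e + 1) → A))
      (p := R j) t
    refine this.symm.trans ?_
    rw [hmapR, Finset.sum_eq_zero, Polynomial.coeff_zero]
    intro m hm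
    obtain ⟨i, -, hi⟩ : ∃ i ∈ Finset.univ, m i ≠ 0 :=
      Finset.exists_ne_zero_of_sum_ne_zero (by rw [hdegm m hm]; exact hn.ne')
    rw [Finset.prod_eq_zero (Finset.mem_univ i), mul_zero]
    simp [hi])
  have hR0 : ∀ j, (R j).map (MvPolynomial.eval y) = 0 := fun j => by
    ext t
    rw [Polynomial.coeff_map, Polynomial.coeff_zero]
    by_cases ht : t < δ + n * e + 1
    · exact hy _ (Finset.mem_image.2 ⟨(j, t), by simpa using ht, rfl⟩)
    · rw [coeff_eq_zero_of_natDegree_lt (by have := hRdeg j; omega), map_zero]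
  let f : ι → A[X] := fun i => ∑ k : Fin (e + 1), Polynomial.C (y (i, k)) * Polynomial.X ^ (k : ℕ)
  refine ⟨fun i => algebraMap A[X] k (f i), fun h => hy0 ?_, ?_⟩
  · ext ⟨i, k'⟩
    have h1 : f i = 0 := IsFractionRing.injective A[X] k (by simpa using congrFun h i)
    have h2 := congrArg (fun p => Polynomial.coeff p (k' : ℕ)) h1
    simp only [f, finsetSum_coeff, Polynomial.coeff_C_mul, Polynomial.coeff_X_pow,
      Polynomial.coeff_zero] at h2
    rw [Finset.sum_eq_single k'] at h2
    · simpa using h2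
    · intro l _ hl
      rw [if_neg (fun h => hl (Fin.ext h.symm)), mul_zero]
    · simp
  · have hD0 : algebraMap A[X] k D ≠ 0 := by
      simp
    have hz : algebraMap A[X] k D • eval (fun i => algebraMap k F (algebraMap A[X] k (f i))) P =
        0 := by
      rw [eval_eq']
      apply b.repr.injective
      ext j
      have h3 : ∀ m, coeff m P * ∏ i, algebraMap k F (algebraMap A[X] k (f i)) ^ m i =
          (algebraMap A[X] k (∏ i, f i ^ m i)) • coeff m P := fun m => by
        rw [Algebra.smul_def, mul_comm]; simp
      simp only [h3, map_smul, map_sum, Finsupp.smul_apply, Finsupp.coe_finsetSum,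
        Finset.sum_apply, smul_eq_mul, map_zero, Finsupp.zero_apply, Finset.mul_sum]
      have h4 := congrArg (algebraMap A[X] k) ((hmapR y j).symm.trans (hR0 j))
      rw [map_zero, map_sum] at h4
      rw [← h4]
      refine Finset.sum_congr rfl fun m hm => ?_
      rw [map_mul, hq m j hm]
      ring
    exact (smul_eq_zero.1 hz).resolve_left hD0

end MvPolynomial

open Polynomial in
/-- Finite extensions of a rational function field over an algebraically closed field are `C₁`. -/
theorem MvPolynomial.IsHomogeneous.exists_zero_of_lt_card {A k F ι : Type*} [Field A]
    [IsAlgClosed A] [Field k] [Algebra A[X] k] [IsFractionRing A[X] k] [Field F] [Algebra k F]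
    [FiniteDimensional k F] [Fintype ι] {P : MvPolynomial ι F} {n : ℕ} (hn : 0 < n)
    (hP : P.IsHomogeneous n) (hcard : n < Fintype.card ι) :
    ∃ y : ι → F, y ≠ 0 ∧ MvPolynomial.eval y P = 0 := by
  classical
  let c := Module.finBasis k F
  let g : ι → MvPolynomial (ι × Fin (Module.finrank k F)) F := fun i =>
    ∑ j, MvPolynomial.C (c j) * MvPolynomial.X (i, j)
  have hQ := hP.aeval g (n := 1) fun i => MvPolynomial.IsHomogeneous.sum _ _ _ fun j _ =>
    MvPolynomial.isHomogeneous_C_mul_X _ _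
  obtain ⟨x, hx, hx0⟩ := hQ.exists_zero_of_finrank_lt (A := A) (k := k) (by simpa using hn) (by
    rw [one_mul, Fintype.card_prod, Fintype.card_fin]
    exact Nat.mul_lt_mul_of_pos_right hcard Module.finrank_pos)
  refine ⟨fun i => ∑ j, c j * algebraMap k F (x (i, j)), fun h => hx ?_, ?_⟩
  · ext ⟨i, j⟩
    have h1 := congrFun h i
    refine Fintype.linearIndependent_iff.1 c.linearIndependent (fun j => x (i, j)) ?_ j
    refine Eq.trans ?_ h1
    exact Finset.sum_congr rfl fun j _ => by rw [Algebra.smul_def, mul_comm]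
  · have h1 : MvPolynomial.eval (fun i => ∑ j, c j * algebraMap k F (x (i, j))) =
        (MvPolynomial.eval fun i => algebraMap k F (x i)).comp
          (MvPolynomial.aeval g).toRingHom := by
      ext i
      · simp
      · simp [g]
    rw [h1]
    exact hx0

open Polynomial in
/-- Every invariant element is a norm, for a cyclic group of automorphisms of an algebraic extension
of a rational function field over an algebraically closed field. -/
theorem exists_prod_pow_apply_eq_of_orderOf {A k E : Type*} [Field A]
    [IsAlgClosed A] [Field k] [Algebra A[X] k] [IsFractionRing A[X] k] [Field E] [Algebra k E]
    [Algebra.IsAlgebraic k E] (σ : E ≃ₐ[k] E) {n : ℕ} (hn : 0 < n) (hσ : orderOf σ = n) {a : E}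
    (ha : σ a = a) : ∃ u : E, ∏ j ∈ Finset.range n, (σ ^ j) u = a := by
  classical
  let H := Subgroup.zpowers σ
  have hcardH : Nat.card H = n := by rw [Nat.card_zpowers, hσ]
  have : Finite H := Nat.finite_of_card_ne_zero (by omega)
  have : Fintype H := Fintype.ofFinite H
  let F₀ := FixedPoints.subfield H E
  have hF₀ : ∀ z : E, σ z = z → z ∈ F₀ := by
    rintro z hz ⟨τ, hτ⟩
    obtain ⟨j, rfl⟩ := Subgroup.mem_zpowers_iff.1 hτ
    have hst : σ ∈ MulAction.stabilizer (E ≃ₐ[k] E) z := hz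
    exact zpow_mem hst j
  have hF₀' : ∀ z ∈ F₀, ∀ j : ℕ, (σ ^ j) z = z := fun z hz j =>
    hz ⟨σ ^ j, Subgroup.npow_mem_zpowers σ j⟩
  have hfr : Module.finrank F₀ E = n := by
    rw [FixedPoints.finrank_eq_card, ← Nat.card_eq_fintype_card, hcardH]
  have : FiniteDimensional F₀ E := Module.finite_of_finrank_pos (by omega)
  let b := (Module.finBasis F₀ E).reindex (finCongr hfr)
  have hσn : σ ^ n = 1 := hσ ▸ pow_orderOf_eq_one σ
  let N : MvPolynomial (Option (Fin n)) E :=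
    ∏ j ∈ Finset.range n, ∑ i, MvPolynomial.C ((σ ^ j) (b i)) * MvPolynomial.X (some i)
  let P : MvPolynomial (Option (Fin n)) E := N - MvPolynomial.C a * MvPolynomial.X none ^ n
  have hP : P.IsHomogeneous n := by
    have h1 := MvPolynomial.IsHomogeneous.prod (Finset.range n) (fun j =>
      ∑ i, MvPolynomial.C ((σ ^ j) (b i)) * MvPolynomial.X (some i)) (fun _ => 1)
      fun j _ => MvPolynomial.IsHomogeneous.sum _ _ _ fun i _ =>
        MvPolynomial.isHomogeneous_C_mul_X _ _
    simp only [Finset.sum_const, Finset.card_range, smul_eq_mul, mul_one] at h1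
    exact h1.sub (MvPolynomial.isHomogeneous_C_mul_X_pow _ _ _)
  have hPσ : P.map (σ : E →+* E) = P := by
    have hN : N.map (σ : E →+* E) = N := by
      have h1 : ∀ j, (∑ i, MvPolynomial.C ((σ ^ j) (b i)) * MvPolynomial.X (some i) :
          MvPolynomial (Option (Fin n)) E).map (σ : E →+* E) =
          ∑ i, MvPolynomial.C ((σ ^ (j + 1)) (b i)) * MvPolynomial.X (some i) := fun j => by
        simp [pow_succ']
      simp only [N, map_prod, h1]
      obtain ⟨m, rfl⟩ := Nat.exists_eq_succ_of_ne_zero hn.ne'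
      rw [Finset.prod_range_succ, Finset.prod_range_succ']
      congr 1
      rw [show σ ^ (m + 1) = σ ^ 0 from hσn]
    rw [map_sub, hN, map_mul, map_pow, MvPolynomial.map_X, MvPolynomial.map_C]
    simp [P, ha]
  let F : IntermediateField k E := IntermediateField.adjoin k (P.coeffs : Set E)
  have : FiniteDimensional k F := IntermediateField.finiteDimensional_adjoin fun x _ =>
    Algebra.IsIntegral.isIntegral x
  have hF : ∀ z ∈ F, σ z = z := by
    have : F ≤ IntermediateField.fixedField H := by
      rw [IntermediateField.adjoin_le_iff]
      intro z hz
      obtain ⟨m, -, rfl⟩ := MvPolynomial.mem_coeffs_iff.1 hz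
      refine hF₀ _ ?_
      conv_rhs => rw [← hPσ, MvPolynomial.coeff_map]
      rfl
    exact fun z hz => this hz ⟨σ, Subgroup.mem_zpowers σ⟩
  obtain ⟨P₁, hP₁⟩ := MvPolynomial.mem_range_map_iff_coeffs_subset.2
    (show (P.coeffs : Set E) ⊆ Set.range F.val.toRingHom from fun z hz =>
      ⟨⟨z, IntermediateField.subset_adjoin _ _ hz⟩, rfl⟩)
  have hP₁h : P₁.IsHomogeneous n := MvPolynomial.IsHomogeneous.of_map
    (f := F.val.toRingHom) F.val.toRingHom.injective (hP₁ ▸ hP)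
  obtain ⟨y, hy0, hy⟩ := hP₁h.exists_zero_of_lt_card (A := A) (k := k) hn (by simp)
  have hyP : MvPolynomial.eval (fun i => (y i : E)) P = 0 := by
    have h1 : (MvPolynomial.eval fun i => (y i : E)).comp (MvPolynomial.map F.val.toRingHom) =
        F.val.toRingHom.comp (MvPolynomial.eval y) := by
      ext i
      · simp
      · simp
    have h2 := congrArg (fun f => f P₁) h1
    simp only [RingHom.comp_apply, hy, map_zero] at h2
    rw [← hP₁]
    exact h2
  have hyF : ∀ i, (y i : E) ∈ F₀ := fun i => hF₀ _ (hF _ (y i).2)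
  let u : E := ∑ i, b i * y (some i)
  have hu : ∏ j ∈ Finset.range n, (σ ^ j) u = a * (y none : E) ^ n := by
    rw [← sub_eq_zero, ← hyP]
    simp only [P, N, map_sub, map_prod, map_sum, map_mul, MvPolynomial.eval_C,
      MvPolynomial.eval_X, map_pow, u]
    congr 1
    refine Finset.prod_congr rfl fun j _ => Finset.sum_congr rfl fun i _ => ?_
    rw [hF₀' _ (hyF _)]
  by_cases hz : y none = 0
  · exfalso
    rw [hz, ZeroMemClass.coe_zero, zero_pow hn.ne', mul_zero, Finset.prod_eq_zero_iff] at hu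
    obtain ⟨j, -, hj⟩ := hu
    rw [map_eq_zero_iff _ (σ ^ j).injective] at hj
    have h1 := Fintype.linearIndependent_iff.1 b.linearIndependent
      (fun i => ⟨y (some i), hyF _⟩) (by
        rw [← hj]
        exact Finset.sum_congr rfl fun i _ => mul_comm _ _)
    apply hy0
    ext i
    cases i with
    | none => rw [hz]; rfl
    | some i => simpa using congrArg Subtype.val (h1 i)
  · have hz' : (y none : E) ≠ 0 := by simpa using hz
    refine ⟨u / y none, ?_⟩
    simp only [map_div₀, Finset.prod_div_distrib, hu, hF₀' _ (hyF none), Finset.prod_const,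
      Finset.card_range]
    exact mul_div_cancel_right₀ _ (pow_ne_zero _ hz')

section Constants

variable (K A : Type*) [Field K] [Finite K] [Field A] [Algebra K A]

/-- The Frobenius automorphism of an algebraic extension of a finite field. -/
noncomputable def frobEquiv [Algebra.IsAlgebraic K A] : A ≃ₐ[K] A :=
  let := Fintype.ofFinite K
  FiniteField.frobeniusAlgEquivOfAlgebraic K A

variable {A}

theorem frobEquiv_pow_apply [Algebra.IsAlgebraic K A] (n : ℕ) (a : A) :
    (frobEquiv K A ^ n) a = a ^ Nat.card K ^ n := by
  let := Fintype.ofFinite K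
  rw [AlgEquiv.coe_pow, frobEquiv, FiniteField.coe_frobeniusAlgEquivOfAlgebraic_iterate,
    Nat.card_eq_fintype_card]

omit [Field K] [Finite K] [Algebra K A] in
theorem pow_card_pow_add (n m : ℕ) (a : A) :
    a ^ Nat.card K ^ (n + m) = (a ^ Nat.card K ^ n) ^ Nat.card K ^ m := by
  rw [pow_add, pow_mul]

omit [Field K] [Finite K] [Algebra K A] in
variable {K} in
theorem pow_card_pow_mul_eq {d : ℕ} {a : A} (ha : a ^ Nat.card K ^ d = a) (n : ℕ) :
    a ^ Nat.card K ^ (d * n) = a := by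
  induction n with
  | zero => simp
  | succ n ih => rw [Nat.mul_succ, pow_card_pow_add, ih, ha]

theorem natCast_card_pow_sub_one_ne_zero {d : ℕ} (hd : 0 < d) :
    ((Nat.card K ^ d - 1 : ℕ) : A) ≠ 0 := by
  have : Fintype K := Fintype.ofFinite K
  have h0 : (Nat.card K : A) = 0 := by
    rw [← map_natCast (algebraMap K A), Nat.card_eq_fintype_card, FiniteField.cast_card_eq_zero,
      map_zero]
  rw [Nat.cast_sub (Nat.one_le_pow _ _ Nat.card_pos), Nat.cast_pow, h0, zero_pow hd.ne']
  simp

/-- The degree of a power of Frobenius on the degree `d` extension is determined modulo `d`. -/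
theorem pow_card_pow_eq_iff [IsAlgClosed A] [Algebra.IsAlgebraic K A] {d : ℕ} (hd : 0 < d)
    {n m : ℕ} : (∀ a : A, a ^ Nat.card K ^ d = a → a ^ Nat.card K ^ n = a ^ Nat.card K ^ m) ↔
      n ≡ m [MOD d] := by
  wlog hnm : n ≤ m generalizing n m
  · rw [Nat.ModEq.comm, ← this (le_of_not_ge hnm)]
    exact forall₂_congr fun _ _ => eq_comm
  obtain ⟨j, rfl⟩ := Nat.exists_eq_add_of_le hnm
  have hinj : ∀ a : A, a ^ Nat.card K ^ n = a ^ Nat.card K ^ (n + j) ↔ a ^ Nat.card K ^ j = a :=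
    fun a => by
      rw [add_comm, pow_card_pow_add, ← frobEquiv_pow_apply K n, ← frobEquiv_pow_apply K n,
        (frobEquiv K A ^ n).injective.eq_iff, eq_comm]
  simp only [hinj]
  rw [Nat.modEq_iff_dvd' hnm, Nat.add_sub_cancel_left]
  refine ⟨fun h => ?_, ?_⟩
  · have hq : 1 < Nat.card K := Finite.one_lt_card
    have : NeZero ((Nat.card K ^ d - 1 : ℕ) : A) := ⟨natCast_card_pow_sub_one_ne_zero K hd⟩
    obtain ⟨ζ, hζ⟩ := HasEnoughRootsOfUnity.exists_primitiveRoot A (Nat.card K ^ d - 1)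
    have hone : 1 < Nat.card K ^ d := Nat.one_lt_pow hd.ne' hq
    have hζ0 : ζ ≠ 0 := hζ.ne_zero (by omega)
    have key : ∀ r : ℕ, ζ ^ Nat.card K ^ r = ζ ↔ Nat.card K ^ d - 1 ∣ Nat.card K ^ r - 1 :=
      fun r => by
        rw [← hζ.pow_eq_one_iff_dvd]
        conv_lhs => rw [← Nat.sub_add_cancel (Nat.one_le_pow r _ (by omega : 0 < Nat.card K)),
          pow_succ]
        exact mul_eq_right₀ hζ0
    have hd' : ζ ^ Nat.card K ^ d = ζ := (key d).2 dvd_rfl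
    have h1 : ζ ^ Nat.card K ^ (j % d) = ζ := by
      have := h ζ hd'
      rwa [← Nat.div_add_mod j d, pow_card_pow_add, pow_card_pow_mul_eq hd'] at this
    rw [key] at h1
    rw [Nat.dvd_iff_mod_eq_zero]
    by_contra h0
    have h2 := Nat.le_of_dvd (Nat.sub_pos_of_lt (Nat.one_lt_pow h0 hq)) h1
    have h3 := Nat.pow_lt_pow_right hq (Nat.mod_lt j hd)
    have h4 := Nat.one_le_pow (j % d) _ (by omega : 0 < Nat.card K)
    omega
  · rintro ⟨r, rfl⟩ a ha
    exact pow_card_pow_mul_eq ha r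

theorem mem_range_algebraMap_of_pow_card_eq {a : A} (ha : a ^ Nat.card K = a) :
    a ∈ Set.range (algebraMap K A) := by
  classical
  have : Fintype K := Fintype.ofFinite K
  rw [Nat.card_eq_fintype_card] at ha
  by_contra h
  have hne := FiniteField.X_pow_card_sub_X_ne_zero A (Fintype.one_lt_card (α := K))
  have := Polynomial.card_le_degree_of_subset_roots
    (p := (Polynomial.X ^ Fintype.card K - Polynomial.X : Polynomial A))
    (Z := insert a (Finset.univ.image (algebraMap K A))) fun x hx => by
      rw [Finset.mem_val, Finset.mem_insert, Finset.mem_image] at hx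
      rw [Polynomial.mem_roots hne, Polynomial.IsRoot.def]
      rcases hx with rfl | ⟨c, -, rfl⟩
      · simp [ha]
      · simp [← map_pow, FiniteField.pow_card]
  rw [Finset.card_insert_of_notMem (by simpa using h),
    Finset.card_image_of_injective _ (algebraMap K A).injective, Finset.card_univ,
    FiniteField.X_pow_card_sub_X_natDegree_eq A Fintype.one_lt_card] at this
  omega

end Constants

section Levels

variable (K A : Type*) {k M : Type*} [Field K] [Finite K] [Field A] [Algebra K A] [Field k]
  [Field M] [Algebra k M] [Algebra A M] [Algebra K k] [Algebra K M] [IsScalarTower K A M]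
  [IsScalarTower K k M]

/-- On the extension of degree `d` of a finite field, every automorphism is a power of Frobenius. -/
theorem exists_forall_apply_eq_pow_card_pow [Algebra.IsAlgebraic K A] {d : ℕ} (hd : 0 < d)
    (γ : M →ₐ[K] M) : ∃ n : ℕ, ∀ a : A, a ^ Nat.card K ^ d = a →
      γ (algebraMap A M a) = algebraMap A M (a ^ Nat.card K ^ n) := by
  let E : IntermediateField K A :=
    IntermediateField.fixedField (Subgroup.zpowers (frobEquiv K A ^ d))
  have hE : ∀ a : A, a ^ Nat.card K ^ d = a → a ∈ E := by
    rintro a ha ⟨τ, hτ⟩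
    obtain ⟨j, rfl⟩ := Subgroup.mem_zpowers_iff.1 hτ
    have hst : frobEquiv K A ^ d ∈ MulAction.stabilizer (A ≃ₐ[K] A) a := by
      rw [MulAction.mem_stabilizer_iff, AlgEquiv.smul_def, frobEquiv_pow_apply, ha]
    exact zpow_mem hst j
  have hE' : ∀ a ∈ E, a ^ Nat.card K ^ d = a := fun a ha => by
    rw [← frobEquiv_pow_apply]
    exact ha ⟨_, Subgroup.mem_zpowers _⟩
  have hq : 1 < Nat.card K := Finite.one_lt_card
  have hone : 1 < Nat.card K ^ d := Nat.one_lt_pow hd.ne' hq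
  have hfin : (E : Set A).Finite := by
    refine Set.Finite.subset (Polynomial.rootSet_finite
      (Polynomial.X ^ Nat.card K ^ d - Polynomial.X : Polynomial A) A) fun a ha => ?_
    rw [Polynomial.mem_rootSet']
    refine ⟨?_, by simp [hE' a ha]⟩
    simpa using FiniteField.X_pow_card_sub_X_ne_zero A hone
  have : Finite E := hfin
  have : IsGalois K E := GaloisField.instIsGaloisOfFinite
  obtain ⟨p, hp⟩ := CharP.exists K
  have : Fact p.Prime := ⟨CharP.char_is_prime K p⟩
  obtain ⟨n, hn⟩ := FiniteField.exists_forall_apply_eq_pow K p E (γ.restrictNormal' E)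
  refine ⟨n, fun a ha => ?_⟩
  have := hn ⟨a, hE a ha⟩
  have h2 := γ.restrictNormal_commutes E ⟨a, hE a ha⟩
  have h3 : γ.restrictNormal E ⟨a, hE a ha⟩ = ⟨a, hE a ha⟩ ^ Nat.card K ^ n := this
  rw [h3, map_pow] at h2
  rw [map_pow]
  exact h2.symm

variable (k M) in
/-- The action of automorphisms on the constant field extension of degree `d`, as a multiple of
Frobenius. -/
theorem exists_frobDegree [IsAlgClosed A] [Algebra.IsAlgebraic K A] {d : ℕ} (hd : 0 < d) :
    ∃ f : (M ≃ₐ[k] M) →* Multiplicative (ZMod d), ∀ γ : M ≃ₐ[k] M, ∀ n : ℕ,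
      f γ = Multiplicative.ofAdd (n : ZMod d) ↔ ∀ a : A, a ^ Nat.card K ^ d = a →
        γ (algebraMap A M a) = algebraMap A M (a ^ Nat.card K ^ n) := by
  have hex : ∀ γ : M ≃ₐ[k] M, ∃ n : ℕ, ∀ a : A, a ^ Nat.card K ^ d = a →
      γ (algebraMap A M a) = algebraMap A M (a ^ Nat.card K ^ n) := fun γ =>
    exists_forall_apply_eq_pow_card_pow K A hd ((γ : M →ₐ[k] M).restrictScalars K)
  choose N hN using hex
  have hiff : ∀ γ : M ≃ₐ[k] M, ∀ n : ℕ, Multiplicative.ofAdd (N γ : ZMod d) =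
      Multiplicative.ofAdd (n : ZMod d) ↔ ∀ a : A, a ^ Nat.card K ^ d = a →
        γ (algebraMap A M a) = algebraMap A M (a ^ Nat.card K ^ n) := fun γ n => by
    rw [Multiplicative.ofAdd.injective.eq_iff, ZMod.natCast_eq_natCast_iff,
      ← pow_card_pow_eq_iff K (A := A) hd]
    refine forall₂_congr fun a ha => ?_
    rw [hN γ a ha, (algebraMap A M).injective.eq_iff]
  refine ⟨MonoidHom.mk' (fun γ => Multiplicative.ofAdd (N γ : ZMod d)) fun γ δ => ?_, hiff⟩
  rw [← ofAdd_add, ← Nat.cast_add, hiff]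
  intro a ha
  rw [AlgEquiv.mul_apply, hN δ a ha, map_pow, map_pow, hN γ a ha, ← map_pow, ← pow_card_pow_add]

variable (k) in
/-- The automorphisms of `M` fixing `T i` and the extension of degree `e` of the field `K` of
constants. -/
def levelSubgroup (T : ℕ → M) (e i : ℕ) : Subgroup (M ≃ₐ[k] M) where
  carrier := {γ | γ (T i) = T i ∧
    ∀ a : A, a ^ Nat.card K ^ e = a → γ (algebraMap A M a) = algebraMap A M a}
  mul_mem' {γ δ} hγ hδ := ⟨by rw [AlgEquiv.mul_apply, hδ.1, hγ.1],
    fun a ha => by rw [AlgEquiv.mul_apply, hδ.2 a ha, hγ.2 a ha]⟩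
  one_mem' := ⟨rfl, fun _ _ => rfl⟩
  inv_mem' {γ} hγ := ⟨γ.symm_apply_eq.2 hγ.1.symm,
    fun a ha => γ.symm_apply_eq.2 (hγ.2 a ha).symm⟩

variable {K A}

omit [Field K] [Finite K] [Algebra K A] [Algebra K k] [Algebra K M] [IsScalarTower K A M]
  [IsScalarTower K k M] in
theorem mem_levelSubgroup {T : ℕ → M} {e i : ℕ} {γ : M ≃ₐ[k] M} :
    γ ∈ levelSubgroup K A k T e i ↔ γ (T i) = T i ∧
      ∀ a : A, a ^ Nat.card K ^ e = a → γ (algebraMap A M a) = algebraMap A M a := Iff.rfl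

theorem mem_levelSubgroup_one {T : ℕ → M} {i : ℕ} {γ : M ≃ₐ[k] M} :
    γ ∈ levelSubgroup K A k T 1 i ↔ γ (T i) = T i := by
  refine ⟨And.left, fun h => ⟨h, fun a ha => ?_⟩⟩
  obtain ⟨c, rfl⟩ := mem_range_algebraMap_of_pow_card_eq K (by rwa [pow_one] at ha)
  rw [← IsScalarTower.algebraMap_apply, IsScalarTower.algebraMap_apply K k M, γ.commutes]

theorem mem_levelSubgroup_iff_of_frobDegree {T : ℕ → M} {e i : ℕ}
    {f : (M ≃ₐ[k] M) →* Multiplicative (ZMod e)} (hf : ∀ γ : M ≃ₐ[k] M, ∀ n : ℕ,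
      f γ = Multiplicative.ofAdd (n : ZMod e) ↔ ∀ a : A, a ^ Nat.card K ^ e = a →
        γ (algebraMap A M a) = algebraMap A M (a ^ Nat.card K ^ n)) {γ : M ≃ₐ[k] M} :
    γ ∈ levelSubgroup K A k T e i ↔ γ ∈ levelSubgroup K A k T 1 i ∧ f γ = 1 := by
  rw [mem_levelSubgroup_one, mem_levelSubgroup, ← ofAdd_zero, ← Nat.cast_zero, hf]
  simp

end Levels

section

open Topology

section Krull

variable {k M : Type*} [Field k] [Field M] [Algebra k M]

theorem exists_open_normal_le_of_mem_nhds [IsGalois k M] {s : Set (M ≃ₐ[k] M)} (hs : s ∈ 𝓝 1) :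
    ∃ U : Subgroup (M ≃ₐ[k] M), IsOpen (U : Set (M ≃ₐ[k] M)) ∧ U.Normal ∧ (U : Set _) ⊆ s := by
  obtain ⟨E, hE, hE', hEs⟩ := (krullTopology_mem_nhds_one_iff_of_normal k M s).1 hs
  have : IsGalois k E := ⟨⟩
  exact ⟨E.fixingSubgroup, E.fixingSubgroup_isOpen, inferInstance, hEs⟩

theorem exists_open_normal_fixing [IsGalois k M] {S : Set M} (hS : S.Finite) :
    ∃ U : Subgroup (M ≃ₐ[k] M), IsOpen (U : Set (M ≃ₐ[k] M)) ∧ U.Normal ∧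
      ∀ γ ∈ U, ∀ x ∈ S, γ x = x := by
  have h1 : (⋂ x ∈ S, (MulAction.stabilizer (M ≃ₐ[k] M) x : Set (M ≃ₐ[k] M))) ∈ 𝓝 1 :=
    (Filter.biInter_mem hS).2 fun x _ =>
      (stabilizer_isOpen_of_isIntegral (K := k) x).mem_nhds (one_mem _)
  obtain ⟨U, hU, hUn, hUs⟩ := exists_open_normal_le_of_mem_nhds h1
  exact ⟨U, hU, hUn, fun γ hγ x hx => Set.mem_iInter₂.1 (hUs hγ) x hx⟩

/-- An element fixed by every automorphism fixing `M ^ H` belongs to a closed subgroup `H`. -/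
theorem mem_of_forall_fixed [IsGalois k M] {H : Subgroup (M ≃ₐ[k] M)}
    (hH : IsClosed (H : Set (M ≃ₐ[k] M))) {γ : M ≃ₐ[k] M}
    (h : ∀ x : M, (∀ δ ∈ H, δ x = x) → γ x = x) : γ ∈ H := by
  have := InfiniteGalois.fixingSubgroup_fixedField (⟨H, hH⟩ : ClosedSubgroup (M ≃ₐ[k] M))
  change (IntermediateField.fixedField H).fixingSubgroup = H at this
  rw [← this, IntermediateField.mem_fixingSubgroup_iff]
  exact fun x hx => h x fun δ hδ => hx ⟨δ, hδ⟩

end Krull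

section Levels

variable {K A k M : Type*} [Field K] [Finite K] [Field A] [Algebra K A] [Field k]
  [Field M] [Algebra k M] [Algebra A M] [Algebra K k] [Algebra K M] [IsScalarTower K A M]
  [IsScalarTower K k M] {T : ℕ → M}

omit [Algebra K k] [Algebra K M] [IsScalarTower K A M] [IsScalarTower K k M] [Algebra K A] in
variable (K A) in
theorem exists_open_normal_le_levelSubgroup [IsGalois k M] {e : ℕ} (i : ℕ) (he : 0 < e) :
    ∃ U : Subgroup (M ≃ₐ[k] M), IsOpen (U : Set (M ≃ₐ[k] M)) ∧ U.Normal ∧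
      U ≤ levelSubgroup K A k T e i := by
  have hq : 1 < Nat.card K := Finite.one_lt_card
  have hone : 1 < Nat.card K ^ e := Nat.one_lt_pow he.ne' hq
  have hfin : {a : A | a ^ Nat.card K ^ e = a}.Finite := by
    refine Set.Finite.subset (Polynomial.rootSet_finite
      (Polynomial.X ^ Nat.card K ^ e - Polynomial.X : Polynomial A) A) fun a ha => ?_
    rw [Polynomial.mem_rootSet']
    refine ⟨?_, by simp [show a ^ Nat.card K ^ e = a from ha]⟩
    simpa using FiniteField.X_pow_card_sub_X_ne_zero A hone
  obtain ⟨U, hU, hUn, hUS⟩ := exists_open_normal_fixing (k := k)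
    ((hfin.image (algebraMap A M)).insert (T i))
  exact ⟨U, hU, hUn, fun γ hγ => ⟨hUS γ hγ _ (Set.mem_insert _ _), fun a ha =>
    hUS γ hγ _ (Set.mem_insert_of_mem _ ⟨a, ha, rfl⟩)⟩⟩

omit [Algebra K k] [Algebra K M] [IsScalarTower K A M] [IsScalarTower K k M] [Algebra K A] in
theorem isOpen_levelSubgroup [IsGalois k M] {e : ℕ} (i : ℕ) (he : 0 < e) :
    IsOpen (levelSubgroup K A k T e i : Set (M ≃ₐ[k] M)) := by
  obtain ⟨U, hU, -, hle⟩ := exists_open_normal_le_levelSubgroup K A (k := k) (T := T) i he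
  exact Subgroup.isOpen_mono hle hU

omit [Algebra K k] [Algebra K M] [IsScalarTower K A M] [IsScalarTower K k M] [Field K] [Finite K]
  [Algebra K A] in
theorem levelSubgroup_anti
    (hT : ∀ i (γ : M ≃ₐ[k] M), γ (T (i + 1)) = T (i + 1) → γ (T i) = T i) {e e' i i' : ℕ}
    (he : e ∣ e') (hi : i ≤ i') : levelSubgroup K A k T e' i' ≤ levelSubgroup K A k T e i := by
  rintro γ ⟨h1, h2⟩
  refine ⟨?_, fun a ha => ?_⟩
  · clear h2
    induction hi with
    | refl => exact h1
    | step _ ih => exact ih (hT _ γ h1)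
  · obtain ⟨j, rfl⟩ := he
    exact h2 a (pow_card_pow_mul_eq ha j)

theorem isTower_levelSubgroup [IsAlgClosed A] [Algebra.IsAlgebraic K A] [IsGalois k M]
    (hT : ∀ i (γ : M ≃ₐ[k] M), γ (T (i + 1)) = T (i + 1) → γ (T i) = T i) (ℓ : ℕ) :
    IsTower ℓ (levelSubgroup K A k T) where
  anti he hi := levelSubgroup_anti hT he hi
  core i he := exists_open_normal_le_levelSubgroup K A i he
  normal {e} i he x hx y hy := by
    obtain ⟨f, hf⟩ := exists_frobDegree K A k M he
    rw [mem_levelSubgroup_iff_of_frobDegree hf] at hy ⊢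
    exact ⟨mul_mem (mul_mem hx hy.1) (inv_mem hx), by simp [hy.2]⟩
  index {e} i he hℓ h := by
    obtain ⟨f, hf⟩ := exists_frobDegree K A k M he
    have : NeZero e := ⟨he.ne'⟩
    have h1 : levelSubgroup K A k T e i = f.ker ⊓ levelSubgroup K A k T 1 i := by
      ext γ
      rw [mem_levelSubgroup_iff_of_frobDegree hf, Subgroup.mem_inf, MonoidHom.mem_ker, and_comm]
    rw [h1, Subgroup.inf_relIndex_right, Subgroup.relIndex_ker] at h
    refine hℓ (h.trans ((Subgroup.card_subgroup_dvd_card _).trans ?_))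
    simp

omit [Algebra K k] [Algebra K M] [IsScalarTower K A M] [IsScalarTower K k M] in
theorem frobDegree_pow_eq_one [IsAlgClosed A] [Algebra.IsAlgebraic K A] {d : ℕ} (hd : 0 < d)
    {f : (M ≃ₐ[k] M) →* Multiplicative (ZMod d)} (hf : ∀ γ : M ≃ₐ[k] M, ∀ n : ℕ,
      f γ = Multiplicative.ofAdd (n : ZMod d) ↔ ∀ a : A, a ^ Nat.card K ^ d = a →
        γ (algebraMap A M a) = algebraMap A M (a ^ Nat.card K ^ n))
    {e : ℕ} (i : ℕ) (he : e ∣ d) {γ : M ≃ₐ[k] M} (hγ : γ ∈ levelSubgroup K A k T e i) :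
    f γ ^ (d / e) = 1 := by
  have : NeZero d := ⟨hd.ne'⟩
  obtain ⟨n, hn⟩ : ∃ n : ℕ, f γ = Multiplicative.ofAdd (n : ZMod d) :=
    ⟨(f γ).toAdd.val, by simp⟩
  have hn' := (hf γ n).1 hn
  have he0 : 0 < e := Nat.pos_of_dvd_of_pos he hd
  have h1 : n ≡ 0 [MOD e] := by
    rw [← pow_card_pow_eq_iff K (A := A) he0]
    intro a ha
    obtain ⟨j, rfl⟩ := he
    have := hn' a (pow_card_pow_mul_eq ha j)
    rw [hγ.2 a ha] at this
    simpa using ((algebraMap A M).injective this).symm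
  obtain ⟨j, rfl⟩ := (Nat.modEq_zero_iff_dvd).1 h1
  obtain ⟨r, rfl⟩ := he
  rw [hn, ← ofAdd_nsmul, Nat.mul_div_cancel_left _ he0, nsmul_eq_mul, ← Nat.cast_mul,
    show r * (e * j) = e * r * j by ring, Nat.cast_mul, ZMod.natCast_self, zero_mul, ofAdd_zero]

end Levels

end

section

open Polynomial

/-- Invariant elements are norms for cyclic extensions of prime degree of fields algebraic over
`A(X)`, phrased for group actions. -/
theorem exists_prod_pow_smul_eq_of_prime {A M P : Type*} [Field A] [IsAlgClosed A] [Field M]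
    [Group P] [MulSemiringAction P M] (ev : A[X] →+* M) (hev : Function.Injective ev)
    (halg : ∀ z : M, ∃ p : A[X][X], p ≠ 0 ∧ p.eval₂ ev z = 0) {N' : Subgroup P} {x : P}
    (hx : ∀ z, x * z * x⁻¹ ∈ N' ↔ z ∈ N') {ℓ : ℕ} (hℓ : ℓ.Prime) (hxl : x ^ ℓ ∈ N')
    (hfix : ∀ n ∈ N', ∀ r, n • ev r = ev r) (hfx : ∀ r, x • ev r = ev r)
    (hne : ∃ z : M, (∀ n ∈ N', n • z = z) ∧ x • z ≠ z) {h : M} (hh : ∀ n ∈ N', n • h = h)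
    (hxh : x • h = h) :
    ∃ v : M, (∀ n ∈ N', n • v = v) ∧ ∏ j ∈ Finset.range ℓ, x ^ j • v = h := by
  let E : Subfield M := FixedPoints.subfield N' M
  have hE : ∀ z : M, z ∈ E ↔ ∀ n ∈ N', n • z = z := fun z =>
    ⟨fun h n hn => h ⟨n, hn⟩, fun h n => h n n.2⟩
  have hxE : ∀ z ∈ E, x • z ∈ E := fun z hz => (hE _).2 fun n hn => by
    have h1 : x⁻¹ * n * x ∈ N' := by rw [← hx]; group; exact hn
    have h2 := (hE z).1 hz _ h1
    rw [mul_smul, mul_smul, inv_smul_eq_iff] at h2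
    exact h2
  have hxE' : ∀ z ∈ E, x⁻¹ • z ∈ E := fun z hz => (hE _).2 fun n hn => by
    have h2 := (hE z).1 hz _ ((hx n).2 hn)
    rw [mul_smul, mul_smul] at h2
    exact eq_inv_smul_iff.2 h2
  let ev' : A[X] →+* E := ev.codRestrict E fun r => (hE _).2 fun n hn => hfix n hn r
  have hev' : Function.Injective ev' := fun a b hab => hev (congrArg Subtype.val hab)
  let k := FractionRing A[X]
  let kE : k →+* E := IsFractionRing.lift (K := k) hev'
  let _ : Algebra k E := kE.toAlgebra
  let _ : Algebra A[X] E := ev'.toAlgebra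
  have htow : IsScalarTower A[X] k E := IsScalarTower.of_algebraMap_eq fun r =>
    (IsFractionRing.lift_algebraMap hev' r).symm
  have halgE : Algebra.IsAlgebraic A[X] E := ⟨fun z => by
    obtain ⟨p, hp, hpz⟩ := halg z
    refine ⟨p, hp, Subtype.ext ?_⟩
    rw [aeval_def, ← Subfield.coe_subtype, hom_eval₂]
    exact hpz⟩
  have : Algebra.IsAlgebraic k E := (IsFractionRing.comap_isAlgebraic_iff (A := A[X])).1 halgE
  let σ₀ : E ≃+* E :=
    { toFun := fun z => ⟨x • z, hxE z z.2⟩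
      invFun := fun z => ⟨x⁻¹ • z, hxE' z z.2⟩
      left_inv := fun z => Subtype.ext (inv_smul_smul x (z : M))
      right_inv := fun z => Subtype.ext (smul_inv_smul x (z : M))
      map_mul' := fun a b => Subtype.ext (smul_mul' x (a : M) b)
      map_add' := fun a b => Subtype.ext (smul_add x (a : M) b) }
  have hσ₀ : (σ₀ : E →+* E).comp kE = kE := by
    refine IsLocalization.ringHom_ext (nonZeroDivisors A[X]) (RingHom.ext fun r => ?_)
    have h1 : kE (algebraMap A[X] k r) = ev' r := IsFractionRing.lift_algebraMap hev' r
    simp only [RingHom.comp_apply, h1]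
    exact Subtype.ext (hfx r)
  let σ : E ≃ₐ[k] E := AlgEquiv.ofRingEquiv (f := σ₀) fun r => RingHom.congr_fun hσ₀ r
  have hσ : ∀ (j : ℕ) (z : E), ((σ ^ j) z : M) = x ^ j • (z : M) := by
    intro j
    induction j with
    | zero => simp
    | succ j ih => intro z; rw [pow_succ, pow_succ, AlgEquiv.mul_apply, ih, mul_smul]; rfl
  have : Fact ℓ.Prime := ⟨hℓ⟩
  have hord : orderOf σ = ℓ := by
    refine orderOf_eq_prime (AlgEquiv.ext fun z => Subtype.ext ?_) fun h1 => ?_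
    · rw [hσ]; exact (hE z).1 z.2 _ hxl
    · obtain ⟨z, hz, hz'⟩ := hne
      exact hz' (congrArg Subtype.val (AlgEquiv.congr_fun h1 (⟨z, (hE z).2 hz⟩ : E)))
  obtain ⟨v, hv⟩ := exists_prod_pow_apply_eq_of_orderOf (A := A) σ hℓ.pos hord
    (a := ⟨h, (hE h).2 hh⟩) (Subtype.ext hxh)
  refine ⟨v, (hE v).1 v.2, ?_⟩
  have := congrArg Subtype.val hv
  rw [← Subfield.coe_subtype, map_prod] at this
  simp only [Subfield.coe_subtype, hσ] at this
  exact this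

end

section

open Polynomial

theorem prod_range_mul_eq {X : Type*} [CommMonoid X] (f : ℕ → X) (m n : ℕ) :
    ∏ c ∈ Finset.range (m * n), f c =
      ∏ b ∈ Finset.range n, ∏ a ∈ Finset.range m, f (m * b + a) := by
  induction n with
  | zero => simp
  | succ n ih => rw [Nat.mul_succ, Finset.prod_range_add, ih, Finset.prod_range_succ]

theorem prod_range_periodic {X : Type*} [CommMonoid X] {f : ℕ → X} {m : ℕ}
    (hf : ∀ a, f (a + m) = f a) (k : ℕ) :
    ∏ a ∈ Finset.range m, f (a + k) = ∏ a ∈ Finset.range m, f a := by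
  induction k with
  | zero => simp
  | succ k ih =>
    rw [← ih]
    rcases m with _ | m
    · simp
    · rw [Finset.prod_range_succ, Finset.prod_range_succ' (fun a => f (a + k))]
      congr 1
      · exact Finset.prod_congr rfl fun a _ => by congr 1; omega
      · rw [← hf (0 + k)]; congr 1; omega

/-- The orbit polynomial `∏ (X - φ ^ a s)` raised to a suitable power is a norm. -/
theorem exists_prod_map_pow_eq_orbit {A : Type*} [Field A] (φ : A →+* A) {s : A} {d n m : ℕ}
    (hd : 0 < d) (hs : (φ ^ d) s = s) (hn : 0 < n) (hm : n ∣ d * m) :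
    ∃ V : A[X], V.map (φ ^ n) = V ∧
      ∏ a ∈ Finset.range n, V.map (φ ^ a) =
        (∏ a ∈ Finset.range d, (X - C ((φ ^ a) s))) ^ m := by
  obtain ⟨g, n', d', hg, hcop, rfl, rfl⟩ :
      ∃ g n' d', 0 < g ∧ n'.Coprime d' ∧ n = g * n' ∧ d = g * d' := by
    obtain ⟨n', hn'⟩ := Nat.gcd_dvd_left n d
    obtain ⟨d', hd'⟩ := Nat.gcd_dvd_right n d
    have hg : 0 < n.gcd d := Nat.gcd_pos_of_pos_left _ hn
    exact ⟨n.gcd d, n', d', hg,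
      Nat.eq_of_mul_eq_mul_left hg (by rw [← Nat.gcd_mul_left, ← hn', ← hd', mul_one]), hn', hd'⟩
  obtain ⟨k, rfl⟩ : n' ∣ m := by
    rw [mul_assoc] at hm
    exact hcop.dvd_of_dvd_mul_left (Nat.dvd_of_mul_dvd_mul_left hg hm)
  let f : ℕ → A[X] := fun c => X - C ((φ ^ c) s)
  have hper : ∀ c, f (c + g * d') = f c := fun c => by
    simp only [f]
    rw [pow_add, RingHom.mul_def, RingHom.comp_apply, hs]
  have hmap : ∀ a c, (f c).map (φ ^ a) = f (a + c) := fun a c => by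
    simp only [f, Polynomial.map_sub, map_X, map_C]
    rw [pow_add, RingHom.mul_def, RingHom.comp_apply]
  have hshift : ∀ b c, ∏ a ∈ Finset.range d', f (g * b + c + g * a) =
      ∏ a ∈ Finset.range d', f (c + g * a) := fun b c => by
    rw [← prod_range_periodic (f := fun a => f (c + g * a)) (m := d') (k := b)]
    · exact Finset.prod_congr rfl fun a _ => by congr 1; ring
    · intro a; rw [mul_add, ← add_assoc, hper]
  refine ⟨(∏ a ∈ Finset.range d', f (g * a)) ^ k, ?_, ?_⟩
  · simp only [Polynomial.map_pow, Polynomial.map_prod, hmap]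
    have := hshift n' 0
    simp only [add_zero, zero_add] at this
    rw [this]
  · simp only [Polynomial.map_pow, Polynomial.map_prod, hmap]
    rw [Finset.prod_pow, prod_range_mul_eq, pow_mul]
    congr 1
    simp only [hshift]
    rw [Finset.prod_const, Finset.card_range]
    congr 1
    rw [prod_range_mul_eq (fun c => X - C ((φ ^ c) s)), Finset.prod_comm]
    exact Finset.prod_congr rfl fun a _ => Finset.prod_congr rfl fun b _ => by
      simp only [f, add_comm]

/-- A polynomial fixed by a power map is a norm as soon as all its root multiplicities are
compatible with the orders of the orbits. -/
theorem exists_prod_map_pow_eq {A : Type*} [Field A] [IsAlgClosed A] (φ : A →+* A) {Q : ℕ}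
    (hQ : 0 < Q) (hφ : ∀ a, φ a = a ^ Q) (hper : ∀ s, ∃ d, 0 < d ∧ (φ ^ d) s = s) {n : ℕ}
    (hn : 0 < n) (N : ℕ) : ∀ R : A[X], R.natDegree ≤ N → R ≠ 0 → R.map φ = R →
    (∀ s d, 0 < d → (φ ^ d) s = s → n ∣ d * R.rootMultiplicity s) →
    ∃ V : A[X], V.map (φ ^ n) = V ∧ ∏ a ∈ Finset.range n, V.map (φ ^ a) = R := by
  have hφn : ∀ a x, (φ ^ a) x = x ^ Q ^ a := fun a x => by
    induction a generalizing x with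
    | zero => simp
    | succ a ih => rw [pow_succ, RingHom.mul_def, RingHom.comp_apply, ih, hφ, ← pow_mul, pow_succ']
  induction N with
  | zero =>
    intro R hR hR0 hφR _
    obtain ⟨r, rfl⟩ := natDegree_eq_zero.1 (Nat.le_zero.1 hR)
    have hr : r ^ Q = r := by rwa [map_C, C_inj, hφ] at hφR
    have hsum : 0 < ∑ a ∈ Finset.range n, Q ^ a :=
      Finset.sum_pos (fun a _ => pow_pos hQ a) (Finset.nonempty_range_iff.2 hn.ne')
    obtain ⟨u, hu⟩ := IsAlgClosed.exists_pow_nat_eq r hsum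
    have hu0 : u ≠ 0 := by
      rintro rfl
      rw [zero_pow hsum.ne'] at hu
      exact hR0 (by rw [← hu, C_0])
    refine ⟨C u, ?_, ?_⟩
    · rw [map_C, hφn]
      congr 1
      have h1 : u ^ (∑ a ∈ Finset.range n, Q ^ a) * u ^ Q ^ n =
          (u ^ (∑ a ∈ Finset.range n, Q ^ a)) ^ Q * u := by
        rw [← pow_add, ← Finset.sum_range_succ, Finset.sum_range_succ', ← pow_mul, Finset.sum_mul,
          pow_add, pow_zero, pow_one]
        simp only [pow_succ]
      rw [hu, hr] at h1
      refine mul_left_cancel₀ ?_ h1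
      rintro rfl
      exact hR0 C_0
    · simp only [map_C, hφn]
      rw [← map_prod, Finset.prod_pow_eq_pow_sum, hu]
  | succ N ih =>
    intro R hR hR0 hφR hdvd
    rcases Nat.lt_or_ge 0 R.natDegree with hpos | hle
    swap
    · exact ih R (hle.trans (Nat.zero_le _)) hR0 hφR hdvd
    obtain ⟨s, hs⟩ := IsAlgClosed.exists_root R (natDegree_pos_iff_degree_pos.1 hpos).ne'
    set m := R.rootMultiplicity s with hm
    have hm0 : 0 < m := (rootMultiplicity_pos hR0).2 hs
    obtain ⟨d₁, hd₁, hsd₁⟩ := hper s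
    have hit : ∀ a, (φ ^ a) s = φ^[a] s := fun a => by rw [RingHom.coe_pow]
    set d := Function.minimalPeriod φ s with hd
    have hd0 : 0 < d := Function.minimalPeriod_pos_of_mem_periodicPts ⟨d₁, hd₁, by
      rw [Function.IsPeriodicPt, Function.IsFixedPt, ← hit, hsd₁]⟩
    have hsd : (φ ^ d) s = s := by
      rw [hit]; exact Function.iterate_minimalPeriod
    set P := ∏ a ∈ Finset.range d, (X - C ((φ ^ a) s)) with hP
    have hPm : P ^ m ∣ R := by
      rw [hP, ← Finset.prod_pow]
      refine Finset.prod_dvd_of_coprime ?_ ?_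
      · intro a ha b hb hab
        refine IsCoprime.pow (isCoprime_X_sub_C_of_isUnit_sub
          (sub_ne_zero.2 fun h => hab ?_).isUnit)
        rw [hit, hit] at h
        exact Function.iterate_injOn_Iio_minimalPeriod (by simpa using ha) (by simpa using hb) h
      · intro a _
        have h1 : (X - C s) ^ m ∣ R := (le_rootMultiplicity_iff hR0).1 le_rfl
        have h2 := Polynomial.map_dvd (φ ^ a) h1
        have h3 : ∀ b, R.map (φ ^ b) = R := fun b => by
          induction b with
          | zero => exact Polynomial.map_id
          | succ b ihb => rw [pow_succ, RingHom.mul_def, ← Polynomial.map_map, hφR, ihb]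
        simpa [h3] using h2
    obtain ⟨R₁, hR₁⟩ := hPm
    obtain ⟨V, hV, hVP⟩ := exists_prod_map_pow_eq_orbit φ hd0 hsd hn (hdvd s d hd0 hsd)
    rw [← hm, ← hP] at hVP
    have hPm0 : P ^ m ≠ 0 := fun h => hR0 (by rw [hR₁, h, zero_mul])
    have hR₁0 : R₁ ≠ 0 := fun h => hR0 (by rw [hR₁, h, mul_zero])
    have hPφ : P.map φ = P := by
      rw [hP]
      simp only [Polynomial.map_prod, Polynomial.map_sub, map_X, map_C]
      rw [← prod_range_periodic (f := fun a => X - C ((φ ^ a) s)) (m := d) (k := 1)]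
      · refine Finset.prod_congr rfl fun a _ => ?_
        rw [pow_succ', RingHom.mul_def, RingHom.comp_apply]
      · intro a; rw [pow_add, RingHom.mul_def, RingHom.comp_apply, hsd]
    have hPdeg : P.natDegree = d := by
      rw [hP, natDegree_prod_of_monic _ _ fun a _ => monic_X_sub_C _]
      simp
    obtain ⟨V₁, hV₁, hVR⟩ := ih R₁ (by
        have h1 := congrArg natDegree hR₁
        rw [natDegree_mul hPm0 hR₁0, natDegree_pow, hPdeg] at h1
        have h2 : 0 < m * d := Nat.mul_pos hm0 hd0
        omega) hR₁0 (by
        have h1 := hφR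
        rw [hR₁, Polynomial.map_mul, Polynomial.map_pow, hPφ] at h1
        exact mul_left_cancel₀ hPm0 h1) (by
      intro t d' hd' ht
      have h1 := hdvd t d' hd' ht
      rw [hR₁, rootMultiplicity_mul (mul_ne_zero hPm0 hR₁0), mul_add] at h1
      refine (Nat.dvd_add_right ?_).1 h1
      by_cases hPt : P.IsRoot t
      · have h2 : rootMultiplicity t (P ^ m) = m * rootMultiplicity t P := by
          classical
          rw [← count_roots, roots_pow, Multiset.count_nsmul, count_roots]
        rw [h2, ← mul_assoc]
        refine Dvd.dvd.mul_right (hdvd s d' hd' ?_) _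
        rw [IsRoot, hP, eval_prod, Finset.prod_eq_zero_iff] at hPt
        obtain ⟨a, -, ha⟩ := hPt
        have ha' : t = (φ ^ a) s := by simpa [sub_eq_zero] using ha
        refine (φ ^ a).injective ?_
        rw [← ha', ← RingHom.comp_apply, ← RingHom.mul_def, ← pow_add, add_comm, pow_add,
          RingHom.mul_def, RingHom.comp_apply, ← ha', ht]
      · rw [rootMultiplicity_eq_zero fun h => hPt ?_, mul_zero]
        · exact dvd_zero _
        · exact (by simpa [IsRoot, hm0.ne'] using h))
    refine ⟨V * V₁, by rw [Polynomial.map_mul, hV, hV₁], ?_⟩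
    simp only [Polynomial.map_mul]
    rw [Finset.prod_mul_distrib, hVP, hVR, ← hR₁]

end

section

attribute [local instance] Units.mulDistribMulActionRight

theorem Subgroup.relIndex_ne_zero_of_forall_eq {P X : Type*} [Group P] [Finite X]
    {N₀ N : Subgroup P} (f : N → X) (hf : ∀ x y, f x = f y → (x : P)⁻¹ * y ∈ N₀) :
    N₀.relIndex N ≠ 0 := by
  have : Finite (N ⧸ N₀.subgroupOf N) :=
    Finite.of_injective (fun c => f c.out) fun c c' h => by
      rw [← c.out_eq, ← c'.out_eq]
      exact QuotientGroup.eq.2 (hf _ _ h)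
  exact Nat.card_ne_zero.2 ⟨inferInstance, this⟩

namespace IsRep

section Fiber

variable {Γ G Q : Type*} [Group Γ] [TopologicalSpace Γ] [Group G] [Group Q] {D D' : Subgroup Γ}
  {φ : Γ → Q}

/-- The part of the fiber product of `π : G →* Q` and a representation `φ` on `D` lying over a
subgroup `S` of `Q`. -/
def fiber (h : IsRep D φ) (π : G →* Q) (S : Subgroup Q) : Subgroup (G × Γ) where
  carrier := {z | z.2 ∈ D ∧ π z.1 = φ z.2 ∧ φ z.2 ∈ S}
  mul_mem' {a b} ha hb := ⟨mul_mem ha.1 hb.1, by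
    rw [Prod.fst_mul, Prod.snd_mul, map_mul, h.1 _ ha.1 _ hb.1, ha.2.1, hb.2.1], by
    rw [Prod.snd_mul, h.1 _ ha.1 _ hb.1]; exact mul_mem ha.2.2 hb.2.2⟩
  one_mem' := ⟨one_mem _, by simp [h.map_one], by simp [h.map_one, one_mem]⟩
  inv_mem' {a} ha := ⟨inv_mem ha.1, by rw [Prod.fst_inv, Prod.snd_inv, _root_.map_inv,
    h.map_inv ha.1, ha.2.1], by rw [Prod.snd_inv, h.map_inv ha.1]; exact inv_mem ha.2.2⟩

variable {π : G →* Q} {S S' : Subgroup Q}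

theorem fiber_le {h : IsRep D φ} {h' : IsRep D' φ} (hD : D' ≤ D) (hS : S' ≤ S) :
    h'.fiber π S' ≤ h.fiber π S := fun _ hz => ⟨hD hz.1, hz.2.1, hS hz.2.2⟩

theorem relIndex_fiber_ne_zero [Finite G] (h : IsRep D φ) (h' : IsRep D' φ)
    (hDD : D'.relIndex D ≠ 0) : (h'.fiber π ⊥).relIndex (h.fiber π S) ≠ 0 := by
  have : Finite (D ⧸ D'.subgroupOf D) := Nat.finite_of_card_ne_zero hDD
  refine Subgroup.relIndex_ne_zero_of_forall_eq
    (X := G × (D ⧸ D'.subgroupOf D)) (fun z => (z.1.1, QuotientGroup.mk ⟨z.1.2, z.2.1⟩))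
    fun x y hxy => ?_
  rw [Prod.mk.injEq, QuotientGroup.eq] at hxy
  have h1 : (x : G × Γ).2⁻¹ * (y : G × Γ).2 ∈ D' := hxy.2
  have h2 : φ ((x : G × Γ).2⁻¹ * (y : G × Γ).2) = 1 := by
    rw [h.1 _ (inv_mem x.2.1) _ y.2.1, h.map_inv x.2.1, ← x.2.2.1, ← y.2.2.1, hxy.1,
      inv_mul_cancel]
  refine ⟨h1, ?_, ?_⟩
  · rw [Prod.snd_mul, Prod.snd_inv, h2, Prod.fst_mul, Prod.fst_inv, hxy.1, inv_mul_cancel,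
      _root_.map_one]
  · rw [Prod.snd_mul, Prod.snd_inv, h2]; exact one_mem _

end Fiber

section Galois

variable {k M : Type*} [Field k] [Field M] [Algebra k M] [IsGalois k M]
  {Q : Type*} [Group Q] {D D' : Subgroup (M ≃ₐ[k] M)} {φ : (M ≃ₐ[k] M) → Q}

theorem mem_of_forall_fixed (h : IsRep D φ) (hD : IsClosed (D : Set (M ≃ₐ[k] M)))
    (S : Subgroup Q) {γ : M ≃ₐ[k] M}
    (hγ : ∀ x : M, (∀ δ ∈ D, φ δ ∈ S → δ x = x) → γ x = x) : γ ∈ D ∧ φ γ ∈ S := by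
  have hDγ : γ ∈ D := _root_.mem_of_forall_fixed hD fun x hx => hγ x fun δ hδ _ => hx δ hδ
  refine ⟨hDγ, ?_⟩
  obtain ⟨U, hU, hUn, hU1⟩ := h.2
  let H : Subgroup (M ≃ₐ[k] M) := (S.comap h.hom).map D.subtype
  have hH : IsClosed ((H ⊔ U : Subgroup (M ≃ₐ[k] M)) : Set (M ≃ₐ[k] M)) :=
    Subgroup.isClosed_of_isOpen _ (Subgroup.isOpen_mono le_sup_right hU)
  have h1 : γ ∈ H ⊔ U := _root_.mem_of_forall_fixed hH fun x hx => hγ x fun δ hδ hS =>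
    hx δ (Subgroup.mem_sup_left ⟨⟨δ, hδ⟩, hS, rfl⟩)
  obtain ⟨δ, ⟨δ, hδS, rfl⟩, u, hu, rfl⟩ := Subgroup.mem_sup_of_normal_right.1 h1
  have hu' : u ∈ D := (Subgroup.mul_mem_cancel_left D δ.2).1 hDγ
  rw [D.coe_subtype, h.1 _ δ.2 _ hu', hU1 u hu hu', mul_one]
  exact hδS

variable {G : Type*} [Group G]

/-- The product of a group with a Galois group acts on the field through the second factor. -/
abbrev sndAction (G k M : Type*) [Group G] [Field k] [Field M] [Algebra k M] :
    MulSemiringAction (G × (M ≃ₐ[k] M)) M :=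
  MulSemiringAction.compHom M (MonoidHom.snd G (M ≃ₐ[k] M))

attribute [local instance] sndAction

theorem mem_of_forall_fiber_fixed {π : G →* Q} (h : IsRep D φ)
    (hD : IsClosed (D : Set (M ≃ₐ[k] M))) (S : Subgroup Q) {z : G × (M ≃ₐ[k] M)}
    (hz : ∀ x : M, (∀ n ∈ h.fiber π S, n • x = x) → z • x = x) : z.2 ∈ D ∧ φ z.2 ∈ S :=
  h.mem_of_forall_fixed hD S fun x hx => hz x fun n hn => hx n.2 hn.1 hn.2.2

/-- Conjugating a crossed homomorphism changes it by a coboundary if it is given on the part of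
its domain lying over `1` by an invariant central map. -/
theorem exists_twist [Finite G] {π : G →* Q} (hcent : π.ker ≤ Subgroup.center G)
    (h' : IsRep D' φ) (hD' : IsClosed (D' : Set (M ≃ₐ[k] M))) {S : Subgroup Q} {θ : G → Mˣ}
    {β : G × (M ≃ₐ[k] M) → Mˣ} (hβ : IsCrossed (h'.fiber π S) β)
    (hβθ : ∀ z ∈ h'.fiber π S, φ z.2 = 1 → β z = θ z.1) {x : G × (M ≃ₐ[k] M)}
    (hx : ∀ z, x * z * x⁻¹ ∈ h'.fiber π S ↔ z ∈ h'.fiber π S)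
    (hxθ : ∀ b ∈ π.ker, x • θ b = θ b) :
    ∃ u : Mˣ, ∀ z ∈ h'.fiber π S,
      β (x * z * x⁻¹) = u * x • β z * ((x * z * x⁻¹) • u)⁻¹ := by
  set N := h'.fiber π S with hN
  have hx' : ∀ z ∈ N, x⁻¹ * z * x ∈ N := fun z hz => by
    rw [← hx]; group; exact hz
  let f : G × (M ≃ₐ[k] M) → Mˣ := fun z => β z * (x • β (x⁻¹ * z * x))⁻¹
  have hf : IsCrossed N f := fun z hz y hy => by
    have h1 : x⁻¹ * (z * y) * x = (x⁻¹ * z * x) * (x⁻¹ * y * x) := by group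
    have h2 : x • (x⁻¹ * z * x) • β (x⁻¹ * y * x) = z • x • β (x⁻¹ * y * x) := by
      simp only [← mul_smul]; congr 1; group
    simp only [f]
    rw [h1, hβ z hz y hy, hβ _ (hx' z hz) _ (hx' y hy), smul_mul', h2, smul_mul', smul_inv']
    simp only [mul_inv]
    exact mul_mul_mul_comm _ _ _ _
  have hle : h'.fiber π ⊥ ≤ N := fiber_le le_rfl bot_le
  have hf₀ : ∀ g ∈ h'.fiber π ⊥, f g = 1 := fun g hg => by
    have hg1 : φ g.2 = 1 := hg.2.2
    have hb : g.1 ∈ π.ker := by rw [MonoidHom.mem_ker, hg.2.1, hg1]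
    have h1 : (x⁻¹ * g * x).1 = g.1 := by
      simp only [Prod.fst_mul, Prod.fst_inv]
      rw [mul_assoc, ← Subgroup.mem_center_iff.1 (hcent hb), inv_mul_cancel_left]
    have h2 : φ (x⁻¹ * g * x).2 = 1 := by
      rw [← (hx' g (hle hg)).2.1, h1]; exact hb
    simp only [f]
    rw [hβθ g (hle hg) hg1, hβθ _ (hx' g (hle hg)) h2, h1, hxθ _ hb, mul_inv_cancel]
  obtain ⟨u, hu⟩ := hf.exists_eq_div hle (h'.relIndex_fiber_ne_zero h' (by simp)) hf₀
    fun g hg hg' => by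
      obtain ⟨h1, h2⟩ := h'.mem_of_forall_fiber_fixed hD' ⊥ hg'
      exact ⟨h1, hg.2.1, h2⟩
  refine ⟨u, fun z hz => ?_⟩
  have h1 := hu _ ((hx z).2 hz)
  simp only [f] at h1
  have h2 : x⁻¹ * (x * z * x⁻¹) * x = z := by group
  rw [h2, mul_inv_eq_iff_eq_mul] at h1
  rw [h1, mul_right_comm]

end Galois

end IsRep

end

section

open Polynomial

attribute [local instance] Units.mulDistribMulActionRight IsRep.sndAction

theorem Subgroup.exists_cyclic_layer {Q : Type*} [Group Q] {ℓ n : ℕ} [Fact ℓ.Prime]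
    {S : Subgroup Q} (hS : Nat.card S = ℓ ^ (n + 1)) :
    ∃ S' ≤ S, Nat.card S' = ℓ ^ n ∧ ∃ q ∈ S, q ∉ S' ∧ (∀ z, q * z * q⁻¹ ∈ S' ↔ z ∈ S') ∧
      q ^ ℓ ∈ S' ∧ (∀ j, q ^ j ∈ S' → ℓ ∣ j) ∧ ∀ s ∈ S, ∃ j, s * (q ^ j)⁻¹ ∈ S' := by
  have hℓ : ℓ.Prime := Fact.out
  have : Finite S := Nat.finite_of_card_ne_zero (by rw [hS]; exact pow_ne_zero _ hℓ.ne_zero)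
  obtain ⟨R, hR⟩ := Sylow.exists_subgroup_card_pow_prime (G := S) ℓ (n := n)
    (by rw [hS]; exact pow_dvd_pow _ n.le_succ)
  have hidx : R.index = ℓ := by
    have h1 := R.index_mul_card
    rw [hR, hS, pow_succ'] at h1
    exact Nat.eq_of_mul_eq_mul_right (pow_pos hℓ.pos n) h1
  have hRn : R.Normal := Subgroup.normal_of_index_eq_minFac_card (by
    rw [hS, hℓ.pow_minFac n.succ_ne_zero, hidx])
  have hcard : Nat.card (S ⧸ R) = ℓ := hidx
  have hne : ∃ q : S, q ∉ R := by
    by_contra! h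
    have : R = ⊤ := (Subgroup.eq_top_iff' R).2 h
    rw [this, Subgroup.index_top] at hidx
    exact hℓ.ne_one hidx.symm
  obtain ⟨q, hq⟩ := hne
  have hq1 : (QuotientGroup.mk q : S ⧸ R) ≠ 1 := fun h => hq ((QuotientGroup.eq_one_iff q).1 h)
  have hord : orderOf (QuotientGroup.mk q : S ⧸ R) = ℓ :=
    orderOf_eq_prime (by rw [← hcard]; exact pow_card_eq_one') hq1
  have hmem : ∀ s : S, (s : Q) ∈ R.map S.subtype ↔ s ∈ R := fun s =>
    Subgroup.mem_map_iff_mem S.subtype_injective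
  have hpow : ∀ j : ℕ, (q : Q) ^ j ∈ R.map S.subtype ↔ ℓ ∣ j := fun j => by
    rw [← Subgroup.coe_pow, hmem, ← QuotientGroup.eq_one_iff, QuotientGroup.mk_pow,
      ← orderOf_dvd_iff_pow_eq_one, hord]
  have hle : R.map S.subtype ≤ S := Subgroup.map_subtype_le R
  refine ⟨R.map S.subtype, hle, ?_, q, q.2, fun h => hq ((hmem q).1 h), fun z => ?_,
    (hpow ℓ).2 dvd_rfl, fun j => (hpow j).1, fun s hs => ?_⟩
  · rw [← hR]; exact Subgroup.card_map_of_injective S.subtype_injective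
  · constructor <;> intro hz
    · have hz' : z ∈ S := by
        have h1 := mul_mem (mul_mem (inv_mem q.2) (hle hz)) q.2
        group at h1; exact h1
      have h1 : q * ⟨z, hz'⟩ * q⁻¹ ∈ R := (hmem _).1 hz
      exact (hmem ⟨z, hz'⟩).2 (by simpa [mul_assoc] using hRn.conj_mem _ h1 q⁻¹)
    · exact (hmem (q * ⟨z, hle hz⟩ * q⁻¹)).2 (hRn.conj_mem _ ((hmem ⟨z, hle hz⟩).1 hz) q)
  · obtain ⟨j, hj⟩ := mem_powers_of_prime_card hcard hq1 (g' := QuotientGroup.mk ⟨s, hs⟩)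
    refine ⟨j, (hmem (⟨s, hs⟩ * (q ^ j)⁻¹)).2 ?_⟩
    rw [← QuotientGroup.eq_one_iff, QuotientGroup.mk_mul, QuotientGroup.mk_inv,
      QuotientGroup.mk_pow]
    exact mul_inv_eq_one.2 hj.symm

section Geometric

variable {A k M : Type*} [Field A] [Field k] [Field M] [Algebra k M] [Algebra A M]

variable (A k) in
/-- The automorphisms fixing the constants and an element `t`. -/
def geomSubgroup (t : M) : Subgroup (M ≃ₐ[k] M) where
  carrier := {γ | γ t = t ∧ ∀ a : A, γ (algebraMap A M a) = algebraMap A M a}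
  mul_mem' {γ δ} hγ hδ := ⟨by rw [AlgEquiv.mul_apply, hδ.1, hγ.1],
    fun a => by rw [AlgEquiv.mul_apply, hδ.2 a, hγ.2 a]⟩
  one_mem' := ⟨rfl, fun _ => rfl⟩
  inv_mem' {γ} hγ := ⟨γ.symm_apply_eq.2 hγ.1.symm, fun a => γ.symm_apply_eq.2 (hγ.2 a).symm⟩

theorem mem_geomSubgroup {t : M} {γ : M ≃ₐ[k] M} : γ ∈ geomSubgroup A k t ↔
    γ t = t ∧ ∀ a : A, γ (algebraMap A M a) = algebraMap A M a := Iff.rfl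

variable [IsGalois k M]

theorem isClosed_geomSubgroup (t : M) :
    IsClosed (geomSubgroup A k t : Set (M ≃ₐ[k] M)) := by
  have h : (geomSubgroup A k t : Set (M ≃ₐ[k] M)) =
      ⋂ x ∈ insert t (Set.range (algebraMap A M)), MulAction.stabilizer (M ≃ₐ[k] M) x := by
    ext γ
    simp [mem_geomSubgroup, MulAction.mem_stabilizer_iff]
  rw [h]
  exact isClosed_biInter fun x _ =>
    Subgroup.isClosed_of_isOpen _ (stabilizer_isOpen_of_isIntegral (K := k) x)

omit [IsGalois k M] in
theorem geomSubgroup_apply_aeval {t : M} {γ : M ≃ₐ[k] M} (hγ : γ ∈ geomSubgroup A k t)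
    (r : A[X]) : γ (aeval t r) = aeval t r := by
  rw [aeval_eq_sum_range, map_sum]
  refine Finset.sum_congr rfl fun n _ => ?_
  rw [Algebra.smul_def, map_mul, map_pow, hγ.1, hγ.2]

/-- Over the constants, an embedding problem with central kernel, embedded by `θ` into the
constants, gives rise to a crossed homomorphism extending `θ`. -/
theorem exists_isCrossed_fiber_geomSubgroup [IsAlgClosed A] {t : M}
    (hev : Function.Injective (aeval (R := A) t))
    (halg : ∀ z : M, ∃ p : A[X][X], p ≠ 0 ∧ p.eval₂ (aeval (R := A) t : A[X] →+* M) z = 0)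
    {G Q : Type*} [Group G] [Group Q] {ℓ : ℕ} [Fact ℓ.Prime] {π : G →* Q}
    (hπ : Function.Surjective π) (hcent : π.ker ≤ Subgroup.center G)
    {φ : (M ≃ₐ[k] M) → Q} (h : IsRep (geomSubgroup A k t) φ) {θ : G → Mˣ}
    [Finite G] (hθ : ∀ b ∈ π.ker, ∀ b' ∈ π.ker, θ (b * b') = θ b * θ b')
    (hθC : ∀ b ∈ π.ker, ∀ γ ∈ geomSubgroup A k t, γ • θ b = θ b) (n : ℕ) (S : Subgroup Q)
    (hS : Nat.card S = ℓ ^ n) (hSφ : ∀ q ∈ S, ∃ γ ∈ geomSubgroup A k t, φ γ = q) :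
    ∃ β, IsCrossed (h.fiber π S) β ∧ ∀ z ∈ h.fiber π S, φ z.2 = 1 → β z = θ z.1 := by
  have hsnd : ∀ (z : G × (M ≃ₐ[k] M)) (x : Mˣ), z • x = z.2 • x := fun z x => rfl
  induction n generalizing S with
  | zero =>
    refine ⟨fun z => θ z.1, fun z hz y hy => ?_, fun z _ _ => rfl⟩
    rw [pow_zero, Subgroup.card_eq_one] at hS
    subst hS
    have h1 : ∀ z ∈ h.fiber π ⊥, z.1 ∈ π.ker := fun z hz => by
      rw [MonoidHom.mem_ker, hz.2.1]; exact hz.2.2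
    change θ (z.1 * y.1) = θ z.1 * z • θ y.1
    rw [hθ _ (h1 z hz) _ (h1 y hy), hsnd, hθC _ (h1 y hy) _ hz.1]
  | succ n ih =>
    obtain ⟨S', hle, hS', q, hqS, hqS', hconj, hql, hqj, hgen⟩ := Subgroup.exists_cyclic_layer hS
    obtain ⟨β', hβ', hβθ⟩ := ih S' hS' fun q hq => hSφ q (hle hq)
    obtain ⟨γ, hγ, rfl⟩ := hSφ q hqS
    obtain ⟨g, hg⟩ := hπ (φ γ)
    set x : G × (M ≃ₐ[k] M) := (g, γ) with hx
    set N := h.fiber π S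
    set N' := h.fiber π S' with hN'
    have hxN : x ∈ N := ⟨hγ, hg, hqS⟩
    have hNN : N' ≤ N := IsRep.fiber_le le_rfl hle
    have hmem : ∀ z ∈ N, z ∈ N' ↔ φ z.2 ∈ S' := fun z hz => ⟨fun h => h.2.2, fun h =>
      ⟨hz.1, hz.2.1, h⟩⟩
    have hφpow : ∀ j : ℕ, φ (x ^ j).2 = φ γ ^ j := fun j => by
      rw [← (pow_mem hxN j).2.1, Prod.pow_fst, map_pow, ← hg]
    have hxx : ∀ z, x * z * x⁻¹ ∈ N' ↔ z ∈ N' := fun z => by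
      have h1 : x * z * x⁻¹ ∈ N ↔ z ∈ N := by
        rw [Subgroup.mul_mem_cancel_right _ (inv_mem hxN), Subgroup.mul_mem_cancel_left _ hxN]
      have h2 : z ∈ N → φ (x * z * x⁻¹).2 = φ γ * φ z.2 * (φ γ)⁻¹ := fun hz => by
        rw [← (h1.2 hz).2.1, ← hg, ← hz.2.1]; simp [hx]
      constructor <;> intro hz
      · have hz' := h1.1 (hNN hz)
        rw [hmem _ (hNN hz), h2 hz', hconj] at hz
        exact (hmem _ hz').2 hz
      · rw [hmem _ (h1.2 (hNN hz)), h2 (hNN hz), hconj]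
        exact hz.2.2
    obtain ⟨u, hu⟩ := h.exists_twist hcent (isClosed_geomSubgroup t) hβ' hβθ hxx
      fun b hb => hθC b hb γ hγ
    have hxl : x ^ ℓ ∈ N' := (hmem _ (pow_mem hxN ℓ)).2 (by rw [hφpow]; exact hql)
    obtain ⟨h1, h2, -⟩ := IsCrossed.obstruction_spec hNN hxx (Fact.out : ℓ.Prime).pos hxl
      (fun j hj => hqj j (by rw [← hφpow]; exact hj.2.2))
      (fun y hy => by
        obtain ⟨j, hj⟩ := hgen _ hy.2.2
        have h3 := mul_mem hy (inv_mem (pow_mem hxN j))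
        refine ⟨j, (hmem _ h3).2 ?_⟩
        rw [← h3.2.1, Prod.fst_mul, Prod.fst_inv, map_mul, _root_.map_inv, hy.2.1,
          (pow_mem hxN j).2.1, hφpow]
        exact hj) hβ' hu rfl
    set H : Mˣ := (∏ a ∈ Finset.range ℓ, x ^ a • u) * (β' (x ^ ℓ))⁻¹
    have hfixN : ∀ n ∈ N, ∀ r : A[X], n • (aeval t r : M) = aeval t r := fun n hn r =>
      geomSubgroup_apply_aeval hn.1 r
    obtain ⟨v, hv, hvH⟩ := exists_prod_pow_smul_eq_of_prime (aeval (R := A) t : A[X] →+* M) hev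
      halg hxx Fact.out hxl (fun n hn => hfixN n (hNN hn)) (hfixN x hxN)
      (by
        by_contra! hcon
        exact hqS' (h.mem_of_forall_fiber_fixed (isClosed_geomSubgroup t) S' hcon).2)
      (h := (H : M)) (fun n hn => congrArg Units.val (h1 n (hNN hn)))
      (congrArg Units.val (h1 x hxN))
    have hv0 : v ≠ 0 := by
      rintro rfl
      refine H.ne_zero ?_
      rw [← hvH]
      exact Finset.prod_eq_zero (Finset.mem_range.2 (Fact.out : ℓ.Prime).pos) (smul_zero _)
    obtain ⟨β, hβ, hββ'⟩ := h2 (Units.mk0 v hv0) (fun z hz => Units.ext (hv z hz))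
      (Units.ext (by
        rw [← hvH, Units.coe_prod]
        rfl))
    refine ⟨β, hβ, fun z hz hz1 => ?_⟩
    have hz' : z ∈ N' := (hmem z hz).2 (by rw [hz1]; exact one_mem _)
    rw [hββ' z hz', hβθ z hz' hz1]

end Geometric

end

section

open Polynomial IntermediateField

attribute [local instance] Units.mulDistribMulActionRight IsRep.sndAction

theorem exists_pow_card_pow_eq (K : Type*) {A : Type*} [Field K] [Finite K] [Field A] [Algebra K A]
    [Algebra.IsAlgebraic K A] (a : A) : ∃ d, 0 < d ∧ a ^ Nat.card K ^ d = a := by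
  have : FiniteDimensional K K⟮a⟯ := IntermediateField.adjoin.finiteDimensional
    (Algebra.IsAlgebraic.isAlgebraic a).isIntegral
  have : Finite K⟮a⟯ := Module.finite_of_finite K
  have := Fintype.ofFinite K⟮a⟯
  have h1 := FiniteField.pow_card (IntermediateField.AdjoinSimple.gen K a)
  rw [← Nat.card_eq_fintype_card, Module.natCard_eq_pow_finrank (K := K)] at h1
  exact ⟨_, Module.finrank_pos, congrArg Subtype.val h1⟩

section Levels

variable {K A k M : Type*} [Field K] [Finite K] [Field A] [Algebra K A] [IsAlgClosed A]
  [Algebra.IsAlgebraic K A] [Field k] [Field M] [Algebra k M] [Algebra A M] [Algebra K k]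
  [Algebra K M] [IsScalarTower K A M] [IsScalarTower K k M] [IsGalois k M] {T : ℕ → M}

omit [IsAlgClosed A] [Algebra.IsAlgebraic K A] [Algebra K k] [Algebra K M] [IsScalarTower K A M]
  [IsScalarTower K k M] [IsGalois k M] [Field K] [Finite K] [Algebra K A] in
variable (K) in
theorem geomSubgroup_le_levelSubgroup (T : ℕ → M) (e i : ℕ) :
    geomSubgroup A k (T i) ≤ levelSubgroup K A k T e i := fun _ hγ => ⟨hγ.1, fun a _ => hγ.2 a⟩

omit [IsAlgClosed A] [Algebra.IsAlgebraic K A] [Algebra K k] [Algebra K M] [IsScalarTower K A M]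
  [IsScalarTower K k M] [IsGalois k M] [Field K] [Finite K] [Algebra K A] in
theorem levelSubgroup_le_of_dvd {e e' : ℕ} (h : e ∣ e') (i : ℕ) :
    levelSubgroup K A k T e' i ≤ levelSubgroup K A k T e i := fun γ hγ => ⟨hγ.1, fun a ha => by
  obtain ⟨n, rfl⟩ := h
  exact hγ.2 a (pow_card_pow_mul_eq ha n)⟩

omit [IsAlgClosed A] [Algebra K k] [Algebra K M] [IsScalarTower K A M] [IsScalarTower K k M] in
/-- An open set containing the geometric subgroup contains some `levelSubgroup`. -/
theorem exists_levelSubgroup_le {e : ℕ} (he : 0 < e) (i : ℕ) {V : Set (M ≃ₐ[k] M)}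
    (hV : IsOpen V) (hVC : (geomSubgroup A k (T i) : Set (M ≃ₐ[k] M)) ⊆ V) :
    ∃ m, 0 < m ∧ (levelSubgroup K A k T (e * m) i : Set (M ≃ₐ[k] M)) ⊆ V := by
  by_contra! hcon
  let Z : ℕ → Set (M ≃ₐ[k] M) := fun n => levelSubgroup K A k T (e * n.factorial) i ∩ Vᶜ
  have hpos : ∀ n : ℕ, 0 < e * n.factorial := fun n => Nat.mul_pos he (Nat.factorial_pos n)
  have hcl : ∀ n, IsClosed (Z n) := fun n =>
    (Subgroup.isClosed_of_isOpen _ (isOpen_levelSubgroup i (hpos n))).inter hV.isClosed_compl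
  obtain ⟨γ, hγ⟩ := IsCompact.nonempty_iInter_of_sequence_nonempty_isCompact_isClosed Z
    (fun n => Set.inter_subset_inter_left _ (levelSubgroup_le_of_dvd
      (mul_dvd_mul_left e (Nat.factorial_dvd_factorial n.le_succ)) i))
    (fun n => by
      obtain ⟨γ, hγ, hγV⟩ := Set.not_subset.1 (hcon _ n.factorial_pos)
      exact ⟨γ, hγ, hγV⟩)
    (hcl 0).isCompact hcl
  rw [Set.mem_iInter] at hγ
  refine (hγ 0).2 (hVC ⟨(hγ 0).1.1, fun a => ?_⟩)
  obtain ⟨d, hd, hda⟩ := exists_pow_card_pow_eq K a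
  obtain ⟨c, hc⟩ := Dvd.dvd.mul_left (Nat.dvd_factorial hd le_rfl) e
  exact (hγ d).1.2 a (by rw [hc]; exact pow_card_pow_mul_eq hda c)

omit [Algebra K k] [Algebra K M] [IsScalarTower K A M] [IsScalarTower K k M] in
theorem exists_isCrossed_fiber_levelSubgroup {e i : ℕ} (he : 0 < e)
    (hev : Function.Injective (aeval (R := A) (T i)))
    (halg : ∀ z : M, ∃ p : A[X][X], p ≠ 0 ∧ p.eval₂ (aeval (R := A) (T i) : A[X] →+* M) z = 0)
    {G Q : Type*} [Group G] [Group Q] {ℓ : ℕ} [Fact ℓ.Prime] {π : G →* Q}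
    (hπ : Function.Surjective π) (hcent : π.ker ≤ Subgroup.center G) [Finite G]
    (hG : IsPGroup ℓ G) {φ : (M ≃ₐ[k] M) → Q} (h : IsRep (levelSubgroup K A k T e i) φ)
    {θ : G → Mˣ} (hθ : ∀ b ∈ π.ker, ∀ b' ∈ π.ker, θ (b * b') = θ b * θ b')
    (hθC : ∀ b ∈ π.ker, ∀ γ ∈ levelSubgroup K A k T e i, γ • θ b = θ b) :
    ∃ m, 0 < m ∧ ∃ hr : IsRep (levelSubgroup K A k T (e * m) i) φ, ∃ b : G → Mˣ,
      IsCrossed (hr.fiber π ⊤) (fun z => b z.1) ∧ ∀ c ∈ π.ker, b c = θ c := by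
  set C := geomSubgroup A k (T i) with hC
  have hCle : C ≤ levelSubgroup K A k T e i := geomSubgroup_le_levelSubgroup K T e i
  have hCr := h.mono hCle
  have hQfin : Finite Q := Finite.of_surjective π hπ
  let S : Subgroup Q := hCr.hom.range
  obtain ⟨n, hn⟩ : ∃ n, Nat.card S = ℓ ^ n :=
    IsPGroup.iff_card.1 ((hG.of_surjective π hπ).to_subgroup S)
  obtain ⟨β, hβ, hβθ⟩ := exists_isCrossed_fiber_geomSubgroup hev halg hπ hcent hCr hθ
    (fun b hb γ hγ => hθC b hb γ (hCle hγ)) n S hn (by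
      rintro _ ⟨γ, rfl⟩
      exact ⟨γ, γ.2, rfl⟩)
  have hmem : ∀ g, ∀ γ ∈ C, π g = φ γ → (g, γ) ∈ hCr.fiber π S := fun g γ hγ hg =>
    ⟨hγ, hg, ⟨⟨γ, hγ⟩, rfl⟩⟩
  have hind : ∀ g, ∀ γ ∈ C, ∀ γ' ∈ C, π g = φ γ → π g = φ γ' → β (g, γ) = β (g, γ') := by
    intro g γ hγ γ' hγ' hg hg'
    have h1 : (g, γ') = (g, γ) * (1, γ⁻¹ * γ') := by simp
    have h2 : φ (γ⁻¹ * γ') = 1 := by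
      rw [hCr.1 _ (inv_mem hγ) _ hγ', hCr.map_inv hγ, ← hg, ← hg', inv_mul_cancel]
    have h3 := hmem 1 _ (mul_mem (inv_mem hγ) hγ') (by rw [h2, map_one])
    rw [h1, hβ _ (hmem g γ hγ hg) _ h3, hβθ _ h3 h2]
    have h4 : θ 1 = 1 := by
      have := hθ 1 (one_mem _) 1 (one_mem _)
      rwa [mul_one, left_eq_mul] at this
    rw [h4, smul_one, mul_one]
  have hex : ∀ g, ∃ b : Mˣ, ∀ γ ∈ C, π g = φ γ → β (g, γ) = b := fun g => by
    by_cases hg : ∃ γ ∈ C, π g = φ γ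
    · obtain ⟨γ, hγ, hg⟩ := hg
      exact ⟨β (g, γ), fun γ' hγ' hg' => hind g γ' hγ' γ hγ hg' hg⟩
    · exact ⟨1, fun γ hγ hg' => (hg ⟨γ, hγ, hg'⟩).elim⟩
  choose b hb using hex
  obtain ⟨U, hU, hUn, hU1⟩ := h.2
  obtain ⟨U', hU', hUn', hU1'⟩ := exists_open_normal_fixing (k := k)
    (Set.finite_range fun g => (b g : M))
  have hWn : (U ⊓ U').Normal := inferInstance
  obtain ⟨m, hm, hmW⟩ := exists_levelSubgroup_le (K := K) (A := A) (k := k)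
    (T := T) (V := (C ⊔ U ⊓ U' : Subgroup (M ≃ₐ[k] M))) he i
    (Subgroup.isOpen_mono le_sup_right (hU.inter hU')) (SetLike.coe_subset_coe.2
      (le_sup_left : C ≤ C ⊔ U ⊓ U'))
  have hle := levelSubgroup_le_of_dvd (K := K) (A := A) (k := k) (T := T) (Dvd.intro m rfl :
    e ∣ e * m) i
  refine ⟨m, hm, h.mono hle, b, ?_, fun c hc => ?_⟩
  · have key : ∀ z ∈ (h.mono hle).fiber π ⊤, ∃ γ ∈ C, π z.1 = φ γ ∧ ∀ g, z • b g = γ • b g := by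
      rintro ⟨g, γ⟩ ⟨hγ, hg, -⟩
      obtain ⟨c, hc, w, hw, rfl⟩ := Subgroup.mem_sup_of_normal_right.1 (hmW hγ)
      have hw' := (Subgroup.mul_mem_cancel_left _ (hCle hc)).1 (hle hγ)
      refine ⟨c, hc, ?_, fun g' => Units.ext ?_⟩
      · rw [hg, h.1 _ (hCle hc) _ hw', hU1 w hw.1 hw', mul_one]
      · change c (w (b g')) = c (b g')
        rw [hU1' w hw.2 _ ⟨g', rfl⟩]
    intro z hz y hy
    obtain ⟨γ, hγ, hg, hz'⟩ := key z hz
    obtain ⟨δ, hδ, hg', -⟩ := key y hy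
    have h1 := hβ _ (hmem _ γ hγ hg) _ (hmem _ δ hδ hg')
    rw [Prod.mk_mul_mk, hb _ _ (mul_mem hγ hδ) (by rw [map_mul, hg, hg', hCr.1 _ hγ _ hδ]),
      hb _ _ hγ hg, hb _ _ hδ hg'] at h1
    exact h1.trans (by rw [hz']; rfl)
  · rw [← hb c 1 (one_mem _) (by rw [hCr.map_one]; exact hc)]
    exact hβθ _ (hmem c 1 (one_mem _) (by rw [hCr.map_one]; exact hc)) hCr.map_one

end Levels

end

section

open Polynomial

attribute [local instance] Units.mulDistribMulActionRight

theorem Nat.exists_forall_pow_dvd_of_pow_dvd {ℓ Q : ℕ} (hℓ : ℓ.Prime) (hQ : 1 < Q)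
    (h : ℓ ∣ Q - 1) (M : ℕ) : ∃ I, ∀ I', I ≤ I' → ∀ d, ℓ ^ I' ∣ Q ^ d - 1 → ℓ ^ M ∣ d := by
  refine ⟨Q ^ ℓ ^ M, fun I hI d hd => ?_⟩
  have h1 : ℓ ^ I ∣ Q ^ ℓ ^ I - 1 := by
    have h2 : ((ℓ : ℕ) : ℤ) ∣ (Q : ℤ) - 1 := by
      have := Int.natCast_dvd_natCast.2 h
      rwa [Nat.cast_sub hQ.le, Nat.cast_one] at this
    have h3 := dvd_sub_pow_of_dvd_sub h2 I
    rw [one_pow] at h3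
    have h4 : ((ℓ ^ I : ℕ) : ℤ) ∣ ((Q ^ ℓ ^ I - 1 : ℕ) : ℤ) := by
      rw [Nat.cast_sub (Nat.one_le_pow _ _ (by omega))]
      push_cast
      exact (pow_dvd_pow _ (Nat.le_succ I)).trans h3
    exact Int.natCast_dvd_natCast.1 h4
  have h2 := Nat.dvd_gcd hd h1
  rw [Nat.pow_sub_one_gcd_pow_sub_one] at h2
  obtain ⟨r, -, hr⟩ := (Nat.dvd_prime_pow hℓ).1 (Nat.gcd_dvd_right d (ℓ ^ I))
  rw [hr] at h2
  have hrd : ℓ ^ r ∣ d := hr ▸ Nat.gcd_dvd_left d (ℓ ^ I)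
  rcases le_or_gt M r with h3 | h3
  · exact (pow_dvd_pow ℓ h3).trans hrd
  · exfalso
    have h4 : 0 < Q ^ ℓ ^ r - 1 := Nat.sub_pos_of_lt
      (Nat.one_lt_pow (pow_pos hℓ.pos r).ne' hQ)
    have h5 := Nat.le_of_dvd h4 h2
    have h6 : Q ^ ℓ ^ r ≤ Q ^ ℓ ^ M :=
      Nat.pow_le_pow_right (by omega) (Nat.pow_le_pow_right hℓ.pos h3.le)
    have h7 := Nat.lt_pow_self hℓ.one_lt (n := I)
    omega

/-- The place of the `i`-th layer of the tower over the root `s` is unramified. -/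
def IsBad {A : Type*} [Monoid A] (ℓ i : ℕ) (s : A) : Prop := ¬ ℓ ∣ orderOf (s ^ ℓ ^ i)

theorem pow_dvd_of_not_isBad {A : Type*} [Monoid A] {ℓ i : ℕ} (hℓ : ℓ.Prime) {s : A} {n : ℕ}
    (hs : ¬ IsBad ℓ i s) (hn : s ^ n = 1) : ℓ ^ i ∣ n := by
  refine Dvd.dvd.trans ?_ (orderOf_dvd_of_pow_eq_one hn)
  rw [IsBad, not_not] at hs
  by_contra h
  rw [orderOf_pow' s (pow_pos hℓ.pos i).ne'] at hs
  obtain ⟨r, hr, hr'⟩ := (Nat.dvd_prime_pow hℓ).1 (Nat.gcd_dvd_right (orderOf s) (ℓ ^ i))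
  have hri : r < i := lt_of_le_of_ne hr fun h' => h (by
    rw [← h', ← hr']; exact Nat.gcd_dvd_left _ _)
  rw [hr'] at hs
  have h1 : ℓ ^ r ∣ orderOf s := hr' ▸ Nat.gcd_dvd_left _ _
  have h2 : ℓ ^ (r + 1) ∣ ℓ ^ r := by
    conv_rhs => rw [← hr']
    refine Nat.dvd_gcd ?_ (pow_dvd_pow ℓ hri)
    rw [pow_succ]
    exact Nat.mul_dvd_of_dvd_div h1 hs
  exact absurd (Nat.le_of_dvd (pow_pos hℓ.pos r) h2)
    (not_le.2 (Nat.pow_lt_pow_right hℓ.one_lt r.lt_succ_self))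

/-- A tower `T i` with `T (i + 1) ^ ℓ = T i` together with a set of valuations `W e i s` above
every unramified point `s` of the `i`-th layer that lie over the Frobenius conjugates of `s`. -/
structure PlaceTower (K A k : Type*) {M : Type*} [Field K] [Field A] [Algebra K A] [Field k]
    [Field M] [Algebra k M] [Algebra A M] (ℓ : ℕ) (T : ℕ → M)
    (W : ℕ → ℕ → A → Set (Mˣ →* Multiplicative ℤ)) : Prop where
  pow : ∀ i, T (i + 1) ^ ℓ = T i
  trans : ∀ i, Function.Injective (aeval (R := A) (T i))
  alg : ∀ i z, ∃ p : A[X][X], p ≠ 0 ∧ p.eval₂ (aeval (R := A) (T i) : A[X] →+* M) z = 0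
  ratio : ∀ e i, 0 < e → ∀ z : M, (∀ γ ∈ levelSubgroup K A k T e i, γ z = z) →
    ∃ P R : A[X], R ≠ 0 ∧ (∀ n, P.coeff n ^ Nat.card K ^ e = P.coeff n) ∧
      (∀ n, R.coeff n ^ Nat.card K ^ e = R.coeff n) ∧ z * aeval (T i) R = aeval (T i) P
  nonempty : ∀ e i s, 0 < e → IsBad ℓ i s → (W e i s).Nonempty
  exists_eq_comp : ∀ e i s, 0 < e → IsBad ℓ i s → ∀ w ∈ W e i s, ∀ w' ∈ W e i s,
    ∃ γ ∈ levelSubgroup K A k T e i, ∀ x, w' x = w (γ • x)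
  frob_mem : ∀ e i s, 0 < e → IsBad ℓ i s → ∀ w ∈ W e i s, w ∈ W e i (s ^ Nat.card K ^ e)
  exists_frob : ∀ e i s d, 0 < e → IsBad ℓ i s → ∀ w ∈ W e i s,
    s ^ Nat.card K ^ (e * d) = s → ∃ γ ∈ levelSubgroup K A k T e i,
      (∀ a : A, γ (algebraMap A M a) = algebraMap A M (a ^ Nat.card K ^ (e * d))) ∧
      ∀ x, w (γ • x) = w x
  poly : ∀ e i s, 0 < e → IsBad ℓ i s → ∀ w ∈ W e i s, ∀ R : A[X], R ≠ 0 →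
    (∀ n, R.coeff n ^ Nat.card K ^ e = R.coeff n) → ∀ u : Mˣ, (u : M) = aeval (T i) R →
    (w u).toAdd = R.rootMultiplicity s
  finite_support : ∀ e i x, 0 < e → ∃ S : Set A, S.Finite ∧
    ∀ s ∉ S, IsBad ℓ i s → ∀ w ∈ W e i s, w x = 1
  root : ∀ e i x, 0 < e → (∀ s, IsBad ℓ i s → ∀ w ∈ W e i s, ∃ z, w x = z ^ ℓ) →
    ∃ y : Mˣ, y ^ ℓ = x

namespace PlaceTower

variable {K A k M : Type*} [Field K] [Finite K] [Field A] [Algebra K A] [IsAlgClosed A]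
  [Algebra.IsAlgebraic K A] [Field k] [Field M] [Algebra k M] [Algebra A M]
  {ℓ : ℕ} {T : ℕ → M} {W : ℕ → ℕ → A → Set (Mˣ →* Multiplicative ℤ)}

omit [Finite K] [IsAlgClosed A] [Algebra.IsAlgebraic K A] in
theorem pow_eq (hP : PlaceTower K A k ℓ T W) (i j : ℕ) : T (i + j) ^ ℓ ^ j = T i := by
  induction j with
  | zero => simp
  | succ j ih => rw [pow_succ', pow_mul, ← add_assoc, hP.pow, ih]

omit [Finite K] [IsAlgClosed A] [Algebra.IsAlgebraic K A] in
theorem aeval_expand (hP : PlaceTower K A k ℓ T W) (i j : ℕ) (R : A[X]) :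
    aeval (T (i + j)) (expand A (ℓ ^ j) R) = aeval (T i) R := by
  rw [expand_aeval, hP.pow_eq]

/-- An invariant element whose valuations are compatible with the orbits of Frobenius becomes a norm
far enough up in the tower. -/
theorem exists_prod_pow_smul_eq (hP : PlaceTower K A k ℓ T W) (hℓ : ℓ.Prime) {e i j n : ℕ}
    (he : 0 < e) (hn : n ≤ j)
    (hI : ∀ d, ℓ ^ (i + j) ∣ (Nat.card K ^ e) ^ d - 1 → ℓ ^ n ∣ d)
    {H : Mˣ} (hH : ∀ γ ∈ levelSubgroup K A k T e i, γ • H = H)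
    (hres : ∀ s d, 0 < d → IsBad ℓ (i + j) s → s ^ Nat.card K ^ (e * d) = s →
      ∀ w ∈ W e (i + j) s, ((ℓ ^ n : ℕ) : ℤ) ∣ d * (w H).toAdd)
    {δ : M ≃ₐ[k] M} (hδ : δ (T (i + j)) = T (i + j))
    (hδA : ∀ a : A, δ (algebraMap A M a) = algebraMap A M (a ^ Nat.card K ^ e)) :
    ∃ v : Mˣ, (∀ γ ∈ levelSubgroup K A k T (e * ℓ ^ n) (i + j), γ • v = v) ∧
      H = ∏ a ∈ Finset.range (ℓ ^ n), δ ^ a • v := by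
  have hq : 1 < Nat.card K := Finite.one_lt_card
  set F : A →+* A := ((frobEquiv K A ^ e : A ≃ₐ[K] A) : A →+* A) with hF
  have hFa : ∀ a, F a = a ^ Nat.card K ^ e := fun a => frobEquiv_pow_apply K e a
  have hFd : ∀ d a, (F ^ d) a = a ^ Nat.card K ^ (e * d) := fun d a => by
    induction d generalizing a with
    | zero => simp
    | succ d ih => rw [pow_succ, RingHom.mul_def, RingHom.comp_apply, ih, hFa, ← pow_mul,
        ← pow_add, Nat.mul_succ, add_comm]
  have hmap : ∀ (d : ℕ) (R : A[X]), R.map (F ^ d) = R ↔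
      ∀ m, R.coeff m ^ Nat.card K ^ (e * d) = R.coeff m := fun d R => by
    simp only [Polynomial.ext_iff, coeff_map, hFd]
  have hmap1 : ∀ R : A[X], R.map F = R ↔ ∀ m, R.coeff m ^ Nat.card K ^ e = R.coeff m := fun R => by
    simpa using hmap 1 R
  obtain ⟨P, R, hR0, hPc, hRc, hPR⟩ := hP.ratio e i he H fun γ hγ => congrArg Units.val (hH γ hγ)
  have hev : ∀ i (R : A[X]), aeval (T i) R = 0 → R = 0 := fun i R h =>
    hP.trans i (h.trans (map_zero _).symm)
  have hP0 : P ≠ 0 := by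
    rintro rfl
    rw [map_zero] at hPR
    exact hR0 (hev i R ((mul_eq_zero.1 hPR).resolve_left H.ne_zero))
  have hlj : 0 < ℓ ^ j := pow_pos hℓ.pos j
  set P' := expand A (ℓ ^ j) P with hP'
  set R' := expand A (ℓ ^ j) R with hR'
  have hP'0 : P' ≠ 0 := (expand_ne_zero hlj).2 hP0
  have hR'0 : R' ≠ 0 := (expand_ne_zero hlj).2 hR0
  have hexp : ∀ R : A[X], (∀ m, R.coeff m ^ Nat.card K ^ e = R.coeff m) →
      (expand A (ℓ ^ j) R).map F = expand A (ℓ ^ j) R := fun R h => by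
    rw [map_expand, (hmap1 R).2 h]
  have hP'F := hexp P hPc
  have hR'F := hexp R hRc
  have hHR : (H : M) * aeval (T (i + j)) R' = aeval (T (i + j)) P' := by
    rw [hP.aeval_expand, hP.aeval_expand, hPR]
  have hmult0 : ∀ R : A[X], R ≠ 0 → ℓ ^ n ∣ rootMultiplicity 0 (expand A (ℓ ^ j) R) := by
    intro R hR
    obtain ⟨R₁, hR₁, hR₁0⟩ := exists_eq_pow_rootMultiplicity_mul_and_not_dvd R hR 0
    rw [C_0, sub_zero] at hR₁ hR₁0
    set m := rootMultiplicity 0 R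
    have h2 : expand A (ℓ ^ j) R = (X - C 0) ^ (ℓ ^ j * m) * expand A (ℓ ^ j) R₁ := by
      conv_lhs => rw [hR₁]
      rw [map_mul, map_pow, expand_X, C_0, sub_zero, pow_mul]
    rw [h2, rootMultiplicity_mul (by rw [← h2]; exact (expand_ne_zero hlj).2 hR),
      rootMultiplicity_X_sub_C_pow, rootMultiplicity_eq_zero, add_zero]
    · exact (pow_dvd_pow ℓ hn).mul_right m
    · rw [IsRoot, expand_eval, zero_pow hlj.ne', ← IsRoot, ← dvd_iff_isRoot, C_0, sub_zero]
      exact hR₁0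
  have hpos : 0 < ℓ ^ n := pow_pos hℓ.pos n
  have hprod0 : P' * R' ^ (ℓ ^ n - 1) ≠ 0 := mul_ne_zero hP'0 (pow_ne_zero _ hR'0)
  have hmult : ∀ s, (P' * R' ^ (ℓ ^ n - 1)).rootMultiplicity s =
      P'.rootMultiplicity s + (ℓ ^ n - 1) * R'.rootMultiplicity s := fun s => by
    classical
    simp only [← count_roots]
    rw [roots_mul hprod0, roots_pow, Multiset.count_add, Multiset.count_nsmul]
  obtain ⟨V, hV, hVP⟩ := exists_prod_map_pow_eq F (pow_pos (by omega : 0 < Nat.card K) e) hFa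
    (fun s => by
      obtain ⟨d, hd, hds⟩ := exists_pow_card_pow_eq K s
      refine ⟨d, hd, ?_⟩
      rw [hFd, mul_comm]
      exact pow_card_pow_mul_eq hds e) hpos _ (P' * R' ^ (ℓ ^ n - 1)) le_rfl hprod0
    (by rw [Polynomial.map_mul, Polynomial.map_pow, hP'F, hR'F]) (by
      intro s d hd hs
      rw [hFd] at hs
      by_cases hbad : IsBad ℓ (i + j) s
      · obtain ⟨w, hw⟩ := hP.nonempty e _ s he hbad
        have h1 := hres s d hd hbad hs w hw
        have hu : ∀ R : A[X], R ≠ 0 → aeval (T (i + j)) R ≠ 0 := fun R hR h => hR (hev _ R h)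
        have hwP := hP.poly e _ s he hbad w hw P' hP'0 ((hmap1 P').1 hP'F)
          (Units.mk0 _ (hu P' hP'0)) rfl
        have hwR := hP.poly e _ s he hbad w hw R' hR'0 ((hmap1 R').1 hR'F)
          (Units.mk0 _ (hu R' hR'0)) rfl
        have h2 : H * Units.mk0 _ (hu R' hR'0) = Units.mk0 _ (hu P' hP'0) := Units.ext hHR
        rw [← h2, map_mul, toAdd_mul, hwR] at hwP
        rw [hmult, ← Int.natCast_dvd_natCast]
        have h3 : ((d * (P'.rootMultiplicity s + (ℓ ^ n - 1) * R'.rootMultiplicity s) : ℕ) : ℤ) =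
            d * (w H).toAdd + (ℓ ^ n : ℕ) * (d * R'.rootMultiplicity s) := by
          rw [Nat.cast_mul, Nat.cast_add, Nat.cast_mul, Nat.cast_sub hpos, ← hwP, Nat.cast_one]
          ring
        rw [h3]
        exact dvd_add h1 (dvd_mul_right _ _)
      · rcases eq_or_ne s 0 with rfl | hs0
        · rw [hmult]
          exact Dvd.dvd.mul_left (dvd_add (hmult0 P hP0) ((hmult0 R hR0).mul_left _)) _
        · refine Dvd.dvd.mul_right (hI d (pow_dvd_of_not_isBad hℓ hbad ?_)) _
          rw [← pow_mul]
          refine mul_left_cancel₀ hs0 ?_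
          rw [← pow_succ', Nat.sub_add_cancel (Nat.one_le_pow _ _ (by omega)), hs, mul_one])
  have hV0 : V ≠ 0 := by
    rintro rfl
    refine hprod0 (hVP.symm.trans (Finset.prod_eq_zero (Finset.mem_range.2 hpos) ?_))
    rw [Polynomial.map_zero]
  have hR'e : aeval (T (i + j)) R' ≠ 0 := fun h => hR'0 (hev _ _ h)
  have hV'e : aeval (T (i + j)) V ≠ 0 := fun h => hV0 (hev _ _ h)
  have hfix : ∀ m, ∀ R : A[X], (∀ n, R.coeff n ^ Nat.card K ^ m = R.coeff n) →
      ∀ γ ∈ levelSubgroup K A k T m (i + j), γ (aeval (T (i + j)) R) = aeval (T (i + j)) R := by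
    intro m R hR γ hγ
    rw [aeval_eq_sum_range, map_sum]
    refine Finset.sum_congr rfl fun n _ => ?_
    rw [Algebra.smul_def, map_mul, map_pow, hγ.1, hγ.2 _ (hR n)]
  have hδV : ∀ (R : A[X]) (a : ℕ), (δ ^ a) (aeval (T (i + j)) R) =
      aeval (T (i + j)) (R.map (F ^ a)) := fun R a => by
    induction a with
    | zero =>
      rw [pow_zero, pow_zero]
      change aeval _ R = aeval _ (R.map (RingHom.id A))
      rw [Polynomial.map_id]
    | succ a ih =>
      rw [pow_succ', AlgEquiv.mul_apply, ih, pow_succ', RingHom.mul_def, ← Polynomial.map_map]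
      generalize R.map (F ^ a) = R
      rw [aeval_eq_sum_range, aeval_eq_sum_range' (n := R.natDegree + 1)
        (Nat.lt_succ_of_le natDegree_map_le), map_sum]
      refine Finset.sum_congr rfl fun n _ => ?_
      rw [Algebra.smul_def, Algebra.smul_def, map_mul, map_pow, hδ, hδA, coeff_map, hFa]
  refine ⟨Units.mk0 _ hV'e * (Units.mk0 _ hR'e)⁻¹, fun γ hγ => ?_, Units.ext ?_⟩
  · have h1 : γ • Units.mk0 _ hV'e = Units.mk0 _ hV'e :=
      Units.ext (hfix _ V ((hmap _ V).1 hV) γ hγ)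
    have h2 : γ • Units.mk0 _ hR'e = Units.mk0 _ hR'e :=
      Units.ext (hfix _ R' ((hmap1 R').1 hR'F) γ (levelSubgroup_le_of_dvd (dvd_mul_right _ _) _ hγ))
    rw [smul_mul', smul_inv', h1, h2]
  · have hR'a : ∀ a : ℕ, R'.map (F ^ a) = R' := fun a => by
      induction a with
      | zero => exact Polynomial.map_id
      | succ a ih => rw [pow_succ, RingHom.mul_def, ← Polynomial.map_map, hR'F, ih]
    have h1 : ∀ a : ℕ, ((δ ^ a • (Units.mk0 _ hV'e * (Units.mk0 _ hR'e)⁻¹) : Mˣ) : M) =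
        aeval (T (i + j)) (V.map (F ^ a)) * (aeval (T (i + j)) R')⁻¹ := fun a => by
      change (δ ^ a) (aeval (T (i + j)) V * (aeval (T (i + j)) R')⁻¹) = _
      rw [map_mul, map_inv₀, hδV, hδV, hR'a]
    rw [Units.coe_prod]
    simp only [h1]
    rw [Finset.prod_mul_distrib, ← map_prod, hVP, Finset.prod_const, Finset.card_range, map_mul,
      map_pow, ← hHR, mul_assoc, mul_assoc, ← mul_assoc (aeval _ R'),
      mul_pow_sub_one hpos.ne', ← mul_pow,
      mul_inv_cancel₀ hR'e, one_pow, mul_one]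

end PlaceTower

end

section

open Polynomial

attribute [local instance] Units.mulDistribMulActionRight IsRep.sndAction

theorem levelSubgroup_relIndex_ne_zero {K A k M : Type*} [Field K] [Finite K] [Field A]
    [Algebra K A] [Field k] [Field M] [Algebra k M] [Algebra A M] [IsGalois k M] {T : ℕ → M}
    {e : ℕ} (he : 0 < e) (i : ℕ) (D : Subgroup (M ≃ₐ[k] M)) :
    (levelSubgroup K A k T e i).relIndex D ≠ 0 := by
  have : Finite ((M ≃ₐ[k] M) ⧸ levelSubgroup K A k T e i) :=
    Subgroup.quotient_finite_of_isOpen _ (isOpen_levelSubgroup i he)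
  have : (levelSubgroup K A k T e i).FiniteIndex := Subgroup.finiteIndex_of_finite_quotient
  exact Subgroup.FiniteIndex.index_ne_zero (H := (levelSubgroup K A k T e i).subgroupOf D)

namespace PlaceTower

variable {K A k M : Type*} [Field K] [Finite K] [Field A] [Algebra K A] [IsAlgClosed A]
  [Algebra.IsAlgebraic K A] [Field k] [Field M] [Algebra k M] [Algebra A M]
  {ℓ : ℕ} {T : ℕ → M} {W : ℕ → ℕ → A → Set (Mˣ →* Multiplicative ℤ)}

omit [IsAlgClosed A] in
/-- An element whose class modulo `ℓ`-th powers of the valuations is invariant is, up to an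
invariant factor, an `ℓ`-th power. -/
theorem exists_mul_pow_eq (hP : PlaceTower K A k ℓ T W) (hℓ : ℓ.Prime) {e i : ℕ} (he : 0 < e)
    {x : Mˣ} (hx : ∀ γ ∈ levelSubgroup K A k T e i, ∃ b : Mˣ, b ^ ℓ = x * (γ • x)⁻¹) :
    ∃ y a : Mˣ, (∀ γ ∈ levelSubgroup K A k T e i, γ • a = a) ∧ a * y ^ ℓ = x := by
  classical
  have hℓ0 : (ℓ : ℤ) ≠ 0 := by exact_mod_cast hℓ.ne_zero
  have hwell : ∀ s, IsBad ℓ i s → ∀ w ∈ W e i s, ∀ w' ∈ W e i s,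
      (w x).toAdd % (ℓ : ℤ) = (w' x).toAdd % (ℓ : ℤ) := by
    intro s hs w hw w' hw'
    obtain ⟨γ, hγ, hγw⟩ := hP.exists_eq_comp e i s he hs w hw w' hw'
    obtain ⟨b, hb⟩ := hx γ hγ
    have h1 := congrArg (fun z => (w z).toAdd) hb
    simp only [map_pow, map_mul, map_inv, toAdd_mul, toAdd_inv, toAdd_pow, ← hγw] at h1
    refine (Int.modEq_iff_dvd.2 ⟨-(w b).toAdd, ?_⟩ : _ ≡ _ [ZMOD ℓ])
    rw [nsmul_eq_mul] at h1
    linarith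
  obtain ⟨n, hn, hn0⟩ : ∃ n : A → ℕ, (∀ s, IsBad ℓ i s → ∀ w ∈ W e i s,
      (n s : ℤ) = (w x).toAdd % (ℓ : ℤ)) ∧ ∀ s, ¬ IsBad ℓ i s → n s = 0 := by
    refine ⟨fun s => if h : IsBad ℓ i s then
      ((((hP.nonempty e i s he h).some) x).toAdd % (ℓ : ℤ)).toNat else 0, fun s hs w hw => ?_,
      fun s hs => dif_neg hs⟩
    dsimp only
    rw [dif_pos hs, Int.toNat_of_nonneg (Int.emod_nonneg _ hℓ0)]
    exact hwell s hs _ (hP.nonempty e i s he hs).some_mem w hw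
  have hFbad : ∀ s : A, IsBad ℓ i (s ^ Nat.card K ^ e) ↔ IsBad ℓ i s := fun s => by
    rw [IsBad, IsBad, ← frobEquiv_pow_apply K e s, ← map_pow]
    exact not_congr (iff_of_eq (congrArg _ (orderOf_injective
      ((frobEquiv K A ^ e : A ≃ₐ[K] A) : A →* A) (AlgEquiv.injective _) _)))
  have hnF : ∀ s, n (s ^ Nat.card K ^ e) = n s := fun s => by
    by_cases hs : IsBad ℓ i s
    · obtain ⟨w, hw⟩ := hP.nonempty e i s he hs
      have h1 := hn _ ((hFbad s).2 hs) w (hP.frob_mem e i s he hs w hw)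
      rw [← hn s hs w hw] at h1
      exact_mod_cast h1
    · rw [hn0 s hs, hn0 _ fun h => hs ((hFbad s).1 h)]
  have hfin : (Function.support n).Finite := by
    obtain ⟨S, hS, hS1⟩ := hP.finite_support e i x he
    refine hS.subset fun s hs => ?_
    by_contra hsS
    by_cases hbad : IsBad ℓ i s
    · obtain ⟨w, hw⟩ := hP.nonempty e i s he hbad
      have h1 := hn s hbad w hw
      rw [hS1 s hsS hbad w hw, toAdd_one, Int.zero_emod] at h1
      exact hs (by exact_mod_cast h1)
    · exact hs (hn0 s hbad)
  set m : Multiset A := Finsupp.toMultiset (Finsupp.ofSupportFinite n hfin) with hm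
  have hmc : ∀ s, m.count s = n s := fun s => by
    rw [hm, Finsupp.count_toMultiset]; rfl
  have hmF : m.map (fun s => s ^ Nat.card K ^ e) = m := by
    ext t
    obtain ⟨s, rfl⟩ := (frobEquiv K A ^ e : A ≃ₐ[K] A).surjective t
    have h1 : (fun s : A => s ^ Nat.card K ^ e) = (frobEquiv K A ^ e : A ≃ₐ[K] A) :=
      funext fun s => (frobEquiv_pow_apply K e s).symm
    rw [h1, Multiset.count_map_eq_count' _ _ (AlgEquiv.injective _), hmc, hmc,
      frobEquiv_pow_apply, hnF]
  set R : A[X] := (m.map fun s => X - C s).prod with hR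
  have hR0 : R ≠ 0 := (monic_multiset_prod_of_monic _ _ fun s _ => monic_X_sub_C s).ne_zero
  have hRc : ∀ j, R.coeff j ^ Nat.card K ^ e = R.coeff j := by
    have h1 : R.map ((frobEquiv K A ^ e : A ≃ₐ[K] A) : A →+* A) = R := by
      conv_rhs => rw [hR, ← hmF]
      rw [hR, Polynomial.map_multiset_prod, Multiset.map_map, Multiset.map_map]
      refine congrArg _ (Multiset.map_congr rfl fun s _ => ?_)
      simp only [Function.comp_apply, Polynomial.map_sub, map_X, map_C, ← frobEquiv_pow_apply]
      rfl
    intro j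
    conv_rhs => rw [← h1, coeff_map]
    exact (frobEquiv_pow_apply K e _).symm
  have hRe : aeval (T i) R ≠ 0 := fun h => hR0 (hP.trans i (h.trans (map_zero _).symm))
  obtain ⟨y, hy⟩ := hP.root e i (x * (Units.mk0 _ hRe)⁻¹) he fun s hs w hw => by
    refine ⟨Multiplicative.ofAdd ((w x).toAdd / ℓ), Multiplicative.toAdd.injective ?_⟩
    rw [map_mul, map_inv, toAdd_mul, toAdd_inv, toAdd_pow, toAdd_ofAdd, nsmul_eq_mul,
      hP.poly e i s he hs w hw R hR0 hRc (Units.mk0 _ hRe) rfl, ← count_roots, hR,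
      roots_multiset_prod_X_sub_C, hmc, hn s hs w hw]
    linarith [Int.mul_ediv_add_emod (w x).toAdd ℓ]
  refine ⟨y, Units.mk0 _ hRe, fun γ hγ => Units.ext ?_, by rw [hy, mul_comm, inv_mul_cancel_right]⟩
  change γ (aeval (T i) R) = aeval (T i) R
  rw [aeval_eq_sum_range, map_sum]
  refine Finset.sum_congr rfl fun n _ => ?_
  rw [Algebra.smul_def, map_mul, map_pow, hγ.1, hγ.2 _ (hRc n)]

section Lift

variable [Algebra K k] [Algebra K M] [IsScalarTower K A M] [IsScalarTower K k M] [IsGalois k M]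

omit [Algebra K k] [Algebra K M] [IsScalarTower K A M] [IsScalarTower K k M] [IsAlgClosed A] in
/-- A crossed homomorphism on the fiber product extending an isomorphism of the kernel with the
roots of unity yields a solution of the central embedding problem. -/
theorem exists_lift_of_isCrossed (hP : PlaceTower K A k ℓ T W) (hℓ : ℓ.Prime) {e i : ℕ}
    (he : 0 < e) {G Q : Type*} [Group G] [Group Q] [Finite G] {π : G →* Q}
    (hπ : Function.Surjective π) {φ : (M ≃ₐ[k] M) → Q}
    (h : IsRep (levelSubgroup K A k T e i) φ) {θ : G → Mˣ}
    (hθ : ∀ b ∈ π.ker, ∀ b' ∈ π.ker, θ (b * b') = θ b * θ b')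
    (hθinj : ∀ b ∈ π.ker, θ b = 1 → b = 1) (hθpow : ∀ b ∈ π.ker, θ b ^ ℓ = 1)
    (hθsurj : ∀ u : Mˣ, u ^ ℓ = 1 → ∃ b ∈ π.ker, θ b = u)
    (hθfix : ∀ b ∈ π.ker, ∀ γ ∈ levelSubgroup K A k T e i, γ • θ b = θ b) {m : ℕ} (hm : 0 < m)
    {β : G × (M ≃ₐ[k] M) → Mˣ} (hβ : IsCrossed (h.fiber π ⊤) β)
    (hβθ : ∀ z ∈ h.fiber π ⊤, z.2 ∈ levelSubgroup K A k T (e * m) i → φ z.2 = 1 → β z = θ z.1) :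
    ∃ ψ : (M ≃ₐ[k] M) → G, IsRep (levelSubgroup K A k T e i) ψ ∧
      ∀ γ ∈ levelSubgroup K A k T e i, π (ψ γ) = φ γ := by
  set D := levelSubgroup K A k T e i with hD
  have hle : levelSubgroup K A k T (e * m) i ≤ D := levelSubgroup_le_of_dvd (dvd_mul_right e m) i
  have h' : IsRep (levelSubgroup K A k T (e * m) i) φ := h.mono hle
  have hem : 0 < e * m := Nat.mul_pos he hm
  have hlift : ∀ γ ∈ D, ∃ g, (g, γ) ∈ h.fiber π ⊤ := fun γ hγ => by
    obtain ⟨g, hg⟩ := hπ (φ γ)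
    exact ⟨g, hγ, hg, Subgroup.mem_top _⟩
  obtain ⟨x, hx⟩ := (hβ.pow ℓ).exists_eq_div (IsRep.fiber_le (h' := h') (S' := ⊥) hle bot_le)
    (h.relIndex_fiber_ne_zero h' (levelSubgroup_relIndex_ne_zero hem i D)) (fun z hz => by
      have hz1 : φ z.2 = 1 := hz.2.2
      change β z ^ ℓ = 1
      rw [hβθ z (IsRep.fiber_le hle bot_le hz) hz.1 hz1]
      exact hθpow _ (by rw [MonoidHom.mem_ker, hz.2.1, hz1])) fun g hg hg' => by
        obtain ⟨h1, h2⟩ := h'.mem_of_forall_fiber_fixed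
          (Subgroup.isClosed_of_isOpen _ (isOpen_levelSubgroup i hem)) ⊥ hg'
        exact ⟨h1, hg.2.1, h2⟩
  obtain ⟨y, a, ha, hay⟩ := hP.exists_mul_pow_eq hℓ he (x := x) fun γ hγ => by
    obtain ⟨g, hg⟩ := hlift γ hγ
    exact ⟨β (g, γ), hx _ hg⟩
  let β₁ : G × (M ≃ₐ[k] M) → Mˣ := fun z => β z * (z • y * y⁻¹)
  have hβ₁pow : ∀ z ∈ h.fiber π ⊤, β₁ z ^ ℓ = 1 := fun z hz => by
    have h1 : β z ^ ℓ = x * (z • x)⁻¹ := hx z hz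
    have h2 : z • a = a := ha z.2 hz.1
    have h3 : z • x = a * (z • y) ^ ℓ := by rw [← hay, smul_mul', smul_pow', h2]
    simp only [β₁]
    rw [mul_pow, h1, h3, ← hay, mul_pow, inv_pow, ← div_eq_mul_inv, ← div_eq_mul_inv,
      mul_div_mul_left_eq_div, div_mul_div_cancel, div_self']
  have hβ₁mul : ∀ z ∈ h.fiber π ⊤, ∀ z' ∈ h.fiber π ⊤, β₁ (z * z') = β₁ z * β₁ z' := by
    intro z hz z' hz'
    have h1 : β₁ (z * z') = β₁ z * z • β₁ z' := by
      simp only [β₁]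
      rw [hβ z hz z' hz', mul_smul, smul_mul', smul_mul', smul_inv',
        mul_mul_mul_comm (β z) (z • y * y⁻¹)]
      congr 1
      rw [mul_comm (z • y * y⁻¹), mul_assoc, inv_mul_cancel_left]
    obtain ⟨b, hb, hb'⟩ := hθsurj _ (hβ₁pow z' hz')
    rw [h1, ← hb']
    congr 1
    exact hθfix b hb z.2 hz.1
  have hβ₁ker : ∀ b ∈ π.ker, β₁ (b, 1) = θ b := fun b hb => by
    have h1 : ((b, 1) : G × (M ≃ₐ[k] M)) ∈ h.fiber π ⊤ :=
      ⟨one_mem _, by rw [h.map_one]; exact hb, Subgroup.mem_top _⟩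
    have h2 : ((b, 1) : G × (M ≃ₐ[k] M)) • y = y := one_smul (M ≃ₐ[k] M) y
    simp only [β₁]
    rw [h2, mul_inv_cancel, mul_one, hβθ _ h1 (one_mem _) h.map_one]
  have hker : ∀ γ, ∀ g g', (g, γ) ∈ h.fiber π ⊤ → (g', γ) ∈ h.fiber π ⊤ →
      β₁ (g, γ) = 1 → β₁ (g', γ) = 1 → g = g' := by
    intro γ g g' hg hg' h1 h2
    have hb : g' * g⁻¹ ∈ π.ker := by
      rw [MonoidHom.mem_ker, map_mul, map_inv, hg.2.1, hg'.2.1, mul_inv_cancel]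
    have h3 := hβ₁mul (g' * g⁻¹, 1) ⟨one_mem _, by rw [h.map_one]; exact hb, Subgroup.mem_top _⟩
      _ hg
    rw [Prod.mk_mul_mk, one_mul, inv_mul_cancel_right, h1, h2, mul_one, hβ₁ker _ hb] at h3
    exact (mul_inv_eq_one.1 (hθinj _ hb h3.symm)).symm
  have hex : ∀ γ ∈ D, ∃ g, (g, γ) ∈ h.fiber π ⊤ ∧ β₁ (g, γ) = 1 := fun γ hγ => by
    obtain ⟨g, hg⟩ := hlift γ hγ
    obtain ⟨b, hb, hb'⟩ := hθsurj (β₁ (g, γ))⁻¹ (by rw [inv_pow, hβ₁pow _ hg, inv_one])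
    have hb1 : ((b, 1) : G × (M ≃ₐ[k] M)) ∈ h.fiber π ⊤ :=
      ⟨one_mem _, by rw [h.map_one]; exact hb, Subgroup.mem_top _⟩
    have h1 : ((b, 1) : G × (M ≃ₐ[k] M)) * (g, γ) = (b * g, γ) := by
      rw [Prod.mk_mul_mk, one_mul]
    refine ⟨b * g, h1 ▸ mul_mem hb1 hg, ?_⟩
    rw [← h1, hβ₁mul _ hb1 _ hg, hβ₁ker b hb, hb', inv_mul_cancel]
  choose! ψ hψ hψ1 using hex
  refine ⟨ψ, ⟨fun γ hγ δ hδ => ?_, ?_⟩, fun γ hγ => (hψ γ hγ).2.1⟩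
  · refine hker _ _ _ (hψ _ (mul_mem hγ hδ)) (mul_mem (hψ γ hγ) (hψ δ hδ)) (hψ1 _ (mul_mem hγ hδ))
      ?_
    rw [← Prod.mk_mul_mk, hβ₁mul _ (hψ γ hγ) _ (hψ δ hδ), hψ1 γ hγ, hψ1 δ hδ, one_mul]
  · obtain ⟨U₁, hU₁, hn₁, hU₁'⟩ := h.2
    obtain ⟨U₂, hU₂, hn₂, hU₂'⟩ := exists_open_normal_le_levelSubgroup K A (k := k) (T := T) i hem
    obtain ⟨U₃, hU₃, hn₃, hU₃'⟩ := exists_open_normal_fixing (k := k) (Set.finite_singleton (y : M))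
    refine ⟨U₁ ⊓ U₂ ⊓ U₃, (hU₁.inter hU₂).inter hU₃, inferInstance, fun γ hγ hγD => ?_⟩
    have h1 : φ γ = 1 := hU₁' γ hγ.1.1 hγD
    have h2 : ((1, γ) : G × (M ≃ₐ[k] M)) ∈ h.fiber π ⊤ :=
      ⟨hγD, by rw [h1, map_one], Subgroup.mem_top _⟩
    refine hker γ _ _ (hψ γ hγD) h2 (hψ1 γ hγD) ?_
    have h3 : ((1, γ) : G × (M ≃ₐ[k] M)) • y = y := Units.ext (hU₃' γ hγ.2 y rfl)
    have h4 : θ 1 = 1 := by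
      have := hθ 1 (one_mem _) 1 (one_mem _)
      simpa using this
    simp only [β₁]
    rw [h3, hβθ _ h2 (hU₂' hγ.1.2) h1, h4, mul_inv_cancel, one_mul]

end Lift

end PlaceTower

end

section

open Polynomial

attribute [local instance] Units.mulDistribMulActionRight IsRep.sndAction

/-- A group of prime order is the group of roots of unity in an algebraically closed field. -/
theorem exists_hom_rootsOfUnity (A M : Type*) [Field A] [IsAlgClosed A] [Field M] [Algebra A M]
    {ℓ : ℕ} (hℓ : ℓ.Prime) (hℓA : (ℓ : A) ≠ 0) {G : Type*} [Group G] (B : Subgroup G)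
    (hB : Nat.card B = ℓ) : ∃ θ : G → Mˣ, (∀ b ∈ B, ∀ b' ∈ B, θ (b * b') = θ b * θ b') ∧
      (∀ b ∈ B, θ b = 1 → b = 1) ∧
      (∀ b ∈ B, ∃ a : A, a ^ ℓ = 1 ∧ (θ b : M) = algebraMap A M a) ∧
      ∀ u : Mˣ, u ^ ℓ = 1 → ∃ b ∈ B, θ b = u := by
  classical
  have : Fact ℓ.Prime := ⟨hℓ⟩
  have : NeZero (ℓ : A) := ⟨hℓA⟩
  have : NeZero ℓ := ⟨hℓ.ne_zero⟩
  obtain ⟨ζ, hζ⟩ := HasEnoughRootsOfUnity.exists_primitiveRoot A ℓ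
  have hcard : Nat.card (rootsOfUnity ℓ A) = ℓ := hζ.card_rootsOfUnity
  let E : B ≃* rootsOfUnity ℓ A := mulEquivOfPrimeCardEq hB hcard
  let f : Aˣ →* Mˣ := Units.map (algebraMap A M : A →* M)
  have hf : Function.Injective f := Units.map_injective (algebraMap A M).injective
  obtain ⟨θ, hθ⟩ : ∃ θ : G → Mˣ, ∀ b (h : b ∈ B), θ b = f (E ⟨b, h⟩) :=
    ⟨fun g => if h : g ∈ B then f (E ⟨g, h⟩) else 1, fun b hb => dif_pos hb⟩
  refine ⟨θ, fun b hb b' hb' => ?_, fun b hb h => ?_, fun b hb => ?_, fun u hu => ?_⟩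
  · rw [hθ b hb, hθ b' hb', hθ _ (mul_mem hb hb'), ← map_mul f, ← Subgroup.coe_mul, ← map_mul E]
    rfl
  · rw [hθ b hb] at h
    have h1 : E ⟨b, hb⟩ = 1 := Subtype.ext (hf (h.trans (map_one f).symm))
    exact congrArg Subtype.val (E.injective (h1.trans (map_one E).symm))
  · refine ⟨((E ⟨b, hb⟩ : Aˣ) : A), ?_, ?_⟩
    · have := (E ⟨b, hb⟩).2
      rw [mem_rootsOfUnity] at this
      rw [← Units.val_pow_eq_pow_val, this, Units.val_one]
    · rw [hθ b hb]; rfl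
  · have hζ' := hζ.map_of_injective (algebraMap A M).injective
    obtain ⟨r, -, hr⟩ := hζ'.eq_pow_of_pow_eq_one (ξ := (u : M)) (by
      rw [← Units.val_pow_eq_pow_val, hu, Units.val_one])
    have hζu : IsUnit ζ := hζ.isUnit hℓ.ne_zero
    let z : rootsOfUnity ℓ A := ⟨hζu.unit ^ r, by
      rw [mem_rootsOfUnity]
      ext
      push_cast
      rw [IsUnit.unit_spec, ← pow_mul, mul_comm, pow_mul, hζ.pow_eq_one, one_pow]⟩
    refine ⟨E.symm z, (E.symm z).2, Units.ext ?_⟩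
    rw [hθ _ (E.symm z).2, Subtype.coe_eta, E.apply_symm_apply, ← hr, ← map_pow]
    rfl

section Frob

variable {K A k M : Type*} [Field K] [Finite K] [Field A] [Algebra K A]
  [Field k] [Field M] [Algebra k M] [Algebra A M] {T : ℕ → M}

omit [Field K] [Finite K] [Algebra K A] in
theorem pow_apply_of_frobenius {γ : M ≃ₐ[k] M} {d : ℕ}
    (hγ : ∀ a : A, γ (algebraMap A M a) = algebraMap A M (a ^ Nat.card K ^ d)) (j : ℕ) (a : A) :
    (γ ^ j) (algebraMap A M a) = algebraMap A M (a ^ Nat.card K ^ (d * j)) := by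
  induction j generalizing a with
  | zero => simp
  | succ j ih => rw [pow_succ, AlgEquiv.mul_apply, hγ, ih, ← pow_mul, ← pow_add, Nat.mul_succ,
      add_comm]

theorem mul_inv_mem_levelSubgroup [Algebra.IsAlgebraic K A] {γ δ : M ≃ₐ[k] M} {e r i : ℕ}
    (hγT : γ (T i) = T i) (hδT : δ (T i) = T i)
    (hγ : ∀ a : A, a ^ Nat.card K ^ e = a → γ (algebraMap A M a) =
      algebraMap A M (a ^ Nat.card K ^ r))
    (hδ : ∀ a : A, a ^ Nat.card K ^ e = a → δ (algebraMap A M a) =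
      algebraMap A M (a ^ Nat.card K ^ r)) :
    γ * δ⁻¹ ∈ levelSubgroup K A k T e i := by
  refine ⟨?_, fun a ha => ?_⟩
  · rw [AlgEquiv.mul_apply]
    change γ (δ.symm (T i)) = T i
    rw [δ.symm_apply_eq.2 hδT.symm, hγT]
  · obtain ⟨b, rfl⟩ := (frobEquiv K A ^ r : A ≃ₐ[K] A).surjective a
    have hb : b ^ Nat.card K ^ e = b := by
      rw [← map_pow] at ha
      exact AlgEquiv.injective _ ha
    rw [frobEquiv_pow_apply, AlgEquiv.mul_apply, ← hδ b hb]
    change γ (δ.symm (δ _)) = _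
    rw [AlgEquiv.symm_apply_apply, hγ b hb, hδ b hb]

end Frob

namespace PlaceTower

variable {K A k M : Type*} [Field K] [Finite K] [Field A] [Algebra K A] [IsAlgClosed A]
  [Algebra.IsAlgebraic K A] [Field k] [Field M] [Algebra k M] [Algebra A M]
  {ℓ : ℕ} {T : ℕ → M} {W : ℕ → ℕ → A → Set (Mˣ →* Multiplicative ℤ)}
  [Algebra K k] [Algebra K M] [IsScalarTower K A M] [IsScalarTower K k M] [IsGalois k M]

omit [Finite K] [IsAlgClosed A] [Algebra.IsAlgebraic K A] [Algebra K k] [Algebra K M]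
  [IsScalarTower K A M] [IsScalarTower K k M] [IsGalois k M] in
theorem apply_eq_of_succ (hP : PlaceTower K A k ℓ T W) (i : ℕ) (γ : M ≃ₐ[k] M)
    (h : γ (T (i + 1)) = T (i + 1)) : γ (T i) = T i := by
  rw [← hP.pow, map_pow, h]

/-- The central step after all the choices: a crossed homomorphism on the part over a cyclic
extension of the constants of degree a power of `ℓ` extends after going up in the tower. -/
theorem exists_isCrossed_extension (hP : PlaceTower K A k ℓ T W) (hℓ : ℓ.Prime) {e i n : ℕ}
    (he : 0 < e) (hℓe : ℓ ∣ Nat.card K ^ e - 1) {G Q : Type*} [Group G] [Group Q] [Finite G]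
    {π : G →* Q} (hπ : Function.Surjective π) (hcent : π.ker ≤ Subgroup.center G)
    {φ : (M ≃ₐ[k] M) → Q} (h : IsRep (levelSubgroup K A k T e i) φ) {θ : G → Mˣ}
    (hθfix : ∀ b ∈ π.ker, ∀ γ ∈ levelSubgroup K A k T e i, γ • θ b = θ b)
    (h' : IsRep (levelSubgroup K A k T (e * ℓ ^ n) i) φ) {b : G → Mˣ}
    (hb : IsCrossed (h'.fiber π ⊤) fun z => b z.1) (hbθ : ∀ c ∈ π.ker, b c = θ c) :
    ∃ i', i ≤ i' ∧ ∃ hr : IsRep (levelSubgroup K A k T e i') φ, ∃ β : G × (M ≃ₐ[k] M) → Mˣ,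
      IsCrossed (hr.fiber π ⊤) β ∧ ∀ z ∈ hr.fiber π ⊤,
        z.2 ∈ levelSubgroup K A k T (e * ℓ ^ n) i' → β z = b z.1 := by
  have hq : 1 < Nat.card K := Finite.one_lt_card
  have hn0 : 0 < ℓ ^ n := pow_pos hℓ.pos n
  have hen : 0 < e * ℓ ^ n := Nat.mul_pos he hn0
  have hanti : ∀ {e e' i i' : ℕ}, e ∣ e' → i ≤ i' →
      levelSubgroup K A k T e' i' ≤ levelSubgroup K A k T e i :=
    fun he hi => levelSubgroup_anti hP.apply_eq_of_succ he hi
  obtain ⟨I, hI⟩ := Nat.exists_forall_pow_dvd_of_pow_dvd hℓ (Nat.one_lt_pow he.ne' hq) hℓe n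
  obtain ⟨j, hnj, hIj⟩ : ∃ j, n ≤ j ∧ I ≤ i + j := ⟨max n I, le_max_left _ _,
    (le_max_right _ _).trans (Nat.le_add_left _ _)⟩
  have hbad1 : IsBad ℓ (i + j) (1 : A) := by
    rw [IsBad, one_pow, orderOf_one, Nat.dvd_one]
    exact hℓ.ne_one
  obtain ⟨w₁, hw₁⟩ := hP.nonempty e (i + j) 1 he hbad1
  obtain ⟨γ₀, hγ₀, hγ₀A, -⟩ := hP.exists_frob e (i + j) 1 1 he hbad1 w₁ hw₁ (one_pow _)
  rw [mul_one] at hγ₀A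
  obtain ⟨g₀, hg₀⟩ := hπ (φ γ₀)
  set x : G × (M ≃ₐ[k] M) := (g₀, γ₀) with hx
  have key : ∀ i₁, i ≤ i₁ → i₁ ≤ i + j → ∀ (hr : IsRep (levelSubgroup K A k T e i₁) φ)
      (hr' : IsRep (levelSubgroup K A k T (e * ℓ ^ n) i₁) φ),
      (∀ z, x * z * x⁻¹ ∈ hr'.fiber π ⊤ ↔ z ∈ hr'.fiber π ⊤) ∧ x ^ ℓ ^ n ∈ hr'.fiber π ⊤ ∧
      (∀ r, x ^ r ∈ hr'.fiber π ⊤ → ℓ ^ n ∣ r) ∧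
      (∀ y ∈ hr.fiber π ⊤, ∀ d, (∀ a : A, a ^ Nat.card K ^ (e * ℓ ^ n) = a →
        y.2 (algebraMap A M a) = algebraMap A M (a ^ Nat.card K ^ (e * d))) →
        y * (x ^ d)⁻¹ ∈ hr'.fiber π ⊤) ∧
      ∀ y ∈ hr.fiber π ⊤, ∃ r, y * (x ^ r)⁻¹ ∈ hr'.fiber π ⊤ := by
    intro i₁ hi₁ hi₁' hr hr'
    have hγ₁ : γ₀ ∈ levelSubgroup K A k T e i₁ := hanti dvd_rfl hi₁' hγ₀
    have hxr : x ∈ hr.fiber π ⊤ := ⟨hγ₁, hg₀, Subgroup.mem_top _⟩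
    have hmem : ∀ z, z ∈ hr'.fiber π ⊤ ↔ z ∈ hr.fiber π ⊤ ∧
        z.2 ∈ levelSubgroup K A k T (e * ℓ ^ n) i₁ := fun z =>
      ⟨fun hz => ⟨IsRep.fiber_le (hanti (dvd_mul_right _ _) le_rfl) le_rfl hz, hz.1⟩,
        fun hz => ⟨hz.2, hz.1.2⟩⟩
    have hγT : ∀ γ ∈ levelSubgroup K A k T e i₁, γ (T i₁) = T i₁ := fun γ hγ => hγ.1
    have hdiff : ∀ y ∈ hr.fiber π ⊤, ∀ d, (∀ a : A, a ^ Nat.card K ^ (e * ℓ ^ n) = a →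
        y.2 (algebraMap A M a) = algebraMap A M (a ^ Nat.card K ^ (e * d))) →
        y * (x ^ d)⁻¹ ∈ hr'.fiber π ⊤ := fun y hy d hd => by
      rw [hmem]
      refine ⟨mul_mem hy (inv_mem (pow_mem hxr d)), ?_⟩
      exact mul_inv_mem_levelSubgroup (hγT _ hy.1) (hγT _ (pow_mem hγ₁ d)) hd
        fun a _ => pow_apply_of_frobenius hγ₀A d a
    have hconj : ∀ y ∈ hr.fiber π ⊤, ∀ z ∈ hr'.fiber π ⊤, y * z * y⁻¹ ∈ hr'.fiber π ⊤ := by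
      intro y hy z hz
      rw [hmem] at hz ⊢
      exact ⟨mul_mem (mul_mem hy hz.1) (inv_mem hy),
        (isTower_levelSubgroup hP.apply_eq_of_succ ℓ).normal i₁ hen _
          (hanti (one_dvd e) le_rfl hy.1) _ hz.2⟩
    refine ⟨fun z => ⟨fun hz => ?_, hconj x hxr z⟩, ?_, fun r hxm => ?_, hdiff, fun y hy => ?_⟩
    · have := hconj x⁻¹ (inv_mem hxr) _ hz
      rwa [show x⁻¹ * (x * z * x⁻¹) * x⁻¹⁻¹ = z by group] at this
    · rw [hmem]
      refine ⟨pow_mem hxr _, hγT _ (pow_mem hγ₁ _), fun a ha => ?_⟩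
      exact (pow_apply_of_frobenius hγ₀A _ a).trans (by rw [ha])
    · have h1 : ∀ a : A, a ^ Nat.card K ^ (e * ℓ ^ n) = a →
          a ^ Nat.card K ^ (e * r) = a ^ Nat.card K ^ 0 := fun a ha => by
        refine (algebraMap A M).injective ?_
        rw [← pow_apply_of_frobenius hγ₀A r a, pow_zero, pow_one]
        exact hxm.1.2 a ha
      exact Nat.dvd_of_mul_dvd_mul_left he
        ((Nat.modEq_zero_iff_dvd).1 ((pow_card_pow_eq_iff K (A := A) hen).1 h1))
    · obtain ⟨r, hr1⟩ := exists_forall_apply_eq_pow_card_pow K A hen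
        ((y.2 : M →ₐ[k] M).restrictScalars K)
      have h1 : ∀ a : A, a ^ Nat.card K ^ e = a →
          a ^ Nat.card K ^ r = a ^ Nat.card K ^ 0 := fun a ha => by
        refine (algebraMap A M).injective ?_
        rw [← hr1 a (pow_card_pow_mul_eq ha _), pow_zero, pow_one]
        exact hy.1.2 a ha
      obtain ⟨d, rfl⟩ := (Nat.modEq_zero_iff_dvd).1 ((pow_card_pow_eq_iff K (A := A) he).1 h1)
      exact ⟨d, hdiff y hy d hr1⟩
  have hle : levelSubgroup K A k T (e * ℓ ^ n) i ≤ levelSubgroup K A k T e i :=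
    hanti (dvd_mul_right _ _) le_rfl
  have hγi : γ₀ ∈ levelSubgroup K A k T e i := hanti dvd_rfl (Nat.le_add_right i j) hγ₀
  obtain ⟨hxN, hxm, hmin, hdiff, hgen⟩ := key i le_rfl (Nat.le_add_right i j) h h'
  obtain ⟨u, hu⟩ := IsRep.exists_twist (x := x) hcent h'
    (Subgroup.isClosed_of_isOpen _ (isOpen_levelSubgroup i hen)) hb
    (fun z hz hz1 => hbθ _ (by rw [MonoidHom.mem_ker, hz.2.1, hz1])) hxN
    (fun c hc => hθfix c hc γ₀ hγi)
  set H : Mˣ := (∏ a ∈ Finset.range (ℓ ^ n), x ^ a • u) * (b (x ^ ℓ ^ n).1)⁻¹ with hH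
  obtain ⟨hHfix, -, hnorm⟩ := hb.obstruction_spec (IsRep.fiber_le hle le_rfl) hxN hn0 hxm hmin
    hgen hu hH
  have hHfix' : ∀ γ ∈ levelSubgroup K A k T e i, γ • H = H := fun γ hγ => by
    obtain ⟨g, hg⟩ := hπ (φ γ)
    exact hHfix (g, γ) ⟨hγ, hg, Subgroup.mem_top _⟩
  have hb1 : b 1 = 1 := hb.map_one
  obtain ⟨v, hv, hHv⟩ := hP.exists_prod_pow_smul_eq hℓ he hnj (fun d hd => hI _ hIj d hd) hHfix'
    (fun s d hd hs hsd w hw => by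
      obtain ⟨γ, hγ, hγA, hγw⟩ := hP.exists_frob e (i + j) s d he hs w hw hsd
      have hγi : γ ∈ levelSubgroup K A k T e i := hanti dvd_rfl (Nat.le_add_right i j) hγ
      obtain ⟨g, hg⟩ := hπ (φ γ)
      set y : G × (M ≃ₐ[k] M) := (g, γ) with hy
      have hyN : y ∈ h.fiber π ⊤ := ⟨hγi, hg, Subgroup.mem_top _⟩
      set N₀ := Nat.card G * ℓ ^ n with hN₀
      have hyN₀ : y ^ N₀ ∈ h'.fiber π ⊤ := by
        have h1 := pow_mem hyN N₀
        refine ⟨⟨h1.1.1, fun a ha => ?_⟩, h1.2⟩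
        refine (pow_apply_of_frobenius hγA N₀ a).trans ?_
        rw [show e * d * N₀ = e * ℓ ^ n * (d * Nat.card G) by rw [hN₀]; ring,
          pow_card_pow_mul_eq ha]
      obtain ⟨w₀, hw₀⟩ := hnorm y hyN d N₀ (hdiff y hyN d fun a _ => hγA a)
        (Dvd.intro_left _ rfl) hyN₀
      have h1 : (y ^ N₀).1 = 1 := by
        change g ^ N₀ = 1
        rw [hN₀, pow_mul, pow_card_eq_one', one_pow]
      have h2 : ∀ a : ℕ, w (y ^ a • w₀) = w w₀ := fun a => by
        induction a with
        | zero => rw [pow_zero, one_smul]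
        | succ a ih => rw [pow_succ', mul_smul]; exact (hγw _).trans ih
      have h3 := congrArg (fun z => (w z).toAdd) hw₀
      simp only [map_prod, h2, h1, hb1, one_mul, Finset.prod_const, Finset.card_range, map_pow,
        toAdd_pow, nsmul_eq_mul] at h3
      rw [hN₀, Nat.mul_div_cancel _ hn0] at h3
      have hG0 : (Nat.card G : ℤ) ≠ 0 := by exact_mod_cast Nat.card_pos.ne'
      refine ⟨(w w₀).toAdd, mul_left_cancel₀ hG0 ?_⟩
      push_cast at h3 ⊢
      linarith) (δ := γ₀) hγ₀.1 hγ₀A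
  have hr : IsRep (levelSubgroup K A k T e (i + j)) φ := h.mono (hanti dvd_rfl (by omega))
  have hle' : levelSubgroup K A k T (e * ℓ ^ n) (i + j) ≤ levelSubgroup K A k T (e * ℓ ^ n) i :=
    hanti dvd_rfl (by omega)
  have hr' : IsRep (levelSubgroup K A k T (e * ℓ ^ n) (i + j)) φ := h'.mono hle'
  obtain ⟨hxN, hxm, hmin, hdiff, hgen⟩ := key (i + j) (by omega) le_rfl hr hr'
  obtain ⟨-, hext, -⟩ := (hb.mono (IsRep.fiber_le (h' := hr') hle' le_rfl)).obstruction_spec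
    (IsRep.fiber_le (h := hr) (hanti (dvd_mul_right _ _) le_rfl) le_rfl) hxN hn0 hxm hmin
    hgen (fun z hz => hu z (IsRep.fiber_le hle' le_rfl hz)) hH
  obtain ⟨β, hβ, hβb⟩ := hext v (fun z hz => hv z.2 hz.1) hHv
  exact ⟨i + j, by omega, hr, β, hβ, fun z hz hz' => hβb z ⟨hz', hz.2⟩⟩

theorem _root_.Nat.dvd_card_pow_sub_one {ℓ q : ℕ} (hℓ : ℓ.Prime) (hq : ¬ ℓ ∣ q) (e : ℕ) :
    ℓ ∣ q ^ (e * (ℓ - 1)) - 1 := by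
  have h1 : (q ^ e) ^ (ℓ - 1) ≡ 1 [MOD ℓ] := by
    rw [← Nat.totient_prime hℓ]
    exact Nat.ModEq.pow_totient (((Nat.Prime.coprime_iff_not_dvd hℓ).2 hq).symm.pow_left e)
  rw [pow_mul]
  have h2 : 1 ≤ (q ^ e) ^ (ℓ - 1) := Nat.one_le_pow _ _ (Nat.pow_pos
    (Nat.pos_of_ne_zero fun h => hq (h ▸ dvd_zero ℓ)))
  exact (Nat.modEq_iff_dvd' h2).1 h1.symm

theorem centralStep (hP : PlaceTower K A k ℓ T W) (hℓ : ℓ.Prime) (hℓA : (ℓ : A) ≠ 0)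
    (hℓK : ¬ ℓ ∣ Nat.card K) : CentralStep.{u} ℓ (levelSubgroup K A k T) := by
  intro G Q _ _ _ hG π hπ hcent hcard e₀ i he₀ hle₀ φ hφ₀
  have : Fact ℓ.Prime := ⟨hℓ⟩
  have hℓ1 : 0 < ℓ - 1 := Nat.sub_pos_of_lt hℓ.one_lt
  have hℓℓ : ¬ ℓ ∣ ℓ - 1 := fun h => by
    have := Nat.le_of_dvd hℓ1 h
    omega
  have he₁ : 0 < e₀ * (ℓ - 1) := Nat.mul_pos he₀ hℓ1
  have hφ₁ : IsRep (levelSubgroup K A k T (e₀ * (ℓ - 1)) i) φ :=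
    hφ₀.mono (levelSubgroup_le_of_dvd (dvd_mul_right _ _) i)
  obtain ⟨θ, hθ, hθinj, hθA, hθsurj⟩ := exists_hom_rootsOfUnity A M hℓ hℓA π.ker hcard
  have hθfix : ∀ e i, e₀ * (ℓ - 1) ∣ e → ∀ b ∈ π.ker, ∀ γ ∈ levelSubgroup K A k T e i,
      γ • θ b = θ b := by
    intro e i hdvd b hb γ hγ
    obtain ⟨a, ha, hab⟩ := hθA b hb
    refine Units.ext ?_
    change γ (θ b : M) = θ b
    rw [hab, hγ.2]
    obtain ⟨f, rfl⟩ := hdvd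
    refine pow_card_pow_mul_eq ?_ f
    obtain ⟨r, hr⟩ := Nat.dvd_card_pow_sub_one hℓ hℓK e₀
    have h1 : Nat.card K ^ (e₀ * (ℓ - 1)) = ℓ * r + 1 := by
      have : 0 < Nat.card K ^ (e₀ * (ℓ - 1)) := pow_pos Nat.card_pos _
      omega
    rw [h1, pow_succ, pow_mul, ha, one_pow, one_mul]
  obtain ⟨m, hm, hex⟩ := exists_isCrossed_fiber_levelSubgroup he₁ (hP.trans i)
    (hP.alg i) hπ hcent hG hφ₁ hθ (hθfix _ i dvd_rfl)
  obtain ⟨n, m', hm', rfl⟩ := Nat.exists_eq_pow_mul_and_not_dvd hm.ne' ℓ hℓ.ne_one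
  rw [show e₀ * (ℓ - 1) * (ℓ ^ n * m') = e₀ * (ℓ - 1) * m' * ℓ ^ n by ring] at hex
  obtain ⟨hr, b, hb, hbθ⟩ := hex
  set e := e₀ * (ℓ - 1) * m' with he
  have hm0 : 0 < m' := Nat.pos_of_ne_zero fun h => hm' (h ▸ dvd_zero ℓ)
  have hepos : 0 < e := Nat.mul_pos he₁ hm0
  have hdvd : e₀ * (ℓ - 1) ∣ e := dvd_mul_right _ _
  have hℓe : ℓ ∣ Nat.card K ^ e - 1 := by
    have := Nat.dvd_card_pow_sub_one hℓ hℓK (e₀ * m')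
    rwa [show e₀ * m' * (ℓ - 1) = e by rw [he]; ring] at this
  obtain ⟨i', hii', hr', β, hβ, hββ⟩ := hP.exists_isCrossed_extension hℓ hepos hℓe hπ hcent
    (hφ₁.mono (levelSubgroup_le_of_dvd hdvd i)) (fun b hb γ hγ => hθfix e i hdvd b hb γ hγ)
    hr hb hbθ
  obtain ⟨ψ, hψ, hπψ⟩ := hP.exists_lift_of_isCrossed hℓ hepos hπ hr' hθ hθinj
    (fun b hb => by
      obtain ⟨a, ha, hab⟩ := hθA b hb
      exact Units.ext (by rw [Units.val_pow_eq_pow_val, hab, ← map_pow, ha, map_one]; rfl))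
    hθsurj (fun b hb γ hγ => hθfix e i' hdvd b hb γ hγ) (pow_pos hℓ.pos n) hβ
    (fun z hz hz2 hz1 => (hββ z hz hz2).trans (hbθ _ (by
      rw [MonoidHom.mem_ker]
      exact hz.2.1.trans hz1)))
  refine ⟨e, i', (dvd_mul_right _ _).trans hdvd, hepos, fun h => ?_, hii', ψ, hψ, hπψ⟩
  rcases (Nat.Prime.dvd_mul hℓ).1 h with h | h
  · exact ((Nat.Prime.dvd_mul hℓ).1 h).elim hle₀ hℓℓ
  · exact hm' h

end PlaceTower

end

namespace PowerSeries

open Polynomial in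
theorem exists_pow_eq {A : Type*} [Field A] {n : ℕ} (hn : (n : A) ≠ 0) {f : A⟦X⟧} {s : A}
    (hs : s ≠ 0) (hsf : s ^ n = constantCoeff f) : ∃ r : A⟦X⟧, r ^ n = f ∧ constantCoeff r = s := by
  have step : ∀ m (r : A⟦X⟧), constantCoeff r = s ∧ X ^ (m + 1) ∣ r ^ n - f →
      ∃ r' : A⟦X⟧, (constantCoeff r' = s ∧ X ^ (m + 1 + 1) ∣ r' ^ n - f) ∧
        X ^ (m + 1) ∣ r' - r := by
    rintro m r ⟨hr, g, hg⟩
    set c : A := -(constantCoeff g) / (n * s ^ (n - 1)) with hc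
    obtain ⟨z, hz⟩ := Polynomial.powAddExpansion r (X ^ (m + 1) * C c) n
    refine ⟨r + X ^ (m + 1) * C c, ⟨by simp [hr], ?_⟩, C c, by ring⟩
    have h1 : X ∣ g + (n : A⟦X⟧) * r ^ (n - 1) * C c := by
      rw [X_dvd_iff]
      have h0 : (n : A) * s ^ (n - 1) ≠ 0 := mul_ne_zero hn (pow_ne_zero _ hs)
      simp only [map_add, map_mul, map_natCast, map_pow, hr, constantCoeff_C]
      rw [hc, mul_div_cancel₀ _ h0, add_neg_cancel]
    obtain ⟨w, hw⟩ := h1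
    refine ⟨w + z * C c ^ 2 * X ^ m, ?_⟩
    rw [hz]
    linear_combination hg + X ^ (m + 1) * hw
  choose! nx hnx hnx' using step
  let F : ℕ → A⟦X⟧ := fun m => Nat.rec (C s) (fun m r => nx m r) m
  have hF : ∀ m, constantCoeff (F m) = s ∧ X ^ (m + 1) ∣ F m ^ n - f := by
    intro m
    induction m with
    | zero =>
      refine ⟨constantCoeff_C _, ?_⟩
      change X ^ 1 ∣ C s ^ n - f
      rw [pow_one, X_dvd_iff]
      simp [hsf]
    | succ m ih => exact hnx m _ ih
  have hF' : ∀ m, X ^ (m + 1) ∣ F (m + 1) - F m := fun m => hnx' m _ (hF m)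
  have hF'' : ∀ m j, X ^ (m + 1) ∣ F (m + j) - F m := by
    intro m j
    induction j with
    | zero => simp
    | succ j ih =>
      rw [← sub_add_sub_cancel _ (F (m + j))]
      exact dvd_add ((pow_dvd_pow _ (by omega)).trans (hF' (m + j))) ih
  let r : A⟦X⟧ := mk fun m => coeff m (F m)
  have hr : ∀ m, X ^ (m + 1) ∣ r - F m := by
    intro m
    rw [X_pow_dvd_iff]
    intro j hj
    obtain ⟨d, rfl⟩ := Nat.exists_eq_add_of_le (Nat.lt_succ_iff.1 hj)
    have := (X_pow_dvd_iff.1 (hF'' j d)) j (Nat.lt_succ_self j)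
    rw [map_sub, coeff_mk, ← neg_sub, ← map_sub, this, neg_zero]
  refine ⟨r, ?_, ?_⟩
  · rw [← sub_eq_zero]
    ext m
    refine X_pow_dvd_iff.1 (?_ : X ^ (m + 1) ∣ _) m (Nat.lt_succ_self m)
    rw [← sub_add_sub_cancel _ (F m ^ n)]
    exact dvd_add ((hr m).trans (sub_dvd_pow_sub_pow _ _ n)) (hF m).2
  · rw [← coeff_zero_eq_constantCoeff_apply, coeff_mk, coeff_zero_eq_constantCoeff_apply]
    exact (hF 0).1

variable {A : Type*} [Field A] {n : ℕ}

theorem exists_sub_mul_eq (hn : (n : A) ≠ 0) {r r' : A⟦X⟧}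
    (h0 : constantCoeff r ≠ 0) (h : constantCoeff r = constantCoeff r') :
    ∃ u : A⟦X⟧, IsUnit u ∧ (r - r') * u = r ^ n - r' ^ n := by
  refine ⟨_, ?_, mul_comm _ _ |>.trans ((Commute.all r r').geom_sum₂_mul n)⟩
  rw [isUnit_iff_constantCoeff, isUnit_iff_ne_zero, map_sum]
  simp only [map_mul, map_pow, ← h, ← pow_add]
  rw [Finset.sum_congr rfl fun i hi => by
    rw [show i + (n - 1 - i) = n - 1 by have := Finset.mem_range.1 hi; omega]]
  rw [Finset.sum_const, Finset.card_range, nsmul_eq_mul]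
  exact mul_ne_zero hn (pow_ne_zero _ h0)

theorem eq_of_pow_eq (hn : (n : A) ≠ 0) {r r' : A⟦X⟧}
    (h0 : constantCoeff r ≠ 0) (h : constantCoeff r = constantCoeff r') (hpow : r ^ n = r' ^ n) :
    r = r' := by
  obtain ⟨u, hu, h1⟩ := exists_sub_mul_eq hn h0 h
  rw [hpow, sub_self] at h1
  exact sub_eq_zero.1 ((mul_eq_zero.1 h1).resolve_right hu.ne_zero)

theorem exists_sub_C_eq (hn : (n : A) ≠ 0) {r : A⟦X⟧} {s : A} (hs : s ≠ 0)
    (hr : constantCoeff r = s) (hpow : r ^ n = C (s ^ n) + X) :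
    ∃ u : A⟦X⟧, IsUnit u ∧ r - C s = X * u := by
  obtain ⟨u, hu, h1⟩ := exists_sub_mul_eq hn (r := r) (r' := C s) (hr ▸ hs) (by simp [hr])
  obtain ⟨v, rfl⟩ := hu
  refine ⟨↑v⁻¹, Units.isUnit _, ?_⟩
  rw [Units.eq_mul_inv_iff_mul_eq, h1, hpow, map_pow]
  ring

open Polynomial in
theorem exists_aeval_eq_X_pow_mul {r : A⟦X⟧} {s : A} {v : A⟦X⟧} (hv : IsUnit v)
    (hr : r - C s = X * v) {R : A[X]} (hR : R ≠ 0) :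
    ∃ u : A⟦X⟧, IsUnit u ∧ Polynomial.aeval r R = X ^ R.rootMultiplicity s * u := by
  obtain ⟨Q, hQ, hQs⟩ := Polynomial.exists_eq_pow_rootMultiplicity_mul_and_not_dvd R hR s
  have hrs : constantCoeff r = s := by
    have := congrArg constantCoeff hr
    simpa [sub_eq_zero] using this
  refine ⟨v ^ R.rootMultiplicity s * Polynomial.aeval r Q, (hv.pow _).mul ?_, ?_⟩
  · rw [isUnit_iff_constantCoeff, isUnit_iff_ne_zero]
    intro h
    refine hQs (Polynomial.dvd_iff_isRoot.2 ?_)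
    rw [Polynomial.aeval_def, Polynomial.hom_eval₂, hrs] at h
    have h1 : (constantCoeff (R := A)).comp (algebraMap A A⟦X⟧) = RingHom.id A := by
      ext a
      simp
    rwa [h1] at h
  · conv_lhs => rw [hQ]
    rw [map_mul, map_pow, map_sub, Polynomial.aeval_X, Polynomial.aeval_C]
    change (r - C s) ^ _ * _ = _
    rw [hr, mul_pow, mul_assoc]

end PowerSeries

namespace LaurentSeries

open HahnSeries PowerSeries

variable {A : Type*} [Field A]

/-- The order of a Laurent series, as a homomorphism on the multiplicative group. -/
noncomputable def orderHom (A : Type*) [Field A] : (A⸨X⸩)ˣ →* Multiplicative ℤ where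
  toFun u := Multiplicative.ofAdd (HahnSeries.order (u : A⸨X⸩))
  map_one' := by rw [Units.val_one, HahnSeries.order_one, ofAdd_zero]
  map_mul' u v := by
    rw [Units.val_mul, HahnSeries.order_mul u.ne_zero v.ne_zero, ofAdd_add]

theorem order_ofPowerSeries_nonneg (f : A⟦X⟧) : 0 ≤ (ofPowerSeries ℤ A f).order := by
  by_cases hf : ofPowerSeries ℤ A f = 0
  · rw [hf, HahnSeries.order_zero]
  by_contra! h
  refine hf (HahnSeries.coeff_order_eq_zero.1 ?_)
  rw [ofPowerSeries_apply]
  refine embDomain_of_notMem_range ?_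
  rintro ⟨n, hn⟩
  have : (n : ℤ) = (ofPowerSeries ℤ A f).order := hn
  omega

theorem order_ofPowerSeries_of_isUnit {f : A⟦X⟧} (hf : IsUnit f) :
    (ofPowerSeries ℤ A f).order = 0 := by
  obtain ⟨u, rfl⟩ := hf
  have h1 := order_ofPowerSeries_nonneg (u : A⟦X⟧)
  have h2 := order_ofPowerSeries_nonneg (↑u⁻¹ : A⟦X⟧)
  have h3 := congrArg HahnSeries.order ((map_mul (ofPowerSeries ℤ A) (u : A⟦X⟧) ↑u⁻¹).symm)
  have hne : ∀ v : A⟦X⟧ˣ, ofPowerSeries ℤ A v ≠ 0 := fun v => by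
    rw [Ne, map_eq_zero_iff _ ofPowerSeries_injective]
    exact v.ne_zero
  rw [HahnSeries.order_mul (hne _) (hne _), Units.mul_inv, map_one, HahnSeries.order_one] at h3
  omega

theorem order_single_mul_ofPowerSeries (n : ℤ) {f : A⟦X⟧} (hf : IsUnit f) :
    (single n (1 : A) * ofPowerSeries ℤ A f).order = n := by
  rw [HahnSeries.order_mul (single_ne_zero one_ne_zero), order_single one_ne_zero,
    order_ofPowerSeries_of_isUnit hf, add_zero]
  rw [Ne, map_eq_zero_iff _ ofPowerSeries_injective]
  exact hf.ne_zero

theorem exists_eq_single_mul {z : A⸨X⸩} (hz : z ≠ 0) :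
    ∃ f : A⟦X⟧, IsUnit f ∧ z = single z.order (1 : A) * ofPowerSeries ℤ A f := by
  refine ⟨z.powerSeriesPart, ?_, (LaurentSeries.single_order_mul_powerSeriesPart z).symm⟩
  rw [isUnit_iff_constantCoeff, isUnit_iff_ne_zero, ← coeff_zero_eq_constantCoeff_apply,
    LaurentSeries.powerSeriesPart_coeff, Nat.cast_zero, add_zero]
  exact mt HahnSeries.coeff_order_eq_zero.1 hz

theorem exists_ofPowerSeries_eq {z : A⸨X⸩} (hz : 0 ≤ z.order) : ∃ f, ofPowerSeries ℤ A f = z := by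
  obtain ⟨n, hn⟩ := Int.eq_ofNat_of_zero_le hz
  refine ⟨X ^ n * z.powerSeriesPart, ?_⟩
  rw [LaurentSeries.X_order_mul_powerSeriesPart hn.symm]

theorem order_ofPowerSeries_X_pow_mul (n : ℕ) {f : A⟦X⟧} (hf : IsUnit f) :
    (ofPowerSeries ℤ A (X ^ n * f)).order = n := by
  rw [map_mul, ofPowerSeries_X_pow, order_single_mul_ofPowerSeries _ hf]

/-- A Laurent series of order divisible by `ℓ` is an `ℓ`-th power. -/
theorem exists_pow_eq_of_order_eq [IsAlgClosed A] {ℓ : ℕ} (hℓ : (ℓ : A) ≠ 0) {z : A⸨X⸩}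
    (hz : z ≠ 0) {m : ℤ} (hm : z.order = ℓ * m) : ∃ y, y ^ ℓ = z := by
  obtain ⟨f, hf, hzf⟩ := exists_eq_single_mul hz
  have hℓ0 : 0 < ℓ := Nat.pos_of_ne_zero fun h => hℓ (by rw [h, Nat.cast_zero])
  obtain ⟨s, hs⟩ := IsAlgClosed.exists_pow_nat_eq (constantCoeff f) hℓ0
  have hf0 : constantCoeff f ≠ 0 := (isUnit_iff_constantCoeff.1 hf).ne_zero
  have hs0 : s ≠ 0 := by
    rintro rfl
    exact hf0 (by rw [← hs, zero_pow hℓ0.ne'])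
  obtain ⟨r, hr, -⟩ := PowerSeries.exists_pow_eq hℓ hs0 hs
  refine ⟨single m 1 * ofPowerSeries ℤ A r, ?_⟩
  rw [mul_pow, ← map_pow (ofPowerSeries ℤ A), hr, HahnSeries.single_pow, one_pow, nsmul_eq_mul,
    ← hm, ← hzf]

/-- The endomorphism of the field of Laurent series induced by an endomorphism of the field of
coefficients. -/
noncomputable def mapHom (f : A →+* A) : A⸨X⸩ →+* A⸨X⸩ :=
  IsFractionRing.map (A := A⟦X⟧) (B := A⟦X⟧) (j := PowerSeries.map f)
    (PowerSeries.map_injective f f.injective)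

theorem mapHom_ofPowerSeries (f : A →+* A) (g : A⟦X⟧) :
    mapHom f (ofPowerSeries ℤ A g) = ofPowerSeries ℤ A (PowerSeries.map f g) :=
  IsLocalization.map_eq (S := A⸨X⸩) (M := nonZeroDivisors A⟦X⟧) (Q := A⸨X⸩)
    (nonZeroDivisors_le_comap_nonZeroDivisors_of_injective _
      (PowerSeries.map_injective f f.injective)) g

theorem mapHom_C (f : A →+* A) (a : A) : mapHom f (HahnSeries.C a) = HahnSeries.C (f a) := by
  rw [← ofPowerSeries_C, mapHom_ofPowerSeries, PowerSeries.map_C, ofPowerSeries_C]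

theorem mapHom_single (f : A →+* A) (n : ℤ) : mapHom f (single n 1) = single n 1 := by
  have h : mapHom f (single 1 1) = single 1 1 := by
    rw [← ofPowerSeries_X, mapHom_ofPowerSeries, PowerSeries.map_X]
  rw [RatFunc.single_zpow, map_zpow₀, h]

theorem order_mapHom (f : A →+* A) (z : A⸨X⸩) : (mapHom f z).order = z.order := by
  by_cases hz : z = 0
  · rw [hz, map_zero]
  obtain ⟨g, hg, hzg⟩ := exists_eq_single_mul hz
  conv_lhs => rw [hzg, map_mul, mapHom_single, mapHom_ofPowerSeries]
  exact order_single_mul_ofPowerSeries _ (hg.map _)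

/-- Constants algebraic over the base field are mapped to constants. -/
theorem exists_C_eq {K : Type*} [Field K] [Algebra K A] [IsAlgClosed A] (ι : A →+* A⸨X⸩)
    (hι : ∀ c : K, ι (algebraMap K A c) = HahnSeries.C (algebraMap K A c)) {a : A}
    (ha : IsIntegral K a) : ∃ b, ι a = HahnSeries.C b := by
  have h1 : (minpoly K a).eval₂ (HahnSeries.C.comp (algebraMap K A)) (ι a) = 0 := by
    rw [← (RingHom.ext hι : ι.comp (algebraMap K A) = HahnSeries.C.comp (algebraMap K A)),
      ← Polynomial.hom_eval₂,
      ← Polynomial.aeval_def, minpoly.aeval, map_zero]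
  have h2 : ((minpoly K a).map (algebraMap K A)).Splits := IsAlgClosed.splits _
  have h3 := h2.eq_prod_roots_of_monic ((minpoly.monic ha).map _)
  rw [← Polynomial.eval₂_map, h3, Polynomial.eval₂_multiset_prod, Multiset.map_map,
    Multiset.prod_eq_zero_iff, Multiset.mem_map] at h1
  obtain ⟨b, -, hb⟩ := h1
  refine ⟨b, sub_eq_zero.1 ?_⟩
  simpa using hb

end LaurentSeries

/-- Extension of an embedding along an algebraic extension in which the minimal polynomials over a
smaller field split. -/
theorem exists_ringHom_comp_eq {k B M N : Type*} [Field k] [Field B] [Field M] [Field N]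
    [Algebra k M] (g : k →+* B) (h : B →+* M) (ρ : B →+* N) (hg : h.comp g = algebraMap k M)
    (hs : ∀ x : M, IsIntegral k x ∧ ((minpoly k x).map (ρ.comp g)).Splits) :
    ∃ ι : M →+* N, ι.comp h = ρ := by
  let := h.toAlgebra
  let := ρ.toAlgebra
  have key : ∀ x : M, IsIntegral B x ∧ ((minpoly B x).map (algebraMap B N)).Splits := by
    intro x
    have h1 : Polynomial.aeval x ((minpoly k x).map g) = 0 := by
      rw [Polynomial.aeval_def, Polynomial.eval₂_map]
      exact (congrArg (fun f => Polynomial.eval₂ f x (minpoly k x)) hg).trans (minpoly.aeval k x)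
    have hm : ((minpoly k x).map g).Monic := (minpoly.monic (hs x).1).map g
    refine ⟨⟨_, hm, h1⟩, Polynomial.Splits.of_dvd ?_ ?_
      (Polynomial.map_dvd (algebraMap B N) (minpoly.dvd B x h1))⟩
    · rw [Polynomial.map_map]
      exact (hs x).2
    · exact ((hm.map _).ne_zero)
  obtain ⟨φ⟩ : Nonempty (M →ₐ[B] N) := IntermediateField.nonempty_algHom_of_splits key
  exact ⟨φ, φ.comp_algebraMap⟩

/-- An embedding over the base field with a prescribed value at an element. -/
theorem exists_ringHom_comp_eq_and_apply_eq {k M N : Type*} [Field k] [Field M] [Field N]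
    [Algebra k M] (ρ : k →+* N)
    (hs : ∀ x : M, IsIntegral k x ∧ ((minpoly k x).map ρ).Splits) {x : M} {z : N}
    (hz : (minpoly k x).eval₂ ρ z = 0) :
    ∃ ι : M →+* N, ι.comp (algebraMap k M) = ρ ∧ ι x = z := by
  let := ρ.toAlgebra
  obtain ⟨φ, hφ⟩ := IntermediateField.exists_algHom_of_splits_of_aeval (F := k) (E := M) (K := N)
    hs (x := x) (y := z) hz
  exact ⟨φ, φ.comp_algebraMap, hφ⟩

/-- Two embeddings of a normal extension differ by an automorphism. -/
theorem Normal.exists_algEquiv_of_comp_eq {k M N : Type*} [Field k] [Field M] [Field N]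
    [Algebra k M] [Normal k M] {ι ι' : M →+* N}
    (h : ι.comp (algebraMap k M) = ι'.comp (algebraMap k M)) :
    ∃ γ : M ≃ₐ[k] M, ∀ x, ι' x = ι (γ x) := by
  let := (ι.comp (algebraMap k M)).toAlgebra
  let := ι.toAlgebra
  have : IsScalarTower k M N := IsScalarTower.of_algebraMap_eq fun _ => rfl
  let f : M →ₐ[k] N := { ι' with commutes' := fun c => (RingHom.congr_fun h c).symm }
  refine ⟨Normal.algHomEquivAut k N M f, fun x => ?_⟩
  have h1 := (Normal.algHomEquivAut k N M).symm_apply_apply f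
  exact (DFunLike.congr_fun h1 x).symm

namespace LaurentSeries

open PowerSeries HahnSeries

variable {A : Type*} [Field A]

/-- Evaluation of polynomials at a power series, as a Laurent series. -/
noncomputable def evalHom (r : A⟦X⟧) : Polynomial A →+* A⸨X⸩ :=
  (ofPowerSeries ℤ A).comp (Polynomial.aeval r : Polynomial A →ₐ[A] A⟦X⟧)

theorem evalHom_X (r : A⟦X⟧) : evalHom r Polynomial.X = ofPowerSeries ℤ A r := by
  simp [evalHom]

theorem evalHom_C (r : A⟦X⟧) (a : A) : evalHom r (Polynomial.C a) = HahnSeries.C a := by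
  rw [evalHom, RingHom.comp_apply, RingHom.coe_coe, Polynomial.aeval_C]
  exact ofPowerSeries_C a

theorem order_evalHom {r : A⟦X⟧} {s : A} {v : A⟦X⟧} (hv : IsUnit v)
    (hr : r - PowerSeries.C s = X * v) {R : Polynomial A} (hR : R ≠ 0) :
    evalHom r R ≠ 0 ∧ (evalHom r R).order = R.rootMultiplicity s := by
  obtain ⟨u, hu, h⟩ := exists_aeval_eq_X_pow_mul hv hr hR
  have h1 : evalHom r R = ofPowerSeries ℤ A (X ^ R.rootMultiplicity s * u) :=
    congrArg (ofPowerSeries ℤ A) h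
  rw [h1]
  refine ⟨?_, order_ofPowerSeries_X_pow_mul _ hu⟩
  rw [Ne, map_eq_zero_iff _ ofPowerSeries_injective]
  exact mul_ne_zero (pow_ne_zero _ X_ne_zero) hu.ne_zero

theorem evalHom_injective {r : A⟦X⟧} {s : A} {v : A⟦X⟧} (hv : IsUnit v)
    (hr : r - PowerSeries.C s = X * v) : Function.Injective (evalHom r) := by
  rw [injective_iff_map_eq_zero]
  intro R hR
  by_contra h
  exact (order_evalHom hv hr h).1 hR

variable (K : Type*) [Field K] [Algebra K A]

theorem evalHom_comp_map_injective (t : A) : Function.Injective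
    ((evalHom (PowerSeries.C t + X)).comp (Polynomial.mapRingHom (algebraMap K A))) :=
  (evalHom_injective isUnit_one (s := t) (by ring)).comp
    (Polynomial.map_injective _ (algebraMap K A).injective)

/-- The completion of the rational function field at the point `t`. -/
noncomputable def shiftHom (t : A) : RatFunc K →+* A⸨X⸩ :=
  IsFractionRing.lift (evalHom_comp_map_injective K t)

theorem shiftHom_algebraMap (t : A) (P : Polynomial K) :
    shiftHom K t (algebraMap (Polynomial K) (RatFunc K) P) =
      evalHom (PowerSeries.C t + X) (P.map (algebraMap K A)) :=
  IsFractionRing.lift_algebraMap (evalHom_comp_map_injective K t) P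

theorem shiftHom_X (t : A) :
    shiftHom K t RatFunc.X = ofPowerSeries ℤ A (PowerSeries.C t + X) := by
  rw [← RatFunc.algebraMap_X, shiftHom_algebraMap, Polynomial.map_X, evalHom_X]

theorem shiftHom_C (t : A) (c : K) :
    shiftHom K t (algebraMap K (RatFunc K) c) = HahnSeries.C (algebraMap K A c) := by
  rw [RatFunc.algebraMap_eq_C, ← RatFunc.algebraMap_C, shiftHom_algebraMap, Polynomial.map_C,
    evalHom_C]

variable {K}

theorem _root_.RatFunc.ringHom_ext {N : Type*} [Field N] {f g : RatFunc K →+* N}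
    (hC : ∀ c, f (algebraMap K (RatFunc K) c) = g (algebraMap K (RatFunc K) c))
    (hX : f RatFunc.X = g RatFunc.X) : f = g := by
  refine IsLocalization.ringHom_ext (nonZeroDivisors (Polynomial K))
    (Polynomial.ringHom_ext (fun c => ?_) ?_)
  · simpa using hC c
  · simpa using hX

end LaurentSeries

section

open LaurentSeries Polynomial

/-- A tower of roots of the variable inside an extension of the rational function field which is
maximal with respect to being split at all points of order prime to `ℓ`. -/
structure SplitTower (K A : Type*) {M : Type*} [Field K] [Field A] [Algebra K A] [Field M]
    [Algebra (RatFunc K) M] (ℓ : ℕ) (T : ℕ → M) : Prop where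
  zero : T 0 = algebraMap (RatFunc K) M RatFunc.X
  pow : ∀ i, T (i + 1) ^ ℓ = T i
  splits : ∀ (x : M) (t : A), ¬ ℓ ∣ orderOf t →
    ((minpoly (RatFunc K) x).map (shiftHom K t)).Splits
  root : ∀ x : M, (∀ t : A, ¬ ℓ ∣ orderOf t →
    ((expand _ ℓ (minpoly (RatFunc K) x)).map (shiftHom K t)).Splits) → ∃ y, y ^ ℓ = x

namespace SplitTower

variable {K A M : Type*} [Field K] [Field A] [Algebra K A] [Field M] [Algebra (RatFunc K) M]
  [Algebra A M] [Algebra K M] [IsScalarTower K A M] [IsScalarTower K (RatFunc K) M] {ℓ : ℕ}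
  {T : ℕ → M}

omit [Algebra A M] [Algebra K M] [IsScalarTower K A M] [IsScalarTower K (RatFunc K) M] in
theorem pow_eq_algebraMap (hT : SplitTower K A ℓ T) (i : ℕ) :
    T i ^ ℓ ^ i = algebraMap (RatFunc K) M RatFunc.X := by
  induction i with
  | zero => rw [pow_zero, pow_one, hT.zero]
  | succ i ih => rw [pow_succ', pow_mul, hT.pow, ih]

theorem aeval_injective (hT : SplitTower K A ℓ T) [Algebra.IsAlgebraic K A] (i : ℕ) :
    Function.Injective (aeval (R := A) (T i)) := by
  rw [← transcendental_iff_injective]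
  intro h
  have h1 : IsAlgebraic K (T i) := h.restrictScalars K
  have h2 := h1.pow (ℓ ^ i)
  rw [hT.pow_eq_algebraMap, isAlgebraic_algebraMap_iff (algebraMap (RatFunc K) M).injective] at h2
  exact RatFunc.transcendental_X h2

variable (K A) in
/-- The inclusion of the polynomials in the variable into the polynomials in its root. -/
noncomputable def expandHom (n : ℕ) : K[X] →+* A[X] :=
  (expand A n : A[X] →+* A[X]).comp (mapRingHom (algebraMap K A))

theorem expandHom_apply (n : ℕ) (P : K[X]) :
    expandHom K A n P = expand A n (P.map (algebraMap K A)) := rfl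

theorem aeval_expandHom (hT : SplitTower K A ℓ T) (i : ℕ) (P : K[X]) :
    aeval (T i) (expandHom K A (ℓ ^ i) P) =
      algebraMap (RatFunc K) M (algebraMap K[X] (RatFunc K) P) := by
  rw [expandHom_apply, expand_aeval, hT.pow_eq_algebraMap, aeval_map_algebraMap,
    aeval_algebraMap_apply]
  congr 1
  rw [← RatFunc.algebraMap_X, aeval_algebraMap_apply, aeval_X_left_apply]

theorem expandHom_injective (hT : SplitTower K A ℓ T) (i : ℕ) :
    Function.Injective (expandHom K A (ℓ ^ i)) := by
  refine Function.Injective.of_comp (f := aeval (T i)) ?_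
  rw [show (aeval (T i) : A[X] → M) ∘ expandHom K A (ℓ ^ i) =
    algebraMap (RatFunc K) M ∘ algebraMap K[X] (RatFunc K) from funext (hT.aeval_expandHom i)]
  exact (algebraMap (RatFunc K) M).injective.comp (IsFractionRing.injective _ _)

theorem exists_eval₂_eq_zero (hT : SplitTower K A ℓ T) [Algebra.IsAlgebraic (RatFunc K) M] (i : ℕ)
    (z : M) : ∃ p : A[X][X], p ≠ 0 ∧ p.eval₂ (aeval (R := A) (T i) : A[X] →+* M) z = 0 := by
  let := ((algebraMap (RatFunc K) M).comp (algebraMap K[X] (RatFunc K))).toAlgebra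
  have : IsScalarTower K[X] (RatFunc K) M := IsScalarTower.of_algebraMap_eq fun _ => rfl
  obtain ⟨p, hp, hpz⟩ := (IsFractionRing.isAlgebraic_iff K[X] (RatFunc K) M (x := z)).2
    (Algebra.IsAlgebraic.isAlgebraic z)
  refine ⟨p.map (expandHom K A (ℓ ^ i)), (Polynomial.map_ne_zero_iff
    (hT.expandHom_injective i)).2 hp, ?_⟩
  rw [eval₂_map]
  convert hpz using 1
  rw [aeval_def]
  congr 1
  exact RingHom.ext (hT.aeval_expandHom i)

theorem exists_mul_aeval_eq (hT : SplitTower K A ℓ T) [Finite K] [Algebra.IsAlgebraic K A]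
    [IsGalois (RatFunc K) M] {e : ℕ} (i : ℕ) {z : M}
    (hz : ∀ γ ∈ levelSubgroup K A (RatFunc K) T e i, γ z = z) :
    ∃ P R : A[X], R ≠ 0 ∧ (∀ n, P.coeff n ^ Nat.card K ^ e = P.coeff n) ∧
      (∀ n, R.coeff n ^ Nat.card K ^ e = R.coeff n) ∧ z * aeval (T i) R = aeval (T i) P := by
  set F : A →+* A := ((frobEquiv K A ^ e : A ≃ₐ[K] A) : A →+* A) with hF
  have hFa : ∀ a, F a = a ^ Nat.card K ^ e := frobEquiv_pow_apply K e
  set B : Subring A[X] := (mapRingHom F).eqLocus (RingHom.id _) with hB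
  have hmemB : ∀ P, P ∈ B ↔ ∀ n, P.coeff n ^ Nat.card K ^ e = P.coeff n := by
    intro P
    rw [hB, RingHom.mem_eqLocus, Polynomial.ext_iff]
    simp [coeff_map, hFa]
  set E : IntermediateField (RatFunc K) M := IntermediateField.adjoin (RatFunc K)
    (insert (T i) (algebraMap A M '' {a | a ^ Nat.card K ^ e = a})) with hE
  have hzE : z ∈ E := by
    rw [← InfiniteGalois.fixedField_fixingSubgroup E]
    rintro ⟨γ, hγ⟩
    refine hz γ ⟨?_, fun a ha => ?_⟩
    · exact (IntermediateField.mem_fixingSubgroup_iff _ _).1 hγ _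
        (IntermediateField.subset_adjoin _ _ (Set.mem_insert _ _))
    · exact (IntermediateField.mem_fixingSubgroup_iff _ _).1 hγ _
        (IntermediateField.subset_adjoin _ _ (Set.mem_insert_of_mem _ ⟨a, ha, rfl⟩))
  have hne : ∀ R : A[X], R ≠ 0 → aeval (T i) R ≠ 0 := fun R hR h =>
    hR (hT.aeval_injective i (h.trans (map_zero _).symm))
  suffices h : ∃ P ∈ B, ∃ R ∈ B, R ≠ 0 ∧ z * aeval (T i) R = aeval (T i) P by
    obtain ⟨P, hP, R, hR, hR0, h⟩ := h
    exact ⟨P, R, hR0, (hmemB P).1 hP, (hmemB R).1 hR, h⟩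
  have hexp : ∀ P : K[X], expandHom K A (ℓ ^ i) P ∈ B := by
    intro P
    rw [hB, RingHom.mem_eqLocus, RingHom.id_apply, coe_mapRingHom, expandHom_apply, map_expand,
      Polynomial.map_map]
    congr 2
    exact RingHom.ext fun c => (frobEquiv K A ^ e).commutes c
  clear hz
  induction hzE using IntermediateField.adjoin_induction with
  | mem x hx =>
    rcases hx with rfl | ⟨a, ha, rfl⟩
    · exact ⟨X, (hmemB _).2 fun n => by rw [coeff_X]; split_ifs <;>
        simp [zero_pow (pow_ne_zero e Nat.card_pos.ne' : Nat.card K ^ e ≠ 0)], 1,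
        one_mem _, one_ne_zero, by simp⟩
    · refine ⟨C a, ?_, 1, one_mem _, one_ne_zero, by simp⟩
      rw [hB, RingHom.mem_eqLocus, RingHom.id_apply, coe_mapRingHom, map_C, hFa, ha]
  | algebraMap x =>
    refine ⟨_, hexp x.num, _, hexp x.denom, ?_, ?_⟩
    · exact (map_ne_zero_iff _ (hT.expandHom_injective i)).2 x.denom_ne_zero
    · rw [hT.aeval_expandHom, hT.aeval_expandHom, ← map_mul]
      congr 1
      exact ((div_eq_iff (RatFunc.algebraMap_ne_zero x.denom_ne_zero)).1
        (RatFunc.num_div_denom x)).symm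
  | add x y _ _ hx hy =>
    obtain ⟨P, hP, R, hR, hR0, h⟩ := hx
    obtain ⟨P', hP', R', hR', hR0', h'⟩ := hy
    refine ⟨P * R' + P' * R, add_mem (mul_mem hP hR') (mul_mem hP' hR), R * R', mul_mem hR hR',
      mul_ne_zero hR0 hR0', ?_⟩
    rw [map_mul, map_add, map_mul, map_mul]
    linear_combination aeval (T i) R' * h + aeval (T i) R * h'
  | mul x y _ _ hx hy =>
    obtain ⟨P, hP, R, hR, hR0, h⟩ := hx
    obtain ⟨P', hP', R', hR', hR0', h'⟩ := hy
    refine ⟨P * P', mul_mem hP hP', R * R', mul_mem hR hR', mul_ne_zero hR0 hR0', ?_⟩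
    rw [map_mul, map_mul, ← h, ← h']
    ring
  | inv x _ hx =>
    obtain ⟨P, hP, R, hR, hR0, h⟩ := hx
    by_cases hx0 : x = 0
    · exact ⟨0, zero_mem _, 1, one_mem _, one_ne_zero, by simp [hx0]⟩
    refine ⟨R, hR, P, hP, ?_, ?_⟩
    · rintro rfl
      rw [map_zero] at h
      exact mul_ne_zero hx0 (hne R hR0) h
    · rw [← h, inv_mul_cancel_left₀ hx0]

end SplitTower

end

section

open LaurentSeries Polynomial

attribute [local instance] Units.mulDistribMulActionRight

/-- An embedding into Laurent series which is centred at `s` in the coordinate `T i` and is the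
identity on the constants of degree dividing `e`. -/
structure IsPlace (K : Type*) {A M : Type*} [Field K] [Field A] [Field M] [Algebra A M]
    (ℓ : ℕ) (T : ℕ → M) (e i : ℕ) (s : A) (ι : M →+* A⸨X⸩) : Prop where
  exists_series : ∃ r : PowerSeries A, PowerSeries.constantCoeff r = s ∧
    r ^ ℓ ^ i = PowerSeries.C (s ^ ℓ ^ i) + PowerSeries.X ∧ ι (T i) = HahnSeries.ofPowerSeries ℤ A r
  map_const : ∀ a : A, a ^ Nat.card K ^ e = a → ι (algebraMap A M a) = HahnSeries.C a

/-- The valuations attached to the embeddings into Laurent series centred at `s`. -/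
def placeValuations (K : Type*) {A M : Type*} [Field K] [Field A] [Field M] [Algebra A M]
    (ℓ : ℕ) (T : ℕ → M) (e i : ℕ) (s : A) : Set (Mˣ →* Multiplicative ℤ) :=
  {w | ∃ ι : M →+* A⸨X⸩, IsPlace K ℓ T e i s ι ∧
    ∀ x, w x = orderHom A (Units.map (ι : M →* A⸨X⸩) x)}

theorem algebraMap_pow_card_pow (K : Type*) {A : Type*} [Field K] [Finite K] [Field A] [Algebra K A]
    [Algebra.IsAlgebraic K A] (e : ℕ) (c : K) :
    algebraMap K A c ^ Nat.card K ^ e = algebraMap K A c :=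
  (frobEquiv_pow_apply K e (algebraMap K A c)).symm.trans ((frobEquiv K A ^ e).commutes c)

theorem IsBad.ne_zero {A : Type*} [Field A] {ℓ i : ℕ} (hℓ : ℓ ≠ 0) {s : A} (h : IsBad ℓ i s) :
    s ≠ 0 := by
  rintro rfl
  refine h ?_
  rw [zero_pow (pow_ne_zero _ hℓ), orderOf_eq_zero_iff'.2 ?_]
  · exact dvd_zero _
  · intro n hn
    rw [zero_pow hn.ne']
    exact zero_ne_one

namespace SplitTower

variable {K A M : Type*} [Field K] [Field A] [Algebra K A] [Field M] [Algebra (RatFunc K) M]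
  [Algebra A M] [Algebra K M] [IsScalarTower K A M] [IsScalarTower K (RatFunc K) M] {ℓ : ℕ}
  {T : ℕ → M} [Finite K] [Algebra.IsAlgebraic K A]

theorem comp_algebraMap (hT : SplitTower K A ℓ T) {e i : ℕ} {s : A} {ι : M →+* A⸨X⸩}
    (hι : IsPlace K ℓ T e i s ι) :
    ι.comp (algebraMap (RatFunc K) M) = shiftHom K (s ^ ℓ ^ i) := by
  refine RatFunc.ringHom_ext (fun c => ?_) ?_
  · rw [RingHom.comp_apply, ← IsScalarTower.algebraMap_apply, IsScalarTower.algebraMap_apply K A M,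
      hι.map_const _ (algebraMap_pow_card_pow K e c), shiftHom_C]
  · obtain ⟨r, -, hr, h⟩ := hι.exists_series
    rw [RingHom.comp_apply, ← hT.pow_eq_algebraMap i, map_pow, h, ← map_pow, hr, shiftHom_X]

omit [Finite K] in
theorem exists_isPlace_aeval (hT : SplitTower K A ℓ T) [Algebra.IsAlgebraic (RatFunc K) M]
    (hℓ : (ℓ : A) ≠ 0) (i : ℕ) {s : A} (hs : IsBad ℓ i s) :
    ∃ (ι : M →+* A⸨X⸩) (r : PowerSeries A), PowerSeries.constantCoeff r = s ∧
      r ^ ℓ ^ i = PowerSeries.C (s ^ ℓ ^ i) + PowerSeries.X ∧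
      ∀ P : A[X], ι (aeval (T i) P) = evalHom r P := by
  have hℓ0 : ℓ ≠ 0 := fun h => hℓ (by rw [h, Nat.cast_zero])
  have hs0 := hs.ne_zero hℓ0
  have hℓi : ((ℓ ^ i : ℕ) : A) ≠ 0 := by rw [Nat.cast_pow]; exact pow_ne_zero _ hℓ
  obtain ⟨r, hr, hrs⟩ := PowerSeries.exists_pow_eq hℓi hs0
    (f := PowerSeries.C (s ^ ℓ ^ i) + PowerSeries.X) (by simp)
  obtain ⟨u, hu, hru⟩ := PowerSeries.exists_sub_C_eq hℓi hs0 hrs hr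
  have hinj := evalHom_injective hu hru
  let ρ : RatFunc A →+* A⸨X⸩ := IsFractionRing.lift hinj
  let h : RatFunc A →+* M := IsFractionRing.lift
    (g := (aeval (R := A) (T i) : A[X] →+* M)) (hT.aeval_injective i)
  let g : RatFunc K →+* RatFunc A := IsFractionRing.lift
    (g := (algebraMap A[X] (RatFunc A)).comp (expandHom K A (ℓ ^ i)))
    ((IsFractionRing.injective A[X] (RatFunc A)).comp (hT.expandHom_injective i))
  have hρ : ∀ P : A[X], ρ (algebraMap A[X] (RatFunc A) P) = evalHom r P :=
    IsFractionRing.lift_algebraMap _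
  have hh : ∀ P : A[X], h (algebraMap A[X] (RatFunc A) P) = aeval (T i) P :=
    IsFractionRing.lift_algebraMap _
  have hg : ∀ P : K[X], g (algebraMap K[X] (RatFunc K) P) =
      algebraMap A[X] (RatFunc A) (expandHom K A (ℓ ^ i) P) :=
    IsFractionRing.lift_algebraMap _
  have h1 : h.comp g = algebraMap (RatFunc K) M := by
    refine IsLocalization.ringHom_ext (nonZeroDivisors K[X]) (RingHom.ext fun P => ?_)
    rw [RingHom.comp_apply, RingHom.comp_apply, hg, hh, hT.aeval_expandHom, RingHom.comp_apply]
  have h2 : ρ.comp g = shiftHom K (s ^ ℓ ^ i) := by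
    refine RatFunc.ringHom_ext (fun c => ?_) ?_
    · rw [shiftHom_C, RatFunc.algebraMap_eq_C, ← RatFunc.algebraMap_C, RingHom.comp_apply, hg, hρ,
        expandHom_apply, Polynomial.map_C, expand_C, evalHom_C]
    · rw [shiftHom_X, ← RatFunc.algebraMap_X, RingHom.comp_apply, hg, hρ, expandHom_apply,
        Polynomial.map_X, expand_X, map_pow, evalHom_X, ← map_pow, hr]
  obtain ⟨ι, hι⟩ := exists_ringHom_comp_eq g h ρ h1 fun x =>
    ⟨(Algebra.IsAlgebraic.isAlgebraic x).isIntegral, h2 ▸ hT.splits x _ hs⟩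
  refine ⟨ι, r, hrs, hr, fun P => ?_⟩
  rw [← hh, ← RingHom.comp_apply, hι, hρ]

omit [Finite K] in
theorem exists_isPlace (hT : SplitTower K A ℓ T) [Algebra.IsAlgebraic (RatFunc K) M]
    (hℓ : (ℓ : A) ≠ 0) (e i : ℕ) {s : A} (hs : IsBad ℓ i s) :
    ∃ ι : M →+* A⸨X⸩, IsPlace K ℓ T e i s ι := by
  obtain ⟨ι, r, hr, hrs, h⟩ := hT.exists_isPlace_aeval hℓ i hs
  refine ⟨ι, ⟨r, hr, hrs, ?_⟩, fun a _ => ?_⟩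
  · simpa [evalHom_X] using h X
  · simpa [evalHom_C] using h (C a)

omit [Algebra K A] [Algebra.IsAlgebraic K A] [Algebra (RatFunc K) M] [Algebra K M]
  [IsScalarTower K A M] [IsScalarTower K (RatFunc K) M] [Finite K] in
theorem _root_.IsPlace.apply_eq (hℓ : (ℓ : A) ≠ 0) {e e' i : ℕ} {s : A} (hs : IsBad ℓ i s)
    {ι ι' : M →+* A⸨X⸩} (hι : IsPlace K ℓ T e i s ι) (hι' : IsPlace K ℓ T e' i s ι') :
    ι (T i) = ι' (T i) := by
  have hℓ0 : ℓ ≠ 0 := fun h => hℓ (by rw [h, Nat.cast_zero])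
  obtain ⟨r, hr, hrs, h⟩ := hι.exists_series
  obtain ⟨r', hr', hrs', h'⟩ := hι'.exists_series
  rw [h, h', PowerSeries.eq_of_pow_eq (n := ℓ ^ i) _ _ (hr.trans hr'.symm) (hrs.trans hrs'.symm)]
  · rw [Nat.cast_pow]; exact pow_ne_zero _ hℓ
  · rw [hr]; exact hs.ne_zero hℓ0

theorem exists_mem_levelSubgroup (hT : SplitTower K A ℓ T) [Normal (RatFunc K) M]
    (hℓ : (ℓ : A) ≠ 0) {e i : ℕ} {s : A} (hs : IsBad ℓ i s)
    {ι ι' : M →+* A⸨X⸩} (hι : IsPlace K ℓ T e i s ι) (hι' : IsPlace K ℓ T e i s ι') :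
    ∃ γ ∈ levelSubgroup K A (RatFunc K) T e i, ∀ x, ι' x = ι (γ x) := by
  obtain ⟨γ, hγ⟩ := Normal.exists_algEquiv_of_comp_eq
    ((hT.comp_algebraMap hι).trans (hT.comp_algebraMap hι').symm)
  refine ⟨γ, ⟨ι.injective ?_, fun a ha => ι.injective ?_⟩, hγ⟩
  · rw [← hγ, hι.apply_eq hℓ hs hι']
  · rw [← hγ, hι.map_const a ha, hι'.map_const a ha]

omit [Algebra (RatFunc K) M] [Algebra K M] [IsScalarTower K A M] [IsScalarTower K (RatFunc K) M] in
theorem _root_.IsPlace.mapHom_comp {e i n : ℕ} {s : A} {ι : M →+* A⸨X⸩}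
    (hι : IsPlace K ℓ T e i s ι) :
    IsPlace K ℓ T e i (s ^ Nat.card K ^ (e * n))
      ((mapHom ((frobEquiv K A ^ (e * n) : A ≃ₐ[K] A) : A →+* A)).comp ι) := by
  set F : A →+* A := ((frobEquiv K A ^ (e * n) : A ≃ₐ[K] A) : A →+* A)
  have hF : ∀ a, F a = a ^ Nat.card K ^ (e * n) := frobEquiv_pow_apply K (e * n)
  obtain ⟨r, hr, hrs, h⟩ := hι.exists_series
  refine ⟨⟨PowerSeries.map F r, ?_, ?_, ?_⟩, fun a ha => ?_⟩
  · rw [← hF, ← hr, ← PowerSeries.coeff_zero_eq_constantCoeff_apply, PowerSeries.coeff_map,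
      PowerSeries.coeff_zero_eq_constantCoeff_apply]
  · rw [← map_pow, hrs, map_add, PowerSeries.map_C, PowerSeries.map_X, map_pow, hF]
  · rw [RingHom.comp_apply, h, mapHom_ofPowerSeries]
  · rw [RingHom.comp_apply, hι.map_const a ha, mapHom_C, hF, pow_card_pow_mul_eq ha]

end SplitTower

end

section

open LaurentSeries Polynomial

attribute [local instance] Units.mulDistribMulActionRight

namespace SplitTower

variable {K A M : Type*} [Field K] [Field A] [Algebra K A] [Field M] [Algebra (RatFunc K) M]
  [Algebra A M] [Algebra K M] [IsScalarTower K A M] [IsScalarTower K (RatFunc K) M] {ℓ : ℕ}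
  {T : ℕ → M} [Finite K] [Algebra.IsAlgebraic K A]

theorem exists_frob [IsAlgClosed A] (hT : SplitTower K A ℓ T) [Normal (RatFunc K) M]
    (hℓ : (ℓ : A) ≠ 0) {e i d : ℕ} {s : A} (hs : IsBad ℓ i s) {ι : M →+* A⸨X⸩}
    (hι : IsPlace K ℓ T e i s ι) (hd : s ^ Nat.card K ^ (e * d) = s) :
    ∃ γ ∈ levelSubgroup K A (RatFunc K) T e i,
      (∀ a : A, γ (algebraMap A M a) = algebraMap A M (a ^ Nat.card K ^ (e * d))) ∧
      ∀ x, (ι (γ x)).order = (ι x).order := by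
  have h1 := hι.mapHom_comp (n := d)
  rw [hd] at h1
  obtain ⟨γ, hγ, h⟩ := hT.exists_mem_levelSubgroup hℓ hs hι h1
  refine ⟨γ, hγ, fun a => ι.injective ?_, fun x => ?_⟩
  · obtain ⟨b, hb⟩ := exists_C_eq (K := K) (ι.comp (algebraMap A M)) (fun c => by
      rw [RingHom.comp_apply, hι.map_const _ (algebraMap_pow_card_pow K e c)])
      (Algebra.IsAlgebraic.isAlgebraic a).isIntegral
    rw [RingHom.comp_apply] at hb
    rw [← h, RingHom.comp_apply, map_pow, map_pow, hb, mapHom_C, ← map_pow]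
    congr 1
    exact frobEquiv_pow_apply K (e * d) b
  · rw [← h, RingHom.comp_apply, order_mapHom]

omit [Algebra K A] [Algebra.IsAlgebraic K A] [Algebra (RatFunc K) M] [Algebra K M]
  [IsScalarTower K A M] [IsScalarTower K (RatFunc K) M] [Finite K] in
theorem _root_.IsPlace.order_aeval (hℓ : (ℓ : A) ≠ 0) {e i : ℕ} {s : A} (hs : IsBad ℓ i s)
    {ι : M →+* A⸨X⸩} (hι : IsPlace K ℓ T e i s ι) {R : A[X]} (hR : R ≠ 0)
    (hRe : ∀ n, R.coeff n ^ Nat.card K ^ e = R.coeff n) :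
    (ι (aeval (T i) R)).order = R.rootMultiplicity s := by
  have hℓ0 : ℓ ≠ 0 := fun h => hℓ (by rw [h, Nat.cast_zero])
  have hℓi : ((ℓ ^ i : ℕ) : A) ≠ 0 := by rw [Nat.cast_pow]; exact pow_ne_zero _ hℓ
  obtain ⟨r, hr, hrs, h⟩ := hι.exists_series
  obtain ⟨u, hu, hru⟩ := PowerSeries.exists_sub_C_eq hℓi (hs.ne_zero hℓ0) hr hrs
  rw [← (order_evalHom hu hru hR).2]
  congr 1
  rw [aeval_eq_sum_range, map_sum]
  conv_rhs => rw [R.as_sum_range_C_mul_X_pow, map_sum]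
  refine Finset.sum_congr rfl fun n _ => ?_
  rw [Algebra.smul_def, map_mul, map_mul, map_pow, map_pow, h, evalHom_X, evalHom_C,
    hι.map_const _ (hRe n)]

theorem exists_finite_order_nonneg (hT : SplitTower K A ℓ T) [Algebra.IsAlgebraic (RatFunc K) M]
    (hℓ : (ℓ : A) ≠ 0) (i : ℕ) (z : M) : ∃ S : Set A, S.Finite ∧ ∀ s ∉ S,
      ∀ (e : ℕ) (ι : M →+* A⸨X⸩), IsPlace K ℓ T e i s ι → 0 ≤ (ι z).order := by
  have hℓ0 : ℓ ≠ 0 := fun h => hℓ (by rw [h, Nat.cast_zero])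
  let := ((algebraMap (RatFunc K) M).comp (algebraMap K[X] (RatFunc K))).toAlgebra
  have : IsScalarTower K[X] (RatFunc K) M := IsScalarTower.of_algebraMap_eq fun _ => rfl
  obtain ⟨p, hp, hpz⟩ := (IsFractionRing.isAlgebraic_iff K[X] (RatFunc K) M (x := z)).2
    (Algebra.IsAlgebraic.isAlgebraic z)
  set c := p.leadingCoeff with hc
  have hc0 : expandHom K A (ℓ ^ i) c ≠ 0 :=
    (map_ne_zero_iff _ (hT.expandHom_injective i)).2 (leadingCoeff_ne_zero.2 hp)
  refine ⟨{s | (expandHom K A (ℓ ^ i) c).IsRoot s}, finite_setOfPred_isRoot hc0,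
    fun s hs e ι hι => ?_⟩
  set t := s ^ ℓ ^ i with ht
  let f : K[X] →+* PowerSeries A := (aeval (R := A) (PowerSeries.C t + PowerSeries.X) :
    A[X] →+* PowerSeries A).comp (mapRingHom (algebraMap K A))
  have hf : ∀ P : K[X], ι (algebraMap K[X] M P) = HahnSeries.ofPowerSeries ℤ A (f P) := by
    intro P
    exact (RingHom.congr_fun (hT.comp_algebraMap hι) (algebraMap K[X] (RatFunc K) P)).trans
      (shiftHom_algebraMap K t P)
  have hxint : IsIntegral (PowerSeries A) (ι (c • z)) := by
    refine IsIntegral.map_of_comp_eq f ι (RingHom.ext fun P => (hf P).symm)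
      (isIntegral_leadingCoeff_smul p z hpz)
  obtain ⟨g, hg⟩ := IsIntegrallyClosed.isIntegral_iff.1 hxint
  have hu : IsUnit (f c) := by
    rw [PowerSeries.isUnit_iff_constantCoeff, isUnit_iff_ne_zero]
    intro h0
    refine hs ?_
    rw [Set.mem_ofPred_eq, IsRoot, expandHom_apply, expand_eval, ← ht, ← h0]
    change _ = PowerSeries.constantCoeff (aeval (PowerSeries.C t + PowerSeries.X) (c.map _))
    rw [aeval_def, hom_eval₂]
    simp [eval_map, eval₂_map]
  rw [Algebra.smul_def, map_mul, hf] at hg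
  by_cases hz : ι z = 0
  · rw [hz, HahnSeries.order_zero]
  have h1 := order_ofPowerSeries_nonneg g
  change (algebraMap (PowerSeries A) A⸨X⸩ g).order ≥ 0 at h1
  rw [hg, HahnSeries.order_mul _ hz, order_ofPowerSeries_of_isUnit hu, zero_add] at h1
  · exact h1
  · rw [Ne, map_eq_zero_iff _ HahnSeries.ofPowerSeries_injective]
    exact hu.ne_zero

theorem exists_eq_mul_order [IsAlgClosed A] (hT : SplitTower K A ℓ T) [IsGalois (RatFunc K) M]
    (hℓ : (ℓ : A) ≠ 0) {e i : ℕ} (he : 0 < e) {x : M}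
    (hx : ∀ s, IsBad ℓ i s → ∀ ι : M →+* A⸨X⸩, IsPlace K ℓ T e i s ι →
      (ℓ : ℤ) ∣ (ι x).order) {t : A} (ht : ¬ ℓ ∣ orderOf t) {ι : M →+* A⸨X⸩}
    (hι : ι.comp (algebraMap (RatFunc K) M) = shiftHom K t) : (ℓ : ℤ) ∣ (ι x).order := by
  have hℓ0 : ℓ ≠ 0 := fun h => hℓ (by rw [h, Nat.cast_zero])
  have hTi : ι (T i) ^ ℓ ^ i =
      HahnSeries.ofPowerSeries ℤ A (PowerSeries.C t + PowerSeries.X) := by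
    rw [← map_pow, hT.pow_eq_algebraMap, ← RingHom.comp_apply, hι, shiftHom_X]
  obtain ⟨r, hr⟩ : ∃ r, HahnSeries.ofPowerSeries ℤ A r = ι (T i) := by
    refine exists_ofPowerSeries_eq ?_
    have h1 := order_ofPowerSeries_nonneg (PowerSeries.C t + PowerSeries.X)
    rw [← hTi, HahnSeries.order_pow, nsmul_eq_mul] at h1
    exact nonneg_of_mul_nonneg_right h1 (by positivity)
  rw [← hr, ← map_pow, HahnSeries.ofPowerSeries_injective.eq_iff] at hTi
  have hs' : PowerSeries.constantCoeff r ^ ℓ ^ i = t := by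
    rw [← map_pow, hTi]; simp
  obtain ⟨ι₀, hι₀⟩ := hT.exists_isPlace hℓ e i (s := PowerSeries.constantCoeff r)
    (by rw [IsBad, hs']; exact ht)
  obtain ⟨γ, hγ⟩ := Normal.exists_algEquiv_of_comp_eq
    (((hT.comp_algebraMap hι₀).trans (by rw [hs'])).trans hι.symm)
  obtain ⟨n, hn⟩ := exists_forall_apply_eq_pow_card_pow K A he
    ((γ : M →ₐ[RatFunc K] M).restrictScalars K)
  set F : A →+* A := ((frobEquiv K A ^ (n * (e - 1)) : A ≃ₐ[K] A) : A →+* A)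
  have hF : ∀ a, F a = a ^ Nat.card K ^ (n * (e - 1)) := frobEquiv_pow_apply K _
  have hplace : IsPlace K ℓ T e i (F (PowerSeries.constantCoeff r)) ((mapHom F).comp ι) := by
    refine ⟨⟨PowerSeries.map F r, ?_, ?_, ?_⟩, fun a ha => ?_⟩
    · rw [← PowerSeries.coeff_zero_eq_constantCoeff_apply, PowerSeries.coeff_map,
        PowerSeries.coeff_zero_eq_constantCoeff_apply]
    · rw [← map_pow, hTi, map_add, PowerSeries.map_C, PowerSeries.map_X, ← hs', map_pow]
    · rw [RingHom.comp_apply, ← hr, mapHom_ofPowerSeries]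
    · have h1 : γ (algebraMap A M a) = algebraMap A M (a ^ Nat.card K ^ n) := hn a ha
      have h2 : (a ^ Nat.card K ^ n) ^ Nat.card K ^ e = a ^ Nat.card K ^ n := by
        rw [← pow_mul, mul_comm, pow_mul, ha]
      have h4 : n + n * (e - 1) = e * n := by
        rw [add_comm, ← Nat.mul_succ, Nat.succ_eq_add_one, Nat.sub_add_cancel he, mul_comm]
      rw [RingHom.comp_apply, hγ, h1, hι₀.map_const _ h2, mapHom_C, hF, ← pow_card_pow_add, h4,
        pow_card_pow_mul_eq ha]
  have hbad : IsBad ℓ i (F (PowerSeries.constantCoeff r)) := by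
    rw [IsBad, ← map_pow, hs', hF]
    exact fun h => ht (h.trans (orderOf_pow_dvd _))
  have h3 := hx _ hbad _ hplace
  rwa [RingHom.comp_apply, order_mapHom] at h3

theorem exists_pow_eq [IsAlgClosed A] (hT : SplitTower K A ℓ T) [IsGalois (RatFunc K) M]
    (hℓ : (ℓ : A) ≠ 0) {e i : ℕ} (he : 0 < e) {x : M} (hx0 : x ≠ 0)
    (hx : ∀ s, IsBad ℓ i s → ∀ ι : M →+* A⸨X⸩, IsPlace K ℓ T e i s ι →
      (ℓ : ℤ) ∣ (ι x).order) : ∃ y, y ^ ℓ = x := by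
  have : NeZero (ℓ : A) := ⟨hℓ⟩
  obtain ⟨ζ, hζ⟩ := HasEnoughRootsOfUnity.exists_primitiveRoot A ℓ
  have hζ' : IsPrimitiveRoot (HahnSeries.C ζ : A⸨X⸩) ℓ := hζ.map_of_injective HahnSeries.C_injective
  have hxint : ∀ x : M, IsIntegral (RatFunc K) x := fun x =>
    (Algebra.IsAlgebraic.isAlgebraic x).isIntegral
  refine hT.root x fun t ht => ?_
  have hm : ((minpoly (RatFunc K) x).map (shiftHom K t)).Monic := (minpoly.monic (hxint x)).map _
  rw [map_expand, (hT.splits x t ht).eq_prod_roots_of_monic hm, ← Multiset.prod_hom,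
    Multiset.map_map]
  refine Splits.multisetProd fun P hP => ?_
  obtain ⟨z, hz, rfl⟩ := Multiset.mem_map.1 hP
  obtain ⟨ι, hι, rfl⟩ := exists_ringHom_comp_eq_and_apply_eq (shiftHom K t)
    (fun x => ⟨hxint x, hT.splits x t ht⟩) (x := x) (z := z)
    (by rw [← eval_map]; exact isRoot_of_mem_roots hz)
  obtain ⟨m, hm⟩ := hT.exists_eq_mul_order hℓ he hx ht hι
  obtain ⟨y, hy⟩ := exists_pow_eq_of_order_eq hℓ ((map_ne_zero ι).2 hx0) hm
  rw [Function.comp_apply, map_sub, expand_X, expand_C]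
  exact X_pow_sub_C_splits_of_isPrimitiveRoot hζ' hy

theorem placeTower [IsAlgClosed A] (hT : SplitTower K A ℓ T) [IsGalois (RatFunc K) M]
    (hℓ : (ℓ : A) ≠ 0) : PlaceTower K A (RatFunc K) ℓ T (placeValuations K ℓ T) where
  pow := hT.pow
  trans := hT.aeval_injective
  alg := hT.exists_eval₂_eq_zero
  ratio e i _ z hz := hT.exists_mul_aeval_eq i hz
  nonempty e i s _ hs := by
    obtain ⟨ι, hι⟩ := hT.exists_isPlace hℓ e i hs
    exact ⟨(orderHom A).comp (Units.map (ι : M →* A⸨X⸩)), ι, hι, fun _ => rfl⟩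
  exists_eq_comp e i s _ hs := by
    rintro w ⟨ι, hι, hw⟩ w' ⟨ι', hι', hw'⟩
    obtain ⟨γ, hγ, h⟩ := hT.exists_mem_levelSubgroup hℓ hs hι hι'
    refine ⟨γ, hγ, fun x => ?_⟩
    rw [hw, hw']
    congr 1
    exact Units.ext (h x)
  frob_mem e i s _ hs := by
    rintro w ⟨ι, hι, hw⟩
    have h := hι.mapHom_comp (n := 1)
    rw [mul_one] at h
    refine ⟨_, h, fun x => ?_⟩
    rw [hw]
    exact congrArg Multiplicative.ofAdd (order_mapHom _ _).symm
  exists_frob e i s d _ hs := by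
    rintro w ⟨ι, hι, hw⟩ hd
    obtain ⟨γ, hγ, h1, h2⟩ := hT.exists_frob hℓ hs hι hd
    refine ⟨γ, hγ, h1, fun x => ?_⟩
    rw [hw, hw]
    exact congrArg Multiplicative.ofAdd (h2 x)
  poly e i s _ hs := by
    rintro w ⟨ι, hι, hw⟩ R hR hRe u hu
    rw [hw, ← hι.order_aeval hℓ hs hR hRe, ← hu]
    rfl
  finite_support e i x _ := by
    obtain ⟨S, hS, h⟩ := hT.exists_finite_order_nonneg hℓ i (x : M)
    obtain ⟨S', hS', h'⟩ := hT.exists_finite_order_nonneg hℓ i (↑x⁻¹ : M)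
    refine ⟨S ∪ S', hS.union hS', ?_⟩
    rintro s hs hbad w ⟨ι, hι, hw⟩
    rw [Set.mem_union, not_or] at hs
    have h1 : 0 ≤ (w x).toAdd := by rw [hw]; exact h s hs.1 e ι hι
    have h2 : 0 ≤ (w x⁻¹).toAdd := by rw [hw]; exact h' s hs.2 e ι hι
    rw [map_inv, toAdd_inv] at h2
    exact Multiplicative.toAdd.injective (by rw [toAdd_one]; omega)
  root e i x he hx := by
    obtain ⟨y, hy⟩ := hT.exists_pow_eq hℓ he x.ne_zero fun s hs ι hι => by
      obtain ⟨z, hz⟩ := hx s hs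
        ((orderHom A).comp (Units.map (ι : M →* A⸨X⸩))) ⟨ι, hι, fun _ => rfl⟩
      refine ⟨z.toAdd, ?_⟩
      rw [← nsmul_eq_mul, ← toAdd_pow, ← hz]
      rfl
    have hℓ0 : ℓ ≠ 0 := fun h => hℓ (by rw [h, Nat.cast_zero])
    have hy0 : y ≠ 0 := by
      rintro rfl
      rw [zero_pow hℓ0] at hy
      exact x.ne_zero hy.symm
    exact ⟨Units.mk0 y hy0, Units.ext (by simpa using hy)⟩

end SplitTower

end

section

open LaurentSeries Polynomial

/-- The maximal extension of the rational function field which is split at all points of order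
prime to `ℓ`. -/
noncomputable def splitField (K A Ω : Type*) [Field K] [Field A] [Algebra K A] [Field Ω]
    [Algebra (RatFunc K) Ω] (ℓ : ℕ) : IntermediateField (RatFunc K) Ω :=
  IntermediateField.adjoin (RatFunc K) {x | IsIntegral (RatFunc K) x ∧ ∀ t : A, ¬ ℓ ∣ orderOf t →
    ((minpoly (RatFunc K) x).map (shiftHom K t)).Splits}

variable {K A Ω : Type*} [Field K] [Field A] [Algebra K A] [Field Ω] [Algebra (RatFunc K) Ω] {ℓ : ℕ}

theorem mem_splitField [Algebra.IsAlgebraic (RatFunc K) Ω] {x : Ω} : x ∈ splitField K A Ω ℓ ↔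
    ∀ t : A, ¬ ℓ ∣ orderOf t → ((minpoly (RatFunc K) x).map (shiftHom K t)).Splits := by
  refine ⟨fun hx t ht => ?_, fun h => IntermediateField.subset_adjoin _ _
    ⟨(Algebra.IsAlgebraic.isAlgebraic x).isIntegral, h⟩⟩
  let := (shiftHom (A := A) K t).toAlgebra
  exact IntermediateField.splits_of_mem_adjoin (RatFunc K) Ω (L := A⸨X⸩)
    (fun s hs => ⟨hs.1, hs.2 t ht⟩) hx

theorem mem_splitField_of_aeval_eq_zero [Algebra.IsAlgebraic (RatFunc K) Ω] {x : Ω}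
    {P : (RatFunc K)[X]} (hP : P ≠ 0) (hPx : aeval x P = 0) (h : ∀ t : A, ¬ ℓ ∣ orderOf t →
    (P.map (shiftHom K t)).Splits) : x ∈ splitField K A Ω ℓ :=
  mem_splitField.2 fun t ht => (h t ht).of_dvd (Polynomial.map_ne_zero hP)
    (map_dvd (mapRingHom (shiftHom K t)) (minpoly.dvd _ _ hPx))

instance [Normal (RatFunc K) Ω] : Normal (RatFunc K) (splitField K A Ω ℓ) := by
  rw [IntermediateField.normal_iff_forall_map_le]
  rintro σ _ ⟨x, hx, rfl⟩
  refine mem_splitField.2 ?_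
  change ∀ t : A, _ → ((minpoly (RatFunc K) (σ x)).map _).Splits
  rw [minpoly.algHom_eq σ σ.injective]
  exact mem_splitField.1 hx

theorem algebraMap_mem_splitField [Algebra.IsAlgebraic (RatFunc K) Ω] [Algebra A Ω] [Algebra K Ω]
    [IsScalarTower K A Ω] [IsScalarTower K (RatFunc K) Ω] [IsAlgClosed A] [Algebra.IsAlgebraic K A]
    (a : A) : algebraMap A Ω a ∈ splitField K A Ω ℓ := by
  have ha : IsIntegral K a := (Algebra.IsAlgebraic.isAlgebraic a).isIntegral
  refine mem_splitField_of_aeval_eq_zero (P := (minpoly K a).map (algebraMap K (RatFunc K)))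
    ((minpoly.monic ha).map _).ne_zero ?_ fun t _ => ?_
  · rw [aeval_map_algebraMap, aeval_algebraMap_apply, minpoly.aeval, map_zero]
  · rw [Polynomial.map_map, show (shiftHom K t).comp (algebraMap K (RatFunc K)) =
      HahnSeries.C.comp (algebraMap K A) from RingHom.ext fun c => shiftHom_C K t c,
      ← Polynomial.map_map]
    exact (IsAlgClosed.splits _).map _

theorem mem_splitField_of_pow_eq [IsAlgClosed A] [Algebra.IsAlgebraic (RatFunc K) Ω]
    (hℓ : (ℓ : A) ≠ 0) {x : Ω} {i : ℕ} (hx : x ^ ℓ ^ i = algebraMap (RatFunc K) Ω RatFunc.X) :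
    x ∈ splitField K A Ω ℓ := by
  have hℓ0 : ℓ ≠ 0 := fun h => hℓ (by rw [h, Nat.cast_zero])
  have hℓi : ((ℓ ^ i : ℕ) : A) ≠ 0 := by rw [Nat.cast_pow]; exact pow_ne_zero _ hℓ
  have : NeZero ((ℓ ^ i : ℕ) : A) := ⟨hℓi⟩
  obtain ⟨ζ, hζ⟩ := HasEnoughRootsOfUnity.exists_primitiveRoot A (ℓ ^ i)
  have hζ' : IsPrimitiveRoot (HahnSeries.C ζ : A⸨X⸩) (ℓ ^ i) :=
    hζ.map_of_injective HahnSeries.C_injective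
  refine mem_splitField_of_aeval_eq_zero (P := X ^ ℓ ^ i - C RatFunc.X)
    (X_pow_sub_C_ne_zero (pow_pos (Nat.pos_of_ne_zero hℓ0) i) _) (by simp [hx]) fun t ht => ?_
  have ht0 : t ≠ 0 := IsBad.ne_zero (i := 0) hℓ0 (by rwa [IsBad, pow_zero, pow_one])
  obtain ⟨s, hs⟩ := IsAlgClosed.exists_pow_nat_eq t (pow_pos (Nat.pos_of_ne_zero hℓ0) i)
  obtain ⟨r, hr, -⟩ := PowerSeries.exists_pow_eq hℓi (s := s)
    (f := PowerSeries.C t + PowerSeries.X)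
    (by rintro rfl; exact ht0 (by rw [← hs, zero_pow (pow_ne_zero _ hℓ0)])) (by simp [hs])
  rw [Polynomial.map_sub, Polynomial.map_pow, Polynomial.map_X, Polynomial.map_C, shiftHom_X]
  exact X_pow_sub_C_splits_of_isPrimitiveRoot hζ' (by rw [← hr, map_pow])

theorem exists_splitTower [IsAlgClosed A] [Normal (RatFunc K) Ω] [IsSepClosed Ω]
    (hℓ : (ℓ : A) ≠ 0) (hℓΩ : (ℓ : Ω) ≠ 0) :
    ∃ T : ℕ → splitField K A Ω ℓ, SplitTower K A ℓ T := by
  have : NeZero (ℓ : Ω) := ⟨hℓΩ⟩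
  have hℓ0 : ℓ ≠ 0 := fun h => hℓ (by rw [h, Nat.cast_zero])
  choose r hr using fun x : Ω => IsSepClosed.exists_pow_nat_eq x ℓ
  let T : ℕ → Ω := fun i => r^[i] (algebraMap (RatFunc K) Ω RatFunc.X)
  have hT : ∀ i, T (i + 1) ^ ℓ = T i := fun i => by
    simp only [T, Function.iterate_succ_apply', hr]
  have hTX : ∀ i, T i ^ ℓ ^ i = algebraMap (RatFunc K) Ω RatFunc.X := by
    intro i
    induction i with
    | zero => simp [T]
    | succ i ih => rw [pow_succ', pow_mul, hT, ih]
  refine ⟨fun i => ⟨T i, mem_splitField_of_pow_eq hℓ (hTX i)⟩, Subtype.ext rfl,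
    fun i => Subtype.ext (hT i), fun x t ht => ?_, fun x hx => ?_⟩
  · rw [← minpoly.algebraMap_eq (algebraMap (splitField K A Ω ℓ) Ω).injective x]
    exact mem_splitField.1 x.2 t ht
  · obtain ⟨y, hy⟩ := IsSepClosed.exists_pow_nat_eq (x : Ω) ℓ
    refine ⟨⟨y, mem_splitField_of_aeval_eq_zero (P := expand _ ℓ (minpoly (RatFunc K) x)) ?_ ?_ hx⟩,
      Subtype.ext hy⟩
    · rw [Ne, expand_eq_zero (Nat.pos_of_ne_zero hℓ0)]
      exact minpoly.ne_zero (Algebra.IsAlgebraic.isAlgebraic x).isIntegral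
    · rw [expand_aeval, hy]
      exact (aeval_algebraMap_apply Ω x _).trans (by rw [minpoly.aeval, map_zero])

end

/-- The logarithmic derivatives of a family `y` of radicals permuted by `Γ`. -/
theorem exists_shift {Γ Y S : Type*} [Group Γ] [CommGroup Y] [MulAction Γ S] {ℓ : ℕ} [NeZero ℓ]
    (σ : Γ →* MulAut Y) (z y : S → Y) (hz : ∀ γ s, σ γ (z s) = z (γ • s))
    (hzo : ∀ s, orderOf (z s) = ℓ)
    (hy : ∀ γ s, ∃ n : ℕ, σ γ (y s) = z (γ • s) ^ n * y (γ • s)) :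
    ∃ Λ : Γ → S → ZMod ℓ, (∀ γ δ s, Λ (γ * δ) s = Λ γ s + Λ δ (γ⁻¹ • s)) ∧
      ∀ γ s (n : ℕ), σ γ (y s) = z (γ • s) ^ n * y (γ • s) ↔ Λ γ (γ • s) = n := by
  have hpow : ∀ s (n m : ℕ), z s ^ n = z s ^ m ↔ (n : ZMod ℓ) = m := fun s n m => by
    rw [pow_eq_pow_iff_modEq, hzo, ZMod.natCast_eq_natCast_iff]
  choose N hN using hy
  refine ⟨fun γ s => N γ (γ⁻¹ • s), fun γ δ s => ?_, fun γ s n => ?_⟩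
  · have h1 := hN (γ * δ) ((γ * δ)⁻¹ • s)
    have h2 := hN δ ((γ * δ)⁻¹ • s)
    rw [map_mul, MulAut.mul_apply, h2, map_mul, map_pow, hz, hN, ← mul_assoc] at h1
    simp only [mul_inv_rev, mul_smul, smul_inv_smul] at h1 ⊢
    rw [mul_left_inj, ← pow_add, hpow] at h1
    rw [← h1, Nat.cast_add, add_comm]
  · change _ ↔ (N γ (γ⁻¹ • γ • s) : ZMod ℓ) = n
    rw [inv_smul_smul, hN, mul_left_inj, hpow]

/-- A crossed homomorphism with values in an elementary abelian group, built from a family of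
independent radicals. -/
theorem exists_crossed_of_radicals {Γ Y V S : Type*} [Group Γ] [CommGroup Y] [CommGroup V]
    [Finite S] [MulAction Γ S] {ℓ : ℕ} [Fact ℓ.Prime] (hV : ∀ v : V, v ^ ℓ = 1)
    (σ : Γ →* MulAut Y) (act : Γ →* MulAut V) (u : S → V) (hu : ∀ γ s, u (γ • s) = act γ (u s))
    (z y : S → Y) (hz : ∀ γ s, σ γ (z s) = z (γ • s)) (hzo : ∀ s, orderOf (z s) = ℓ)
    (hzz : ∃ ζ : Y, ζ ^ ℓ = 1 ∧ ∀ s, ∃ r : ℕ, z s = ζ ^ r)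
    (hy : ∀ γ s, ∃ n : ℕ, σ γ (y s) = z (γ • s) ^ n * y (γ • s)) :
    ∃ a : Γ → V, (∀ γ δ, a (γ * δ) = a γ * act γ (a δ)) ∧
      (∀ γ, (∀ s : S, γ • s = s) → (∀ s, σ γ (y s) = y s) → a γ = 1) ∧
      ∀ H : Subgroup Γ, (∀ γ ∈ H, ∀ s : S, γ • s = s) →
        (∀ k : S → ℕ, (∀ γ ∈ H, σ γ (∏ᶠ s, y s ^ k s) = ∏ᶠ s, y s ^ k s) → ∀ s, ℓ ∣ k s) →
        ∀ s, ∃ γ ∈ H, a γ = u s := by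
  classical
  have := Fintype.ofFinite S
  have hℓ : ℓ.Prime := Fact.out
  have : Fact (1 < ℓ) := ⟨hℓ.one_lt⟩
  simp only [finprod_eq_prod_of_fintype]
  obtain ⟨Λ, hΛ, hΛ'⟩ := exists_shift σ z y hz hzo hy
  have hmod : ∀ (v : V) (n : ℕ), v ^ (n : ZMod ℓ).val = v ^ n := fun v n => by
    rw [ZMod.val_natCast, ← pow_eq_pow_mod n (hV v)]
  have hadd : ∀ (v : V) (a b : ZMod ℓ), v ^ (a + b).val = v ^ a.val * v ^ b.val := fun v a b => by
    rw [← pow_add, ← hmod v (a.val + b.val)]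
    simp
  refine ⟨fun γ => ∏ s, u s ^ (Λ γ s).val, fun γ δ => ?_, fun γ h1 h2 => ?_, fun H hH hind s => ?_⟩
  · simp only [hΛ, hadd, Finset.prod_mul_distrib, map_prod, map_pow, ← hu]
    congr 1
    refine (Fintype.prod_bijective _ (MulAction.bijective γ) _ _ fun s => ?_).symm
    rw [inv_smul_smul]
  · refine Finset.prod_eq_one fun s _ => ?_
    have := (hΛ' γ s 0).1 (by rw [h1, h2]; simp)
    rw [h1] at this
    rw [this]; simp
  · obtain ⟨ζ, hζ1, hζ⟩ := hzz
    choose r hr using hζ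
    let P : AddSubgroup (S → ZMod ℓ) :=
      { carrier := {f | ∃ γ ∈ H, Λ γ = f}
        zero_mem' := ⟨1, H.one_mem, by
          ext s
          have := hΛ 1 1 s
          simpa using this⟩
        add_mem' := by
          rintro _ _ ⟨γ, hγ, rfl⟩ ⟨δ, hδ, rfl⟩
          refine ⟨γ * δ, H.mul_mem hγ hδ, ?_⟩
          ext s
          rw [hΛ, hH _ (H.inv_mem hγ)]; rfl
        neg_mem' := by
          rintro _ ⟨γ, hγ, rfl⟩
          refine ⟨γ⁻¹, H.inv_mem hγ, ?_⟩
          ext s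
          have h1 := hΛ γ⁻¹ γ s
          have h2 := hΛ 1 1 s
          rw [inv_inv, hH γ hγ, inv_mul_cancel] at h1
          have h3 : Λ 1 s = 0 := by simpa using h2
          rw [h3] at h1
          exact eq_neg_of_add_eq_zero_left h1.symm }
    have hP : AddSubgroup.toZModSubmodule ℓ P = ⊤ := by
      by_contra hne
      obtain ⟨f, hf, hle⟩ := Submodule.exists_le_ker_of_lt_top _ (lt_top_iff_ne_top.2 hne)
      refine hf ?_
      have hrz : ∀ s, (r s : ZMod ℓ) ≠ 0 := fun s h => by
        obtain ⟨c, hc⟩ := (ZMod.natCast_eq_zero_iff _ _).1 h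
        have h1 := hzo s
        rw [hr, hc, pow_mul, hζ1, one_pow, orderOf_one] at h1
        exact hℓ.one_lt.ne h1
      set l : S → ZMod ℓ := fun s => f (Pi.single s 1) with hl
      have hfl : ∀ x : S → ZMod ℓ, f x = ∑ s, x s * l s := fun x => by
        conv_lhs => rw [LinearMap.pi_apply_eq_sum_univ f x]
        refine Finset.sum_congr rfl fun s _ => ?_
        rw [hl, smul_eq_mul]
        congr 2
        ext t
        simp [Pi.single_apply, eq_comm]
      suffices h : ∀ s, l s = 0 by
        refine LinearMap.ext fun x => ?_
        simp [hfl, h]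
      have key := hind (fun s => (l s * (r s : ZMod ℓ)⁻¹).val) fun γ hγ => ?_
      · intro s
        have h1 := (ZMod.natCast_eq_zero_iff _ _).2 (key s)
        rw [ZMod.natCast_zmod_val] at h1
        exact (mul_eq_zero.1 h1).resolve_right (inv_ne_zero (hrz s))
      · have h1 : ∀ s, σ γ (y s) = z s ^ (Λ γ s).val * y s := fun s => by
          have := (hΛ' γ s (Λ γ s).val).2 (by rw [hH γ hγ, ZMod.natCast_zmod_val])
          rwa [hH γ hγ] at this
        simp only [map_prod, map_pow, h1, mul_pow, Finset.prod_mul_distrib, hr, ← pow_mul,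
          Finset.prod_pow_eq_pow_sum]
        rw [mul_eq_right]
        refine orderOf_dvd_iff_pow_eq_one.1 ((orderOf_dvd_of_pow_eq_one hζ1).trans
          ((ZMod.natCast_eq_zero_iff _ _).1 ?_))
        have h2 : f (Λ γ) = 0 := hle ⟨γ, hγ, rfl⟩
        rw [hfl] at h2
        rw [← h2]
        push_cast
        refine Finset.sum_congr rfl fun s _ => ?_
        rw [ZMod.natCast_zmod_val, ZMod.natCast_zmod_val]
        field_simp [hrz s]
    have hmem : Pi.single s 1 ∈ AddSubgroup.toZModSubmodule ℓ P := hP ▸ Submodule.mem_top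
    obtain ⟨γ, hγ, hγ'⟩ := hmem
    refine ⟨γ, hγ, ?_⟩
    simp only [hγ']
    rw [Finset.prod_eq_single s]
    · simp [ZMod.val_one]
    · intro t _ ht
      simp [Pi.single_eq_of_ne ht]
    · simp

section

variable {K A k M : Type*} [Field K] [Finite K] [Field A] [Algebra K A] [IsAlgClosed A]
  [Algebra.IsAlgebraic K A] [Field k] [Field M] [Algebra k M] [Algebra A M] [Algebra K k]
  [Algebra K M] [IsScalarTower K A M] [IsScalarTower K k M]

theorem pow_card_pow_eq_of_modEq {d n m : ℕ} (hd : 0 < d) (h : n ≡ m [MOD d]) {a : A}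
    (ha : a ^ Nat.card K ^ d = a) : a ^ Nat.card K ^ n = a ^ Nat.card K ^ m :=
  (pow_card_pow_eq_iff K hd).2 h a ha

omit [Algebra K A] [IsAlgClosed A] [Algebra.IsAlgebraic K A] in
theorem IsPrimitiveRoot.pow_card_pow_eq {m : ℕ} {t : A}
    (ht : IsPrimitiveRoot t (Nat.card K ^ m - 1)) : t ^ Nat.card K ^ m = t := by
  have h1 : Nat.card K ^ m = Nat.card K ^ m - 1 + 1 :=
    (Nat.sub_add_cancel (Nat.one_le_pow _ _ Nat.card_pos)).symm
  rw [h1, pow_succ, ht.pow_eq_one, one_mul]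

theorem IsPrimitiveRoot.modEq_of_pow_card_pow_eq {m : ℕ} (hm : 0 < m) {t : A}
    (ht : IsPrimitiveRoot t (Nat.card K ^ m - 1)) {a b : ℕ}
    (h : t ^ Nat.card K ^ a = t ^ Nat.card K ^ b) : a ≡ b [MOD m] := by
  have hq : 1 < Nat.card K ^ m := Nat.one_lt_pow hm.ne' Finite.one_lt_card
  refine (pow_card_pow_eq_iff K (A := A) hm).1 fun x hx => ?_
  rcases eq_or_ne x 0 with rfl | hx0
  · rw [zero_pow (pow_pos Nat.card_pos _).ne', zero_pow (pow_pos Nat.card_pos _).ne']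
  · have h1 : x ^ (Nat.card K ^ m - 1) = 1 := by
      refine mul_right_cancel₀ hx0 ?_
      rw [← pow_succ, Nat.sub_add_cancel hq.le, hx, one_mul]
    have : NeZero (Nat.card K ^ m - 1) := ⟨by omega⟩
    obtain ⟨j, -, rfl⟩ := ht.eq_pow_of_pow_eq_one h1
    rw [← pow_mul, mul_comm, pow_mul, h, ← pow_mul, mul_comm, pow_mul]

omit [Algebra K A] [IsAlgClosed A] [Algebra.IsAlgebraic K A] in
theorem orderOf_pow_card_pow {m : ℕ} (hm : 0 < m) {t : A}
    (ht : IsPrimitiveRoot t (Nat.card K ^ m - 1)) (n : ℕ) :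
    orderOf (t ^ Nat.card K ^ n) = Nat.card K ^ m - 1 := by
  rw [Nat.Coprime.orderOf_pow, ← ht.eq_orderOf]
  rw [← ht.eq_orderOf]
  refine Nat.Coprime.pow_right _ ?_
  obtain ⟨j, hj⟩ := dvd_pow_self (Nat.card K) hm.ne'
  have h1 : 1 ≤ Nat.card K ^ m := Nat.one_le_pow _ _ Nat.card_pos
  refine Nat.isCoprime_iff_coprime.1 ⟨-1, j, ?_⟩
  rw [Nat.cast_sub h1, hj]
  push_cast
  ring

/-- A finite set of constants stable under Frobenius with a surjective equivariant map to `V`. -/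
theorem exists_points {d : ℕ} (hd : 0 < d) {fr : (M ≃ₐ[k] M) →* Multiplicative (ZMod d)}
    (hfr : ∀ γ : M ≃ₐ[k] M, ∀ n : ℕ,
      fr γ = Multiplicative.ofAdd (n : ZMod d) ↔ ∀ a : A, a ^ Nat.card K ^ d = a →
        γ (algebraMap A M a) = algebraMap A M (a ^ Nat.card K ^ n))
    {ℓ : ℕ} (hℓ : ℓ.Prime) (V : Type u) [Group V] [Finite V]
    (act : Multiplicative (ZMod d) →* MulAut V) :
    ∃ (S : Type u) (_ : Finite S) (_ : MulAction (M ≃ₐ[k] M) S) (m : ℕ) (pt : S → A) (u : S → V),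
      0 < m ∧ d ∣ m ∧ (∀ s, pt s ^ Nat.card K ^ m = pt s) ∧ Function.Injective pt ∧
      Function.Surjective u ∧ (∀ γ : M ≃ₐ[k] M, ∀ s, u (γ • s) = act (fr γ) (u s)) ∧
      (∀ γ : M ≃ₐ[k] M, ∀ s, γ (algebraMap A M (pt s)) = algebraMap A M (pt (γ • s))) ∧
      (¬ ℓ ∣ Nat.card K → ∀ s, orderOf (pt s) ≠ 0 ∧ ℓ ∣ orderOf (pt s)) := by
  classical
  have hℓ1 : 0 < ℓ - 1 := Nat.sub_pos_of_lt hℓ.one_lt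
  obtain ⟨N, ⟨e⟩⟩ := Finite.exists_equiv_fin V
  set m : V → ℕ := fun v => d * (e v + 1) * (ℓ - 1) with hm
  have hm0 : ∀ v, 0 < m v := fun v => Nat.mul_pos (Nat.mul_pos hd (Nat.succ_pos _)) hℓ1
  have hminj : Function.Injective m := fun v w h => e.injective <| Fin.ext <| by
    have := Nat.eq_of_mul_eq_mul_left hd (Nat.eq_of_mul_eq_mul_right hℓ1 h)
    omega
  have hdm : ∀ v, d ∣ m v := fun v => ⟨(e v + 1) * (ℓ - 1), mul_assoc _ _ _⟩
  have ht : ∀ v, ∃ t : A, IsPrimitiveRoot t (Nat.card K ^ m v - 1) := fun v => by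
    have : NeZero ((Nat.card K ^ m v - 1 : ℕ) : A) :=
      ⟨natCast_card_pow_sub_one_ne_zero K (hm0 v)⟩
    exact HasEnoughRootsOfUnity.exists_primitiveRoot A _
  choose t ht using ht
  have htm : ∀ v, t v ^ Nat.card K ^ m v = t v := fun v => (ht v).pow_card_pow_eq
  have hf := fun v => exists_frobDegree K A k M (hm0 v)
  choose f hf using hf
  have hval : ∀ v γ, f v γ = Multiplicative.ofAdd (((f v γ).toAdd.val : ℕ) : ZMod (m v)) :=
    fun v γ => by
      have : NeZero (m v) := ⟨(hm0 v).ne'⟩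
      rw [ZMod.natCast_zmod_val]; rfl
  have hffr : ∀ v γ, fr γ = Multiplicative.ofAdd (ZMod.castHom (hdm v) (ZMod d) (f v γ).toAdd) :=
    fun v γ => by
      conv_rhs => rw [hval v γ]
      rw [toAdd_ofAdd, map_natCast, hfr]
      intro a ha
      refine (hf v γ _).1 (hval v γ) a ?_
      obtain ⟨j, hj⟩ := hdm v
      rw [hj, pow_card_pow_mul_eq ha]
  have hpt : ∀ v (x y : ZMod (m v)), t v ^ Nat.card K ^ (x + y).val =
      (t v ^ Nat.card K ^ y.val) ^ Nat.card K ^ x.val := fun v x y => by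
    have : NeZero (m v) := ⟨(hm0 v).ne'⟩
    rw [← pow_card_pow_add]
    refine pow_card_pow_eq_of_modEq (hm0 v) ?_ (htm v)
    rw [← ZMod.natCast_eq_natCast_iff, Nat.cast_add, ZMod.natCast_zmod_val, ZMod.natCast_zmod_val,
      ZMod.natCast_zmod_val, add_comm]
  have hfin : ∀ v, Finite (Multiplicative (ZMod (m v))) := fun v => by
    have : NeZero (m v) := ⟨(hm0 v).ne'⟩
    infer_instance
  let act' : MulAction (M ≃ₐ[k] M) (Σ v, Multiplicative (ZMod (m v))) :=
    { smul := fun γ x => ⟨x.1, f x.1 γ * x.2⟩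
      one_smul := fun x => Sigma.ext rfl (heq_of_eq (by
        change f x.1 1 * x.2 = x.2
        rw [map_one, one_mul]))
      mul_smul := fun γ δ x => Sigma.ext rfl (heq_of_eq (by
        change f x.1 (γ * δ) * x.2 = f x.1 γ * (f x.1 δ * x.2)
        rw [map_mul, mul_assoc])) }
  refine ⟨_, inferInstance, act', ∏ᶠ v, m v,
    fun x => t x.1 ^ Nat.card K ^ x.2.toAdd.val,
    fun x => act (Multiplicative.ofAdd (ZMod.castHom (hdm x.1) (ZMod d) x.2.toAdd)) x.1,
    ?_, ?_, ?_, ?_, ?_, ?_, ?_, ?_⟩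
  · exact finprod_induction (p := fun n : ℕ => 0 < n) one_pos (fun _ _ => Nat.mul_pos) hm0
  · have := Fintype.ofFinite V
    rw [finprod_eq_prod_of_fintype]
    exact (hdm 1).trans (Finset.dvd_prod_of_mem _ (Finset.mem_univ 1))
  · intro x
    have := Fintype.ofFinite V
    obtain ⟨j, hj⟩ := Finset.dvd_prod_of_mem m (Finset.mem_univ x.1)
    rw [finprod_eq_prod_of_fintype, hj, ← pow_card_pow_add, add_comm, pow_card_pow_add,
      pow_card_pow_mul_eq (htm x.1)]
  · rintro ⟨v, x⟩ ⟨w, y⟩ h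
    have hvw : v = w := by
      have h1 := congrArg orderOf h
      simp only [orderOf_pow_card_pow (hm0 _) (ht _)] at h1
      refine hminj (Nat.pow_right_injective (Finite.one_lt_card (α := K)) ?_)
      have h2 : 1 ≤ Nat.card K ^ m v := Nat.one_le_pow _ _ Nat.card_pos
      have h3 : 1 ≤ Nat.card K ^ m w := Nat.one_le_pow _ _ Nat.card_pos
      change Nat.card K ^ m v = Nat.card K ^ m w
      omega
    subst hvw
    have : NeZero (m v) := ⟨(hm0 v).ne'⟩
    have h1 := (ht v).modEq_of_pow_card_pow_eq (hm0 v) h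
    rw [← ZMod.natCast_eq_natCast_iff, ZMod.natCast_zmod_val, ZMod.natCast_zmod_val] at h1
    exact Sigma.ext rfl (heq_of_eq (Multiplicative.toAdd.injective h1))
  · intro v
    refine ⟨⟨v, 1⟩, ?_⟩
    simp
  · rintro γ ⟨v, x⟩
    change act (Multiplicative.ofAdd (ZMod.castHom (hdm v) (ZMod d) (f v γ * x).toAdd)) v = _
    rw [hffr v γ, ← MulAut.mul_apply, ← map_mul, toAdd_mul, map_add, ofAdd_add]
  · rintro γ ⟨v, x⟩
    change γ (algebraMap A M (t v ^ Nat.card K ^ x.toAdd.val)) =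
      algebraMap A M (t v ^ Nat.card K ^ (f v γ * x).toAdd.val)
    rw [toAdd_mul, hpt]
    refine (hf v γ _).1 (hval v γ) _ ?_
    rw [← pow_card_pow_add, add_comm, pow_card_pow_add, htm]
  · rintro hℓK ⟨v, x⟩
    change orderOf (t v ^ Nat.card K ^ x.toAdd.val) ≠ 0 ∧
      ℓ ∣ orderOf (t v ^ Nat.card K ^ x.toAdd.val)
    rw [orderOf_pow_card_pow (hm0 v) (ht v)]
    exact ⟨(Nat.sub_pos_of_lt (Nat.one_lt_pow (hm0 v).ne' Finite.one_lt_card)).ne',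
      Nat.dvd_card_pow_sub_one hℓ hℓK _⟩

end

section

variable {K A k M : Type*} [Field K] [Finite K] [Field A] [Algebra K A] [IsAlgClosed A]
  [Algebra.IsAlgebraic K A] [Field k] [Field M] [Algebra k M] [Algebra A M] [Algebra K k]
  [Algebra K M] [IsScalarTower K A M] [IsScalarTower K k M] [IsGalois k M]

theorem initialStep_of_radicals {T : ℕ → M} {d : ℕ} (hd : 0 < d)
    {fr : (M ≃ₐ[k] M) →* Multiplicative (ZMod d)}
    (hfr : ∀ γ : M ≃ₐ[k] M, ∀ n : ℕ,
      fr γ = Multiplicative.ofAdd (n : ZMod d) ↔ ∀ a : A, a ^ Nat.card K ^ d = a →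
        γ (algebraMap A M a) = algebraMap A M (a ^ Nat.card K ^ n))
    {ℓ : ℕ} (hℓ : ℓ.Prime) {Y : Type*} [CommGroup Y] (σ : (M ≃ₐ[k] M) →* MulAut Y)
    (hσ : ∀ y, ∃ x : M, ∀ γ : M ≃ₐ[k] M, γ x = x → σ γ y = y)
    (hrad : ∀ (S : Type u) [Finite S] [MulAction (M ≃ₐ[k] M) S] (pt : S → A),
      Function.Injective pt →
      (¬ ℓ ∣ Nat.card K → ∀ s, orderOf (pt s) ≠ 0 ∧ ℓ ∣ orderOf (pt s)) →
      (∀ γ : M ≃ₐ[k] M, ∀ s, γ (algebraMap A M (pt s)) = algebraMap A M (pt (γ • s))) →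
      ∃ z y : S → Y, (∀ γ s, σ γ (z s) = z (γ • s)) ∧ (∀ s, orderOf (z s) = ℓ) ∧
        (∃ ζ : Y, ζ ^ ℓ = 1 ∧ ∀ s, ∃ r : ℕ, z s = ζ ^ r) ∧
        (∀ γ s, ∃ n : ℕ, σ γ (y s) = z (γ • s) ^ n * y (γ • s)) ∧
        ∀ e i, 0 < e → (∀ s, pt s ^ Nat.card K ^ e = pt s) → ∀ n : S → ℕ,
          (∀ γ ∈ levelSubgroup K A k T e i, σ γ (∏ᶠ s, y s ^ n s) = ∏ᶠ s, y s ^ n s) →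
          ∀ s, ℓ ∣ n s) :
    InitialStep.{u} ℓ d (levelSubgroup K A k T) fr := by
  intro V _ _ hVc hVℓ act
  let : CommGroup V := { (inferInstance : Group V) with mul_comm := hVc }
  have : Fact ℓ.Prime := ⟨hℓ⟩
  obtain ⟨S, _, _, m, pt, u, hm, hdm, hpm, hpt, hu, huγ, hγ, hord⟩ :=
    exists_points (k := k) hd hfr hℓ V act
  obtain ⟨z, y, hz, hzo, hzz, hy, hind⟩ := hrad S pt hpt hord hγ
  obtain ⟨a, ha, ha1, hsurj⟩ := exists_crossed_of_radicals hVℓ σ (act.comp fr) u huγ z y hz hzo hzz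
      hy
  have htriv : ∀ γ : M ≃ₐ[k] M, ∀ s, γ (algebraMap A M (pt s)) = algebraMap A M (pt s) →
      γ • s = s := fun γ s h => by
    rw [hγ] at h
    exact hpt ((algebraMap A M).injective h)
  refine ⟨fun γ => ⟨a γ, fr γ⟩, ⟨fun γ _ δ _ => ?_, ?_⟩, fun γ _ => rfl, fun i v => ?_⟩
  · rw [SemidirectProduct.ext_iff]
    exact ⟨ha γ δ, map_mul fr γ δ⟩
  · choose x hx using hσ
    obtain ⟨U, hU, hUn, hUS⟩ := exists_open_normal_fixing (k := k) (M := M)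
      ((Set.finite_range fun s => x (y s)).union (Set.finite_range fun s => algebraMap A M (pt s)))
    obtain ⟨U', hU', hUn', hUS'⟩ :=
      exists_open_normal_le_levelSubgroup K A (k := k) (T := T) 0 hd
    refine ⟨U ⊓ U', hU.inter hU', inferInstance, fun γ hγU _ => ?_⟩
    rw [SemidirectProduct.ext_iff]
    refine ⟨ha1 γ (fun s => htriv γ s (hUS γ hγU.1 _ (Or.inr ⟨s, rfl⟩)))
      fun s => hx _ γ (hUS γ hγU.1 _ (Or.inl ⟨s, rfl⟩)), ?_⟩
    exact ((mem_levelSubgroup_iff_of_frobDegree hfr).1 (hUS' hγU.2)).2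
  · obtain ⟨s, rfl⟩ := hu v
    obtain ⟨γ, hγ', h⟩ := hsurj (levelSubgroup K A k T m i)
      (fun γ hγ' s => htriv γ s (hγ'.2 _ (hpm s))) (fun n hn => hind m i hm hpm n hn) s
    exact ⟨γ, levelSubgroup_le_of_dvd hdm i hγ', h⟩

end

section

open Polynomial

attribute [local instance] Units.mulDistribMulActionRight

/-- Simple radicals with distinct branch points are independent. -/
theorem dvd_of_prod_X_pow_sub_C_pow_mul_pow_eq {A S : Type*} [Field A] [IsAlgClosed A] [Finite S]
    {pt : S → A} (hpt : Function.Injective pt) (h0 : ∀ s, pt s ≠ 0) {N ℓ : ℕ} (hN : (N : A) ≠ 0)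
    {n : S → ℕ} {P R : A[X]} (hR : R ≠ 0)
    (h : (∏ᶠ s, (X ^ N - C (pt s)) ^ n s) * R ^ ℓ = P ^ ℓ) (s : S) : ℓ ∣ n s := by
  classical
  have := Fintype.ofFinite S
  have hN' : 0 < N := Nat.pos_of_ne_zero fun h => hN (by simp [h])
  rw [finprod_eq_prod_of_fintype, ← Finset.mul_prod_erase _ _ (Finset.mem_univ s)] at h
  obtain ⟨t, ht⟩ := IsAlgClosed.exists_pow_nat_eq (pt s) hN'
  have hne : ∀ s, (X ^ N - C (pt s) : A[X]) ≠ 0 := fun s => X_pow_sub_C_ne_zero hN' _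
  have h1 : (∏ x ∈ Finset.univ.erase s, (X ^ N - C (pt x)) ^ n x).rootMultiplicity t = 0 := by
    refine rootMultiplicity_eq_zero fun hr => ?_
    rw [IsRoot, eval_prod, Finset.prod_eq_zero_iff] at hr
    obtain ⟨x, hx, hr⟩ := hr
    rw [eval_pow] at hr
    have hr := eq_zero_of_pow_eq_zero hr
    simp only [eval_sub, eval_pow, eval_X, eval_C, ht, sub_eq_zero] at hr
    exact Finset.ne_of_mem_erase hx (hpt hr).symm
  have h2 : (X ^ N - C (pt s) : A[X]).rootMultiplicity t = 1 := by
    refine le_antisymm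
      (rootMultiplicity_le_one_of_separable (separable_X_pow_sub_C _ hN (h0 s)) t)
      ((rootMultiplicity_pos (hne s)).2 ?_)
    simp [ht]
  have h3 : (∏ x ∈ Finset.univ.erase s, (X ^ N - C (pt x)) ^ n x) ≠ 0 :=
    Finset.prod_ne_zero_iff.2 fun x _ => pow_ne_zero _ (hne x)
  have hp : ∀ (f : A[X]) (m : ℕ), (f ^ m).rootMultiplicity t = m * f.rootMultiplicity t :=
    fun f m => by rw [← count_roots, roots_pow, Multiset.count_nsmul, count_roots]
  have h4 := congrArg (rootMultiplicity t) h
  rw [rootMultiplicity_mul (mul_ne_zero (mul_ne_zero (pow_ne_zero _ (hne s)) h3)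
    (pow_ne_zero _ hR)), rootMultiplicity_mul (mul_ne_zero (pow_ne_zero _ (hne s)) h3), h1, hp,
    hp, hp, h2, mul_one, add_zero] at h4
  exact (Nat.dvd_add_left (dvd_mul_right _ _)).1 (h4 ▸ dvd_mul_right _ _)

variable {K A k M : Type*} [Field K] [Finite K] [Field A] [Algebra K A] [IsAlgClosed A]
  [Algebra.IsAlgebraic K A] [Field k] [Field M] [Algebra k M] [Algebra A M] [Algebra K k]
  [Algebra K M] [IsScalarTower K A M] [IsScalarTower K k M] [IsGalois k M]

theorem PlaceTower.initialStep {ℓ : ℕ} {T : ℕ → M} {W : ℕ → ℕ → A → Set (Mˣ →* Multiplicative ℤ)}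
    (hP : PlaceTower K A k ℓ T W) (hℓ : ℓ.Prime) (hℓA : (ℓ : A) ≠ 0) (hℓK : ¬ ℓ ∣ Nat.card K)
    (hT : ∀ γ : M ≃ₐ[k] M, γ (T 0) = T 0)
    {d : ℕ} (hd : 0 < d) {fr : (M ≃ₐ[k] M) →* Multiplicative (ZMod d)}
    (hfr : ∀ γ : M ≃ₐ[k] M, ∀ n : ℕ,
      fr γ = Multiplicative.ofAdd (n : ZMod d) ↔ ∀ a : A, a ^ Nat.card K ^ d = a →
        γ (algebraMap A M a) = algebraMap A M (a ^ Nat.card K ^ n)) :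
    InitialStep.{u} ℓ d (levelSubgroup K A k T) fr := by
  refine initialStep_of_radicals hd hfr hℓ (MulDistribMulAction.toMulAut (M ≃ₐ[k] M) Mˣ)
    (fun y => ⟨y, fun γ h => Units.ext h⟩) fun S _ _ pt hpt hord hγ => ?_
  have hord := hord hℓK
  have h0 : ∀ s, pt s ≠ 0 := fun s h => (hord s).1 (by
    rw [h, orderOf_eq_zero_iff']
    intro n hn
    simp [hn.ne'])
  have : NeZero ((ℓ : ℕ) : A) := ⟨hℓA⟩
  have : NeZero ℓ := ⟨hℓ.ne_zero⟩
  obtain ⟨ζ, hζ⟩ := HasEnoughRootsOfUnity.exists_primitiveRoot A ℓ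
  have hTpt : ∀ s, T 0 - algebraMap A M (pt s) ≠ 0 := fun s h => by
    refine X_sub_C_ne_zero (pt s) (hP.trans 0 ?_)
    simpa using h
  have hy : ∀ s, ∃ y : Mˣ, y ^ ℓ = Units.mk0 _ (hTpt s) := fun s => by
    obtain ⟨e, he, hes⟩ := exists_pow_card_pow_eq K (pt s)
    refine hP.root e 0 _ he fun t ht w hw => ⟨1, ?_⟩
    rw [one_pow, ← toAdd_eq_zero, hP.poly e 0 t he ht w hw (X - C (pt s)) (X_sub_C_ne_zero _)
      (fun n => ?_) _ (by simp), Nat.cast_eq_zero]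
    · refine rootMultiplicity_eq_zero fun h => ?_
      rw [root_X_sub_C] at h
      rw [IsBad, pow_zero, pow_one, ← h] at ht
      exact ht (hord s).2
    · rw [← frobEquiv_pow_apply, coeff_sub, map_sub, coeff_X, coeff_C, frobEquiv_pow_apply,
        frobEquiv_pow_apply]
      split_ifs <;> simp [hes, Nat.card_pos.ne', he.ne']
  choose y hy using hy
  have hiA : Function.Injective (algebraMap A M) := (algebraMap A M).injective
  have hoA : ∀ a : A, orderOf (algebraMap A M a) = orderOf a :=
    orderOf_injective (algebraMap A M).toMonoidHom hiA
  set z : S → Mˣ := fun s => Units.map (algebraMap A M).toMonoidHom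
    (Units.mk0 (pt s) (h0 s) ^ (orderOf (pt s) / ℓ)) with hz
  have hzval : ∀ s, (z s : M) = algebraMap A M (pt s ^ (orderOf (pt s) / ℓ)) := fun s => by
    simp [hz]
  have hzo : ∀ s, orderOf (z s) = ℓ := fun s => by
    rw [← orderOf_units, hzval, hoA,
      orderOf_pow_orderOf_div (hord s).1 (hord s).2]
  have hroot : ∀ (x : Mˣ) s, x ^ ℓ = 1 → ∃ n : ℕ, x = z s ^ n := fun x s hx => by
    have h1 : IsPrimitiveRoot (z s) ℓ := hzo s ▸ IsPrimitiveRoot.orderOf (z s)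
    obtain ⟨i, -, hi⟩ := (IsPrimitiveRoot.coe_units_iff.2 h1).eq_pow_of_pow_eq_one
      (ξ := (x : M)) (by rw [← Units.val_pow_eq_pow_val, hx, Units.val_one])
    exact ⟨i, Units.ext (by rw [← hi]; simp)⟩
  refine ⟨z, y, fun γ s => Units.ext ?_, hzo, ?_, fun γ s => ?_, fun e i he hes n hn => ?_⟩
  · change γ (z s : M) = z (γ • s)
    have h1 : orderOf (pt s) = orderOf (pt (γ • s)) := by
      rw [← hoA (pt (γ • s)), ← hγ, ← hoA (pt s)]
      exact (orderOf_injective (γ : M →* M) γ.injective _).symm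
    rw [hzval, hzval, map_pow, map_pow, map_pow, hγ, h1]
  · rcases isEmpty_or_nonempty S with hS | ⟨⟨s⟩⟩
    · exact ⟨1, one_pow _, fun s => hS.elim s⟩
    · refine ⟨z s, hzo s ▸ pow_orderOf_eq_one _, fun t => hroot _ s (hzo t ▸ pow_orderOf_eq_one _)⟩
  · have h1 : (γ • y s) ^ ℓ = y (γ • s) ^ ℓ := by
      rw [← smul_pow', hy, hy]
      refine Units.ext ?_
      change γ (T 0 - algebraMap A M (pt s)) = T 0 - algebraMap A M (pt (γ • s))
      rw [map_sub, hT, hγ]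
    obtain ⟨i, hi⟩ := hroot (γ • y s * (y (γ • s))⁻¹) (γ • s) (by
      rw [mul_pow, inv_pow, h1, mul_inv_cancel])
    exact ⟨i, by rw [← hi, inv_mul_cancel_right]; rfl⟩
  · set Φ := ∏ᶠ s, y s ^ n s with hΦ
    obtain ⟨P, R, hR, -, -, hPR⟩ := hP.ratio e i he (Φ : M) fun γ hγ' =>
      congrArg Units.val (hn γ hγ')
    refine dvd_of_prod_X_pow_sub_C_pow_mul_pow_eq hpt h0 (N := ℓ ^ i) (by simp [hℓA]) hR
      (P := P) (hP.trans i ?_)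
    have := Fintype.ofFinite S
    have h1 : (Φ : M) ^ ℓ = ∏ s, (T 0 - algebraMap A M (pt s)) ^ n s := by
      rw [hΦ, finprod_eq_prod_of_fintype, ← Units.val_pow_eq_pow_val, ← Finset.prod_pow]
      simp only [← pow_mul, mul_comm _ ℓ]
      simp only [pow_mul, hy]
      simp
    have h2 : T i ^ ℓ ^ i = T 0 := by
      have := hP.pow_eq 0 i
      rwa [zero_add] at this
    rw [finprod_eq_prod_of_fintype, map_mul, map_pow, map_pow, ← hPR, mul_pow, h1, map_prod]
    simp [h2]

end

section

open Polynomial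

/-- Artin–Schreier radicals with simple poles at distinct points are independent. -/
theorem dvd_of_artinSchreier {A S : Type*} [Field A] [Fintype S] [DecidableEq S]
    {pt : S → A} (hpt : Function.Injective pt) {p : ℕ} (hp : p.Prime) [CharP A p]
    {n : S → ℕ} {P R : A[X]} (hPR : IsCoprime P R)
    (h : (P ^ p - P * R ^ (p - 1)) * ∏ s, (X - C (pt s)) =
      R ^ p * ∑ s, C (n s : A) * ∏ t ∈ Finset.univ.erase s, (X - C (pt t))) (s : S) : p ∣ n s := by
  by_contra hs
  have hq : ∀ s, (∏ t ∈ Finset.univ.erase s, (X - C (pt t)) : A[X]) ≠ 0 := fun s =>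
    Finset.prod_ne_zero_iff.2 fun _ _ => X_sub_C_ne_zero _
  have hqs : (∏ t ∈ Finset.univ.erase s, (X - C (pt t)) : A[X]).eval (pt s) ≠ 0 := by
    rw [eval_prod]
    refine Finset.prod_ne_zero_iff.2 fun t ht => ?_
    rw [eval_sub, eval_X, eval_C, sub_ne_zero]
    exact fun h => Finset.ne_of_mem_erase ht (hpt h).symm
  have hN : (∑ s, C (n s : A) * ∏ t ∈ Finset.univ.erase s, (X - C (pt t))).eval (pt s) ≠ 0 := by
    rw [eval_finsetSum, Finset.sum_eq_single s]
    · rw [eval_mul, eval_C]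
      exact mul_ne_zero (fun h => hs ((CharP.cast_eq_zero_iff A p _).1 h)) hqs
    · intro t _ hts
      rw [eval_mul, eval_prod, Finset.prod_eq_zero
        (Finset.mem_erase.2 ⟨hts.symm, Finset.mem_univ s⟩)
        (by simp), mul_zero]
    · simp
  have hp1 : 0 < p - 1 := Nat.sub_pos_of_lt hp.one_lt
  rw [← Finset.mul_prod_erase _ _ (Finset.mem_univ s)] at h
  have h1 := congrArg (eval (pt s)) h
  simp only [eval_mul, eval_sub, eval_X, eval_C, sub_self, zero_mul, mul_zero, eval_pow] at h1
  have hRs : R.eval (pt s) = 0 :=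
    eq_zero_of_pow_eq_zero ((mul_eq_zero.1 h1.symm).resolve_right hN)
  have hPs : P.eval (pt s) ≠ 0 := fun hPs => by
    obtain ⟨a, b, hab⟩ := hPR
    have := congrArg (eval (pt s)) hab
    simp [hRs, hPs] at this
  obtain ⟨R', hR'⟩ := dvd_iff_isRoot.2 hRs
  have h2 : (P ^ p - P * R ^ (p - 1)) * (∏ t ∈ Finset.univ.erase s, (X - C (pt t))) =
      (X - C (pt s)) ^ (p - 1) *
        (R' ^ p * ∑ s, C (n s : A) * ∏ t ∈ Finset.univ.erase s, (X - C (pt t))) := by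
    refine mul_left_cancel₀ (X_sub_C_ne_zero (pt s)) ?_
    rw [← mul_assoc (X - C (pt s)) ((X - C (pt s)) ^ (p - 1)), ← pow_succ',
      Nat.sub_add_cancel hp.one_lt.le, ← mul_assoc _ (R' ^ p), ← mul_pow, ← hR', ← h]
    ring
  have h3 := congrArg (eval (pt s)) h2
  simp only [eval_mul, eval_sub, eval_X, eval_C, sub_self, eval_pow, hRs,
    zero_pow hp1.ne', mul_zero, sub_zero, zero_mul] at h3
  exact mul_ne_zero (pow_ne_zero p hPs) hqs h3

theorem exists_eq_mul_isCoprime {A : Type*} [Field A] (P : A[X]) {R : A[X]} (hR : R ≠ 0) :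
    ∃ G P' R' : A[X], P = G * P' ∧ R = G * R' ∧ IsCoprime P' R' := by
  classical
  let := EuclideanDomain.gcdMonoid A[X]
  exact ⟨GCDMonoid.gcd P R, P / GCDMonoid.gcd P R, R / GCDMonoid.gcd P R,
    (EuclideanDomain.mul_div_cancel' (gcd_ne_zero_of_right hR) (gcd_dvd_left _ _)).symm,
    (EuclideanDomain.mul_div_cancel' (gcd_ne_zero_of_right hR) (gcd_dvd_right _ _)).symm,
    isCoprime_div_gcd_div_gcd hR⟩

theorem splitTower_one (K A : Type*) {M : Type*} [Field K] [Field A] [Algebra K A] [Field M]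
    [Algebra (RatFunc K) M] : SplitTower K A 1 fun _ => algebraMap (RatFunc K) M RatFunc.X where
  zero := rfl
  pow _ := pow_one _
  splits _ _ h := absurd (one_dvd _) h
  root x _ := ⟨x, pow_one x⟩

variable {K A M : Type*} [Field K] [Finite K] [Field A] [Algebra K A] [IsAlgClosed A]
  [Algebra.IsAlgebraic K A] [Field M] [Algebra (RatFunc K) M] [Algebra A M]
  [Algebra K M] [IsScalarTower K A M] [IsScalarTower K (RatFunc K) M] [IsGalois (RatFunc K) M]

theorem initialStep_char [IsSepClosed M] {p : ℕ} (hp : p.Prime) [CharP A p]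
    {d : ℕ} (hd : 0 < d) {fr : (M ≃ₐ[RatFunc K] M) →* Multiplicative (ZMod d)}
    (hfr : ∀ γ : M ≃ₐ[RatFunc K] M, ∀ n : ℕ,
      fr γ = Multiplicative.ofAdd (n : ZMod d) ↔ ∀ a : A, a ^ Nat.card K ^ d = a →
        γ (algebraMap A M a) = algebraMap A M (a ^ Nat.card K ^ n)) :
    InitialStep.{u} p d (levelSubgroup K A (RatFunc K)
      fun _ => algebraMap (RatFunc K) M RatFunc.X) fr := by
  have : Fact p.Prime := ⟨hp⟩
  have hT := splitTower_one K A (M := M)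
  have : CharP M p := charP_of_injective_algebraMap (algebraMap A M).injective p
  refine initialStep_of_radicals (k := RatFunc K) hd hfr hp
    (Y := Multiplicative M)
    { toFun := fun γ => AddEquiv.toMultiplicative γ.toRingEquiv.toAddEquiv
      map_one' := rfl
      map_mul' := fun _ _ => rfl }
    (fun y => ⟨y.toAdd, fun γ h => Multiplicative.toAdd.injective h⟩) fun S _ _ pt hpt _ hγ => ?_
  have hTpt : ∀ s, algebraMap (RatFunc K) M RatFunc.X - algebraMap A M (pt s) ≠ 0 := fun s h => by
    refine X_sub_C_ne_zero (pt s) (hT.aeval_injective 0 ?_)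
    simpa using h
  have hy : ∀ s, ∃ y : M,
      y ^ p - y = (algebraMap (RatFunc K) M RatFunc.X - algebraMap A M (pt s))⁻¹ := fun s => by
    obtain ⟨x, hx⟩ := IsSepClosed.exists_root_C_mul_X_pow_add_C_mul_X_add_C' (k := M) p p 1 (-1)
      (-(algebraMap (RatFunc K) M RatFunc.X - algebraMap A M (pt s))⁻¹) dvd_rfl hp.two_le (by simp)
    exact ⟨x, by linear_combination hx⟩
  choose y hy using hy
  have hone : orderOf (Multiplicative.ofAdd (1 : M)) = p :=
    orderOf_eq_prime (by rw [← ofAdd_nsmul]; simp) (by simp)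
  refine ⟨fun _ => Multiplicative.ofAdd 1, fun s => Multiplicative.ofAdd (y s), fun γ s => ?_,
    fun _ => hone, ⟨Multiplicative.ofAdd 1, hone ▸ pow_orderOf_eq_one _, fun _ => ⟨1, by simp⟩⟩,
    fun γ s => ?_, fun e i he _ n hn => ?_⟩
  · exact Multiplicative.toAdd.injective (map_one γ)
  · have h1 : γ (y s) ^ p - γ (y s) = y (γ • s) ^ p - y (γ • s) := by
      rw [hy, ← map_pow, ← map_sub, hy, map_inv₀, map_sub, γ.commutes, hγ]
    have h2 : γ (y s) - y (γ • s) ∈ (⊥ : Subfield M) := by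
      rw [Subfield.mem_bot_iff_pow_eq_self M p, sub_pow_char]
      linear_combination h1
    obtain ⟨c, hc⟩ : ∃ c : ℕ, (c : M) = γ (y s) - y (γ • s) := by
      rw [← ZMod.fieldRange_castHom_eq_bot p] at h2
      obtain ⟨c, hc⟩ := h2
      obtain ⟨c, rfl⟩ := ZMod.natCast_zmod_surjective c
      exact ⟨c, by simpa using hc⟩
    refine ⟨c, Multiplicative.toAdd.injective ?_⟩
    change γ (y s) = _
    simp [hc]
  · classical
    have := Fintype.ofFinite S
    simp only [finprod_eq_prod_of_fintype] at hn
    set z : M := ∑ s, (n s : M) * y s with hz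
    have hz' : ∏ s, Multiplicative.ofAdd (y s) ^ n s = Multiplicative.ofAdd z := by
      simp [hz, ofAdd_sum, ← ofAdd_nsmul]
    rw [hz'] at hn
    obtain ⟨P, R, hR, -, -, hPR⟩ := hT.exists_mul_aeval_eq 0 (z := z) fun γ hγ' =>
      congrArg Multiplicative.toAdd (hn γ hγ')
    obtain ⟨G, P, R, rfl, rfl, hco⟩ := exists_eq_mul_isCoprime P hR
    have hinj := hT.aeval_injective 0
    have hR' := right_ne_zero_of_mul hR
    have hG : aeval (R := A) (algebraMap (RatFunc K) M RatFunc.X) G ≠ 0 := fun h =>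
      left_ne_zero_of_mul hR (hinj (h.trans (map_zero _).symm))
    have hzR : z * aeval (algebraMap (RatFunc K) M RatFunc.X) R =
        aeval (algebraMap (RatFunc K) M RatFunc.X) P := by
      refine mul_left_cancel₀ hG ?_
      rw [map_mul, map_mul] at hPR
      linear_combination hPR
    refine dvd_of_artinSchreier hpt hp hco (hinj ?_)
    have hzp : z ^ p - z = ∑ s, (n s : M) *
        (algebraMap (RatFunc K) M RatFunc.X - algebraMap A M (pt s))⁻¹ := by
      rw [hz, sum_pow_char, ← Finset.sum_sub_distrib]
      refine Finset.sum_congr rfl fun s _ => ?_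
      rw [mul_pow, ← hy s, mul_sub]
      congr 2
      exact map_natCast (frobenius M p) (n s)
    simp only [map_mul, map_sub, map_pow, map_prod, map_sum, aeval_X, aeval_C, ← hzR,
      map_natCast]
    rw [show ∀ r : M, (z * r) ^ p - z * r * r ^ (p - 1) = r ^ p * (z ^ p - z) from fun r => by
      obtain ⟨m, rfl⟩ := Nat.exists_eq_add_of_le' hp.one_lt.le
      rw [Nat.add_sub_cancel]
      ring, hzp, mul_assoc, Finset.sum_mul]
    congr 1
    refine Finset.sum_congr rfl fun s _ => ?_
    rw [← Finset.mul_prod_erase _ _ (Finset.mem_univ s), mul_assoc,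
      inv_mul_cancel_left₀ (hTpt s)]

end

namespace IsRep

variable {k M : Type*} [Field k] [Field M] [Algebra k M] [IsGalois k M]
  {Q : Type*} [Group Q] {D : Subgroup (M ≃ₐ[k] M)} {φ : (M ≃ₐ[k] M) → Q}

/-- The conjugates of an element of trace one. -/
theorem exists_equivariant_sum_eq_one [Fintype Q] (h : IsRep D φ)
    (hD : IsClosed (D : Set (M ≃ₐ[k] M))) :
    ∃ E : Q → M, (∀ γ ∈ D, ∀ x, γ (E x) = E (φ γ * x)) ∧ ∑ x, E x = 1 := by
  classical
  let S : Submonoid M :=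
    { carrier := {x | ∀ δ ∈ D, φ δ = 1 → δ x = x}
      mul_mem' := fun {a b} ha hb δ hδ h1 => by rw [map_mul, ha δ hδ h1, hb δ hδ h1]
      one_mem' := fun δ _ _ => _root_.map_one δ }
  choose τ hτD hτ using fun x : {x : Q // ∃ δ ∈ D, φ δ = x} => x.2
  let χ : {x : Q // ∃ δ ∈ D, φ δ = x} → S →* M := fun i => ((τ i : M →* M)).comp S.subtype
  have hχ : ∀ i (x : S), χ i x = τ i (x : M) := fun _ _ => rfl
  have hinj : Function.Injective χ := by
    intro i j hij
    have h1 : (τ i)⁻¹ * τ j ∈ D ∧ φ ((τ i)⁻¹ * τ j) ∈ (⊥ : Subgroup Q) := by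
      refine h.mem_of_forall_fixed hD ⊥ fun x hx => ?_
      have hxS : x ∈ S := fun δ hδ h1 => hx δ hδ (Subgroup.mem_bot.2 h1)
      have := DFunLike.congr_fun hij (⟨x, hxS⟩ : S)
      rw [hχ, hχ] at this
      rw [AlgEquiv.mul_apply, ← this]
      exact (τ i).symm_apply_apply x
    have h2 := Subgroup.mem_bot.1 h1.2
    rw [h.1 _ (inv_mem (hτD i)) _ (hτD j), h.map_inv (hτD i), hτ, hτ, inv_mul_eq_one] at h2
    exact Subtype.ext h2
  have hli := (linearIndependent_monoidHom S M).comp χ hinj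
  have h1I : ∃ δ ∈ D, φ δ = 1 := ⟨1, one_mem D, h.map_one⟩
  obtain ⟨e, he⟩ : ∃ e : S, ∑ i, τ i (e : M) ≠ 0 := by
    by_contra! hcon
    have h0 := Fintype.linearIndependent_iff.1 hli (fun _ => (1 : M)) (by
      ext x
      simpa [hχ] using hcon x)
    exact one_ne_zero (h0 ⟨1, h1I⟩)
  obtain ⟨E, hE, hE0⟩ : ∃ E : Q → M, (∀ δ ∈ D, E (φ δ) = δ (e : M)) ∧
      ∀ x, (¬ ∃ δ ∈ D, φ δ = x) → E x = 0 := by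
    refine ⟨fun x => if hx : ∃ δ ∈ D, φ δ = x then τ ⟨x, hx⟩ (e : M) else 0, fun δ hδ => ?_,
      fun x hx => dif_neg hx⟩
    have hx : ∃ δ' ∈ D, φ δ' = φ δ := ⟨δ, hδ, rfl⟩
    refine (dif_pos hx).trans ?_
    have := e.2 ((τ ⟨φ δ, hx⟩)⁻¹ * δ) (mul_mem (inv_mem (hτD _)) hδ) (by
      rw [h.1 _ (inv_mem (hτD _)) _ hδ, h.map_inv (hτD _), hτ, inv_mul_cancel])
    rw [AlgEquiv.mul_apply] at this
    exact ((τ ⟨φ δ, hx⟩).symm_apply_eq.1 this).symm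
  have hEe : ∀ γ ∈ D, ∀ x, γ (E x) = E (φ γ * x) := by
    intro γ hγ x
    by_cases hx : ∃ δ ∈ D, φ δ = x
    · obtain ⟨δ, hδ, rfl⟩ := hx
      rw [hE δ hδ, ← h.1 γ hγ δ hδ, hE _ (mul_mem hγ hδ)]
      rfl
    · rw [hE0 x hx, map_zero, hE0]
      rintro ⟨δ, hδ, h1⟩
      refine hx ⟨γ⁻¹ * δ, mul_mem (inv_mem hγ) hδ, ?_⟩
      rw [h.1 _ (inv_mem hγ) _ hδ, h.map_inv hγ, h1, inv_mul_cancel_left]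
  have hsum : ∑ x, E x = ∑ i, τ i (e : M) := by
    rw [← Finset.sum_filter_of_ne (p := fun x => ∃ δ ∈ D, φ δ = x)
      fun x _ hx => not_imp_comm.1 (hE0 x) hx,
      Finset.sum_subtype (p := fun x => ∃ δ ∈ D, φ δ = x) _ (by simp)]
    refine Finset.sum_congr rfl fun i _ => ?_
    rw [← hE _ (hτD i), hτ]
  have ht : ∀ γ ∈ D, γ (∑ x, E x) = ∑ x, E x := fun γ hγ => by
    rw [map_sum]
    simp only [hEe γ hγ]
    exact Equiv.sum_comp (Equiv.mulLeft (φ γ)) E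
  refine ⟨fun x => E x * (∑ x, E x)⁻¹, fun γ hγ x => ?_, ?_⟩
  · rw [map_mul, map_inv₀, ht γ hγ, hEe γ hγ]
  · rw [← Finset.sum_mul, mul_inv_cancel₀ (hsum ▸ he)]

end IsRep

theorem exists_hom_natCast (M : Type*) [Field M] {p : ℕ} [Fact p.Prime] [CharP M p]
    {G : Type*} [Group G] (B : Subgroup G) (hB : Nat.card B = p) :
    ∃ (θ : G → M) (η : M → G), (∀ b ∈ B, ∀ b' ∈ B, θ (b * b') = θ b + θ b') ∧
      (∀ b ∈ B, θ b ^ p = θ b) ∧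
      (∀ c, c ^ p = c → η c ∈ B) ∧ (∀ b ∈ B, η (θ b) = b) ∧
      (∀ c c', c ^ p = c → c' ^ p = c' → η (c + c') = η c * η c') := by
  classical
  have hcard : Nat.card (Multiplicative (⊥ : Subfield M)) = p := Subfield.card_bot M p
  let E : B ≃* Multiplicative (⊥ : Subfield M) := mulEquivOfPrimeCardEq hB hcard
  obtain ⟨θ, hθ⟩ : ∃ θ : G → M, ∀ b (h : b ∈ B), θ b = ((E ⟨b, h⟩).toAdd : M) :=
    ⟨fun g => if h : g ∈ B then ((E ⟨g, h⟩).toAdd : M) else 0, fun b hb => dif_pos hb⟩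
  obtain ⟨η, hη⟩ : ∃ η : M → G, ∀ c (h : c ∈ (⊥ : Subfield M)),
      η c = (E.symm (Multiplicative.ofAdd ⟨c, h⟩) : B) :=
    ⟨fun c => if h : c ∈ (⊥ : Subfield M) then (E.symm (Multiplicative.ofAdd ⟨c, h⟩) : B) else 1,
      fun b hb => dif_pos hb⟩
  have hbot : ∀ {c : M}, c ^ p = c → c ∈ (⊥ : Subfield M) := fun h =>
    (Subfield.mem_bot_iff_pow_eq_self M p).2 h
  refine ⟨θ, η, fun b hb b' hb' => ?_, fun b hb => ?_, fun c hc => ?_, fun b hb => ?_,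
    fun c c' hc hc' => ?_⟩
  · rw [hθ b hb, hθ b' hb', hθ _ (mul_mem hb hb'), ← Subfield.coe_add, ← toAdd_mul, ← map_mul E]
    rfl
  · rw [hθ b hb]
    exact (Subfield.mem_bot_iff_pow_eq_self M p).1 (E ⟨b, hb⟩).toAdd.2
  · rw [hη c (hbot hc)]
    exact SetLike.coe_mem _
  · rw [hη _ (by rw [hθ b hb]; exact SetLike.coe_mem _)]
    simp [hθ b hb]
  · rw [hη c (hbot hc), hη c' (hbot hc'), hη _ (add_mem (hbot hc) (hbot hc')), ← Subgroup.coe_mul,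
      ← map_mul E.symm]
    rfl

namespace IsRep

variable {k M : Type*} [Field k] [Field M] [Algebra k M] [IsGalois k M]
  {G Q : Type*} [Group G] [Group Q] {D : Subgroup (M ≃ₐ[k] M)} {φ : (M ≃ₐ[k] M) → Q}

/-- Central embedding problems with kernel of order the characteristic are solvable. -/
theorem exists_lift_char [Finite G] [IsSepClosed M] {p : ℕ} (hp : p.Prime) [CharP M p]
    {π : G →* Q} (hπ : Function.Surjective π) (hcent : π.ker ≤ Subgroup.center G)
    (hcard : Nat.card π.ker = p) (h : IsRep D φ) (hD : IsClosed (D : Set (M ≃ₐ[k] M))) :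
    ∃ ψ : (M ≃ₐ[k] M) → G, IsRep D ψ ∧ ∀ γ ∈ D, π (ψ γ) = φ γ := by
  classical
  have : Fact p.Prime := ⟨hp⟩
  have : Finite Q := Finite.of_surjective π hπ
  have := Fintype.ofFinite Q
  obtain ⟨θ, η, hθ, hθp, hηB, hηθ, hη⟩ := exists_hom_natCast M π.ker hcard
  obtain ⟨E, hE, hE1⟩ := h.exists_equivariant_sum_eq_one hD
  obtain ⟨s, hs, hs1⟩ : ∃ s : Q → G, (∀ x, π (s x) = x) ∧ s 1 = 1 := by
    refine ⟨Function.update (Function.surjInv hπ) 1 1, fun x => ?_, Function.update_self ..⟩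
    rcases eq_or_ne x 1 with rfl | hx
    · simp
    · rw [Function.update_of_ne hx, Function.surjInv_eq hπ]
  set c : Q → Q → G := fun x y => s x * s y * (s (x * y))⁻¹ with hc
  have hcB : ∀ x y, c x y ∈ π.ker := fun x y => by simp [hc, MonoidHom.mem_ker, hs]
  have hcz : ∀ x y g, c x y * g = g * c x y := fun x y g =>
    (Subgroup.mem_center_iff.1 (hcent (hcB x y)) g).symm
  have hss : ∀ x y, s x * s y = c x y * s (x * y) := fun x y => by simp [hc]
  have hcoc : ∀ x y z, θ (c x y) + θ (c (x * y) z) = θ (c y z) + θ (c x (y * z)) := by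
    intro x y z
    rw [← hθ _ (hcB _ _) _ (hcB _ _), ← hθ _ (hcB _ _) _ (hcB _ _)]
    congr 1
    refine mul_right_cancel (b := s (x * y * z)) ?_
    rw [mul_assoc, ← hss, ← mul_assoc, ← hss, mul_assoc, hss y z, ← mul_assoc, ← hcz,
      mul_assoc, hss, ← mul_assoc, mul_assoc x]
  have hθ1 : θ 1 = 0 := by simpa using hθ 1 (one_mem _) 1 (one_mem _)
  have hpfix : ∀ (γ : M ≃ₐ[k] M) (a : M), a ^ p = a → γ a = a := fun γ a ha => by
    have := (Subfield.mem_bot_iff_pow_eq_self M p).2 ha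
    rw [← ZMod.fieldRange_castHom_eq_bot p] at this
    obtain ⟨n, hn⟩ := this
    obtain ⟨n, rfl⟩ := ZMod.natCast_zmod_surjective n
    rw [← hn]
    simp
  have hfix : ∀ b ∈ π.ker, ∀ γ : M ≃ₐ[k] M, γ (θ b) = θ b := fun b hb γ =>
    hpfix γ _ (hθp b hb)
  have hη1 : η 0 = 1 := by rw [← hθ1, hηθ 1 (one_mem _)]
  set b : Q → M := fun x => ∑ y, θ (c x y) * E (x * y) with hb
  have hb1 : b 1 = 0 := by simp [hb, hc, hs1, hθ1]
  have hbc : ∀ γ ∈ D, ∀ x, b (φ γ) + γ (b x) = b (φ γ * x) + θ (c (φ γ) x) := by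
    intro γ hγ x
    have h1 : b (φ γ) = ∑ y, θ (c (φ γ) (x * y)) * E (φ γ * x * y) := by
      refine (Equiv.sum_comp (Equiv.mulLeft x) fun y => θ (c (φ γ) y) * E (φ γ * y)).symm.trans ?_
      simp [mul_assoc]
    rw [h1]
    have h2 : γ (b x) = ∑ y, θ (c x y) * E (φ γ * x * y) := by
      simp only [hb, map_sum, map_mul, hfix _ (hcB _ _), hE γ hγ, mul_assoc]
    have h3 : θ (c (φ γ) x) = ∑ y, θ (c (φ γ) x) * E (φ γ * x * y) := by
      rw [← Finset.mul_sum]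
      exact ((congrArg _ ((Equiv.sum_comp (Equiv.mulLeft (φ γ * x)) E).trans hE1)).trans
        (mul_one _)).symm
    rw [h2, h3, hb, ← Finset.sum_add_distrib, ← Finset.sum_add_distrib]
    refine Finset.sum_congr rfl fun y _ => ?_
    linear_combination - E (φ γ * x * y) * hcoc (φ γ) x y
  obtain ⟨x, hx⟩ : ∃ x : M, ∀ γ ∈ D, γ x - x = b (φ γ) ^ p - b (φ γ) := by
    refine ⟨-∑ y, (b y ^ p - b y) * E y, fun γ hγ => ?_⟩
    have h1 : ∀ y, γ (b y ^ p - b y) = (b (φ γ * y) ^ p - b (φ γ * y)) -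
        (b (φ γ) ^ p - b (φ γ)) := fun y => by
      rw [map_sub, map_pow, eq_sub_of_add_eq' (hbc γ hγ y), sub_pow_char, add_pow_char,
        hθp _ (hcB _ _)]
      ring
    have h2 : ∑ y, (b (φ γ * y) ^ p - b (φ γ * y)) * E (φ γ * y) = ∑ y, (b y ^ p - b y) * E y :=
      Equiv.sum_comp (Equiv.mulLeft (φ γ)) fun y => (b y ^ p - b y) * E y
    have h3 : ∑ y, E (φ γ * y) = 1 := (Equiv.sum_comp (Equiv.mulLeft (φ γ)) E).trans hE1
    rw [map_neg, map_sum]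
    simp only [map_mul, h1, hE γ hγ, sub_mul _ (b (φ γ) ^ p - b (φ γ)), Finset.sum_sub_distrib,
      ← Finset.mul_sum]
    rw [h2, h3]
    ring
  obtain ⟨y, hy⟩ : ∃ y : M, y ^ p - y = x := by
    obtain ⟨y, hy⟩ := IsSepClosed.exists_root_C_mul_X_pow_add_C_mul_X_add_C' (k := M) p p 1 (-1)
      (-x) dvd_rfl hp.two_le (by simp)
    exact ⟨y, by linear_combination hy⟩
  set f : (M ≃ₐ[k] M) → M := fun γ => γ y - y - b (φ γ) with hf
  have hfp : ∀ γ ∈ D, f γ ^ p = f γ := fun γ hγ => by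
    have := hx γ hγ
    rw [← hy, map_sub, map_pow] at this
    rw [hf, sub_pow_char, sub_pow_char]
    linear_combination this
  have hfη : ∀ γ ∈ D, ∀ δ : M ≃ₐ[k] M, δ (f γ) = f γ := fun γ hγ δ => hpfix δ _ (hfp γ hγ)
  have hfc : ∀ γ ∈ D, ∀ δ ∈ D, f γ + f δ + θ (c (φ γ) (φ δ)) = f (γ * δ) := by
    intro γ hγ δ hδ
    have h1 := hbc γ hγ (φ δ)
    have h2 := hfη δ hδ γ
    simp only [hf, map_sub, h.1 γ hγ δ hδ, AlgEquiv.mul_apply] at h2 ⊢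
    linear_combination -h2 - h1
  refine ⟨fun γ => η (f γ) * s (φ γ), ⟨fun γ hγ δ hδ => ?_, ?_⟩, fun γ hγ => ?_⟩
  · dsimp only
    rw [← hfc γ hγ δ hδ, hη _ _ ?_ (hθp _ (hcB _ _)), hη _ _ (hfp γ hγ) (hfp δ hδ),
      hηθ _ (hcB _ _), h.1 γ hγ δ hδ, mul_assoc, ← hss]
    · have := Subgroup.mem_center_iff.1 (hcent (hηB _ (hfp δ hδ))) (s (φ γ))
      rw [mul_assoc (η (f γ)) (s (φ γ)), ← mul_assoc (s (φ γ)) (η (f δ)), this]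
      simp only [mul_assoc]
    · rw [add_pow_char, hfp γ hγ, hfp δ hδ]
  · obtain ⟨U, hU, hUn, hU1⟩ := h.2
    obtain ⟨V, hV, hVn, hV1⟩ := exists_open_normal_fixing (k := k) (Set.finite_singleton y)
    refine ⟨U ⊓ V, hU.inter hV, inferInstance, fun γ hγ hγD => ?_⟩
    rw [hf]
    simp only
    rw [hU1 γ hγ.1 hγD, hV1 γ hγ.2 y rfl, hb1, sub_self, sub_zero, hη1, hs1, one_mul]
  · rw [map_mul, hs, (MonoidHom.mem_ker).1 (hηB _ (hfp γ hγ)), one_mul]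

end IsRep

/-- The central step for the constant tower, in the case of the characteristic. -/
theorem centralStep_char {K A k M : Type*} [Field K] [Finite K] [Field A] [Algebra K A]
    [IsAlgClosed A] [Algebra.IsAlgebraic K A] [Field k] [Field M] [Algebra k M] [Algebra A M]
    [Algebra K k] [Algebra K M] [IsScalarTower K A M] [IsScalarTower K k M] [IsGalois k M]
    [IsSepClosed M] {p : ℕ} (hp : p.Prime) [CharP M p] {T : ℕ → M} :
    CentralStep.{u} p (levelSubgroup K A k T) :=
  fun _ _ _ _ _ _ _ hπ hcent hcard e i he hpe _ hφ =>
    ⟨e, i, dvd_rfl, he, hpe, le_rfl, hφ.exists_lift_char hp hπ hcent hcard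
      (Subgroup.isClosed_of_isOpen _ (isOpen_levelSubgroup i he))⟩

section SepClosure

theorem IsSepClosure.of_comp {k k' Ω : Type*} [Field k] [Field k'] [Field Ω] [Algebra k Ω]
    [Algebra k' Ω] [IsSepClosed Ω] [Algebra.IsSeparable k Ω] (f : k →+* k')
    (hf : (algebraMap k' Ω).comp f = algebraMap k Ω) : IsSepClosure k' Ω where
  sep_closed := inferInstance
  separable := ⟨fun x => by
    have h1 := (Algebra.IsSeparable.isSeparable k x)
    refine Polynomial.Separable.of_dvd (Polynomial.Separable.map (f := f) h1) (minpoly.dvd _ _ ?_)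
    rw [Polynomial.aeval_def, Polynomial.eval₂_map, hf]
    exact minpoly.aeval k x⟩

/-- A separable endomorphism of the base field extends to separable closures. -/
theorem exists_ringEquiv_comp_eq {k Ω : Type*} [Field k] [Field Ω] [Algebra k Ω] [IsSepClosed Ω]
    [Algebra.IsSeparable k Ω] (τ : k →+* Ω) (f : k →+* k) (hf : τ.comp f = algebraMap k Ω) :
    ∃ ψ : Ω ≃+* Ω, ∀ c, ψ (algebraMap k Ω c) = τ c := by
  have : IsSepClosure k Ω := ⟨inferInstance, inferInstance⟩
  have : @IsSepClosure k _ Ω _ τ.toAlgebra :=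
    @IsSepClosure.of_comp k k Ω _ _ _ _ τ.toAlgebra _ _ f hf
  let e := @IsSepClosure.equiv k _ Ω Ω _ _ τ.toAlgebra _ _ _
  exact ⟨@AlgEquiv.toRingEquiv k Ω Ω _ _ _ _ τ.toAlgebra e,
    @AlgEquiv.commutes k Ω Ω _ _ _ _ τ.toAlgebra e⟩

end SepClosure

section RatFunc

theorem RatFunc.ringHom_ext' {K R : Type*} [Field K] [CommRing R] {f g : RatFunc K →+* R}
    (hC : ∀ c : K, f (algebraMap K (RatFunc K) c) = g (algebraMap K (RatFunc K) c))
    (hX : f RatFunc.X = g RatFunc.X) : f = g := by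
  refine IsLocalization.ringHom_ext (nonZeroDivisors (Polynomial K))
    (Polynomial.ringHom_ext (fun c => ?_) ?_)
  · simpa [RatFunc.algebraMap_C] using hC c
  · simpa using hX

theorem RatFunc.exists_ringHom {K Ω : Type*} [Field K] [Field Ω] [Algebra K Ω] {t : Ω}
    (ht : Transcendental K t) : ∃ τ : RatFunc K →+* Ω,
      (∀ c : K, τ (algebraMap K (RatFunc K) c) = algebraMap K Ω c) ∧ τ RatFunc.X = t := by
  refine ⟨IsFractionRing.lift (A := Polynomial K) (g := (Polynomial.aeval t).toRingHom)
    (transcendental_iff_injective.1 ht), fun c => ?_, ?_⟩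
  · rw [IsScalarTower.algebraMap_apply K (Polynomial K) (RatFunc K), IsFractionRing.lift_algebraMap]
    simp
  · rw [← RatFunc.algebraMap_X, IsFractionRing.lift_algebraMap]
    simp

end RatFunc

section Conj

variable {k Ω : Type*} [Field k] [Field Ω] [Algebra k Ω]

theorem continuous_of_apply_eq_conj [IsGalois k Ω] (ψ : Ω ≃+* Ω)
    (r : (Ω ≃ₐ[k] Ω) →* (Ω ≃ₐ[k] Ω)) (hr : ∀ γ x, r γ x = ψ (γ (ψ.symm x))) : Continuous r := by
  refine continuous_of_continuousAt_one r ?_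
  rw [ContinuousAt, map_one]
  intro s hs
  obtain ⟨E, hE, hEs⟩ := (krullTopology_mem_nhds_one_iff k Ω s).1 hs
  let b := Module.finBasis k E
  obtain ⟨U, hU, -, hUb⟩ := exists_open_normal_fixing (k := k)
    (Set.finite_range fun i => ψ.symm (b i : Ω))
  refine Filter.mem_map.2 (Filter.mem_of_superset (hU.mem_nhds (one_mem U)) fun γ hγ => hEs ?_)
  have h1 : ((r γ : Ω →ₐ[k] Ω).toLinearMap ∘ₗ E.val.toLinearMap) = E.val.toLinearMap :=
    b.ext fun i => by
      change r γ (b i) = b i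
      rw [hr, hUb γ hγ _ ⟨i, rfl⟩, ψ.apply_symm_apply]
  rw [SetLike.mem_coe, IntermediateField.mem_fixingSubgroup_iff]
  exact fun x hx => LinearMap.congr_fun h1 ⟨x, hx⟩

/-- Conjugation by a ring automorphism, on the automorphisms whose conjugates fix `k`. -/
theorem exists_conj_hom (ψ : Ω ≃+* Ω)
    (h : ∀ (γ : Ω ≃ₐ[k] Ω) (c : k), ψ (γ (ψ.symm (algebraMap k Ω c))) = algebraMap k Ω c) :
    ∃ r : (Ω ≃ₐ[k] Ω) →* (Ω ≃ₐ[k] Ω), ∀ γ x, r γ x = ψ (γ (ψ.symm x)) :=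
  ⟨{ toFun := fun γ => AlgEquiv.ofRingEquiv (f := ψ.symm.trans (γ.toRingEquiv.trans ψ)) (h γ)
     map_one' := AlgEquiv.ext fun x => ψ.apply_symm_apply x
     map_mul' := fun γ δ => AlgEquiv.ext fun x => by
      change ψ (γ (δ _)) = ψ (γ (ψ.symm (ψ (δ _))))
      rw [ψ.symm_apply_apply] }, fun _ _ => rfl⟩

end Conj

theorem IsRep.comp_hom {Γ Γ' Q : Type*} [Group Γ] [TopologicalSpace Γ] [Group Γ']
    [TopologicalSpace Γ'] [Group Q] {D : Subgroup Γ'} {φ : Γ' → Q} (h : IsRep D φ) {r : Γ →* Γ'}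
    (hr : Continuous r) (hD : ∀ x, r x ∈ D) : IsRep ⊤ fun x => φ (r x) := by
  obtain ⟨U, hU, hUn, hU1⟩ := h.2
  exact ⟨fun x _ y _ => by dsimp only; rw [map_mul, h.1 _ (hD x) _ (hD y)],
    U.comap r, hU.preimage hr, inferInstance, fun x hx _ => hU1 _ hx (hD x)⟩

section FiniteSubfield

variable {K A Ω : Type*} [Field K] [Finite K] [Field A] [Algebra K A] [IsAlgClosed A] [Field Ω]
  [Algebra A Ω]

theorem mem_range_algebraMap_of_pow_eq {n : ℕ} (hn : 1 < n) {y : Ω} (hy : y ^ n = y) :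
    ∃ a : A, a ^ n = a ∧ algebraMap A Ω a = y := by
  have h := (IsAlgClosed.splits
    (Polynomial.X ^ n - Polynomial.X : Polynomial A)).mem_range_of_isRoot
    (FiniteField.X_pow_card_sub_X_ne_zero A hn) (i := algebraMap A Ω) (x := y) (by simp [hy])
  obtain ⟨a, rfl⟩ := h
  exact ⟨a, (algebraMap A Ω).injective (by rw [map_pow, hy]), rfl⟩

end FiniteSubfield

section PerPrime

variable {K A M : Type*} [Field K] [Finite K] [Field A] [Algebra K A] [IsAlgClosed A]
  [Algebra.IsAlgebraic K A] [Field M] [Algebra (RatFunc K) M] [Algebra A M]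
  [Algebra K M] [IsScalarTower K A M] [IsScalarTower K (RatFunc K) M] [IsGalois (RatFunc K) M]

theorem exists_rep_char [IsSepClosed M] {p : ℕ} (hp : p.Prime) [CharP A p]
    {d : ℕ} (hd : 0 < d) {fr : (M ≃ₐ[RatFunc K] M) →* Multiplicative (ZMod d)}
    (hfr : ∀ γ : M ≃ₐ[RatFunc K] M, ∀ n : ℕ,
      fr γ = Multiplicative.ofAdd (n : ZMod d) ↔ ∀ a : A, a ^ Nat.card K ^ d = a →
        γ (algebraMap A M a) = algebraMap A M (a ^ Nat.card K ^ n))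
    (N : Type u) [Group N] [Finite N] (hN : IsPGroup p N)
    (act : Multiplicative (ZMod d) →* MulAut N) :
    ∃ ρ : (M ≃ₐ[RatFunc K] M) → N ⋊[act] Multiplicative (ZMod d), IsRep ⊤ ρ ∧
      (∀ γ, (ρ γ).right = fr γ) ∧ ∀ n, ∃ γ, fr γ = 1 ∧ (ρ γ).left = n := by
  have : Fact p.Prime := ⟨hp⟩
  have : CharP M p := charP_of_injective_algebraMap (algebraMap A M).injective p
  obtain ⟨i, ρ, h1, h2, h3⟩ := exists_semidirect_rep
    (isTower_levelSubgroup (K := K) (A := A) (k := RatFunc K)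
      (T := fun _ => algebraMap (RatFunc K) M RatFunc.X) (fun _ _ h => h) p)
    (centralStep_char hp) hd fr (initialStep_char hp hd hfr)
    (fun e i he γ hγ => frobDegree_pow_eq_one hd hfr i he hγ) N hN act
  have htop : ∀ γ : M ≃ₐ[RatFunc K] M, γ ∈ levelSubgroup K A (RatFunc K)
      (fun _ => algebraMap (RatFunc K) M RatFunc.X) 1 i := fun γ =>
    mem_levelSubgroup_one.2 (γ.commutes _)
  refine ⟨ρ, ?_, fun γ => h2 γ (htop γ), fun n => ?_⟩
  · rwa [(Subgroup.eq_top_iff' _).2 htop] at h1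
  · obtain ⟨γ, hγ, hn⟩ := h3 n
    exact ⟨γ, ((mem_levelSubgroup_iff_of_frobDegree hfr).1 hγ).2, hn⟩

theorem SplitTower.exists_rep {ℓ : ℕ} {T : ℕ → M} (hT : SplitTower K A ℓ T) (hℓ : ℓ.Prime)
    (hℓA : (ℓ : A) ≠ 0) (hℓK : ¬ ℓ ∣ Nat.card K)
    {d : ℕ} (hd : 0 < d) {fr : (M ≃ₐ[RatFunc K] M) →* Multiplicative (ZMod d)}
    (hfr : ∀ γ : M ≃ₐ[RatFunc K] M, ∀ n : ℕ,
      fr γ = Multiplicative.ofAdd (n : ZMod d) ↔ ∀ a : A, a ^ Nat.card K ^ d = a →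
        γ (algebraMap A M a) = algebraMap A M (a ^ Nat.card K ^ n))
    (N : Type u) [Group N] [Finite N] (hN : IsPGroup ℓ N)
    (act : Multiplicative (ZMod d) →* MulAut N) :
    ∃ i, ∃ ρ : (M ≃ₐ[RatFunc K] M) → N ⋊[act] Multiplicative (ZMod d),
      IsRep (levelSubgroup K A (RatFunc K) T 1 i) ρ ∧
      (∀ γ, γ (T i) = T i → (ρ γ).right = fr γ) ∧
      ∀ n, ∃ γ, γ (T i) = T i ∧ fr γ = 1 ∧ (ρ γ).left = n := by
  have : Fact ℓ.Prime := ⟨hℓ⟩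
  have hP := hT.placeTower hℓA
  obtain ⟨i, ρ, h1, h2, h3⟩ := exists_semidirect_rep
    (isTower_levelSubgroup hP.apply_eq_of_succ ℓ)
    (hP.centralStep hℓ hℓA hℓK) hd fr
    (hP.initialStep hℓ hℓA hℓK (fun γ => by rw [hT.zero, γ.commutes]) hd hfr)
    (fun e i he γ hγ => frobDegree_pow_eq_one hd hfr i he hγ) N hN act
  refine ⟨i, ρ, h1, fun γ hγ => h2 γ (mem_levelSubgroup_one.2 hγ), fun n => ?_⟩
  obtain ⟨γ, hγ, hn⟩ := h3 n
  exact ⟨γ, hγ.1, ((mem_levelSubgroup_iff_of_frobDegree hfr).1 hγ).2, hn⟩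

end PerPrime

section Transport

variable {K A Ω : Type*} [Field K] [Finite K] [Field A] [Algebra K A] [IsAlgClosed A]
  [Algebra.IsAlgebraic K A] [Field Ω] [Algebra (RatFunc K) Ω] [Algebra A Ω]
  [Algebra K Ω] [IsScalarTower K A Ω] [IsScalarTower K (RatFunc K) Ω] [IsGalois (RatFunc K) Ω]
  [IsSepClosed Ω]

omit [Finite K] in
/-- The change of variable `X ↦ T i` extends to the separable closure. -/
theorem SplitTower.exists_ringEquiv {ℓ : ℕ} {T : ℕ → Ω} (hℓ : 0 < ℓ) {i : ℕ}
    (hT : T i ^ ℓ ^ i = algebraMap (RatFunc K) Ω RatFunc.X) : ∃ ψ : Ω ≃+* Ω,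
      (∀ c : K, ψ (algebraMap K Ω c) = algebraMap K Ω c) ∧
      ψ (algebraMap (RatFunc K) Ω RatFunc.X) = T i := by
  have hX : Transcendental K (algebraMap (RatFunc K) Ω RatFunc.X) :=
    (transcendental_algebraMap_iff (algebraMap (RatFunc K) Ω).injective).2 RatFunc.transcendental_X
  have ht : Transcendental K (T i) := fun h => hX (hT ▸ h.pow _)
  obtain ⟨τ, hτK, hτX⟩ := RatFunc.exists_ringHom ht
  obtain ⟨f, hfK, hfX⟩ := RatFunc.exists_ringHom (K := K) (Ω := RatFunc K)
    (t := RatFunc.X ^ ℓ ^ i) (RatFunc.transcendental_X.pow (pow_pos hℓ i))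
  obtain ⟨ψ, hψ⟩ := exists_ringEquiv_comp_eq τ f (RatFunc.ringHom_ext' (fun c => by
    rw [RingHom.comp_apply, hfK, hτK, ← IsScalarTower.algebraMap_apply]) (by
    rw [RingHom.comp_apply, hfX, map_pow, hτX, hT]))
  exact ⟨ψ, fun c => by rw [IsScalarTower.algebraMap_apply K (RatFunc K) Ω, hψ, hτK,
    ← IsScalarTower.algebraMap_apply], by rw [hψ, hτX]⟩

omit [IsScalarTower K A Ω] in
theorem SplitTower.exists_rep_top {E : IntermediateField (RatFunc K) Ω} [Normal (RatFunc K) E]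
    [Algebra A E] [IsScalarTower A E Ω] [IsScalarTower K A E] {ℓ : ℕ} {T : ℕ → E}
    (hT : SplitTower K A ℓ T) (hℓ : ℓ.Prime) (hℓA : (ℓ : A) ≠ 0) (hℓK : ¬ ℓ ∣ Nat.card K)
    {d : ℕ} (hd : 0 < d) {fr : (Ω ≃ₐ[RatFunc K] Ω) →* Multiplicative (ZMod d)}
    (hfr : ∀ γ : Ω ≃ₐ[RatFunc K] Ω, ∀ n : ℕ,
      fr γ = Multiplicative.ofAdd (n : ZMod d) ↔ ∀ a : A, a ^ Nat.card K ^ d = a →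
        γ (algebraMap A Ω a) = algebraMap A Ω (a ^ Nat.card K ^ n))
    (N : Type u) [Group N] [Finite N] (hN : IsPGroup ℓ N)
    (act : Multiplicative (ZMod d) →* MulAut N) :
    ∃ ρ : (Ω ≃ₐ[RatFunc K] Ω) → N ⋊[act] Multiplicative (ZMod d), IsRep ⊤ ρ ∧
      (∀ γ, (ρ γ).right = fr γ) ∧ ∀ n, ∃ γ, fr γ = 1 ∧ (ρ γ).left = n := by
  have : NeZero d := ⟨hd.ne'⟩
  have : IsGalois (RatFunc K) E := ⟨⟩
  obtain ⟨frE, hfrE⟩ := exists_frobDegree K A (RatFunc K) E hd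
  obtain ⟨i, ρ, h1, h2, h3⟩ := hT.exists_rep hℓ hℓA hℓK hd hfrE N hN act
  have hTi : (T i : Ω) ^ ℓ ^ i = algebraMap (RatFunc K) Ω RatFunc.X :=
    congrArg Subtype.val (hT.pow_eq_algebraMap i)
  obtain ⟨ψ, hψK, hψX⟩ := SplitTower.exists_ringEquiv (K := K) (T := fun i => (T i : Ω))
    hℓ.pos hTi
  have hψX' : ψ.symm (algebraMap (RatFunc K) Ω RatFunc.X) =
      algebraMap (RatFunc K) Ω RatFunc.X ^ ℓ ^ i := by
    rw [ψ.symm_apply_eq, map_pow, hψX, hTi]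
  have hfix : ∀ (χ : Ω ≃+* Ω), χ (algebraMap (RatFunc K) Ω RatFunc.X) =
      algebraMap (RatFunc K) Ω RatFunc.X → (∀ c : K, χ (algebraMap K Ω c) = algebraMap K Ω c) →
      ∀ c, χ (algebraMap (RatFunc K) Ω c) = algebraMap (RatFunc K) Ω c := fun χ hX hK =>
    RingHom.congr_fun (RatFunc.ringHom_ext' (f := (χ : Ω →+* Ω).comp (algebraMap (RatFunc K) Ω))
      (fun c => by
        rw [RingHom.comp_apply, ← IsScalarTower.algebraMap_apply]
        exact hK c) hX)
  have hψK' : ∀ c : K, ψ.symm (algebraMap K Ω c) = algebraMap K Ω c := fun c => by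
    rw [ψ.symm_apply_eq, hψK]
  have hγK : ∀ (γ : Ω ≃ₐ[RatFunc K] Ω) (c : K), γ (algebraMap K Ω c) = algebraMap K Ω c :=
    fun γ c => by rw [IsScalarTower.algebraMap_apply K (RatFunc K) Ω, γ.commutes]
  obtain ⟨r, hr⟩ := exists_conj_hom (k := RatFunc K) ψ fun γ =>
    hfix (ψ.symm.trans (γ.toRingEquiv.trans ψ)) (by
      change ψ (γ (ψ.symm _)) = _
      rw [hψX', map_pow, γ.commutes, map_pow, hψX, hTi]) (fun c => by
      change ψ (γ (ψ.symm _)) = _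
      rw [hψK', hγK, hψK])
  have hrT : ∀ γ, r γ (T i) = T i := fun γ => by
    rw [hr, ← hψX, ψ.symm_apply_apply, γ.commutes]
  have hqd : 1 < Nat.card K ^ d := Nat.one_lt_pow hd.ne' Finite.one_lt_card
  let R := AlgEquiv.restrictNormalHom (F := RatFunc K) (K₁ := Ω) E
  have hR : ∀ (γ : Ω ≃ₐ[RatFunc K] Ω) (x : E), (R γ x : Ω) = γ x := fun γ x =>
    AlgEquiv.restrictNormal_commutes γ E x
  have hAE : ∀ a : A, ((algebraMap A E a : E) : Ω) = algebraMap A Ω a := fun a =>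
    (IsScalarTower.algebraMap_apply A E Ω a).symm
  have hfrR : ∀ γ, frE (R (r γ)) = fr γ := fun γ => by
    obtain ⟨n, hn⟩ : ∃ n : ℕ, fr γ = Multiplicative.ofAdd (n : ZMod d) :=
      ⟨(fr γ).toAdd.val, by simp⟩
    rw [hn, hfrE]
    intro a ha
    refine Subtype.ext ?_
    rw [hR, hAE, hAE, hr]
    obtain ⟨a', ha', h⟩ := mem_range_algebraMap_of_pow_eq (A := A) hqd
      (y := ψ.symm (algebraMap A Ω a)) (by rw [← map_pow, ← map_pow, ha])
    rw [← h, (hfr γ n).1 hn a' ha', map_pow, map_pow, h, ψ.apply_symm_apply, map_pow]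
  have hRT : ∀ γ, R (r γ) (T i) = T i := fun γ => Subtype.ext (by rw [hR, hrT])
  refine ⟨fun γ => ρ (R (r γ)), h1.comp_hom (r := R.comp r)
    ((InfiniteGalois.restrictNormalHom_continuous E).comp (continuous_of_apply_eq_conj ψ r hr))
    fun γ => mem_levelSubgroup_one.2 (hRT γ), fun γ => by rw [h2 _ (hRT γ), hfrR], fun n => ?_⟩
  obtain ⟨δ, hδT, hδ, hn⟩ := h3 n
  obtain ⟨γ, hγ⟩ := AlgEquiv.restrictNormalHom_surjective (F := RatFunc K) (K₁ := E) Ω δ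
  have hγT : γ (T i) = T i := by rw [← hR, show R γ = δ from hγ, hδT]
  have hγψ : ∀ c, ψ.symm (γ (ψ (algebraMap (RatFunc K) Ω c))) = algebraMap (RatFunc K) Ω c :=
    hfix (ψ.trans (γ.toRingEquiv.trans ψ.symm)) (by
      change ψ.symm (γ (ψ _)) = _
      rw [hψX, hγT, ψ.symm_apply_eq, hψX]) (fun c => by
      change ψ.symm (γ (ψ _)) = _
      rw [hψK, hγK, hψK'])
  have hrγ : r (AlgEquiv.ofRingEquiv (f := ψ.trans (γ.toRingEquiv.trans ψ.symm)) hγψ) = γ :=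
    AlgEquiv.ext fun x => by
      rw [hr]
      change ψ (ψ.symm (γ (ψ (ψ.symm x)))) = γ x
      rw [ψ.apply_symm_apply, ψ.apply_symm_apply]
  refine ⟨AlgEquiv.ofRingEquiv (f := ψ.trans (γ.toRingEquiv.trans ψ.symm)) hγψ, ?_, ?_⟩
  · rw [← hfrR, hrγ, ← hδ]
    exact congrArg frE hγ
  · dsimp only
    rw [hrγ, ← hn]
    exact congrArg (fun x => (ρ x).left) hγ

theorem exists_rep_prime {ℓ : ℕ} (hℓ : ℓ.Prime)
    {d : ℕ} (hd : 0 < d) {fr : (Ω ≃ₐ[RatFunc K] Ω) →* Multiplicative (ZMod d)}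
    (hfr : ∀ γ : Ω ≃ₐ[RatFunc K] Ω, ∀ n : ℕ,
      fr γ = Multiplicative.ofAdd (n : ZMod d) ↔ ∀ a : A, a ^ Nat.card K ^ d = a →
        γ (algebraMap A Ω a) = algebraMap A Ω (a ^ Nat.card K ^ n))
    (N : Type u) [Group N] [Finite N] (hN : IsPGroup ℓ N)
    (act : Multiplicative (ZMod d) →* MulAut N) :
    ∃ ρ : (Ω ≃ₐ[RatFunc K] Ω) → N ⋊[act] Multiplicative (ZMod d), IsRep ⊤ ρ ∧
      (∀ γ, (ρ γ).right = fr γ) ∧ ∀ n, ∃ γ, fr γ = 1 ∧ (ρ γ).left = n := by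
  by_cases hℓA : (ℓ : A) = 0
  · have : CharP A ℓ := by
      obtain ⟨p, hp⟩ := CharP.exists A
      obtain h | h := (Nat.dvd_prime hℓ).1 ((CharP.cast_eq_zero_iff A p ℓ).1 hℓA)
      · exact (CharP.char_ne_one A p h).elim
      · rwa [← h]
    exact exists_rep_char hℓ hd hfr N hN act
  have hℓΩ : (ℓ : Ω) ≠ 0 := fun h => hℓA ((algebraMap A Ω).injective (by simpa using h))
  have hℓK : ¬ ℓ ∣ Nat.card K := fun h => hℓA (by
    have : Fact ℓ.Prime := ⟨hℓ⟩
    obtain ⟨x, hx⟩ := exists_prime_addOrderOf_dvd_card' ℓ h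
    have hx0 : x ≠ 0 := fun h0 => hℓ.ne_one (by rw [← hx, h0, addOrderOf_zero])
    have h1 : (ℓ : K) * x = 0 := by rw [← nsmul_eq_mul, ← hx, addOrderOf_nsmul_eq_zero]
    have h2 := (mul_eq_zero.1 h1).resolve_right hx0
    rw [← map_natCast (algebraMap K A), h2, map_zero])
  obtain ⟨T, hT⟩ := exists_splitTower (K := K) (A := A) (Ω := Ω) hℓA hℓΩ
  let : Algebra A (splitField K A Ω ℓ) :=
    ((algebraMap A Ω).codRestrict _ algebraMap_mem_splitField).toAlgebra
  have : IsScalarTower A (splitField K A Ω ℓ) Ω := IsScalarTower.of_algebraMap_eq fun _ => rfl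
  have : IsScalarTower K A (splitField K A Ω ℓ) := IsScalarTower.of_algebraMap_eq fun c =>
    Subtype.ext (IsScalarTower.algebraMap_apply K A Ω c)
  exact SplitTower.exists_rep_top hT hℓ hℓA hℓK hd hfr N hN act

end Transport

/-- Homomorphisms onto groups of pairwise coprime orders are jointly surjective. -/
theorem MonoidHom.surjective_pi_of_coprime {ι H : Type*} [Finite ι] [Group H] {P : ι → Type*}
    [∀ i, Group (P i)] [∀ i, Finite (P i)] (f : ∀ i, H →* P i)
    (hf : ∀ i, Function.Surjective (f i))
    (hP : Pairwise fun i j => (Nat.card (P i)).Coprime (Nat.card (P j))) :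
    Function.Surjective (MonoidHom.pi f) := by
  have := Fintype.ofFinite ι
  rw [← MonoidHom.range_eq_top]
  refine Subgroup.eq_top_of_le_card _ (Nat.le_of_dvd Nat.card_pos ?_)
  rw [Nat.card_pi]
  refine Fintype.prod_dvd_of_isRelPrime (fun i j hij => Nat.coprime_iff_isRelPrime.1 (hP hij))
    fun i => ?_
  · refine Subgroup.card_dvd_of_surjective
      ((Pi.evalMonoidHom P i).comp (MonoidHom.pi f).range.subtype)
      fun x => ?_
    obtain ⟨h, rfl⟩ := hf i x
    exact ⟨⟨MonoidHom.pi f h, h, rfl⟩, rfl⟩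

/-- Solutions for the Sylow subgroups of a nilpotent kernel combine to a solution. -/
theorem exists_hom_of_forall_prime {Γ C : Type*} [Group Γ] [TopologicalSpace Γ] [Group C]
    (fr : Γ →* C) {G : Type u} [Group G] [Finite G] (c : C →* G) (N : Subgroup G) [N.Normal]
    (hN : Group.IsNilpotent N)
    (h : ∀ ℓ : ℕ, ℓ.Prime → ∀ (P : Type u) [Group P] [Finite P], IsPGroup ℓ P →
      ∀ act : C →* MulAut P, ∃ ρ : Γ → P ⋊[act] C, IsRep ⊤ ρ ∧ (∀ γ, (ρ γ).right = fr γ) ∧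
        ∀ n, ∃ γ, fr γ = 1 ∧ (ρ γ).left = n) :
    ∃ ρ : Γ →* G, (∃ U : Subgroup Γ, IsOpen (U : Set Γ) ∧ U.Normal ∧ U ≤ ρ.ker) ∧
      (∀ γ, ρ γ * (c (fr γ))⁻¹ ∈ N) ∧ ∀ n ∈ N, ∃ γ, ρ γ = n := by
  classical
  let ι := (Nat.card N).primeFactors
  have hι : ∀ i : ι, Fact (i : ℕ).Prime := fun i => ⟨Nat.prime_of_mem_primeFactors i.2⟩
  let S : ∀ i : ι, Sylow i N := fun i => default
  have hSn : ∀ i, (S i : Subgroup N).Normal := fun i =>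
    ((Group.isNilpotent_of_finite_tfae (G := N)).out 0 3 rfl rfl).1 hN i (hι i) (S i)
  have hSc : ∀ i, (S i : Subgroup N).Characteristic := fun i =>
    (S i).characteristic_of_normal (hSn i)
  let P : ι → Subgroup G := fun i => (S i : Subgroup N).map N.subtype
  have hPN : ∀ i, P i ≤ N := fun i => Subgroup.map_subtype_le _
  have hPn : ∀ i, (P i).Normal := fun i => inferInstance
  have hPp : ∀ i : ι, IsPGroup i (P i) := fun i => (S i).isPGroup'.map _
  have hcop : Pairwise fun i j => (Nat.card (P i)).Coprime (Nat.card (P j)) := fun i j hij =>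
    IsPGroup.coprime_card_of_ne _ _ (fun h => hij (Subtype.ext h)) _ _ (hPp i) (hPp j)
  have hcomm : Pairwise fun i j => ∀ x y : G, x ∈ P i → y ∈ P j → Commute x y := fun i j hij =>
    Subgroup.commute_of_normal_of_disjoint _ _ (hPn i) (hPn j)
      (IsPGroup.disjoint_of_ne _ _ (fun h => hij (Subtype.ext h)) _ _ (hPp i) (hPp j))
  have hsup : ⨆ i, P i = N := by
    refine Subgroup.eq_of_le_of_card_ge (iSup_le hPN) (Nat.le_of_dvd Nat.card_pos ?_)
    refine (Nat.dvd_iff_prime_pow_dvd_dvd _ _).2 fun p k hp hk => ?_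
    obtain rfl | hk0 := Nat.eq_zero_or_pos k
    · simp
    let i : ι := ⟨p, Nat.mem_primeFactors.2
      ⟨hp, (dvd_pow_self p hk0.ne').trans hk, Nat.card_pos.ne'⟩⟩
    have : Fact p.Prime := ⟨hp⟩
    have h1 : p ^ k ∣ Nat.card (S i : Subgroup N) := (S i).pow_dvd_card_of_pow_dvd_card hk
    have h2 : Nat.card (P i) = Nat.card (S i : Subgroup N) :=
      Subgroup.card_map_of_injective N.subtype_injective
    exact (h2 ▸ h1).trans (Subgroup.card_dvd_of_le (le_iSup P i))
  choose ρ hρ hρr hρl using fun i : ι => h i (hι i).out (P i) (hPp i)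
    ((MulAut.conjNormal (H := P i)).comp c)
  obtain ⟨ρ₀, hρ₀, hρ₀r, -⟩ := h 2 Nat.prime_two PUnit (IsPGroup.of_card (n := 0) (by simp)) 1
  let Φ : (∀ i, P i) →* G := Subgroup.noncommPiCoprod hcomm
  have hΦ : ∀ g x, g * Φ x * g⁻¹ = Φ fun i => MulAut.conjNormal g (x i) := fun g x => by
    let ψ : (∀ i, P i) →* ∀ i, P i := MonoidHom.pi fun i =>
      (MulAut.conjNormal g : MulAut (P i)).toMonoidHom.comp (Pi.evalMonoidHom _ i)
    have h1 : (MulAut.conj g).toMonoidHom.comp Φ = Φ.comp ψ := by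
      refine MonoidHom.pi_ext fun i y => ?_
      have h2 : ψ (Pi.mulSingle i y) = Pi.mulSingle i (MulAut.conjNormal g y) := by
        ext j
        obtain rfl | hij := eq_or_ne j i
        · simp [ψ]
        · simp [ψ, Pi.mulSingle_eq_of_ne hij]
      rw [MonoidHom.comp_apply, MonoidHom.comp_apply, h2, Subgroup.noncommPiCoprod_mulSingle,
        Subgroup.noncommPiCoprod_mulSingle]
      simp
    exact DFunLike.congr_fun h1 x
  have hmul : ∀ i γ δ, (ρ i (γ * δ)).left =
      (ρ i γ).left * MulAut.conjNormal (c (fr γ)) (ρ i δ).left := fun i γ δ => by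
    rw [(hρ i).1 _ trivial _ trivial, SemidirectProduct.mul_left, hρr]
    rfl
  let b : Γ → ∀ i, P i := fun γ i => (ρ i γ).left
  have hb : ∀ γ δ, Φ (b (γ * δ)) = Φ (b γ) * (c (fr γ) * Φ (b δ) * (c (fr γ))⁻¹) := fun γ δ => by
    rw [hΦ, ← map_mul]
    exact congrArg Φ (funext fun i => hmul i γ δ)
  refine ⟨MonoidHom.mk' (fun γ => Φ (b γ) * c (fr γ)) fun γ δ => ?_, ?_, fun γ => ?_,
    fun n hn => ?_⟩
  · rw [hb, map_mul, map_mul]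
    group
  · choose U hU hUn hU1 using fun i => (hρ i).2
    obtain ⟨V, hV, hVn, hV1⟩ := hρ₀.2
    refine ⟨V ⊓ ⨅ i, U i, ?_, ?_, ?_⟩
    · rw [Subgroup.coe_inf, Subgroup.coe_iInf]
      exact hV.inter (isOpen_iInter_of_finite hU)
    · have : (⨅ i, U i).Normal := Subgroup.normal_iInf_normal hUn
      infer_instance
    · rintro γ ⟨hγV, hγU⟩
      have h1 : fr γ = 1 := by rw [← hρ₀r, hV1 γ hγV trivial]; rfl
      have h2 : b γ = 1 := funext fun i => by
        simp only [b]
        rw [hU1 i γ (Subgroup.mem_iInf.1 hγU i) trivial]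
        rfl
      simp [MonoidHom.mem_ker, h1, h2]
  · have : Φ (b γ) ∈ Φ.range := ⟨_, rfl⟩
    rw [Subgroup.noncommPiCoprod_range, hsup] at this
    simpa using this
  · rw [← hsup, ← Subgroup.noncommPiCoprod_range (hcomm := hcomm)] at hn
    obtain ⟨x, rfl⟩ := hn
    let f : ∀ i, fr.ker →* P i := fun i => MonoidHom.mk' (fun γ => b γ i) fun γ δ => by
      simp only [b, Subgroup.coe_mul]
      rw [hmul, (MonoidHom.mem_ker).1 γ.2, map_one, map_one, MulAut.one_apply]
    obtain ⟨γ, hγ⟩ := MonoidHom.surjective_pi_of_coprime f (fun i z => by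
      obtain ⟨γ, h1, h2⟩ := hρl i z
      exact ⟨⟨γ, h1⟩, h2⟩) hcop x
    refine ⟨γ, ?_⟩
    have h1 : b γ = x := hγ
    simp [h1, (MonoidHom.mem_ker).1 γ.2, Φ]

section

variable {K A Ω : Type*} [Field K] [Finite K] [Field A] [Algebra K A] [IsAlgClosed A]
  [Algebra.IsAlgebraic K A] [Field Ω] [Algebra (RatFunc K) Ω] [Algebra A Ω]
  [Algebra K Ω] [IsScalarTower K A Ω] [IsScalarTower K (RatFunc K) Ω] [IsGalois (RatFunc K) Ω]
  [IsSepClosed Ω]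

variable (K A Ω) in
/-- The Frobenius automorphism of the constants extends to the separable closure. -/
theorem exists_apply_algebraMap_eq_pow_card : ∃ γ : Ω ≃ₐ[RatFunc K] Ω,
    ∀ a : A, γ (algebraMap A Ω a) = algebraMap A Ω (a ^ Nat.card K) := by
  obtain ⟨ℓ, hℓ, hℓA⟩ : ∃ ℓ : ℕ, ℓ.Prime ∧ (ℓ : A) ≠ 0 := by
    by_cases h : ((2 : ℕ) : A) = 0
    · refine ⟨3, Nat.prime_three, fun h3 => one_ne_zero (α := A) ?_⟩
      push_cast at h h3
      linear_combination h3 - h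
    · exact ⟨2, Nat.prime_two, h⟩
  have hℓΩ : (ℓ : Ω) ≠ 0 := fun h => hℓA ((algebraMap A Ω).injective (by simpa using h))
  obtain ⟨T, hT⟩ := exists_splitTower (K := K) (A := A) (Ω := Ω) hℓA hℓΩ
  let : Algebra A (splitField K A Ω ℓ) :=
    ((algebraMap A Ω).codRestrict _ algebraMap_mem_splitField).toAlgebra
  have : IsScalarTower A (splitField K A Ω ℓ) Ω := IsScalarTower.of_algebraMap_eq fun _ => rfl
  have : IsScalarTower K A (splitField K A Ω ℓ) := IsScalarTower.of_algebraMap_eq fun c =>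
    Subtype.ext (IsScalarTower.algebraMap_apply K A Ω c)
  have : IsGalois (RatFunc K) (splitField K A Ω ℓ) := ⟨⟩
  have hP := hT.placeTower hℓA
  have hbad : IsBad ℓ 0 (1 : A) := by
    rw [IsBad, one_pow, orderOf_one, Nat.dvd_one]
    exact hℓ.ne_one
  obtain ⟨w, hw⟩ := hP.nonempty 1 0 1 one_pos hbad
  obtain ⟨γ, -, hγ, -⟩ := hP.exists_frob 1 0 1 1 one_pos hbad w hw (one_pow _)
  obtain ⟨δ, rfl⟩ := AlgEquiv.restrictNormalHom_surjective (F := RatFunc K)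
    (K₁ := splitField K A Ω ℓ) Ω γ
  refine ⟨δ, fun a => ?_⟩
  rw [IsScalarTower.algebraMap_apply A (splitField K A Ω ℓ) Ω,
    IsScalarTower.algebraMap_apply A (splitField K A Ω ℓ) Ω]
  refine (AlgEquiv.restrictNormal_commutes δ (splitField K A Ω ℓ) _).symm.trans ?_
  refine congrArg (algebraMap (splitField K A Ω ℓ) Ω) ((hγ a).trans ?_)
  rw [mul_one, pow_one]

variable (Ω) in
theorem exists_surjective_hom {L : Type*} [Field L] [Algebra K L] [FiniteDimensional K L]
    (σ : L →ₐ[K] A) {G : Type u} [Group G] [Finite G] (α : G →* (L ≃ₐ[K] L))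
    (hα : Function.Surjective α) (hker : Group.IsNilpotent α.ker) :
    ∃ ρ : (Ω ≃ₐ[RatFunc K] Ω) →* G, Function.Surjective ρ ∧
      IsOpen (ρ.ker : Set (Ω ≃ₐ[RatFunc K] Ω)) ∧
      ∀ γ x, γ (algebraMap A Ω (σ x)) = algebraMap A Ω (σ (α (ρ γ) x)) := by
  obtain ⟨g, hg⟩ := hα (frobEquiv K L)
  have hd : 0 < Nat.card G := Nat.card_pos
  have : NeZero (Nat.card G) := ⟨hd.ne'⟩
  obtain ⟨fr, hfr⟩ := exists_frobDegree K A (RatFunc K) Ω hd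
  obtain ⟨c, hc⟩ : ∃ c : Multiplicative (ZMod (Nat.card G)) →* G,
      ∀ n : ℕ, c (Multiplicative.ofAdd (n : ZMod (Nat.card G))) = g ^ n := by
    refine ⟨AddMonoidHom.toMultiplicativeLeft (ZMod.lift (Nat.card G)
      ⟨zmultiplesHom (Additive G) (Additive.ofMul g), ?_⟩), fun n => ?_⟩
    · simp [← ofMul_pow]
    · have h := ZMod.lift_coe (Nat.card G) ⟨zmultiplesHom (Additive G) (Additive.ofMul g), by
        simp [← ofMul_pow]⟩ (n : ℤ)
      rw [Int.cast_natCast] at h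
      exact (congrArg Additive.toMul h).trans (by simp)
  obtain ⟨ρ, ⟨U, hU, -, hUρ⟩, hρN, hN⟩ := exists_hom_of_forall_prime fr c α.ker hker
    fun ℓ hℓ P _ _ hP act => exists_rep_prime hℓ hd hfr P hP act
  have hαc : ∀ n, α (g ^ n) = frobEquiv K L ^ n := fun n => by rw [map_pow, hg]
  have hσ : ∀ x, σ x ^ Nat.card K ^ Nat.card G = σ x := fun x => by
    rw [← map_pow, ← frobEquiv_pow_apply, ← hαc, pow_card_eq_one', map_one, AlgEquiv.one_apply]
  have hαρ : ∀ γ, α (ρ γ) = α (c (fr γ)) := fun γ => by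
    have := hρN γ
    rwa [MonoidHom.mem_ker, map_mul, map_inv, mul_inv_eq_one] at this
  refine ⟨ρ, fun h => ?_, Subgroup.isOpen_mono hUρ hU, fun γ x => ?_⟩
  · obtain ⟨γ, hγ⟩ := exists_apply_algebraMap_eq_pow_card K A Ω
    have h1 : fr γ = Multiplicative.ofAdd ((1 : ℕ) : ZMod (Nat.card G)) :=
      (hfr γ 1).2 fun a _ => by rw [pow_one, hγ]
    have : Finite L := Module.finite_of_finite K
    obtain ⟨n, hn⟩ : ∃ n, α h = frobEquiv K L ^ n := by
      obtain ⟨p, hp⟩ := CharP.exists K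
      have : Fact p.Prime := ⟨CharP.char_is_prime K p⟩
      obtain ⟨n, hn⟩ := FiniteField.exists_forall_apply_eq_pow K p L (α h)
      exact ⟨n, AlgEquiv.ext fun x => by rw [hn, frobEquiv_pow_apply]⟩
    obtain ⟨δ, hδ⟩ := hN (h * (ρ (γ ^ n))⁻¹) (by
      rw [MonoidHom.mem_ker, map_mul, map_inv, hαρ, map_pow, h1, map_pow, map_pow, hc, pow_one, hg,
        hn, mul_inv_cancel])
    exact ⟨δ * γ ^ n, by rw [map_mul, hδ, inv_mul_cancel_right]⟩
  · obtain ⟨n, hn⟩ : ∃ n : ℕ, fr γ = Multiplicative.ofAdd (n : ZMod (Nat.card G)) :=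
      ⟨(fr γ).toAdd.val, by simp⟩
    rw [hαρ, hn, hc, hαc, frobEquiv_pow_apply, map_pow σ]
    exact (hfr γ n).1 hn _ (hσ x)

end

/-- **Geometric solutions over finite fields.**
Every finite embedding problem `α : G → Gal(L/K)` with nilpotent kernel over a finite field
`K` has a geometric solution: there are a finite Galois extension `F` of the rational function
field `K(T)` containing `L(T)` (compatibly over `K(T)`) and an isomorphism
`β : Gal(F/K(T)) → G` such that `α ∘ β` is the restriction map to `Gal(L/K)`. -/
theorem embedding_problem_nilpotent_kernel_geometric_solution
    (K : Type u) [Field K] [Finite K]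
    (L : Type u) [Field L] [Algebra K L] [FiniteDimensional K L] [IsGalois K L]
    (G : Type u) [Group G] [Finite G]
    (α : G →* (L ≃ₐ[K] L)) (hα : Function.Surjective α)
    (hker : Group.IsNilpotent α.ker) :
    ∃ (F : Type u) (_ : Field F) (_ : Algebra (RatFunc K) F),
      FiniteDimensional (RatFunc K) F ∧ IsGalois (RatFunc K) F ∧
      -- `F` contains `L(T)`, compatibly with the inclusion of `K(T)`:
      ∃ j : RatFunc L →+* F,
        (∀ c : K, j (algebraMap L (RatFunc L) (algebraMap K L c)) =
            algebraMap (RatFunc K) F (algebraMap K (RatFunc K) c)) ∧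
        j RatFunc.X = algebraMap (RatFunc K) F RatFunc.X ∧
        -- a solution to the induced embedding problem over `K(T)`:
        ∃ β : (F ≃ₐ[RatFunc K] F) ≃* G,
          ∀ (φ : F ≃ₐ[RatFunc K] F) (x : L),
            φ (j (algebraMap L (RatFunc L) x)) =
              j (algebraMap L (RatFunc L) ((α (β φ)) x)) := by
  let A := AlgebraicClosure K
  let Ω := SeparableClosure (RatFunc K)
  let : Algebra K Ω := ((algebraMap (RatFunc K) Ω).comp (algebraMap K (RatFunc K))).toAlgebra
  have : IsScalarTower K (RatFunc K) Ω := IsScalarTower.of_algebraMap_eq fun _ => rfl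
  let ι : A →ₐ[K] Ω := IsSepClosed.lift
  let : Algebra A Ω := ι.toRingHom.toAlgebra
  have : IsScalarTower K A Ω := IsScalarTower.of_algebraMap_eq fun c => (ι.commutes c).symm
  let σ : L →ₐ[K] A := IsAlgClosed.lift
  obtain ⟨ρ, hρ, hρo, hρσ⟩ := exists_surjective_hom Ω σ α hα hker
  let H : ClosedSubgroup (Ω ≃ₐ[RatFunc K] Ω) := ⟨ρ.ker, Subgroup.isClosed_of_isOpen _ hρo⟩
  let F := IntermediateField.fixedField ρ.ker
  have hF : F.fixingSubgroup = ρ.ker := InfiniteGalois.fixingSubgroup_fixedField H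
  have hFfin : FiniteDimensional (RatFunc K) F := by
    rw [← InfiniteGalois.isOpen_iff_finite]
    change IsOpen (F.fixingSubgroup : Set (Ω ≃ₐ[RatFunc K] Ω))
    rwa [hF]
  have hFgal : IsGalois (RatFunc K) F := by
    rw [← InfiniteGalois.normal_iff_isGalois, hF]
    infer_instance
  have hLF : ∀ x : L, algebraMap A Ω (σ x) ∈ F := fun x γ => by
    change γ.1 _ = _
    rw [hρσ, (MonoidHom.mem_ker).1 γ.2, map_one, AlgEquiv.one_apply]
  let : Algebra L F := (((algebraMap A Ω).comp σ.toRingHom).codRestrict F hLF).toAlgebra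
  have hLFv : ∀ x : L, ((algebraMap L F x : F) : Ω) = algebraMap A Ω (σ x) := fun _ => rfl
  have : IsScalarTower K L F := IsScalarTower.of_algebraMap_eq fun c => Subtype.ext (by
    rw [hLFv, σ.commutes, ← IsScalarTower.algebraMap_apply]
    rfl)
  have ht : Transcendental L (algebraMap (RatFunc K) F RatFunc.X) := fun h =>
    (transcendental_algebraMap_iff (algebraMap (RatFunc K) F).injective).2
      RatFunc.transcendental_X (h.restrictScalars K)
  obtain ⟨j, hjL, hjX⟩ := RatFunc.exists_ringHom ht
  let R := AlgEquiv.restrictNormalHom (F := RatFunc K) (K₁ := Ω) F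
  have hR : Function.Surjective R := AlgEquiv.restrictNormalHom_surjective Ω
  have hRker : R.ker = ρ.ker := (IntermediateField.restrictNormalHom_ker F).trans hF
  let β : (F ≃ₐ[RatFunc K] F) ≃* G := (QuotientGroup.quotientKerEquivOfSurjective R hR).symm.trans
    ((QuotientGroup.quotientMulEquivOfEq hRker).trans
      (QuotientGroup.quotientKerEquivOfSurjective ρ hρ))
  have hβ : ∀ γ, β (R γ) = ρ γ := fun γ => by
    have h : (QuotientGroup.quotientKerEquivOfSurjective R hR).symm (R γ) = (γ : _ ⧸ R.ker) :=
      (MulEquiv.symm_apply_eq _).2 rfl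
    change QuotientGroup.quotientKerEquivOfSurjective ρ hρ (QuotientGroup.quotientMulEquivOfEq hRker
      ((QuotientGroup.quotientKerEquivOfSurjective R hR).symm (R γ))) = _
    rw [h]
    rfl
  refine ⟨F, inferInstance, inferInstance, hFfin, hFgal, j, fun c => ?_, hjX, β, fun φ x => ?_⟩
  · rw [hjL, ← IsScalarTower.algebraMap_apply, ← IsScalarTower.algebraMap_apply]
  · obtain ⟨γ, rfl⟩ := hR φ
    rw [hβ, hjL, hjL]
    refine Subtype.ext ?_
    rw [hLFv, ← hρσ]
    exact AlgEquiv.restrictNormal_commutes γ F _
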